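/- Let S be a finite set of rational primes. When ordered by absolute discriminant, the average size of Cl(K)_S[3], as K ranges over real quadratic fields in which every prime of S splits completely, equals 1 + 3^{-|S|-1}. -/

import Mathlib

open IntermediateField NumberField Filter Asymptotics
open scoped nonZeroDivisors

/-- A square root of `d` in `ℂ`. -/
noncomputable def sqrtD (d : ℤ) : ℂ :=
  if 0 ≤ d then ((Real.sqrt d : ℝ) : ℂ) else Complex.I * ((Real.sqrt (-d) : ℝ) : ℂ)

lemma sqrtD_sq (d : ℤ) : (sqrtD d) ^ 2 = (d : ℂ) := by
  unfold sqrtD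
  split_ifs with h
  · rw [← Complex.ofReal_pow, Real.sq_sqrt (by exact_mod_cast h)]
    simp
  · rw [mul_pow, Complex.I_sq, ← Complex.ofReal_pow,
      Real.sq_sqrt (by push_neg at h; nlinarith [show (d:ℝ) < 0 from by exact_mod_cast h])]
    push_cast
    ring

/-- The quadratic field `K = ℚ(√d)` realized inside `ℂ`.  For `d` a fundamental
discriminant, these realize all quadratic fields (identified with their
fundamental discriminants), `d > 0` giving the real ones and `d < 0` the
imaginary ones. -/
noncomputable def Kd (d : ℤ) : IntermediateField ℚ ℂ := ℚ⟮sqrtD d⟯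

instance (d : ℤ) : FiniteDimensional ℚ (Kd d) := by
  apply IntermediateField.adjoin.finiteDimensional
  have : IsAlgebraic ℚ (sqrtD d) := by
    refine ⟨Polynomial.X ^ 2 - Polynomial.C (d : ℚ), ?_, ?_⟩
    · exact Polynomial.X_pow_sub_C_ne_zero (by norm_num) _
    · simp [sqrtD_sq d]
  exact this.isIntegral

instance (d : ℤ) : NumberField (Kd d) := ⟨⟩

/-- The ring of integers `O_K` of `K = ℚ(√d)`. -/
noncomputable abbrev Od (d : ℤ) := 𝓞 (Kd d)

/-- `d` is a fundamental discriminant, i.e. the discriminant of a quadratic field: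
either `d ≡ 1 (mod 4)` and `d` squarefree, or `d = 4m` with `m` squarefree and
`m ≡ 2, 3 (mod 4)` (and `d ≠ 1`, which is not the discriminant of a quadratic field). -/
def IsFundamentalDiscriminant (d : ℤ) : Prop :=
  d ≠ 1 ∧ ((d % 4 = 1 ∧ Squarefree d) ∨
    ∃ m : ℤ, d = 4 * m ∧ (m % 4 = 2 ∨ m % 4 = 3) ∧ Squarefree m)

/-- The average of `f` over the family of quadratic fields (identified with their
fundamental discriminants `d`) satisfying `F`, ordered by absolute discriminant,
exists and equals `A`:
`lim_{X→∞} (∑_{F d, |d| < X} f d) / #{d : F d, |d| < X} = A`. -/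
noncomputable def HasAverage (F : ℤ → Prop) (f : ℤ → ℝ) (A : ℝ) : Prop :=
  Tendsto (fun X : ℝ =>
      (∑ᶠ d ∈ {d : ℤ | F d ∧ |(d : ℝ)| < X}, f d) /
        (Nat.card {d : ℤ // F d ∧ |(d : ℝ)| < X} : ℝ))
    atTop (nhds A)

/-- The rational prime `p` splits (completely) in `K = ℚ(√d)`: `pO_K` is a product of
two distinct prime ideals. -/
def SplitsIn (p : ℕ) (d : ℤ) : Prop :=
  ∃ P Q : Ideal (Od d), P ≠ Q ∧ P.IsPrime ∧ Q.IsPrime ∧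
    Ideal.span {((p : ℕ) : Od d)} = P * Q

/-- The subgroup `⟨S_K⟩` of the class group generated by the classes of the primes
of `O_K` lying above the primes in `S`. -/
noncomputable def SClassSubgroup (S : Finset ℕ) (d : ℤ) : Subgroup (ClassGroup (Od d)) :=
  Subgroup.closure {c | ∃ P : (Ideal (Od d))⁰, (P : Ideal (Od d)).IsPrime ∧
    (∃ p ∈ S, ((p : ℕ) : Od d) ∈ (P : Ideal (Od d))) ∧ c = ClassGroup.mk0 P}

/-- `Cl(K)_S := Cl(K)/⟨S_K⟩` for `K = ℚ(√d)`. -/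
noncomputable def ClS (S : Finset ℕ) (d : ℤ) :=
  ClassGroup (Od d) ⧸ SClassSubgroup S d

noncomputable instance (S : Finset ℕ) (d : ℤ) : CommGroup (ClS S d) := by
  unfold ClS; infer_instance

section

open Set Finset ZMod Metric Real MeasureTheory FractionalIdeal ENNReal Polynomial ClassGroup Ideal Complex

local notation "ℤ⁴" => Fin 4 → ℤ
local notation "ℝ⁴" => Fin 4 → ℝ

variable {p : ℕ} {S T : Finset ℕ} {f g : ℤ⁴} {E : Set ℤ⁴}

/-! ### Binary cubic forms with triplicate central coefficients -/

lemma form_ext {R : Type*} {f g : Fin 4 → R} (h0 : f 0 = g 0) (h1 : f 1 = g 1) (h2 : f 2 = g 2)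
    (h3 : f 3 = g 3) : f = g := by
  funext i; fin_cases i <;> assumption

section CubicForms

variable {R : Type*} [CommRing R]

/-- The leading coefficient of the Hessian of `f₀ x³ + 3 f₁ x² y + 3 f₂ x y² + f₃ y³`. -/
def hA (f : Fin 4 → R) : R := f 1 ^ 2 - f 0 * f 2

/-- The middle coefficient of the Hessian. -/
def hB (f : Fin 4 → R) : R := f 1 * f 2 - f 0 * f 3

/-- The last coefficient of the Hessian. -/
def hC (f : Fin 4 → R) : R := f 2 ^ 2 - f 1 * f 3

/-- The (reduced) discriminant of a cubic form: the discriminant of its Hessian. -/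
def cdisc (f : Fin 4 → R) : R := hB f ^ 2 - 4 * hA f * hC f

/-- The value of a cubic form. -/
def ceval (f : Fin 4 → R) (x y : R) : R :=
  f 0 * x ^ 3 + 3 * f 1 * x ^ 2 * y + 3 * f 2 * x * y ^ 2 + f 3 * y ^ 3

/-- The substitution `x ↦ px + qy`, `y ↦ rx + sy`. -/
def cact (p q r s : R) (f : Fin 4 → R) : Fin 4 → R :=
  ![f 0 * p ^ 3 + 3 * f 1 * p ^ 2 * r + 3 * f 2 * p * r ^ 2 + f 3 * r ^ 3,
    f 0 * p ^ 2 * q + f 1 * (p ^ 2 * s + 2 * p * q * r) + f 2 * (2 * p * r * s + q * r ^ 2)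
      + f 3 * r ^ 2 * s,
    f 0 * p * q ^ 2 + f 1 * (2 * p * q * s + q ^ 2 * r) + f 2 * (p * s ^ 2 + 2 * q * r * s)
      + f 3 * r * s ^ 2,
    f 0 * q ^ 3 + 3 * f 1 * q ^ 2 * s + 3 * f 2 * q * s ^ 2 + f 3 * s ^ 3]

lemma cact_zero (p q r s : R) (f : Fin 4 → R) : cact p q r s f 0 =
    f 0 * p ^ 3 + 3 * f 1 * p ^ 2 * r + 3 * f 2 * p * r ^ 2 + f 3 * r ^ 3 := rfl

lemma cact_one (p q r s : R) (f : Fin 4 → R) : cact p q r s f 1 =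
    f 0 * p ^ 2 * q + f 1 * (p ^ 2 * s + 2 * p * q * r) + f 2 * (2 * p * r * s + q * r ^ 2)
      + f 3 * r ^ 2 * s := rfl

lemma cact_two (p q r s : R) (f : Fin 4 → R) : cact p q r s f 2 =
    f 0 * p * q ^ 2 + f 1 * (2 * p * q * s + q ^ 2 * r) + f 2 * (p * s ^ 2 + 2 * q * r * s)
      + f 3 * r * s ^ 2 := rfl

lemma cact_three (p q r s : R) (f : Fin 4 → R) : cact p q r s f 3 =
    f 0 * q ^ 3 + 3 * f 1 * q ^ 2 * s + 3 * f 2 * q * s ^ 2 + f 3 * s ^ 3 := rfl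

lemma hA_cact (p q r s : R) (f : Fin 4 → R) : hA (cact p q r s f) =
    (p * s - q * r) ^ 2 * (hA f * p ^ 2 + hB f * p * r + hC f * r ^ 2) := by
  simp only [hA, hB, hC, cact_zero, cact_one, cact_two]; ring

lemma hB_cact (p q r s : R) (f : Fin 4 → R) : hB (cact p q r s f) =
    (p * s - q * r) ^ 2 * (2 * hA f * p * q + hB f * (p * s + q * r) + 2 * hC f * r * s) := by
  simp only [hA, hB, hC, cact_zero, cact_one, cact_two, cact_three]; ring

lemma hC_cact (p q r s : R) (f : Fin 4 → R) : hC (cact p q r s f) =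
    (p * s - q * r) ^ 2 * (hA f * q ^ 2 + hB f * q * s + hC f * s ^ 2) := by
  simp only [hA, hB, hC, cact_one, cact_two, cact_three]; ring

lemma cdisc_cact (p q r s : R) (f : Fin 4 → R) :
    cdisc (cact p q r s f) = (p * s - q * r) ^ 6 * cdisc f := by
  simp only [cdisc, hA_cact, hB_cact, hC_cact]; ring

lemma ceval_cact (p q r s : R) (f : Fin 4 → R) (x y : R) :
    ceval (cact p q r s f) x y = ceval f (p * x + q * y) (r * x + s * y) := by
  simp only [ceval, cact_zero, cact_one, cact_two, cact_three]; ring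

lemma cact_cact (p q r s p' q' r' s' : R) (f : Fin 4 → R) :
    cact p q r s (cact p' q' r' s' f) =
      cact (p' * p + q' * r) (p' * q + q' * s) (r' * p + s' * r) (r' * q + s' * s) f := by
  apply form_ext <;> simp only [cact_zero, cact_one, cact_two, cact_three] <;> ring

lemma cact_id (f : Fin 4 → R) : cact 1 0 0 1 f = f := by
  apply form_ext <;> simp [cact_zero, cact_one, cact_two, cact_three]

lemma cact_neg_id (f : Fin 4 → R) : cact (-1) 0 0 (-1) f = -f := by
  apply form_ext <;> simp [cact_zero, cact_one, cact_two, cact_three] <;> ring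

lemma hA_neg (f : Fin 4 → R) : hA (-f) = hA f := by simp [hA]
lemma hB_neg (f : Fin 4 → R) : hB (-f) = hB f := by simp [hB]
lemma hC_neg (f : Fin 4 → R) : hC (-f) = hC f := by simp [hC]
lemma cdisc_neg (f : Fin 4 → R) : cdisc (-f) = cdisc f := by simp [cdisc, hA_neg, hB_neg, hC_neg]

end CubicForms

/-- Two integral cubic forms are `SL₂(ℤ)`-equivalent. -/
def SLEquiv (f g : ℤ⁴) : Prop :=
  ∃ p q r s : ℤ, p * s - q * r = 1 ∧ g = cact p q r s f

lemma SLEquiv.refl (f : ℤ⁴) : SLEquiv f f := ⟨1, 0, 0, 1, by norm_num, (cact_id f).symm⟩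

lemma SLEquiv.symm (h : SLEquiv f g) : SLEquiv g f := by
  obtain ⟨p, q, r, s, h, rfl⟩ := h
  refine ⟨s, -q, -r, p, by linarith, ?_⟩
  rw [cact_cact, show p * s + q * -r = 1 by linarith, show p * -q + q * p = 0 by ring,
    show r * s + s * -r = 0 by ring, show r * -q + s * p = 1 by linarith, cact_id]

lemma SLEquiv.trans {f g k : ℤ⁴} (h : SLEquiv f g) (h' : SLEquiv g k) : SLEquiv f k := by
  obtain ⟨p, q, r, s, h, rfl⟩ := h
  obtain ⟨p', q', r', s', h', rfl⟩ := h'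
  refine ⟨_, _, _, _, ?_, cact_cact _ _ _ _ _ _ _ _ _⟩
  linear_combination (p' * s' - q' * r') * h + h'

lemma SLEquiv.neg (f : ℤ⁴) : SLEquiv f (-f) :=
  ⟨-1, 0, 0, -1, by norm_num, (cact_neg_id f).symm⟩

/-- The setoid of `SL₂(ℤ)`-equivalence. -/
instance formSetoid : Setoid ℤ⁴ where
  r := SLEquiv
  iseqv := ⟨SLEquiv.refl, SLEquiv.symm, SLEquiv.trans⟩

/-- The set of `SL₂(ℤ)`-classes meeting `E`. -/
def clsSet (E : Set ℤ⁴) : Set (Quotient formSetoid) := Set.image (Quotient.mk formSetoid) E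

/-- A set of forms stable under `SL₂(ℤ)`. -/
def SLInv (E : Set ℤ⁴) : Prop := ∀ f g, SLEquiv f g → f ∈ E → g ∈ E

lemma mk_mem_clsSet (hE : SLInv E) (f : ℤ⁴) :
    Quotient.mk formSetoid f ∈ clsSet E ↔ f ∈ E := by
  constructor
  · rintro ⟨g, hg, h⟩
    exact hE g f (Quotient.exact h) hg
  · exact fun h => ⟨f, h, rfl⟩

/-- A cubic form is reducible if it has a rational linear factor. -/
def Reducible (f : ℤ⁴) : Prop := ∃ x y : ℤ, (x ≠ 0 ∨ y ≠ 0) ∧ ceval f x y = 0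

lemma Reducible.of_equiv (h : SLEquiv f g) (hf : Reducible f) : Reducible g := by
  obtain ⟨p, q, r, s, h1, rfl⟩ := h
  obtain ⟨x, y, hxy, h0⟩ := hf
  refine ⟨s * x - q * y, p * y - r * x, ?_, ?_⟩
  · by_contra hcon
    push Not at hcon
    have hx : x = p * (s * x - q * y) + q * (p * y - r * x) := by linear_combination (-x) * h1
    have hy : y = r * (s * x - q * y) + s * (p * y - r * x) := by linear_combination (-y) * h1
    rw [hcon.1, hcon.2] at hx hy
    simp at hx hy
    tauto
  · rw [ceval_cact]
    convert h0 using 2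
    · linear_combination x * h1
    · linear_combination y * h1

lemma SLEquiv.reducible_iff (h : SLEquiv f g) : Reducible f ↔ Reducible g :=
  ⟨Reducible.of_equiv h, Reducible.of_equiv h.symm⟩

lemma SLEquiv.cdisc_eq (h : SLEquiv f g) : cdisc g = cdisc f := by
  obtain ⟨p, q, r, s, h1, rfl⟩ := h
  rw [cdisc_cact, h1]; ring

lemma reducible_of_zero (h : f 0 = 0) : Reducible f :=
  ⟨1, 0, by simp, by simp [ceval, h]⟩

/-- A reducible form is equivalent to one with vanishing leading coefficient. -/
lemma Reducible.exists_zero (h : Reducible f) : ∃ g, SLEquiv f g ∧ g 0 = 0 := by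
  obtain ⟨x, y, hxy, h0⟩ := h
  obtain ⟨x', y', hc, hx, hy⟩ : ∃ x' y' : ℤ, IsCoprime x' y' ∧ x = Int.gcd x y * x' ∧
      y = Int.gcd x y * y' := by
    have hg : 0 < Int.gcd x y := Int.gcd_pos_iff.mpr hxy
    refine ⟨x / Int.gcd x y, y / Int.gcd x y, ?_, ?_, ?_⟩
    · exact Int.isCoprime_iff_gcd_eq_one.mpr (Int.gcd_div_gcd_div_gcd hg)
    · exact (Int.mul_ediv_cancel' (Int.gcd_dvd_left x y)).symm
    · exact (Int.mul_ediv_cancel' (Int.gcd_dvd_right x y)).symm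
  have hg : (Int.gcd x y : ℤ) ≠ 0 := by
    have := Int.gcd_pos_iff.mpr hxy
    positivity
  have h0' : ceval f x' y' = 0 := by
    generalize (Int.gcd x y : ℤ) = k at hx hy hg
    have : k ^ 3 * ceval f x' y' = 0 := by
      rw [← h0, hx, hy]; unfold ceval
      ring
    exact (mul_eq_zero.mp this).resolve_left (pow_ne_zero _ hg)
  obtain ⟨u, v, huv⟩ := hc
  refine ⟨cact x' (-v) y' u f, ⟨x', -v, y', u, by linarith, rfl⟩, ?_⟩
  rw [← h0', cact_zero, ceval]

/-! ### Sums of two cubes of real linear forms, and reduction theory -/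

/-- The cubic form `(m₀x + m₁y)³ + (m₂x + m₃y)³`. -/
def cubeMap (m : ℝ⁴) : ℝ⁴ :=
  ![m 0 ^ 3 + m 2 ^ 3, m 0 ^ 2 * m 1 + m 2 ^ 2 * m 3, m 0 * m 1 ^ 2 + m 2 * m 3 ^ 2,
    m 1 ^ 3 + m 3 ^ 3]

/-- The determinant of the pair of linear forms `m₀x + m₁y`, `m₂x + m₃y`. -/
def mdet (m : ℝ⁴) : ℝ := m 0 * m 3 - m 1 * m 2

/-- The first coefficient of the covariant `(m₀x + m₁y)² + (m₂x + m₃y)²`. -/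
def mA (m : ℝ⁴) : ℝ := m 0 ^ 2 + m 2 ^ 2

/-- The second coefficient of the covariant. -/
def mB (m : ℝ⁴) : ℝ := 2 * (m 0 * m 1 + m 2 * m 3)

/-- The third coefficient of the covariant. -/
def mC (m : ℝ⁴) : ℝ := m 1 ^ 2 + m 3 ^ 2

/-- Linear substitution in a pair of linear forms. -/
def mact (p q r s : ℝ) (m : ℝ⁴) : ℝ⁴ :=
  ![m 0 * p + m 1 * r, m 0 * q + m 1 * s, m 2 * p + m 3 * r, m 2 * q + m 3 * s]

/-- Closed reducedness condition. -/
def RedC (m : ℝ⁴) : Prop := |mB m| ≤ mA m ∧ mA m ≤ mC m ∧ 0 < mdet m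

/-- Open reducedness condition. -/
def RedO (m : ℝ⁴) : Prop := |mB m| < mA m ∧ mA m < mC m ∧ 0 < mdet m

lemma cubeMap_zero (m : ℝ⁴) : cubeMap m 0 = m 0 ^ 3 + m 2 ^ 3 := rfl
lemma cubeMap_one (m : ℝ⁴) : cubeMap m 1 = m 0 ^ 2 * m 1 + m 2 ^ 2 * m 3 := rfl
lemma cubeMap_two (m : ℝ⁴) : cubeMap m 2 = m 0 * m 1 ^ 2 + m 2 * m 3 ^ 2 := rfl
lemma cubeMap_three (m : ℝ⁴) : cubeMap m 3 = m 1 ^ 3 + m 3 ^ 3 := rfl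
lemma mact_zero (p q r s : ℝ) (m : ℝ⁴) : mact p q r s m 0 = m 0 * p + m 1 * r := rfl
lemma mact_one (p q r s : ℝ) (m : ℝ⁴) : mact p q r s m 1 = m 0 * q + m 1 * s := rfl
lemma mact_two (p q r s : ℝ) (m : ℝ⁴) : mact p q r s m 2 = m 2 * p + m 3 * r := rfl
lemma mact_three (p q r s : ℝ) (m : ℝ⁴) : mact p q r s m 3 = m 2 * q + m 3 * s := rfl

lemma cubeMap_mact (p q r s : ℝ) (m : ℝ⁴) :
    cubeMap (mact p q r s m) = cact p q r s (cubeMap m) := by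
  apply form_ext <;> simp only [cubeMap_zero, cubeMap_one, cubeMap_two, cubeMap_three, mact_zero,
    mact_one, mact_two, mact_three, cact_zero, cact_one, cact_two, cact_three] <;> ring

lemma mdet_mact (p q r s : ℝ) (m : ℝ⁴) :
    mdet (mact p q r s m) = (p * s - q * r) * mdet m := by
  simp only [mdet, mact_zero, mact_one, mact_two, mact_three]; ring

lemma mA_mact (p q r s : ℝ) (m : ℝ⁴) :
    mA (mact p q r s m) = mA m * p ^ 2 + mB m * p * r + mC m * r ^ 2 := by
  simp only [mA, mB, mC, mact_zero, mact_two]; ring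

lemma mB_mact (p q r s : ℝ) (m : ℝ⁴) :
    mB (mact p q r s m) = 2 * mA m * p * q + mB m * (p * s + q * r) + 2 * mC m * r * s := by
  simp only [mA, mB, mC, mact_zero, mact_one, mact_two, mact_three]; ring

lemma mC_mact (p q r s : ℝ) (m : ℝ⁴) :
    mC (mact p q r s m) = mA m * q ^ 2 + mB m * q * s + mC m * s ^ 2 := by
  simp only [mA, mB, mC, mact_one, mact_three]; ring

lemma cdisc_cubeMap (m : ℝ⁴) : cdisc (cubeMap m) = mdet m ^ 6 := by
  simp only [cdisc, hA, hB, hC, cubeMap_zero, cubeMap_one, cubeMap_two, cubeMap_three, mdet]; ring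

lemma four_mA_mul_mC (m : ℝ⁴) : 4 * mA m * mC m = mB m ^ 2 + 4 * mdet m ^ 2 := by
  simp only [mA, mB, mC, mdet]; ring

lemma exists_cube_root (u : ℝ) : ∃ k : ℝ, k ^ 3 = u := by
  have h : Function.Surjective (fun x : ℝ => x ^ 3) := by
    apply Continuous.surjective (by fun_prop)
    · exact tendsto_pow_atTop (by norm_num)
    · have h3 := (tendsto_pow_atTop (α := ℝ) (n := 3) (by norm_num)).comp tendsto_neg_atBot_atTop
      refine (tendsto_neg_atTop_atBot.comp h3).congr fun x => ?_
      simp only [Function.comp_apply]; ring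
  exact h u

lemma exists_cubeMap_of_hA {f : ℝ⁴} (hf : 0 < cdisc f) (hA0 : hA f ≠ 0) :
    ∃ m, 0 < mdet m ∧ cubeMap m = f := by
  suffices ∃ m, cubeMap m = f by
    obtain ⟨m, rfl⟩ := this
    have h0 : mdet m ≠ 0 := by
      intro h; rw [cdisc_cubeMap, h] at hf; norm_num at hf
    rcases lt_or_gt_of_ne h0 with h | h
    · refine ⟨![m 2, m 3, m 0, m 1], ?_, ?_⟩
      · simp only [mdet] at h ⊢; simp; linarith
      · apply form_ext <;> simp [cubeMap] <;> ring
    · exact ⟨m, h, rfl⟩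
  obtain ⟨w, hw0, hw⟩ : ∃ w : ℝ, 0 < w ∧ w ^ 2 = cdisc f :=
    ⟨√(cdisc f), Real.sqrt_pos.mpr hf, sq_sqrt hf.le⟩
  set θ₁ := (hB f + w) / (2 * hA f) with h1
  set θ₂ := (hB f - w) / (2 * hA f) with h2
  have hsub : θ₁ - θ₂ = w / hA f := by rw [h1, h2]; field_simp; ring
  have hne : θ₁ - θ₂ ≠ 0 := by rw [hsub]; exact div_ne_zero hw0.ne' hA0
  have hq1 : hA f * θ₁ ^ 2 = hB f * θ₁ - hC f := by
    rw [h1]; field_simp; unfold cdisc at hw; linear_combination hw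
  have hq2 : hA f * θ₂ ^ 2 = hB f * θ₂ - hC f := by
    rw [h2]; field_simp; unfold cdisc at hw; linear_combination hw
  obtain ⟨k, hk⟩ := exists_cube_root ((f 1 - f 0 * θ₂) / (θ₁ - θ₂))
  obtain ⟨l, hl⟩ := exists_cube_root ((f 0 * θ₁ - f 1) / (θ₁ - θ₂))
  have e0 : k ^ 3 + l ^ 3 = f 0 := by rw [hk, hl]; field_simp; ring
  have e1 : k ^ 3 * θ₁ + l ^ 3 * θ₂ = f 1 := by rw [hk, hl]; field_simp; ring
  have e2 : k ^ 3 * θ₁ ^ 2 + l ^ 3 * θ₂ ^ 2 = f 2 := by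
    apply mul_left_cancel₀ hA0
    have : hA f * f 2 = hB f * f 1 - hC f * f 0 := by simp only [hA, hB, hC]; ring
    rw [this, ← e1, ← e0]
    linear_combination k ^ 3 * hq1 + l ^ 3 * hq2
  have e3 : k ^ 3 * θ₁ ^ 3 + l ^ 3 * θ₂ ^ 3 = f 3 := by
    apply mul_left_cancel₀ hA0
    have : hA f * f 3 = hB f * f 2 - hC f * f 1 := by simp only [hA, hB, hC]; ring
    rw [this, ← e2, ← e1]
    linear_combination k ^ 3 * θ₁ * hq1 + l ^ 3 * θ₂ * hq2
  refine ⟨![k, k * θ₁, l, l * θ₂], ?_⟩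
  apply form_ext
  · simpa [cubeMap] using e0
  · rw [← e1]; simp [cubeMap]; ring
  · rw [← e2]; simp [cubeMap]; ring
  · rw [← e3]; simp [cubeMap]; ring

/-- A real cubic form of positive reduced discriminant is a sum of two cubes of linear forms. -/
lemma exists_cubeMap {f : ℝ⁴} (hf : 0 < cdisc f) : ∃ m, 0 < mdet m ∧ cubeMap m = f := by
  have key : ∃ t : ℝ, hA (cact 1 0 t 1 f) ≠ 0 := by
    by_contra hcon
    push Not at hcon
    have a0 := hcon 0
    have a1 := hcon 1
    have a2 := hcon (-1)
    rw [hA_cact] at a0 a1 a2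
    norm_num at a0 a1 a2
    have hB0 : hB f = 0 := by linarith
    rw [cdisc, a0, hB0] at hf
    norm_num at hf
  obtain ⟨t, ht⟩ := key
  obtain ⟨m, hm, hmf⟩ := exists_cubeMap_of_hA (f := cact 1 0 t 1 f)
    (by rw [cdisc_cact]; simpa using hf) ht
  refine ⟨mact 1 0 (-t) 1 m, by rw [mdet_mact]; simpa using hm, ?_⟩
  rw [cubeMap_mact, hmf, cact_cact]
  simp [cact_id]

lemma cube_inj {x y : ℝ} (h : x ^ 3 = y ^ 3) : x = y :=
  (Odd.strictMono_pow (by decide : Odd 3)).injective h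

lemma cubeMap_injOn : InjOn cubeMap {m | 0 < mdet m} := by
  intro m hm m' hm' h
  have hd : mdet m = mdet m' := by
    have := cdisc_cubeMap m
    rw [h, cdisc_cubeMap] at this
    exact ((pow_left_inj₀ (le_of_lt hm') (le_of_lt hm) (by norm_num)).mp this).symm
  have g0 : ∀ k : ℝ⁴, mdet k ^ 3 * (k 0 ^ 3 - k 2 ^ 3) =
      (cubeMap k 0) ^ 2 * cubeMap k 3 - 3 * cubeMap k 0 * cubeMap k 1 * cubeMap k 2
        + 2 * cubeMap k 1 ^ 3 := by
    intro k
    simp only [cubeMap_zero, cubeMap_one, cubeMap_two, cubeMap_three, mdet]; ring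
  have g3 : ∀ k : ℝ⁴, mdet k ^ 3 * (k 3 ^ 3 - k 1 ^ 3) =
      (cubeMap k 3) ^ 2 * cubeMap k 0 - 3 * cubeMap k 1 * cubeMap k 2 * cubeMap k 3
        + 2 * cubeMap k 2 ^ 3 := by
    intro k
    simp only [cubeMap_zero, cubeMap_one, cubeMap_two, cubeMap_three, mdet]; ring
  have hne : mdet m ^ 3 ≠ 0 := pow_ne_zero _ (ne_of_gt hm)
  have h0 := congrFun h 0
  have h3 := congrFun h 3
  simp only [cubeMap_zero, cubeMap_three] at h0 h3
  have e0 : m 0 ^ 3 - m 2 ^ 3 = m' 0 ^ 3 - m' 2 ^ 3 := by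
    apply mul_left_cancel₀ hne
    rw [g0 m, h, ← g0 m', hd]
  have e3 : m 3 ^ 3 - m 1 ^ 3 = m' 3 ^ 3 - m' 1 ^ 3 := by
    apply mul_left_cancel₀ hne
    rw [g3 m, h, ← g3 m', hd]
  apply form_ext
  · exact cube_inj (by linarith)
  · exact cube_inj (by linarith)
  · exact cube_inj (by linarith)
  · exact cube_inj (by linarith)

/-- The real form underlying an integral form. -/
def toR (f : ℤ⁴) : ℝ⁴ := fun i => (f i : ℝ)

lemma toR_cact (p q r s : ℤ) (f : ℤ⁴) :
    toR (cact p q r s f) = cact (p : ℝ) q r s (toR f) := by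
  apply form_ext <;> simp [toR, cact_zero, cact_one, cact_two, cact_three]

lemma cdisc_toR (f : ℤ⁴) : cdisc (toR f) = (((cdisc f : ℤ)) : ℝ) := by
  simp [toR, cdisc, hA, hB, hC]

open UpperHalfPlane Modular in
lemma exists_redC (m : ℝ⁴) (hm : 0 < mdet m) :
    ∃ p q r s : ℤ, p * s - q * r = 1 ∧ RedC (mact p q r s m) := by
  have mk : ∀ k : ℝ⁴, 0 < mdet k → mA k ≠ 0 ∧ ((k 0 : ℂ) + k 2 * Complex.I) ≠ 0 ∧
      (((k 1 : ℂ) + k 3 * Complex.I) / ((k 0 : ℂ) + k 2 * Complex.I)).re = mB k / 2 / mA k ∧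
      (((k 1 : ℂ) + k 3 * Complex.I) / ((k 0 : ℂ) + k 2 * Complex.I)).im = mdet k / mA k ∧
      normSq (((k 1 : ℂ) + k 3 * Complex.I) / ((k 0 : ℂ) + k 2 * Complex.I))
        = mC k / mA k := by
    intro k hk
    have hA0 : mA k ≠ 0 := by
      intro h
      have h1 : k 0 = 0 := by unfold mA at h; nlinarith [sq_nonneg (k 0), sq_nonneg (k 2)]
      have h2 : k 2 = 0 := by unfold mA at h; nlinarith [sq_nonneg (k 0), sq_nonneg (k 2)]
      simp [mdet, h1, h2] at hk
    have hns : normSq ((k 0 : ℂ) + k 2 * Complex.I) = mA k := by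
      simp [normSq_apply, mA]; ring
    have hns' : normSq ((k 1 : ℂ) + k 3 * Complex.I) = mC k := by
      simp [normSq_apply, mC]; ring
    refine ⟨hA0, ?_, ?_, ?_, ?_⟩
    · intro h; rw [h] at hns; simp at hns; exact hA0 hns.symm
    · rw [div_re, hns]; simp [mB]; field_simp
    · rw [div_im, hns]; simp [mdet]; field_simp
    · rw [map_div₀, hns, hns']
  have hApos : ∀ k : ℝ⁴, 0 < mdet k → 0 < mA k := fun k hk =>
    lt_of_le_of_ne (by unfold mA; positivity) (mk k hk).1.symm
  obtain ⟨-, hne, -, him, -⟩ := mk m hm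
  set z : ℍ := ⟨((m 1 : ℂ) + m 3 * Complex.I) / ((m 0 : ℂ) + m 2 * Complex.I), by
    rw [him]; exact div_pos hm (hApos m hm)⟩ with hz
  obtain ⟨g, hg⟩ := ModularGroup.exists_smul_mem_fd z
  have hdet : g 1 1 * g 0 0 - g 0 1 * g 1 0 = 1 := by
    have := Matrix.det_fin_two g.1
    rw [g.2] at this
    linarith
  refine ⟨g 1 1, g 0 1, g 1 0, g 0 0, hdet, ?_⟩
  set k := mact (g 1 1) (g 0 1) (g 1 0) (g 0 0) m with hk
  have hkd : 0 < mdet k := by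
    rw [hk, mdet_mact]
    have : ((g 1 1 : ℤ) : ℝ) * g 0 0 - g 0 1 * g 1 0 = 1 := by exact_mod_cast hdet
    rw [this, one_mul]; exact hm
  obtain ⟨_, hkne, hre, -, hns⟩ := mk k hkd
  have hgz : ((g • z : ℍ) : ℂ) =
      ((k 1 : ℂ) + k 3 * Complex.I) / ((k 0 : ℂ) + k 2 * Complex.I) := by
    rw [UpperHalfPlane.coe_specialLinearGroup_apply]
    have hzc : (z : ℂ) = ((m 1 : ℂ) + m 3 * Complex.I) / ((m 0 : ℂ) + m 2 * Complex.I) := rfl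
    have e1 : (k 1 : ℂ) + k 3 * Complex.I =
        g 0 0 * ((m 1 : ℂ) + m 3 * Complex.I) + g 0 1 * ((m 0 : ℂ) + m 2 * Complex.I) := by
      simp [hk, mact]; ring
    have e2 : (k 0 : ℂ) + k 2 * Complex.I =
        g 1 0 * ((m 1 : ℂ) + m 3 * Complex.I) + g 1 1 * ((m 0 : ℂ) + m 2 * Complex.I) := by
      simp [hk, mact]; ring
    rw [e2] at hkne
    rw [e1, e2, hzc]
    simp only [algebraMap_int_eq, eq_intCast, ofReal_intCast]
    generalize (m 1 : ℂ) + m 3 * Complex.I = cw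
    generalize (m 0 : ℂ) + m 2 * Complex.I = cu at hne ⊢
    rw [← mul_div_mul_right _ _ hne]
    congr 1 <;> rw [add_mul, mul_assoc, div_mul_cancel₀ _ hne]
  obtain ⟨h1, h2⟩ := hg
  rw [← UpperHalfPlane.coe_re] at h2
  rw [hgz] at h1 h2
  rw [hns] at h1
  rw [hre] at h2
  have hp := hApos k hkd
  refine ⟨?_, ?_, hkd⟩
  · rw [abs_div, abs_div, abs_of_pos hp] at h2
    rw [div_le_div_iff₀ hp (by norm_num)] at h2
    norm_num at h2
    linarith
  · rwa [one_le_div hp] at h1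

/-- Every integral form of positive reduced discriminant is equivalent to a reduced one. -/
lemma exists_reduced (f : ℤ⁴) (hf : 0 < cdisc f) :
    ∃ g m, SLEquiv f g ∧ toR g = cubeMap m ∧ RedC m := by
  obtain ⟨m, hm, hmf⟩ := exists_cubeMap (f := toR f) (by rw [cdisc_toR]; exact_mod_cast hf)
  obtain ⟨p, q, r, s, h1, h2⟩ := exists_redC m hm
  exact ⟨cact p q r s f, mact p q r s m, ⟨p, q, r, s, h1, rfl⟩, by
    rw [toR_cact, cubeMap_mact, hmf], h2⟩

lemma redC_neg {m : ℝ⁴} (h : RedC m) : RedC (-m) := by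
  simpa [RedC, mA, mB, mC, mdet] using h

lemma cubeMap_neg (m : ℝ⁴) : cubeMap (-m) = -cubeMap m := by
  apply form_ext <;> simp [cubeMap] <;> ring

lemma toR_neg (f : ℤ⁴) : toR (-f) = -toR f := by
  funext i; simp [toR]

lemma RedO.redC {m : ℝ⁴} (h : RedO m) : RedC m := ⟨h.1.le, h.2.1.le, h.2.2⟩

lemma mA_pos {m : ℝ⁴} (h : 0 < mdet m) : 0 < mA m := by
  by_contra hcon
  have h1 : m 0 = 0 := by unfold mA at hcon; nlinarith [sq_nonneg (m 0), sq_nonneg (m 2)]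
  have h2 : m 2 = 0 := by unfold mA at hcon; nlinarith [sq_nonneg (m 0), sq_nonneg (m 2)]
  simp [mdet, h1, h2] at h

lemma sq_ge_one_of_ne_zero {x : ℤ} (h : x ≠ 0) : (1 : ℝ) ≤ (x : ℝ) ^ 2 := by
  have : 1 ≤ x ^ 2 := by have := sq_pos_of_ne_zero h; lia
  exact_mod_cast this

/-- Values of a reduced form at nonzero integral points are at least the first coefficient. -/
lemma RedC.le_value {m : ℝ⁴} (h : RedC m) {x y : ℤ} (hxy : x ≠ 0 ∨ y ≠ 0) :
    mA m ≤ mA m * (x : ℝ) ^ 2 + mB m * x * y + mC m * (y : ℝ) ^ 2 := by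
  have hA := mA_pos h.2.2
  obtain ⟨h1, h2, -⟩ := h
  rw [abs_le] at h1
  have hxyZ : 1 ≤ x ^ 2 - |x * y| + y ^ 2 := by
    have h3 : |x * y| * |x * y| = x ^ 2 * y ^ 2 := by rw [abs_mul_abs_self]; ring
    rcases hxy with hx | hy
    · have := sq_pos_of_ne_zero hx
      nlinarith [sq_nonneg (x ^ 2 - y ^ 2), sq_nonneg (|x| - |y|), abs_mul x y, sq_abs x, sq_abs y,
        abs_nonneg x, abs_nonneg y, sq_nonneg y, sq_nonneg (2 * |y| - |x|)]
    · have := sq_pos_of_ne_zero hy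
      nlinarith [sq_nonneg (x ^ 2 - y ^ 2), sq_nonneg (|x| - |y|), abs_mul x y, sq_abs x, sq_abs y,
        abs_nonneg x, abs_nonneg y, sq_nonneg x, sq_nonneg (2 * |x| - |y|)]
  have hxyR : (1 : ℝ) ≤ (x : ℝ) ^ 2 - |(x : ℝ) * y| + (y : ℝ) ^ 2 := by exact_mod_cast hxyZ
  have hb : -(mA m * |(x : ℝ) * y|) ≤ mB m * (x * y) := by
    have : |mB m * ((x : ℝ) * y)| ≤ mA m * |(x : ℝ) * y| := by
      rw [abs_mul]
      exact mul_le_mul_of_nonneg_right (abs_le.mpr h1) (abs_nonneg _)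
    exact (abs_le.mp this).1
  nlinarith [mul_le_mul_of_nonneg_right h2 (sq_nonneg (y : ℝ)), mul_le_mul_of_nonneg_left hxyR hA.le]

lemma RedO.lt_value {m : ℝ⁴} (h : RedO m) {x y : ℤ} (hy : y ≠ 0) :
    mA m < mA m * (x : ℝ) ^ 2 + mB m * x * y + mC m * (y : ℝ) ^ 2 := by
  have hA := mA_pos h.2.2
  obtain ⟨h1, h2, -⟩ := h
  have hy1 := sq_ge_one_of_ne_zero hy
  have h3 : 0 ≤ (mA m - |mB m|) := by linarith
  have hb : -(mA m * |(x : ℝ) * y|) ≤ mB m * (x * y) := by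
    have : |mB m * ((x : ℝ) * y)| ≤ mA m * |(x : ℝ) * y| := by
      rw [abs_mul]
      exact mul_le_mul_of_nonneg_right h1.le (abs_nonneg _)
    exact (abs_le.mp this).1
  have hZ : 1 ≤ x ^ 2 - |x * y| + y ^ 2 := by
    have := sq_pos_of_ne_zero hy
    nlinarith [sq_nonneg (x ^ 2 - y ^ 2), sq_nonneg (|x| - |y|), abs_mul x y, sq_abs x, sq_abs y,
        abs_nonneg x, abs_nonneg y, sq_nonneg x, sq_nonneg (2 * |x| - |y|)]
  have hR : (1 : ℝ) ≤ (x : ℝ) ^ 2 - |(x : ℝ) * y| + (y : ℝ) ^ 2 := by exact_mod_cast hZ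
  nlinarith [mul_lt_mul_of_pos_right h2 (by linarith : 0 < (y : ℝ) ^ 2),
    mul_le_mul_of_nonneg_left hR hA.le]

/-- A form in the interior of the reduced region is equivalent, within the closed reduced region,
only to itself and its opposite. -/
lemma RedO.unique {m m' : ℝ⁴} (hf : toR f = cubeMap m) (hm : RedO m)
    (hg : toR g = cubeMap m') (hm' : RedC m') (h : SLEquiv f g) : g = f ∨ g = -f := by
  obtain ⟨p, q, r, s, hdet, rfl⟩ := h
  have hdetR : (p : ℝ) * s - q * r = 1 := by exact_mod_cast hdet
  have hmm : m' = mact p q r s m := by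
    apply cubeMap_injOn hm'.2.2
    · change 0 < mdet _
      rw [mdet_mact, hdetR, one_mul]; exact hm.2.2
    · rw [cubeMap_mact, ← hf, ← hg, toR_cact]
  have hr : r = 0 := by
    by_contra hr
    have h1 := hm.lt_value (x := p) hr
    rw [← mA_mact (p : ℝ) q r s m, ← hmm] at h1
    have h2 := hm'.le_value (x := s) (y := -r) (Or.inr (by simpa using hr))
    have h3 : mA m' * (s : ℝ) ^ 2 + mB m' * s * ((-r : ℤ) : ℝ) + mC m' * ((-r : ℤ) : ℝ) ^ 2
        = mA m := by
      rw [hmm, mA_mact, mB_mact, mC_mact]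
      push_cast
      linear_combination (mA m * ((p : ℝ) * s - q * r) + mA m) * hdetR
    linarith
  subst hr
  have hps : p * s = 1 := by linarith
  have hA := mA_pos hm.2.2
  have hp2 : p = 1 ∧ s = 1 ∨ p = -1 ∧ s = -1 := Int.mul_eq_one_iff_eq_one_or_neg_one.mp hps
  have hq : q = 0 := by
    by_contra hq
    have hb' := hm'.1
    have hb := hm.1
    rw [hmm, mB_mact, mA_mact] at hb'
    have : (1 : ℝ) ≤ |(q : ℝ)| := by exact_mod_cast Int.one_le_abs hq
    rcases hp2 with ⟨rfl, rfl⟩ | ⟨rfl, rfl⟩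
    · norm_num at hb'
      have := abs_sub_abs_le_abs_sub (2 * mA m * q) (-mB m)
      rw [abs_mul, abs_mul, abs_of_pos hA, abs_neg, sub_neg_eq_add] at this
      norm_num at this
      nlinarith
    · norm_num at hb'
      have := abs_sub_abs_le_abs_sub (-(2 * mA m * q)) (-mB m)
      rw [abs_neg, abs_mul, abs_mul, abs_of_pos hA, abs_neg, sub_neg_eq_add] at this
      norm_num at this
      nlinarith
  subst hq
  rcases hp2 with ⟨rfl, rfl⟩ | ⟨rfl, rfl⟩
  · left; exact cact_id f
  · right; exact cact_neg_id f

/-! ### Counting points of periodic subsets of the lattice in dilated regions -/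

/-- Reduction of an integral vector modulo `m`. -/
def redMod (m : ℕ) (z : ℤ⁴) : Fin 4 → ZMod m := fun i => (z i : ZMod m)

/-- The half-open cell of side `s` with index `w`. -/
def cell (s : ℝ) (w : ℤ⁴) : Set ℝ⁴ :=
  Set.pi Set.univ fun i => Set.Ico (s * w i) (s * (w i + 1))

lemma mem_cell {s : ℝ} {w : ℤ⁴} {x : ℝ⁴} :
    x ∈ cell s w ↔ ∀ i, s * w i ≤ x i ∧ x i < s * (w i + 1) := by
  simp [cell]

lemma measurableSet_cell (s : ℝ) (w : ℤ⁴) : MeasurableSet (cell s w) :=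
  MeasurableSet.univ_pi fun _ => measurableSet_Ico

lemma volume_cell {s : ℝ} (hs : 0 ≤ s) (w : ℤ⁴) :
    MeasureTheory.volume (cell s w) = ENNReal.ofReal (s ^ 4) := by
  rw [cell, volume_pi_Ico]
  simp only [mul_add, mul_one, add_sub_cancel_left, prod_const, card_univ,
    Fintype.card_fin]
  rw [ENNReal.ofReal_pow hs]

lemma exists_cell {s : ℝ} (hs : 0 < s) (x : ℝ⁴) : ∃ w, x ∈ cell s w := by
  refine ⟨fun i => ⌊x i / s⌋, mem_cell.mpr fun i => ⟨?_, ?_⟩⟩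
  · have := Int.floor_le (x i / s)
    rw [le_div_iff₀ hs] at this; linarith
  · have := Int.lt_floor_add_one (x i / s)
    rw [div_lt_iff₀ hs] at this; linarith

lemma cell_unique {s : ℝ} (hs : 0 < s) {x : ℝ⁴} {w w' : ℤ⁴} (h : x ∈ cell s w)
    (h' : x ∈ cell s w') : w = w' := by
  rw [mem_cell] at h h'
  funext i
  have h1 := lt_of_mul_lt_mul_left ((h i).1.trans_lt (h' i).2) hs.le
  have h2 := lt_of_mul_lt_mul_left ((h' i).1.trans_lt (h i).2) hs.le
  have h1' : w i < w' i + 1 := by exact_mod_cast h1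
  have h2' : w' i < w i + 1 := by exact_mod_cast h2
  lia

lemma cell_dist {s : ℝ} (hs : 0 < s) {x y : ℝ⁴} {w : ℤ⁴} (hx : x ∈ cell s w)
    (hy : y ∈ cell s w) : dist x y ≤ s := by
  rw [dist_pi_le_iff hs.le]
  intro i
  rw [mem_cell] at hx hy
  rw [Real.dist_eq, abs_le]
  have := hx i
  have := hy i
  constructor <;> nlinarith

/-- Indices of the cells meeting `K`. -/
def cellsOf (s : ℝ) (K : Set ℝ⁴) : Set ℤ⁴ := {w | (cell s w ∩ K).Nonempty}

lemma cellsOf_finite {s : ℝ} (hs : 0 < s) {K : Set ℝ⁴} (hK : Bornology.IsBounded K) :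
    (cellsOf s K).Finite := by
  obtain ⟨R, hR⟩ := hK.subset_closedBall 0
  refine (finite_Icc (fun _ => ⌊-R / s⌋ - 1 : ℤ⁴) (fun _ => ⌊R / s⌋ + 1)).subset ?_
  rintro w ⟨x, hxw, hxK⟩
  rw [mem_cell] at hxw
  have hx : ∀ i, |x i| ≤ R := fun i => by
    have := hR hxK
    rw [mem_closedBall_zero_iff] at this
    exact (norm_le_pi_norm x i).trans this
  constructor <;> intro i
  · have h1 := (hxw i).2
    have h2 := (abs_le.mp (hx i)).1
    have : -R / s < w i + 1 := by rw [div_lt_iff₀ hs]; linarith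
    have := Int.floor_lt (z := w i + 1) |>.mpr (by push_cast; exact this)
    simp only; lia
  · have h1 := (hxw i).1
    have h2 := (abs_le.mp (hx i)).2
    have : (w i : ℝ) ≤ R / s := by rw [le_div_iff₀ hs]; linarith
    have := Int.le_floor.mpr this
    simp only; lia

lemma cellsOf_ncard_mul_le {s : ℝ} (hs : 0 < s) {K : Set ℝ⁴}
    (hK : Bornology.IsBounded K) :
    ((cellsOf s K).ncard : ENNReal) * ENNReal.ofReal (s ^ 4)
      ≤ volume (cthickening s K) := by
  have hfin := cellsOf_finite hs hK
  have hsub : (⋃ w ∈ hfin.toFinset, cell s w) ⊆ cthickening s K := by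
    intro x hx
    simp only [mem_iUnion, Set.Finite.mem_toFinset] at hx
    obtain ⟨w, ⟨y, hyw, hyK⟩, hxw⟩ := hx
    exact mem_cthickening_of_dist_le x y s K hyK (cell_dist hs hxw hyw)
  refine le_trans ?_ (measure_mono hsub)
  rw [measure_biUnion_finset]
  · simp only [volume_cell hs.le]
    rw [sum_const, nsmul_eq_mul, ncard_eq_toFinset_card _ hfin]
  · intro w _ w' _ hne
    exact Set.disjoint_left.mpr fun x hx hx' => hne (cell_unique hs hx hx')
  · exact fun w _ => measurableSet_cell s w

lemma le_cellsOf_ncard_mul {s : ℝ} (hs : 0 < s) {K : Set ℝ⁴}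
    (hK : Bornology.IsBounded K) :
    volume K ≤ ((cellsOf s K).ncard : ENNReal) * ENNReal.ofReal (s ^ 4) := by
  have hfin := cellsOf_finite hs hK
  have hsub : K ⊆ (⋃ w ∈ hfin.toFinset, cell s w) := by
    intro x hx
    obtain ⟨w, hw⟩ := exists_cell hs x
    simp only [mem_iUnion, Set.Finite.mem_toFinset]
    exact ⟨w, ⟨x, hw, hx⟩, hw⟩
  refine (measure_mono hsub).trans ((measure_biUnion_finset_le _ _).trans ?_)
  simp only [volume_cell hs.le]
  rw [sum_const, nsmul_eq_mul, ncard_eq_toFinset_card _ hfin]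

lemma scaled_mem_cell {m : ℕ} (hm : 0 < m) {t : ℝ} (ht : 0 < t) (z w : ℤ⁴) :
    (t⁻¹ • toR z) ∈ cell (m / t) w ↔ ∀ i, z i / (m : ℤ) = w i := by
  rw [mem_cell]
  refine forall_congr' fun i => ?_
  have hm' : (0 : ℤ) < m := by exact_mod_cast hm
  have e : (t⁻¹ • toR z) i = (z i : ℝ) / t := by simp [toR]; ring
  have h1 : (m : ℝ) / t * w i ≤ (t⁻¹ • toR z) i ↔ (m : ℤ) * w i ≤ z i := by
    rw [e, div_mul_eq_mul_div, div_le_div_iff_of_pos_right ht]; norm_cast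
  have h2 : (t⁻¹ • toR z) i < (m : ℝ) / t * (w i + 1) ↔ z i < (m : ℤ) * (w i + 1) := by
    rw [e, div_mul_eq_mul_div, div_lt_div_iff_of_pos_right ht]; norm_cast
  rw [h1, h2]
  constructor
  · rintro ⟨h3, h4⟩
    apply le_antisymm
    · exact Int.lt_add_one_iff.mp (Int.ediv_lt_of_lt_mul hm' (by linarith))
    · exact Int.le_ediv_of_mul_le hm' (by linarith)
  · intro h
    rw [← h]
    exact ⟨Int.mul_ediv_self_le hm'.ne', Int.lt_mul_ediv_self_add hm' |>.trans_eq (by ring)⟩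

/-- Integral points of the periodic set `S` mod `m` in a dilated region. -/
def latPts (m : ℕ) (S : Set (Fin 4 → ZMod m)) (t : ℝ) (K : Set ℝ⁴) :
    Set ℤ⁴ := {z | redMod m z ∈ S ∧ t⁻¹ • toR z ∈ K}

lemma cell_point_inj {m : ℕ} {z z' : ℤ⁴}
    (h : ∀ i, z i / (m : ℤ) = z' i / (m : ℤ)) (h' : redMod m z = redMod m z') : z = z' := by
  funext i
  have h1 := congrFun h' i
  simp only [redMod] at h1
  rw [intCast_eq_intCast_iff] at h1
  rw [← Int.mul_ediv_add_emod (z i) m, ← Int.mul_ediv_add_emod (z' i) m, h i, h1]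

lemma latPts_ncard_le {m : ℕ} (hm : 0 < m) (S : Set (Fin 4 → ZMod m)) {t : ℝ} (ht : 0 < t)
    {K : Set ℝ⁴} (hK : Bornology.IsBounded K) :
    (latPts m S t K).Finite ∧
      (latPts m S t K).ncard ≤ (cellsOf (m / t) K).ncard * S.ncard := by
  have : NeZero m := ⟨hm.ne'⟩
  have hfin := cellsOf_finite (div_pos (by exact_mod_cast hm : (0 : ℝ) < m) ht) hK
  have hmap : MapsTo (fun z : ℤ⁴ => ((fun i => z i / (m : ℤ) : ℤ⁴), redMod m z))
      (latPts m S t K) (cellsOf (m / t) K ×ˢ S) := by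
    rintro z ⟨h1, h2⟩
    exact ⟨⟨_, (scaled_mem_cell hm ht z _).mpr fun i => rfl, h2⟩, h1⟩
  have hinj : InjOn (fun z : ℤ⁴ => ((fun i => z i / (m : ℤ) : ℤ⁴), redMod m z))
      (latPts m S t K) := by
    intro z _ z' _ h
    simp only [Prod.mk.injEq] at h
    exact cell_point_inj (fun i => congrFun h.1 i) h.2
  have hfin2 : (cellsOf (m / t) K ×ˢ S).Finite := hfin.prod S.toFinite
  refine ⟨Set.Finite.of_injOn hmap hinj hfin2, ?_⟩
  rw [← ncard_prod]
  exact ncard_le_ncard_of_injOn _ hmap hinj hfin2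

lemma le_latPts_ncard {m : ℕ} (hm : 0 < m) (S : Set (Fin 4 → ZMod m)) {t : ℝ} (ht : 0 < t)
    {K U : Set ℝ⁴} (hU : Bornology.IsBounded U) (hKU : cthickening (m / t) K ⊆ U) :
    (cellsOf (m / t) K).ncard * S.ncard ≤ (latPts m S t U).ncard := by
  have : NeZero m := ⟨hm.ne'⟩
  have hmt : 0 < (m : ℝ) / t := div_pos (by exact_mod_cast hm) ht
  have hm' : (0 : ℤ) < m := by exact_mod_cast hm
  rw [← ncard_prod]
  have hdiv : ∀ (p : ℤ⁴ × (Fin 4 → ZMod m)) (i : Fin 4),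
      (m * p.1 i + ((p.2 i).val : ℤ)) / (m : ℤ) = p.1 i := fun p i => by
    rw [Int.mul_add_ediv_left _ _ hm'.ne', Int.ediv_eq_zero_of_lt (by positivity)
      (by exact_mod_cast val_lt _), add_zero]
  have hred : ∀ (p : ℤ⁴ × (Fin 4 → ZMod m)),
      redMod m (fun i => m * p.1 i + ((p.2 i).val : ℤ)) = p.2 := fun p => by
    funext i
    simp [redMod]
  refine ncard_le_ncard_of_injOn
    (fun p : ℤ⁴ × (Fin 4 → ZMod m) => (fun i => m * p.1 i + ((p.2 i).val : ℤ))) ?_ ?_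
    (latPts_ncard_le hm S ht hU).1
  · rintro p ⟨⟨y, hy, hyK⟩, h2⟩
    refine ⟨by rw [hred]; exact h2, hKU ?_⟩
    exact mem_cthickening_of_dist_le _ y _ K hyK
      (cell_dist hmt ((scaled_mem_cell hm ht _ _).mpr (hdiv p)) hy)
  · intro p _ q _ h
    refine Prod.ext (funext fun i => ?_) ?_
    · rw [← hdiv p i, ← hdiv q i]; exact congrArg (· / (m : ℤ)) (congrFun h i)
    · rw [← hred p, ← hred q]; exact congrArg (redMod m) h

lemma tendsto_div_nhdsGT (m : ℝ) (hm : 0 < m) :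
    Tendsto (fun t : ℝ => m / t) atTop (nhdsWithin 0 (Set.Ioi 0)) := by
  rw [tendsto_nhdsWithin_iff]
  exact ⟨tendsto_const_nhds.div_atTop tendsto_id, by
    filter_upwards [eventually_gt_atTop 0] with t ht using div_pos hm ht⟩

lemma div_add_one_mul_le {ε a : ℝ} (hε : 0 ≤ ε) (ha : 0 ≤ a) : ε / (a + 1) * a ≤ ε := by
  rw [div_mul_eq_mul_div, div_le_iff₀ (by positivity)]
  nlinarith

/-- Upper bound for lattice points of a periodic set in dilations of a compact set. -/
lemma eventually_latPts_le {m : ℕ} (hm : 0 < m) (S : Set (Fin 4 → ZMod m))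
    {K : Set ℝ⁴} (hK : IsCompact K) {ε : ℝ} (hε : 0 < ε) :
    ∀ᶠ t : ℝ in atTop, ((latPts m S t K).ncard : ℝ) ≤
      ((S.ncard : ℝ) / m ^ 4 * (volume K).toReal + ε) * t ^ 4 := by
  have hm' : (0 : ℝ) < m := by exact_mod_cast hm
  have hS : (0 : ℝ) ≤ (S.ncard : ℝ) / m ^ 4 := by positivity
  have hlim := tendsto_measure_cthickening_of_isCompact (μ := volume) hK
  have hfin : volume K ≠ ⊤ := hK.measure_lt_top.ne
  have hε' : 0 < ε / ((S.ncard : ℝ) / m ^ 4 + 1) := by positivity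
  have hev : ∀ᶠ δ in nhds (0 : ℝ), volume (cthickening δ K)
      < volume K + ENNReal.ofReal (ε / ((S.ncard : ℝ) / m ^ 4 + 1)) :=
    hlim.eventually_lt_const (lt_add_right hfin (by simpa using hε'))
  have h1 := (tendsto_div_nhdsGT m hm').mono_right nhdsWithin_le_nhds |>.eventually hev
  filter_upwards [h1, eventually_gt_atTop 0] with t h1 ht
  have hmt : 0 < (m : ℝ) / t := div_pos hm' ht
  have h2 := (cellsOf_ncard_mul_le hmt hK.isBounded).trans h1.le
  have h3 := (latPts_ncard_le hm S ht hK.isBounded).2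
  have h4 : ((cellsOf (m / t) K).ncard : ℝ) * (m / t) ^ 4 ≤
      (volume K).toReal + ε / ((S.ncard : ℝ) / m ^ 4 + 1) := by
    have := toReal_mono (by finiteness) h2
    rwa [toReal_mul, toReal_natCast, toReal_ofReal (by positivity),
      toReal_add hfin (by finiteness), toReal_ofReal hε'.le] at this
  have h5 : ((latPts m S t K).ncard : ℝ) ≤ (cellsOf (m / t) K).ncard * S.ncard := by
    exact_mod_cast h3
  refine h5.trans ?_
  rw [show ((cellsOf (m / t) K).ncard : ℝ) * S.ncard
      = (((cellsOf (m / t) K).ncard : ℝ) * (m / t) ^ 4) * ((S.ncard : ℝ) / m ^ 4) * t ^ 4 by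
    field_simp]
  refine mul_le_mul_of_nonneg_right ?_ (by positivity)
  refine (mul_le_mul_of_nonneg_right h4 hS).trans ?_
  have h7 := div_add_one_mul_le hε.le hS
  linarith

/-- Lower bound for lattice points of a periodic set in dilations of a bounded open set. -/
lemma eventually_le_latPts {m : ℕ} (hm : 0 < m) (S : Set (Fin 4 → ZMod m))
    {U : Set ℝ⁴} (hU : IsOpen U) (hb : Bornology.IsBounded U) {ε : ℝ} (hε : 0 < ε) :
    ∀ᶠ t : ℝ in atTop, ((S.ncard : ℝ) / m ^ 4 * (volume U).toReal - ε) * t ^ 4 ≤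
      ((latPts m S t U).ncard : ℝ) := by
  have hm' : (0 : ℝ) < m := by exact_mod_cast hm
  have hS : (0 : ℝ) ≤ (S.ncard : ℝ) / m ^ 4 := by positivity
  have hfin : volume U ≠ ⊤ := hb.measure_lt_top.ne
  have hε' : 0 < ε / ((S.ncard : ℝ) / m ^ 4 + 1) := by positivity
  obtain ⟨K, hKU, hK, hKv⟩ : ∃ K ⊆ U, IsCompact K ∧
      (volume U).toReal - ε / ((S.ncard : ℝ) / m ^ 4 + 1) ≤ (volume K).toReal := by
    obtain ⟨K, h1, h2, h3⟩ := hU.measurableSet.exists_isCompact_lt_add hfin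
      (ε := ENNReal.ofReal (ε / ((S.ncard : ℝ) / m ^ 4 + 1))) (by simpa using hε')
    refine ⟨K, h1, h2, ?_⟩
    have := toReal_mono (by have := h2.measure_lt_top (μ := volume); finiteness) h3.le
    rw [toReal_add h2.measure_lt_top.ne (by finiteness),
      toReal_ofReal hε'.le] at this
    linarith
  obtain ⟨δ, hδ, hδU⟩ := hK.exists_cthickening_subset_open hU hKU
  have h1 := (tendsto_div_nhdsGT m hm').mono_right nhdsWithin_le_nhds |>.eventually
    (eventually_lt_nhds hδ)
  filter_upwards [h1, eventually_gt_atTop 0] with t h1 ht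
  have hmt : 0 < (m : ℝ) / t := div_pos hm' ht
  have h3 := le_latPts_ncard hm S ht hb ((cthickening_mono h1.le K).trans hδU)
  have h4 : (volume K).toReal ≤ ((cellsOf (m / t) K).ncard : ℝ) * (m / t) ^ 4 := by
    have := toReal_mono (by finiteness) (le_cellsOf_ncard_mul hmt hK.isBounded)
    rwa [toReal_mul, toReal_natCast, toReal_ofReal (by positivity)] at this
  have h5 : ((cellsOf (m / t) K).ncard : ℝ) * S.ncard ≤ (latPts m S t U).ncard := by
    exact_mod_cast h3
  refine le_trans ?_ h5
  rw [show ((cellsOf (m / t) K).ncard : ℝ) * S.ncard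
      = (((cellsOf (m / t) K).ncard : ℝ) * (m / t) ^ 4) * ((S.ncard : ℝ) / m ^ 4) * t ^ 4 by
    field_simp]
  refine mul_le_mul_of_nonneg_right ?_ (by positivity)
  refine le_trans ?_ (mul_le_mul_of_nonneg_right (hKv.trans h4) hS)
  have h7 := div_add_one_mul_le hε.le hS
  nlinarith

/-! ### The volume of the fundamental region -/

/-- The Jacobian matrix of `cubeMap`. -/
def cubeJac (m : ℝ⁴) : Matrix (Fin 4) (Fin 4) ℝ :=
  !![3 * m 0 ^ 2, 0, 3 * m 2 ^ 2, 0;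
     2 * m 0 * m 1, m 0 ^ 2, 2 * m 2 * m 3, m 2 ^ 2;
     m 1 ^ 2, 2 * m 0 * m 1, m 3 ^ 2, 2 * m 2 * m 3;
     0, 3 * m 1 ^ 2, 0, 3 * m 3 ^ 2]

lemma det_cubeJac (m : ℝ⁴) : (cubeJac m).det = 9 * mdet m ^ 4 := by
  simp [cubeJac, Matrix.det_succ_row_zero, Fin.sum_univ_succ, Fin.succAbove, mdet]
  ring

/-- The linear forms attached to the coordinates `(s, r, u₀, u₁)`. -/
def formPar (x : ℝ⁴) : ℝ⁴ :=
  ![x 2, x 0 * x 2 - x 1 * x 3, x 3, x 0 * x 3 + x 1 * x 2]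

/-- The Jacobian matrix of `formPar`. -/
def formParJac (x : ℝ⁴) : Matrix (Fin 4) (Fin 4) ℝ :=
  !![0, 0, 1, 0;
     x 2, -x 3, x 0, -x 1;
     0, 0, 0, 1;
     x 3, x 2, x 1, x 0]

lemma det_formParJac (x : ℝ⁴) : (formParJac x).det = -(x 2 ^ 2 + x 3 ^ 2) := by
  simp [formParJac, Matrix.det_succ_row_zero, Fin.sum_univ_succ, Fin.succAbove]
  ring

lemma hasStrictFDerivAt_cubeMap (m : ℝ⁴) :
    HasStrictFDerivAt cubeMap (LinearMap.toContinuousLinearMap (Matrix.toLin' (cubeJac m))) m := by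
  have P : ∀ i : Fin 4, HasStrictFDerivAt (fun m : ℝ⁴ => m i)
    (ContinuousLinearMap.proj (R := ℝ) (φ := fun _ : Fin 4 => ℝ) i) m := fun i => hasStrictFDerivAt_apply i m
  refine hasStrictFDerivAt_pi'.mpr ?_
  intro i
  fin_cases i
  · refine HasStrictFDerivAt.congr_fderiv (((P 0).pow 3).add ((P 2).pow 3)) ?_
    ext v
    simp [cubeJac, dotProduct, Fin.sum_univ_four]
  · refine HasStrictFDerivAt.congr_fderiv ((((P 0).pow 2).mul (P 1)).add (((P 2).pow 2).mul (P 3))) ?_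
    ext v
    simp [cubeJac, dotProduct, Fin.sum_univ_four]
    ring
  · refine HasStrictFDerivAt.congr_fderiv (((P 0).mul ((P 1).pow 2)).add ((P 2).mul ((P 3).pow 2))) ?_
    ext v
    simp [cubeJac, dotProduct, Fin.sum_univ_four]
    ring
  · refine HasStrictFDerivAt.congr_fderiv (((P 1).pow 3).add ((P 3).pow 3)) ?_
    ext v
    simp [cubeJac, dotProduct, Fin.sum_univ_four]

lemma hasStrictFDerivAt_formPar (x : ℝ⁴) :
    HasStrictFDerivAt formPar
      (LinearMap.toContinuousLinearMap (Matrix.toLin' (formParJac x))) x := by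
  have P : ∀ i : Fin 4, HasStrictFDerivAt (fun m : ℝ⁴ => m i)
    (ContinuousLinearMap.proj (R := ℝ) (φ := fun _ : Fin 4 => ℝ) i) x := fun i => hasStrictFDerivAt_apply i x
  refine hasStrictFDerivAt_pi'.mpr ?_
  intro i
  fin_cases i
  · refine HasStrictFDerivAt.congr_fderiv (P 2) ?_
    ext v
    simp [formParJac, dotProduct, Fin.sum_univ_four]
  · refine HasStrictFDerivAt.congr_fderiv (((P 0).mul (P 2)).sub ((P 1).mul (P 3))) ?_
    ext v
    simp [formParJac, dotProduct, Fin.sum_univ_four]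
    ring
  · refine HasStrictFDerivAt.congr_fderiv (P 3) ?_
    ext v
    simp [formParJac, dotProduct, Fin.sum_univ_four]
  · refine HasStrictFDerivAt.congr_fderiv (((P 0).mul (P 3)).add ((P 1).mul (P 2))) ?_
    ext v
    simp [formParJac, dotProduct, Fin.sum_univ_four]
    ring

lemma isOpen_cubeMap_image {U : Set ℝ⁴} (hU : IsOpen U) (hd : ∀ m ∈ U, mdet m ≠ 0) :
    IsOpen (cubeMap '' U) := by
  rw [isOpen_iff_mem_nhds]
  rintro _ ⟨m, hm, rfl⟩
  have hs := hasStrictFDerivAt_cubeMap m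
  have hsurj : (LinearMap.toContinuousLinearMap (Matrix.toLin' (cubeJac m))).range = ⊤ := by
    have hu : IsUnit (cubeJac m).det := by
      rw [det_cubeJac]
      have := hd m hm
      simp [this]
    rw [LinearMap.range_eq_top]
    intro y
    refine ⟨(cubeJac m)⁻¹.mulVec y, ?_⟩
    simp [Matrix.mulVec_mulVec, Matrix.mul_nonsing_inv _ hu]
  rw [← hs.map_nhds_eq_of_surj hsurj]
  exact image_mem_map (hU.mem_nhds hm)

lemma continuous_cubeMap : Continuous cubeMap :=
  continuous_iff_continuousAt.mpr fun m => (hasStrictFDerivAt_cubeMap m).continuousAt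

lemma mdet_formPar (x : ℝ⁴) : mdet (formPar x) = x 1 * (x 2 ^ 2 + x 3 ^ 2) := by
  simp [mdet, formPar]; ring

lemma mA_formPar (x : ℝ⁴) : mA (formPar x) = x 2 ^ 2 + x 3 ^ 2 := by
  simp [mA, formPar]

lemma mB_formPar (x : ℝ⁴) : mB (formPar x) = 2 * x 0 * (x 2 ^ 2 + x 3 ^ 2) := by
  simp [mB, formPar]; ring

lemma mC_formPar (x : ℝ⁴) :
    mC (formPar x) = (x 0 ^ 2 + x 1 ^ 2) * (x 2 ^ 2 + x 3 ^ 2) := by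
  simp [mC, formPar]; ring

lemma exists_formPar {m : ℝ⁴} (h : mA m ≠ 0) : ∃ x, formPar x = m := by
  refine ⟨![(m 0 * m 1 + m 2 * m 3) / mA m, mdet m / mA m, m 0, m 2], ?_⟩
  apply form_ext
  · simp [formPar]
  · simp [formPar]; field_simp; simp only [mA, mdet]; ring
  · simp [formPar]
  · simp [formPar]; field_simp; simp only [mA, mdet]; ring

lemma formPar_injOn : InjOn formPar {x | 0 < x 2 ^ 2 + x 3 ^ 2} := by
  intro x hx y _ h
  have h0 := congrFun h 0
  have h1 := congrFun h 1
  have h2 := congrFun h 2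
  have h3 := congrFun h 3
  simp [formPar] at h0 h1 h2 h3
  rw [← h0, ← h2] at h1 h3
  have hx' : x 2 ^ 2 + x 3 ^ 2 ≠ 0 := ne_of_gt hx
  apply form_ext
  · apply mul_right_cancel₀ hx'; linear_combination x 2 * h1 + x 3 * h3
  · apply mul_right_cancel₀ hx'; linear_combination -x 3 * h1 + x 2 * h3
  · exact h0
  · exact h2

lemma volume_cubeMap_formPar_image {P : Set ℝ⁴} (hP : MeasurableSet P)
    (hpos : ∀ x ∈ P, 0 < x 1 ∧ 0 < x 2 ^ 2 + x 3 ^ 2) :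
    volume (cubeMap '' (formPar '' P)) =
      ∫⁻ x in P, ENNReal.ofReal (9 * x 1 ^ 4 * (x 2 ^ 2 + x 3 ^ 2) ^ 5) := by
  rw [← Set.image_comp, ← lintegral_abs_det_fderiv_eq_addHaar_image volume hP
    (f' := fun x => (LinearMap.toContinuousLinearMap (Matrix.toLin' (cubeJac (formPar x)))).comp
      (LinearMap.toContinuousLinearMap (Matrix.toLin' (formParJac x))))]
  · refine setLIntegral_congr_fun hP fun x hx => ?_
    congr 1
    have : ((LinearMap.toContinuousLinearMap (Matrix.toLin' (cubeJac (formPar x)))).comp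
      (LinearMap.toContinuousLinearMap (Matrix.toLin' (formParJac x)))).det =
        (cubeJac (formPar x)).det * (formParJac x).det := by
      rw [ContinuousLinearMap.det, ContinuousLinearMap.toLinearMap_comp, LinearMap.det_comp]
      simp
    rw [this, det_cubeJac, det_formParJac, mdet_formPar]
    rw [mul_neg, abs_neg, abs_of_nonneg (by positivity)]
    ring
  · intro x _
    exact ((hasStrictFDerivAt_cubeMap (formPar x)).hasFDerivAt.comp x
      (hasStrictFDerivAt_formPar x).hasFDerivAt).hasFDerivWithinAt
  · refine cubeMap_injOn.comp (formPar_injOn.mono fun x hx => (hpos x hx).2) ?_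
    intro x hx
    change 0 < mdet _
    rw [mdet_formPar]
    exact mul_pos (hpos x hx).1 (hpos x hx).2

section Volume
lemma lintegral_fin_four {F : ℝ⁴ → ENNReal} (hF : Measurable F) :
    ∫⁻ x, F x = ∫⁻ s : ℝ, ∫⁻ r : ℝ, ∫⁻ u : ℝ × ℝ, F ![s, r, u.1, u.2] := by
  rw [← (volume_preserving_piFinSuccAbove (fun _ : Fin 4 => ℝ) 0).symm.lintegral_comp hF]
  rw [Measure.volume_eq_prod, lintegral_prod _ (by fun_prop)]
  refine lintegral_congr fun s => ?_
  have h3 : Measurable fun y : Fin 3 → ℝ =>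
      F ((MeasurableEquiv.piFinSuccAbove (fun _ : Fin 4 => ℝ) 0).symm (s, y)) := by fun_prop
  rw [← (volume_preserving_piFinSuccAbove (fun _ : Fin 3 => ℝ) 0).symm.lintegral_comp h3]
  rw [Measure.volume_eq_prod, lintegral_prod _ (by fun_prop)]
  refine lintegral_congr fun r => ?_
  have h2 : Measurable fun y : Fin 2 → ℝ =>
      F ((MeasurableEquiv.piFinSuccAbove (fun _ : Fin 4 => ℝ) 0).symm
        (s, (MeasurableEquiv.piFinSuccAbove (fun _ : Fin 3 => ℝ) 0).symm (r, y))) := by fun_prop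
  rw [← (volume_preserving_finTwoArrow ℝ).symm.lintegral_comp h2]
  refine lintegral_congr fun u => ?_
  congr 1
  apply form_ext <;> rfl

lemma lintegral_radial {h : ℝ → ENNReal} (hm : Measurable h) :
    ∫⁻ u : ℝ × ℝ, h (u.1 ^ 2 + u.2 ^ 2) =
      ENNReal.ofReal (2 * Real.pi) * ∫⁻ v in Set.Ioi (0 : ℝ), ENNReal.ofReal v * h (v ^ 2) := by
  rw [← lintegral_comp_polarCoord_symm]
  have e : ∀ p : ℝ × ℝ, (polarCoord.symm p).1 ^ 2 + (polarCoord.symm p).2 ^ 2 = p.1 ^ 2 := by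
    intro p
    simp only [polarCoord_symm_apply]
    linear_combination p.1 ^ 2 * Real.cos_sq_add_sin_sq p.2
  simp only [e, smul_eq_mul, polarCoord_target]
  rw [Measure.volume_eq_prod, ← Measure.prod_restrict, lintegral_prod _ (by fun_prop)]
  simp only [lintegral_const, Measure.restrict_apply, MeasurableSet.univ, Set.univ_inter,
    volume_Ioo]
  rw [lintegral_mul_const _ (by fun_prop), mul_comm]
  congr 2
  ring

lemma ae_eq_Ioo_of_between {a b : ℝ} {A : Set ℝ} (h1 : Set.Ioo a b ⊆ A) (h2 : A ⊆ Set.Icc a b) :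
    A =ᵐ[volume] Set.Ioo a b :=
  (h2.eventuallyLE.trans Ioo_ae_eq_Icc.symm.le).antisymm h1.eventuallyLE

lemma ae_eq_Ioi_of_between {a : ℝ} {A : Set ℝ} (h1 : Set.Ioi a ⊆ A) (h2 : A ⊆ Set.Ici a) :
    A =ᵐ[volume] Set.Ioi a :=
  (h2.eventuallyLE.trans Ioi_ae_eq_Ici.symm.le).antisymm h1.eventuallyLE

/-- The parameter region, for a relation between `<` and `≤`. -/
def parReg (rel : ℝ → ℝ → Prop) : Set ℝ⁴ :=
  {x | rel |x 0| (1 / 2) ∧ rel 1 (x 0 ^ 2 + x 1 ^ 2) ∧ 0 < x 1 ∧ 0 < x 2 ^ 2 + x 3 ^ 2 ∧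
    rel (x 1 * (x 2 ^ 2 + x 3 ^ 2)) 1}

variable {rel : ℝ → ℝ → Prop}

lemma measurableSet_rel (hmeas : MeasurableSet {p : ℝ × ℝ | rel p.1 p.2}) {α : Type*}
    [MeasurableSpace α] {f g : α → ℝ} (hf : Measurable f) (hg : Measurable g) :
    MeasurableSet {x | rel (f x) (g x)} := (hf.prodMk hg) hmeas

lemma measurableSet_setOf_and {α : Type*} [MeasurableSpace α] {p q : α → Prop}
    (hp : MeasurableSet {x | p x}) (hq : MeasurableSet {x | q x}) :
    MeasurableSet {x | p x ∧ q x} := hp.inter hq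

lemma measurableSet_parReg (hmeas : MeasurableSet {p : ℝ × ℝ | rel p.1 p.2}) :
    MeasurableSet (parReg rel) := by
  refine measurableSet_setOf_and ?_ (measurableSet_setOf_and ?_ (measurableSet_setOf_and ?_
    (measurableSet_setOf_and ?_ ?_)))
  · refine measurableSet_rel hmeas ?_ ?_ <;> fun_prop
  · refine measurableSet_rel hmeas ?_ ?_ <;> fun_prop
  · refine measurableSet_lt ?_ ?_ <;> fun_prop
  · refine measurableSet_lt ?_ ?_ <;> fun_prop
  · refine measurableSet_rel hmeas ?_ ?_ <;> fun_prop

lemma lintegral_pow_eleven {c : ℝ} (hc : 0 ≤ c) :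
    ∫⁻ v in Set.Ioo 0 c, ENNReal.ofReal (v ^ 11) = ENNReal.ofReal (c ^ 12 / 12) := by
  rw [restrict_Ioo_eq_restrict_Ioc, ← ofReal_integral_eq_lintegral_ofReal,
    ← intervalIntegral.integral_of_le hc, integral_pow]
  · norm_num
  · exact (intervalIntegral.intervalIntegrable_pow 11).1
  · filter_upwards [self_mem_ae_restrict measurableSet_Ioc] with v hv
    exact pow_nonneg hv.1.le _

open Classical in
lemma lintegral_inner (hlt : ∀ a b, a < b → rel a b) (hle : ∀ a b, rel a b → a ≤ b)
    (hmeas : MeasurableSet {p : ℝ × ℝ | rel p.1 p.2}) {r : ℝ} (hr : 0 < r) :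
    ∫⁻ u : ℝ × ℝ, (if 0 < u.1 ^ 2 + u.2 ^ 2 ∧ rel (r * (u.1 ^ 2 + u.2 ^ 2)) 1 then
      ENNReal.ofReal (9 * r ^ 4 * (u.1 ^ 2 + u.2 ^ 2) ^ 5) else 0) =
      ENNReal.ofReal (3 * Real.pi / 2 * r ^ (-2 : ℝ)) := by
  have hmeas' : MeasurableSet {q : ℝ | 0 < q ∧ rel (r * q) 1} := by
    refine measurableSet_setOf_and ?_ ?_
    · refine measurableSet_lt ?_ ?_ <;> fun_prop
    · refine measurableSet_rel hmeas ?_ ?_ <;> fun_prop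
  rw [lintegral_radial (h := fun q => if 0 < q ∧ rel (r * q) 1 then
      ENNReal.ofReal (9 * r ^ 4 * q ^ 5) else 0) (Measurable.ite hmeas' (by fun_prop) (by fun_prop))]
  obtain ⟨c, hc0, hc⟩ : ∃ c : ℝ, 0 < c ∧ r * c ^ 2 = 1 :=
    ⟨√(r⁻¹), by positivity, by rw [sq_sqrt (by positivity)]; field_simp⟩
  have e1 : ∫⁻ v in Set.Ioi (0 : ℝ), ENNReal.ofReal v * (if 0 < v ^ 2 ∧ rel (r * v ^ 2) 1 then
      ENNReal.ofReal (9 * r ^ 4 * (v ^ 2) ^ 5) else 0) =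
      ∫⁻ v in {v | 0 < v ∧ rel (r * v ^ 2) 1}, ENNReal.ofReal (9 * r ^ 4) *
        ENNReal.ofReal (v ^ 11) := by
    have hm2 : MeasurableSet {v : ℝ | 0 < v ∧ rel (r * v ^ 2) 1} := by
      refine measurableSet_setOf_and ?_ ?_
      · refine measurableSet_lt ?_ ?_ <;> fun_prop
      · refine measurableSet_rel hmeas ?_ ?_ <;> fun_prop
    rw [← lintegral_indicator measurableSet_Ioi, ← lintegral_indicator hm2]
    refine lintegral_congr fun v => ?_
    by_cases hv : 0 < v
    · by_cases hv2 : rel (r * v ^ 2) 1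
      · rw [indicator_of_mem (by exact hv), indicator_of_mem (by exact ⟨hv, hv2⟩),
          if_pos ⟨by positivity, hv2⟩, ← ENNReal.ofReal_mul hv.le,
          ← ENNReal.ofReal_mul (by positivity)]
        congr 1; ring
      · rw [indicator_of_mem (by exact hv), indicator_of_notMem (fun h => hv2 h.2),
          if_neg (fun h => hv2 h.2), mul_zero]
    · rw [indicator_of_notMem (by exact hv), indicator_of_notMem (fun h => hv h.1)]
  have e2 : ({v : ℝ | 0 < v ∧ rel (r * v ^ 2) 1} : Set ℝ) =ᵐ[volume] Set.Ioo 0 c := by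
    apply ae_eq_Ioo_of_between
    · rintro v ⟨h1, h2⟩
      refine ⟨h1, hlt _ _ ?_⟩
      rw [← hc]
      exact mul_lt_mul_of_pos_left (pow_lt_pow_left₀ h2 h1.le (by norm_num)) hr
    · rintro v ⟨h1, h2⟩
      refine ⟨h1.le, ?_⟩
      have h3 := hle _ _ h2
      rw [← hc] at h3
      exact (pow_le_pow_iff_left₀ h1.le hc0.le (by norm_num)).mp (le_of_mul_le_mul_left h3 hr)
  rw [e1, setLIntegral_congr e2, lintegral_const_mul _ (by fun_prop), lintegral_pow_eleven hc0.le,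
    ← ENNReal.ofReal_mul (by positivity), ← ENNReal.ofReal_mul (by positivity)]
  congr 1
  have h4 : r ^ (-2 : ℝ) = c ^ 4 := by
    have : r ^ (-2 : ℝ) = (r ^ 2)⁻¹ := by
      rw [Real.rpow_neg hr.le]; norm_num
    rw [this]
    have hr2 : r ^ 2 ≠ 0 := by positivity
    field_simp
    linear_combination -(r * c ^ 2 + 1) * hc
  rw [h4]
  have h5 : r ^ 4 * c ^ 8 = 1 := by
    have : r ^ 4 * c ^ 8 = (r * c ^ 2) ^ 4 := by ring
    rw [this, hc]; norm_num
  linear_combination (3 * Real.pi / 2 * c ^ 4) * h5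

open Classical in
lemma lintegral_middle (hlt : ∀ a b, a < b → rel a b) (hle : ∀ a b, rel a b → a ≤ b)
    (hmeas : MeasurableSet {p : ℝ × ℝ | rel p.1 p.2}) {s : ℝ} (hs : |s| ≤ 1 / 2) :
    ∫⁻ r : ℝ, (if rel 1 (s ^ 2 + r ^ 2) ∧ 0 < r then
      ENNReal.ofReal (3 * Real.pi / 2 * r ^ (-2 : ℝ)) else 0) =
      ENNReal.ofReal (3 * Real.pi / 2 * (1 / √(1 - s ^ 2))) := by
  have hs2 : s ^ 2 ≤ 1 / 4 := by
    have := sq_abs s; nlinarith [abs_nonneg s]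
  have hc0 : 0 < √(1 - s ^ 2) := Real.sqrt_pos.mpr (by linarith)
  have hcsq : √(1 - s ^ 2) ^ 2 = 1 - s ^ 2 := sq_sqrt (by linarith)
  set c := √(1 - s ^ 2)
  have hm2 : MeasurableSet {r : ℝ | rel 1 (s ^ 2 + r ^ 2) ∧ 0 < r} := by
    refine measurableSet_setOf_and ?_ ?_
    · refine measurableSet_rel hmeas ?_ ?_ <;> fun_prop
    · refine measurableSet_lt ?_ ?_ <;> fun_prop
  have e1 : ∫⁻ r : ℝ, (if rel 1 (s ^ 2 + r ^ 2) ∧ 0 < r then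
      ENNReal.ofReal (3 * Real.pi / 2 * r ^ (-2 : ℝ)) else 0) =
      ∫⁻ r in {r : ℝ | rel 1 (s ^ 2 + r ^ 2) ∧ 0 < r}, ENNReal.ofReal (3 * Real.pi / 2) *
        ENNReal.ofReal (r ^ (-2 : ℝ)) := by
    rw [← lintegral_indicator hm2]
    refine lintegral_congr fun r => ?_
    simp only [indicator, mem_setOf_eq]
    rw [ENNReal.ofReal_mul (by positivity)]
  have e2 : ({r : ℝ | rel 1 (s ^ 2 + r ^ 2) ∧ 0 < r} : Set ℝ) =ᵐ[volume] Set.Ioi c := by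
    apply ae_eq_Ioi_of_between
    · intro r hr
      have hr : c < r := hr
      have hr' := pow_lt_pow_left₀ hr hc0.le (two_ne_zero)
      exact ⟨hlt _ _ (by linarith), hc0.trans hr⟩
    · rintro r ⟨h1, h2⟩
      have := hle _ _ h1
      exact (pow_le_pow_iff_left₀ hc0.le h2.le two_ne_zero).mp (by linarith)
  rw [e1, setLIntegral_congr e2, lintegral_const_mul _ (by fun_prop),
    ← ofReal_integral_eq_lintegral_ofReal (integrableOn_Ioi_rpow_of_lt (by norm_num) hc0),
    integral_Ioi_rpow_of_lt (by norm_num) hc0, ← ENNReal.ofReal_mul (by positivity)]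
  · congr 2
    norm_num
    rw [Real.rpow_neg_one]
  · filter_upwards [self_mem_ae_restrict measurableSet_Ioi] with v hv
    have hv : c < v := hv
    have : 0 < v := hc0.trans hv
    change 0 ≤ v ^ (-2 : ℝ)
    positivity

lemma lintegral_outer : ∫⁻ s in Set.Ioo (-(1 / 2) : ℝ) (1 / 2),
    ENNReal.ofReal (3 * Real.pi / 2 * (1 / √(1 - s ^ 2))) = ENNReal.ofReal (Real.pi ^ 2 / 2) := by
  have hcont : ContinuousOn (fun s : ℝ => 1 / √(1 - s ^ 2)) (Set.uIcc (-(1 / 2)) (1 / 2)) := by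
    rw [Set.uIcc_of_le (by norm_num)]
    apply ContinuousOn.div (by fun_prop) (by fun_prop)
    rintro s ⟨h1, h2⟩
    exact (Real.sqrt_pos.mpr (by nlinarith)).ne'
  have hint : IntervalIntegrable (fun s : ℝ => 1 / √(1 - s ^ 2)) volume (-(1 / 2)) (1 / 2) :=
    hcont.intervalIntegrable
  have hval : ∫ s in (-(1 / 2) : ℝ)..(1 / 2), 1 / √(1 - s ^ 2) = Real.pi / 3 := by
    rw [intervalIntegral.integral_eq_sub_of_hasDerivAt (f := arcsin) _ hint]
    · have : arcsin (1 / 2) = Real.pi / 6 := by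
        rw [← sin_pi_div_six]
        exact arcsin_sin (by linarith [pi_pos]) (by linarith [pi_pos])
      rw [arcsin_neg, this]; ring
    · intro s hs
      rw [Set.uIcc_of_le (by norm_num)] at hs
      exact hasDerivAt_arcsin (by linarith [hs.1]) (by linarith [hs.2])
  rw [restrict_Ioo_eq_restrict_Ioc, ← ofReal_integral_eq_lintegral_ofReal,
    ← intervalIntegral.integral_of_le (by norm_num), intervalIntegral.integral_const_mul, hval]
  · congr 1; ring
  · exact (hint.1).const_mul _
  · exact Eventually.of_forall fun s => by positivity

/-- The integral of the Jacobian over the parameter region. -/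
lemma lintegral_parReg (hlt : ∀ a b, a < b → rel a b) (hle : ∀ a b, rel a b → a ≤ b)
    (hmeas : MeasurableSet {p : ℝ × ℝ | rel p.1 p.2}) :
    ∫⁻ x in parReg rel, ENNReal.ofReal (9 * x 1 ^ 4 * (x 2 ^ 2 + x 3 ^ 2) ^ 5) =
      ENNReal.ofReal (Real.pi ^ 2 / 2) := by
  classical
  have hm := measurableSet_parReg hmeas
  rw [← lintegral_indicator hm, lintegral_fin_four (Measurable.indicator (by fun_prop) hm)]
  have e1 : ∀ s r : ℝ, ∫⁻ u : ℝ × ℝ, (parReg rel).indicator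
      (fun x => ENNReal.ofReal (9 * x 1 ^ 4 * (x 2 ^ 2 + x 3 ^ 2) ^ 5)) ![s, r, u.1, u.2] =
      if rel |s| (1 / 2) then (if rel 1 (s ^ 2 + r ^ 2) ∧ 0 < r then
      ENNReal.ofReal (3 * Real.pi / 2 * r ^ (-2 : ℝ)) else 0) else 0 := by
    intro s r
    by_cases h1 : rel |s| (1 / 2)
    · rw [if_pos h1]
      by_cases h2 : rel 1 (s ^ 2 + r ^ 2) ∧ 0 < r
      · rw [if_pos h2, ← lintegral_inner hlt hle hmeas h2.2]
        refine lintegral_congr fun u => ?_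
        simp only [indicator, parReg, mem_setOf_eq, Matrix.cons_val]
        simp only [h1, h2.1, h2.2, true_and]
      · rw [if_neg h2, ← lintegral_zero]
        refine lintegral_congr fun u => ?_
        rw [indicator_of_notMem]
        rintro ⟨-, h3, h4, -⟩
        exact h2 ⟨h3, h4⟩
    · rw [if_neg h1, ← lintegral_zero]
      refine lintegral_congr fun u => ?_
      rw [indicator_of_notMem]
      rintro ⟨h3, -⟩
      exact h1 h3
  simp only [e1]
  have e2 : ∀ s : ℝ, ∫⁻ r : ℝ, (if rel |s| (1 / 2) then (if rel 1 (s ^ 2 + r ^ 2) ∧ 0 < r then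
      ENNReal.ofReal (3 * Real.pi / 2 * r ^ (-2 : ℝ)) else 0) else 0) =
      {s : ℝ | rel |s| (1 / 2)}.indicator
        (fun s => ENNReal.ofReal (3 * Real.pi / 2 * (1 / √(1 - s ^ 2)))) s := by
    intro s
    by_cases h1 : rel |s| (1 / 2)
    · simp only [h1, if_true]
      rw [lintegral_middle hlt hle hmeas (hle _ _ h1), indicator_of_mem (by exact h1)]
    · simp only [h1, if_false, lintegral_zero]
      rw [indicator_of_notMem (by exact h1)]
  simp only [e2]
  have e3 : ({s : ℝ | rel |s| (1 / 2)} : Set ℝ) =ᵐ[volume] Set.Ioo (-(1 / 2)) (1 / 2) := by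
    apply ae_eq_Ioo_of_between
    · intro s hs
      exact hlt _ _ (abs_lt.mpr hs)
    · intro s hs
      exact abs_le.mp (hle _ _ hs)
  rw [lintegral_indicator (measurableSet_rel hmeas (by fun_prop) (by fun_prop)),
    setLIntegral_congr e3, lintegral_outer]

end Volume

/-! ### Truncated fundamental regions -/

/-- Closed truncated region of pairs of linear forms. -/
def regC (η : ℝ) : Set ℝ⁴ :=
  {m | |mB m| ≤ mA m ∧ mA m ≤ mC m ∧ 0 ≤ mdet m ∧ mdet m ≤ 1 ∧ η ≤ mA m}

/-- Open truncated region of pairs of linear forms. -/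
def regO (η : ℝ) : Set ℝ⁴ :=
  {m | |mB m| < mA m ∧ mA m < mC m ∧ 0 < mdet m ∧ mdet m < 1 ∧ η < mA m}

lemma continuous_mA : Continuous mA := by unfold mA; fun_prop
lemma continuous_mB : Continuous mB := by unfold mB; fun_prop
lemma continuous_mC : Continuous mC := by unfold mC; fun_prop
lemma continuous_mdet : Continuous mdet := by unfold mdet; fun_prop

lemma mdet_pos_of_regC {η : ℝ} (hη : 0 < η) {m : ℝ⁴} (h : m ∈ regC η) : 0 < mdet m := by
  obtain ⟨h1, h2, h3, -, h5⟩ := h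
  rcases h3.lt_or_eq with h | h
  · exact h
  · exfalso
    have := four_mA_mul_mC m
    rw [← h] at this
    rw [abs_le] at h1
    nlinarith

lemma isCompact_regC {η : ℝ} (hη : 0 < η) : IsCompact (regC η) := by
  apply isCompact_of_isClosed_isBounded
  · exact (isClosed_le continuous_mB.abs continuous_mA).inter
      ((isClosed_le continuous_mA continuous_mC).inter
      ((isClosed_le continuous_const continuous_mdet).inter
      ((isClosed_le continuous_mdet continuous_const).inter
      (isClosed_le continuous_const continuous_mA))))
  · have hb : ∀ m ∈ regC η, mA m ≤ 2 ∧ mC m ≤ 2 / η := by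
      rintro m ⟨h1, h2, h3, h4, h5⟩
      have h := four_mA_mul_mC m
      have hA : 0 < mA m := hη.trans_le h5
      have hB2 : mB m ^ 2 ≤ mA m ^ 2 := by
        rw [← sq_abs (mB m)]
        exact pow_le_pow_left₀ (abs_nonneg _) h1 2
      have hA2 : mA m ^ 2 ≤ mA m * mC m := by nlinarith
      have hA3 : mA m ≤ 2 := by nlinarith
      refine ⟨hA3, ?_⟩
      rw [le_div_iff₀ hη]
      have hC : 0 < mC m := hA.trans_le h2
      nlinarith
    refine (isBounded_closedBall (x := (0 : ℝ⁴)) (r := 2 + 2 / η)).subset ?_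
    intro m hm
    obtain ⟨h1, h2⟩ := hb m hm
    rw [mem_closedBall_zero_iff, pi_norm_le_iff_of_nonneg (by positivity)]
    have hη2 : 0 < 2 / η := by positivity
    intro i
    rw [norm_eq_abs]
    apply abs_le_of_sq_le_sq _ (by positivity)
    unfold mA at h1
    unfold mC at h2
    fin_cases i <;> simp <;>
      nlinarith [sq_nonneg (m 0), sq_nonneg (m 1), sq_nonneg (m 2), sq_nonneg (m 3)]

lemma isOpen_regO (η : ℝ) : IsOpen (regO η) := by
  exact (isOpen_lt continuous_mB.abs continuous_mA).inter
    ((isOpen_lt continuous_mA continuous_mC).inter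
    ((isOpen_lt continuous_const continuous_mdet).inter
    ((isOpen_lt continuous_mdet continuous_const).inter
    (isOpen_lt continuous_const continuous_mA))))

lemma regO_subset_regC (η : ℝ) : regO η ⊆ regC η :=
  fun _ h => ⟨h.1.le, h.2.1.le, h.2.2.1.le, h.2.2.2.1.le, h.2.2.2.2.le⟩

lemma formPar_image_parReg_le {η : ℝ} (hη : 0 < η) : regC η ⊆ formPar '' parReg (· ≤ ·) := by
  intro m hm
  have hd := mdet_pos_of_regC hη hm
  obtain ⟨h1, h2, h3, h4, h5⟩ := hm
  have hA : 0 < mA m := hη.trans_le h5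
  obtain ⟨x, rfl⟩ := exists_formPar hA.ne'
  rw [mdet_formPar] at hd h4
  rw [mA_formPar] at hA h1 h2
  rw [mB_formPar, abs_mul, abs_mul, abs_of_pos hA, abs_two] at h1
  rw [mC_formPar] at h2
  refine ⟨x, ⟨?_, ?_, ?_, hA, h4⟩, rfl⟩
  · change |x 0| ≤ 1 / 2
    nlinarith
  · change 1 ≤ x 0 ^ 2 + x 1 ^ 2
    nlinarith
  · exact pos_of_mul_pos_left hd hA.le

lemma formPar_image_parReg_lt : formPar '' parReg (· < ·) ⊆ ⋃ k : ℕ, regO (1 / (k + 1)) := by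
  rintro _ ⟨x, ⟨h1, h2, h3, h4, h5⟩, rfl⟩
  obtain ⟨k, hk⟩ := exists_nat_one_div_lt h4
  rw [mem_iUnion]
  refine ⟨k, ?_, ?_, ?_, ?_, ?_⟩
  · rw [mB_formPar, mA_formPar, abs_mul, abs_mul, abs_of_pos h4, abs_two]
    have h1 : |x 0| < 1 / 2 := h1
    nlinarith
  · rw [mC_formPar, mA_formPar]
    have h2 : 1 < x 0 ^ 2 + x 1 ^ 2 := h2
    nlinarith
  · rw [mdet_formPar]; positivity
  · rw [mdet_formPar]; exact h5
  · rw [mA_formPar]; exact hk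

section
lemma measurableSet_le_rel : MeasurableSet {p : ℝ × ℝ | p.1 ≤ p.2} :=
  measurableSet_le measurable_fst measurable_snd

lemma measurableSet_lt_rel : MeasurableSet {p : ℝ × ℝ | p.1 < p.2} :=
  measurableSet_lt measurable_fst measurable_snd

lemma volume_regC_le {η : ℝ} (hη : 0 < η) :
    (volume (cubeMap '' regC η)).toReal ≤ Real.pi ^ 2 / 2 := by
  have h := volume_cubeMap_formPar_image (measurableSet_parReg measurableSet_le_rel)
    (fun x hx => ⟨hx.2.2.1, hx.2.2.2.1⟩)
  rw [lintegral_parReg (rel := (· ≤ ·)) (fun _ _ h => h.le) (fun _ _ h => h)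
    measurableSet_le_rel] at h
  have h2 := measure_mono (μ := volume) (Set.image_mono (f := cubeMap) (formPar_image_parReg_le hη))
  rw [h] at h2
  exact toReal_le_of_le_ofReal (by positivity) h2

lemma exists_volume_regO {ε : ℝ} (hε : 0 < ε) :
    ∃ η, 0 < η ∧ Real.pi ^ 2 / 2 - ε < (volume (cubeMap '' regO η)).toReal := by
  have h := volume_cubeMap_formPar_image (measurableSet_parReg measurableSet_lt_rel)
    (fun x hx => ⟨hx.2.2.1, hx.2.2.2.1⟩)
  rw [lintegral_parReg (rel := (· < ·)) (fun _ _ h => h) (fun _ _ h => h.le)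
    measurableSet_lt_rel] at h
  have h2 := measure_mono (μ := volume) (Set.image_mono (f := cubeMap) formPar_image_parReg_lt)
  rw [h, image_iUnion] at h2
  have hmono : Monotone fun k : ℕ => cubeMap '' regO (1 / ((k : ℝ) + 1)) := by
    intro k l hkl
    refine Set.image_mono fun m hm => ⟨hm.1, hm.2.1, hm.2.2.1, hm.2.2.2.1, lt_of_le_of_lt ?_
      hm.2.2.2.2⟩
    exact one_div_le_one_div_of_le (by positivity) (by gcongr)
  rw [hmono.measure_iUnion] at h2
  have h3 : ENNReal.ofReal (Real.pi ^ 2 / 2 - ε) < ENNReal.ofReal (Real.pi ^ 2 / 2) :=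
    (ofReal_lt_ofReal_iff (by positivity)).mpr (by linarith)
  obtain ⟨k, hk⟩ := lt_iSup_iff.mp (h3.trans_le h2)
  refine ⟨1 / ((k : ℝ) + 1), by positivity, ?_⟩
  have hfin : volume (cubeMap '' regO (1 / ((k : ℝ) + 1))) ≠ ⊤ := by
    have hc := (isCompact_regC (η := 1 / ((k : ℝ) + 1)) (by positivity)).image continuous_cubeMap
    exact ((measure_mono (Set.image_mono (regO_subset_regC _))).trans_lt hc.measure_lt_top).ne
  by_cases h0 : 0 ≤ Real.pi ^ 2 / 2 - ε
  · exact (ofReal_lt_iff_lt_toReal h0 hfin).mp hk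
  · exact lt_of_lt_of_le (not_le.mp h0) toReal_nonneg

end

/-! ### Counting classes through reduced forms -/

lemma mA_smul (k : ℝ) (m : ℝ⁴) : mA (k • m) = k ^ 2 * mA m := by
  simp [mA]; ring
lemma mB_smul (k : ℝ) (m : ℝ⁴) : mB (k • m) = k ^ 2 * mB m := by
  simp [mB]; ring
lemma mC_smul (k : ℝ) (m : ℝ⁴) : mC (k • m) = k ^ 2 * mC m := by
  simp [mC]; ring
lemma mdet_smul (k : ℝ) (m : ℝ⁴) : mdet (k • m) = k ^ 2 * mdet m := by
  simp [mdet]; ring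
lemma cubeMap_smul (k : ℝ) (m : ℝ⁴) : cubeMap (k • m) = k ^ 3 • cubeMap m := by
  apply form_ext <;> simp [cubeMap] <;> ring

/-- Integral forms with reduced covariant and bounded discriminant. -/
def redForms (κ η : ℝ) : Set ℤ⁴ :=
  {f | ∃ m, toR f = cubeMap m ∧ RedC m ∧ mdet m < κ ^ 2 ∧ η * κ ^ 2 ≤ mA m}

/-- Integral forms with strictly reduced covariant and bounded discriminant. -/
def openForms (κ η : ℝ) : Set ℤ⁴ :=
  {f | ∃ m, toR f = cubeMap m ∧ RedO m ∧ mdet m < κ ^ 2 ∧ η * κ ^ 2 < mA m}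

lemma openForms_subset (κ η : ℝ) : openForms κ η ⊆ redForms κ η :=
  fun _ ⟨m, h1, h2, h3, h4⟩ => ⟨m, h1, h2.redC, h3, h4.le⟩

lemma redForms_subset_latPts {κ η : ℝ} (hκ : 0 < κ) (m : ℕ) (S : Set (Fin 4 → ZMod m)) :
    {f | redMod m f ∈ S} ∩ redForms κ η ⊆ latPts m S (κ ^ 3) (cubeMap '' regC η) := by
  rintro f ⟨hS, x, hx, ⟨h1, h2, h3⟩, h4, h5⟩
  have hk : 0 < κ⁻¹ := inv_pos.mpr hκ
  have hk2 : κ⁻¹ ^ 2 * κ ^ 2 = 1 := by field_simp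
  refine ⟨hS, κ⁻¹ • x, ⟨?_, ?_, ?_, ?_, ?_⟩, ?_⟩
  · rw [mA_smul, mB_smul, abs_mul, abs_of_pos (by positivity : 0 < κ⁻¹ ^ 2)]
    gcongr
  · rw [mA_smul, mC_smul]; gcongr
  · rw [mdet_smul]; positivity
  · rw [mdet_smul, ← hk2]; gcongr
  · rw [mA_smul]
    calc η = κ⁻¹ ^ 2 * (η * κ ^ 2) := by rw [mul_left_comm, hk2, mul_one]
      _ ≤ _ := by gcongr
  · rw [cubeMap_smul, hx, inv_pow]

lemma latPts_subset_openForms {κ η : ℝ} (hκ : 0 < κ) (m : ℕ) (S : Set (Fin 4 → ZMod m)) :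
    latPts m S (κ ^ 3) (cubeMap '' regO η) ⊆ {f | redMod m f ∈ S} ∩ openForms κ η := by
  rintro f ⟨hS, x, ⟨h1, h2, h3, h4, h5⟩, hx⟩
  refine ⟨hS, κ • x, ?_, ⟨?_, ?_, ?_⟩, ?_, ?_⟩
  · rw [cubeMap_smul, hx, smul_smul, mul_inv_cancel₀ (by positivity), one_smul]
  · rw [mA_smul, mB_smul, abs_mul, abs_of_pos (by positivity : 0 < κ ^ 2)]
    gcongr
  · rw [mA_smul, mC_smul]; gcongr
  · rw [mdet_smul]; positivity
  · rw [mdet_smul]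
    have : 0 < κ ^ 2 := by positivity
    nlinarith
  · rw [mA_smul, mul_comm]; gcongr

lemma redForms_finite {κ η : ℝ} (hκ : 0 < κ) (hη : 0 < η) : (redForms κ η).Finite := by
  have h := redForms_subset_latPts (η := η) hκ 1 Set.univ
  refine ((latPts_ncard_le one_pos Set.univ (pow_pos hκ 3)
    ((isCompact_regC hη).image continuous_cubeMap).isBounded).1).subset ?_
  simpa using h

lemma eventually_redForms_le {m : ℕ} (hm : 0 < m) (S : Set (Fin 4 → ZMod m)) {η ε : ℝ}
    (hη : 0 < η) (hε : 0 < ε) :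
    ∀ᶠ κ : ℝ in atTop, (({f | redMod m f ∈ S} ∩ redForms κ η).ncard : ℝ) ≤
      ((S.ncard : ℝ) / m ^ 4 * (Real.pi ^ 2 / 2) + ε) * κ ^ 12 := by
  have hc := (isCompact_regC hη).image continuous_cubeMap
  have h := (tendsto_pow_atTop (α := ℝ) (n := 3) (by norm_num)).eventually
    (eventually_latPts_le hm S hc hε)
  filter_upwards [h, eventually_gt_atTop 0] with κ h hκ
  have h1 := ncard_le_ncard (redForms_subset_latPts (η := η) hκ m S)
    (latPts_ncard_le hm S (pow_pos hκ 3) hc.isBounded).1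
  have hm' : (0 : ℝ) < m := by exact_mod_cast hm
  calc _ ≤ _ := by exact_mod_cast h1
    _ ≤ _ := h
    _ ≤ _ := by
      rw [← pow_mul]
      have := volume_regC_le hη
      gcongr

lemma isOpen_cubeMap_regO (η : ℝ) : IsOpen (cubeMap '' regO η) :=
  isOpen_cubeMap_image (isOpen_regO η) fun _ h => h.2.2.1.ne'

lemma exists_eventually_le_openForms {ε : ℝ} (hε : 0 < ε) :
    ∃ η, 0 < η ∧ ∀ (m : ℕ) (_ : 0 < m) (S : Set (Fin 4 → ZMod m)),
    ∀ᶠ κ : ℝ in atTop, ((S.ncard : ℝ) / m ^ 4 * (Real.pi ^ 2 / 2) - ε) * κ ^ 12 ≤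
      (({f | redMod m f ∈ S} ∩ openForms κ η).ncard : ℝ) := by
  obtain ⟨η, hη, hv⟩ := exists_volume_regO (half_pos hε)
  refine ⟨η, hη, fun m hm S => ?_⟩
  have hb : Bornology.IsBounded (cubeMap '' regO η) :=
    ((isCompact_regC hη).image continuous_cubeMap).isBounded.subset
      (Set.image_mono (regO_subset_regC η))
  have h := (tendsto_pow_atTop (α := ℝ) (n := 3) (by norm_num)).eventually
    (eventually_le_latPts hm S (isOpen_cubeMap_regO η) hb (half_pos hε))
  filter_upwards [h, eventually_gt_atTop 0] with κ h hκ
  have h1 := ncard_le_ncard (latPts_subset_openForms (η := η) hκ m S)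
    ((redForms_finite hκ hη).subset (Set.inter_subset_right.trans (openForms_subset κ η)))
  have hm' : (0 : ℝ) < m := by exact_mod_cast hm
  have : NeZero m := ⟨hm.ne'⟩
  have hd : (S.ncard : ℝ) / m ^ 4 ≤ 1 := by
    rw [div_le_one (by positivity)]
    have := ncard_le_card S
    simp only [Nat.card_eq_fintype_card, Fintype.card_fun, ZMod.card, Fintype.card_fin] at this
    exact_mod_cast this
  have hd0 : 0 ≤ (S.ncard : ℝ) / m ^ 4 := by positivity
  calc _ ≤ ((S.ncard : ℝ) / m ^ 4 *
        (MeasureTheory.volume (cubeMap '' regO η)).toReal - ε / 2) * (κ ^ 3) ^ 4 := by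
        rw [← pow_mul]
        have h3 := mul_le_mul_of_nonneg_left hv.le hd0
        have h4 := mul_le_mul_of_nonneg_right hd hε.le
        exact mul_le_mul_of_nonneg_right (by linarith) (by positivity)
    _ ≤ _ := h
    _ ≤ _ := by exact_mod_cast h1

/-! ### Classes -/

lemma toR_zero_bound {m : ℝ⁴} (h : toR f = cubeMap m) (h0 : f 0 ≠ 0) :
    1 ≤ mA m := by
  by_contra hcon
  push Not at hcon
  have h1 : ((f 0 : ℤ) : ℝ) = m 0 ^ 3 + m 2 ^ 3 := by
    have := congrFun h 0
    simpa [toR, cubeMap] using this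
  have h2 : (1 : ℝ) ≤ (f 0 : ℝ) ^ 2 := sq_ge_one_of_ne_zero h0
  rw [h1] at h2
  unfold mA at hcon
  have e : (m 0 ^ 2 + m 2 ^ 2) ^ 3 - (m 0 ^ 3 + m 2 ^ 3) ^ 2 =
      (m 0 * m 2) ^ 2 * (2 * m 0 ^ 2 + 2 * m 2 ^ 2 + (m 0 - m 2) ^ 2) := by ring
  have : (m 0 ^ 2 + m 2 ^ 2) ^ 3 < 1 :=
    pow_lt_one₀ (by positivity) hcon (by norm_num)
  have : 0 ≤ (m 0 * m 2) ^ 2 * (2 * m 0 ^ 2 + 2 * m 2 ^ 2 + (m 0 - m 2) ^ 2) := by positivity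
  linarith

/-- Reduced forms with nonzero leading coefficient and bounded discriminant. -/
def redSet (κ : ℝ) : Set ℤ⁴ :=
  {f | f 0 ≠ 0 ∧ ∃ m, toR f = cubeMap m ∧ RedC m ∧ mdet m < κ ^ 2}

lemma redSet_finite {κ : ℝ} (hκ : 0 < κ) : (redSet κ).Finite := by
  refine (redForms_finite (η := (κ ^ 2)⁻¹) hκ (by positivity)).subset ?_
  rintro f ⟨h0, m, h1, h2, h3⟩
  refine ⟨m, h1, h2, h3, ?_⟩
  rw [inv_mul_cancel₀ (by positivity)]
  exact toR_zero_bound h1 h0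

lemma redSet_neg {κ : ℝ} (h : f ∈ redSet κ) : -f ∈ redSet κ := by
  obtain ⟨h0, m, h1, h2, h3⟩ := h
  refine ⟨by simpa using h0, -m, ?_, redC_neg h2, by simpa [mdet] using h3⟩
  rw [toR_neg, h1, cubeMap_neg]

lemma cdisc_eq_mdet_pow {m : ℝ⁴} (h : toR f = cubeMap m) :
    ((cdisc f : ℤ) : ℝ) = mdet m ^ 6 := by
  rw [← cdisc_toR, h, cdisc_cubeMap]

/-- Irreducible forms in `E` with discriminant in `(0, X)`. -/
def irrForms (E : Set ℤ⁴) (X : ℝ) : Set ℤ⁴ :=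
  {f | f ∈ E ∧ ¬ Reducible f ∧ 0 < cdisc f ∧ ((cdisc f : ℤ) : ℝ) < X}

lemma irrForms_inv (hE : SLInv E) (X : ℝ) : SLInv (irrForms E X) := by
  rintro f g h ⟨h1, h2, h3, h4⟩
  exact ⟨hE f g h h1, by rwa [← h.reducible_iff], by rwa [h.cdisc_eq], by rwa [h.cdisc_eq]⟩

/-- The set of classes of irreducible forms in `E` with discriminant in `(0, X)`. -/
def irrCls (E : Set ℤ⁴) (X : ℝ) : Set (Quotient formSetoid) := clsSet (irrForms E X)

lemma irrCls_rep (hE : SLInv E) {κ : ℝ} (hκ : 0 < κ)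
    (c : Quotient formSetoid) (hc : c ∈ irrCls E (κ ^ 12)) :
    ∃ g ∈ E ∩ redSet κ, Quotient.mk formSetoid g = c := by
  obtain ⟨f, hf, rfl⟩ := hc
  obtain ⟨g, m, hg, hm, hr⟩ := exists_reduced f hf.2.2.1
  obtain ⟨h1, h2, h3, h4⟩ := irrForms_inv hE _ f g hg hf
  refine ⟨g, ⟨h1, ?_, m, hm, hr, ?_⟩, Quotient.sound (s := formSetoid) hg.symm⟩
  · intro h0
    exact h2 (reducible_of_zero h0)
  · rw [cdisc_eq_mdet_pow hm] at h4
    have : mdet m ^ 6 < (κ ^ 2) ^ 6 := by rw [← pow_mul]; exact h4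
    exact lt_of_pow_lt_pow_left₀ 6 (by positivity) this

lemma irrCls_finite (hE : SLInv E) {κ : ℝ} (hκ : 0 < κ) :
    (irrCls E (κ ^ 12)).Finite := by
  refine (((redSet_finite hκ).subset (Set.inter_subset_right (s := E))).image
    (Quotient.mk formSetoid)).subset ?_
  intro c hc
  obtain ⟨g, hg, h⟩ := irrCls_rep hE hκ c hc
  exact ⟨g, hg, h⟩

/-- Twice the number of irreducible classes is bounded by the number of reduced forms. -/
lemma two_mul_irrCls_le (hE : SLInv E) {κ : ℝ} (hκ : 0 < κ) :
    2 * (irrCls E (κ ^ 12)).ncard ≤ (E ∩ redSet κ).ncard := by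
  choose! r hr hrc using irrCls_rep hE hκ
  have hfin : (E ∩ redSet κ).Finite := (redSet_finite hκ).subset Set.inter_subset_right
  have hinj : InjOn r (irrCls E (κ ^ 12)) := by
    intro c hc c' hc' h
    rw [← hrc c hc, ← hrc c' hc', h]
  have hinj' : InjOn (fun c => -r c) (irrCls E (κ ^ 12)) := by
    intro c hc c' hc' h
    exact hinj hc hc' (neg_injective h)
  have hdisj : Disjoint (r '' irrCls E (κ ^ 12)) ((fun c => -r c) '' irrCls E (κ ^ 12)) := by
    rw [Set.disjoint_left]
    rintro _ ⟨c, hc, rfl⟩ ⟨c', hc', h⟩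
    have h : -r c' = r c := h
    have e : c' = c := by
      rw [← hrc c hc, ← hrc c' hc', ← h]
      exact Quotient.sound (s := formSetoid) (SLEquiv.neg _)
    subst e
    have h0 := congrFun h 0
    have := (hr c' hc).2.1
    simp at h0
    omega
  have hsub : r '' irrCls E (κ ^ 12) ∪ (fun c => -r c) '' irrCls E (κ ^ 12) ⊆ E ∩ redSet κ := by
    rintro _ (⟨c, hc, rfl⟩ | ⟨c, hc, rfl⟩)
    · exact hr c hc
    · exact ⟨hE _ _ (SLEquiv.neg _) (hr c hc).1, redSet_neg (hr c hc).2⟩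
  have h1 := ncard_le_ncard hsub hfin
  rw [ncard_union_eq hdisj ((irrCls_finite hE hκ).image _) ((irrCls_finite hE hκ).image _),
    hinj.ncard_image, hinj'.ncard_image] at h1
  omega

/-- The number of irreducible strictly reduced forms is at most twice the number of classes. -/
lemma openForms_le_two_mul (hE : SLInv E) {κ η : ℝ} (hκ : 0 < κ)
    (hη : 0 < η) :
    (E ∩ openForms κ η ∩ {f | ¬ Reducible f}).ncard ≤ 2 * (irrCls E (κ ^ 12)).ncard := by
  classical
  have hfin : (E ∩ openForms κ η ∩ {f | ¬ Reducible f}).Finite :=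
    (redForms_finite hκ hη).subset fun f hf => openForms_subset κ η hf.1.2
  have hfin2 := irrCls_finite hE hκ
  rw [ncard_eq_toFinset_card _ hfin, ncard_eq_toFinset_card _ hfin2]
  apply card_le_mul_card_image_of_maps_to (f := Quotient.mk formSetoid)
  · intro f hf
    rw [Set.Finite.mem_toFinset] at hf ⊢
    obtain ⟨⟨h1, m, h2, h3, h4, h5⟩, h6⟩ := hf
    refine ⟨f, ⟨h1, h6, ?_, ?_⟩, rfl⟩
    · have := cdisc_eq_mdet_pow h2
      have h0 : 0 < mdet m ^ 6 := pow_pos h3.2.2 6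
      rw [← this] at h0
      exact_mod_cast h0
    · rw [cdisc_eq_mdet_pow h2, show κ ^ 12 = (κ ^ 2) ^ 6 by ring]
      exact pow_lt_pow_left₀ h4 h3.2.2.le (by norm_num)
  · intro c _
    by_cases hne : ∃ f ∈ hfin.toFinset, Quotient.mk formSetoid f = c
    · obtain ⟨f, hf, hfc⟩ := hne
      rw [Set.Finite.mem_toFinset] at hf
      obtain ⟨⟨h1, m, h2, h3, -⟩, -⟩ := hf
      refine (Finset.card_le_card (t := {f, -f}) ?_).trans card_le_two
      intro g hg
      rw [mem_filter, Set.Finite.mem_toFinset] at hg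
      obtain ⟨⟨⟨-, m', h2', h3', -⟩, -⟩, hgc⟩ := hg
      have he : SLEquiv f g := Quotient.exact (s := formSetoid) (hfc.trans hgc.symm)
      have := RedO.unique h2 h3 h2' h3'.redC he
      simpa using this
    · rw [Finset.filter_eq_empty_iff.mpr]
      · simp
      · intro f hf h
        exact hne ⟨f, hf, h⟩

/-! ### Averaging over the unipotent group -/

/-- The box containing the unipotent translates of reduced forms at height `τ`. -/
def ubox (κ τ : ℝ) : Set ℤ⁴ :=
  {f | f 0 ≠ 0 ∧ |(f 0 : ℝ)| ≤ 8 * τ ^ 3 ∧ |(f 1 : ℝ)| ≤ 16 * τ * κ ^ 2 ∧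
    |(f 2 : ℝ)| ≤ 32 * κ ^ 4 / τ ∧ |(f 3 : ℝ)| ≤ 64 * κ ^ 6 / τ ^ 3}

lemma finite_abs_le (R : ℝ) : {x : ℤ | |(x : ℝ)| ≤ R}.Finite := by
  refine (finite_Icc (-⌊R⌋) ⌊R⌋).subset fun x hx => ?_
  have hx : |(x : ℝ)| ≤ R := hx
  rw [abs_le] at hx
  refine ⟨?_, Int.le_floor.mpr hx.2⟩
  have : -x ≤ ⌊R⌋ := Int.le_floor.mpr (by push_cast; linarith [hx.1])
  omega

lemma finite_box (R : ℝ⁴) : {f : ℤ⁴ | ∀ i, |(f i : ℝ)| ≤ R i}.Finite := by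
  have := Set.Finite.pi (t := fun i => {x : ℤ | |(x : ℝ)| ≤ R i}) fun i => finite_abs_le (R i)
  refine this.subset fun f hf i _ => hf i

lemma ubox_finite (κ τ : ℝ) : (ubox κ τ).Finite := by
  refine (finite_box ![8 * τ ^ 3, 16 * τ * κ ^ 2, 32 * κ ^ 4 / τ, 64 * κ ^ 6 / τ ^ 3]).subset ?_
  rintro f ⟨-, h0, h1, h2, h3⟩ i
  fin_cases i <;> assumption

/-- Reduced forms at height `τ`. -/
def redAt (κ τ : ℝ) : Set ℤ⁴ :=
  {f | f 0 ≠ 0 ∧ ∃ m, toR f = cubeMap m ∧ RedC m ∧ mdet m < κ ^ 2 ∧ τ ^ 2 ≤ mA m ∧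
    mA m < 4 * τ ^ 2}

lemma abs_cubeMap_le {m : ℝ⁴} {P Q : ℝ} (hP : 0 ≤ P) (hQ : 0 ≤ Q) (h1 : mA m ≤ P ^ 2)
    (h2 : mC m ≤ Q ^ 2) : |cubeMap m 0| ≤ P ^ 3 ∧ |cubeMap m 1| ≤ P ^ 2 * Q ∧
      |cubeMap m 2| ≤ P * Q ^ 2 ∧ |cubeMap m 3| ≤ Q ^ 3 := by
  have a0 : |m 0| ≤ P := abs_le_of_sq_le_sq (by unfold mA at h1; nlinarith [sq_nonneg (m 2)]) hP
  have a2 : |m 2| ≤ P := abs_le_of_sq_le_sq (by unfold mA at h1; nlinarith [sq_nonneg (m 0)]) hP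
  have a1 : |m 1| ≤ Q := abs_le_of_sq_le_sq (by unfold mC at h2; nlinarith [sq_nonneg (m 3)]) hQ
  have a3 : |m 3| ≤ Q := abs_le_of_sq_le_sq (by unfold mC at h2; nlinarith [sq_nonneg (m 1)]) hQ
  have key : ∀ x y u v S T : ℝ, |u| ≤ T → |v| ≤ T → 0 ≤ T → x ^ 2 + y ^ 2 ≤ S →
      |x ^ 2 * u + y ^ 2 * v| ≤ S * T := by
    intro x y u v S T hu hv hT hS
    calc |x ^ 2 * u + y ^ 2 * v| ≤ |x ^ 2 * u| + |y ^ 2 * v| := abs_add_le _ _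
      _ = x ^ 2 * |u| + y ^ 2 * |v| := by
        rw [abs_mul, abs_mul, abs_of_nonneg (sq_nonneg x), abs_of_nonneg (sq_nonneg y)]
      _ ≤ x ^ 2 * T + y ^ 2 * T := by gcongr
      _ = (x ^ 2 + y ^ 2) * T := by ring
      _ ≤ _ := by gcongr
  unfold mA at h1
  unfold mC at h2
  refine ⟨?_, ?_, ?_, ?_⟩
  · have := key _ _ _ _ _ _ a0 a2 hP h1
    rw [cubeMap_zero]
    convert this using 2 <;> ring
  · have := key _ _ _ _ _ _ a1 a3 hQ h1
    rw [cubeMap_one]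
    convert this using 2
  · have := key _ _ _ _ _ _ a0 a2 hP h2
    rw [cubeMap_two]
    convert this.trans_eq (mul_comm _ _) using 2
    ring
  · have := key _ _ _ _ _ _ a1 a3 hQ h2
    rw [cubeMap_three]
    convert this using 2 <;> ring

lemma RedC.mul_le {m : ℝ⁴} (h : RedC m) : 3 * (mA m * mC m) ≤ 4 * mdet m ^ 2 ∧
    3 * mA m ^ 2 ≤ 4 * mdet m ^ 2 := by
  have hA := mA_pos h.2.2
  obtain ⟨h1, h2, h3⟩ := h
  have e := four_mA_mul_mC m
  have hB : mB m ^ 2 ≤ mA m ^ 2 := by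
    rw [← sq_abs (mB m)]
    exact pow_le_pow_left₀ (abs_nonneg _) h1 2
  have : mA m ^ 2 ≤ mA m * mC m := by nlinarith
  constructor <;> nlinarith

lemma mact_unip_bound {m : ℝ⁴} (h : RedC m) {κ τ k : ℝ} (hτ : 0 < τ)
    (hd : mdet m < κ ^ 2) (h1 : τ ^ 2 ≤ mA m) (hk0 : 0 ≤ k) (hk : k ≤ κ ^ 2 / τ ^ 2)
    (h2 : mA m < 4 * τ ^ 2) :
    mA (mact 1 k 0 1 m) ≤ (2 * τ) ^ 2 ∧ mC (mact 1 k 0 1 m) ≤ (4 * κ ^ 2 / τ) ^ 2 := by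
  rw [mA_mact, mC_mact]
  refine ⟨by nlinarith, ?_⟩
  have hk' : k * τ ^ 2 ≤ κ ^ 2 := by rwa [le_div_iff₀ (by positivity)] at hk
  rw [div_pow, le_div_iff₀ (by positivity)]
  have hdet : mdet m ^ 2 ≤ κ ^ 4 := by
    have := pow_le_pow_left₀ h.2.2.le hd.le 2
    nlinarith
  obtain ⟨e1, e2⟩ := h.mul_le
  have e := four_mA_mul_mC m
  have hA := mA_pos h.2.2
  have hC : 0 < mC m := hA.trans_le h.2.1
  have hB : mB m ≤ 3 * κ ^ 2 := by
    apply le_of_sq_le_sq _ (by positivity)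
    nlinarith [sq_nonneg (mdet m)]
  have t1 : mC m * τ ^ 2 ≤ 2 * κ ^ 4 := by nlinarith
  have hkk : (k * τ ^ 2) ^ 2 ≤ (κ ^ 2) ^ 2 := pow_le_pow_left₀ (by positivity) hk' 2
  have t2 : mA m * k ^ 2 * τ ^ 2 ≤ 4 * κ ^ 4 := by
    calc mA m * k ^ 2 * τ ^ 2 ≤ (4 * τ ^ 2) * k ^ 2 * τ ^ 2 := by gcongr
      _ = 4 * (k * τ ^ 2) ^ 2 := by ring
      _ ≤ _ := by linarith
  have t3 : mB m * (k * τ ^ 2) ≤ 3 * κ ^ 2 * κ ^ 2 := by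
    calc mB m * (k * τ ^ 2) ≤ 3 * κ ^ 2 * (k * τ ^ 2) := by gcongr
      _ ≤ _ := by gcongr
  nlinarith [sq_nonneg (κ ^ 2)]

lemma redAt_card_mul_le (hE : SLInv E) {κ τ : ℝ} (hτ : 0 < τ) :
    (E ∩ redAt κ τ).ncard * (⌊κ ^ 2 / (2 * τ ^ 2)⌋₊ + 1) ≤ (E ∩ ubox κ τ).ncard := by
  set K := ⌊κ ^ 2 / (2 * τ ^ 2)⌋₊ with hK
  have e : (Set.Iic K).ncard = K + 1 := by simp [ncard_eq_toFinset_card']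
  rw [← e, ← ncard_prod]
  refine ncard_le_ncard_of_injOn
    (fun x : ℤ⁴ × ℕ => cact 1 (2 * (x.2 : ℤ)) 0 1 x.1) ?_ ?_
    ((ubox_finite κ τ).subset Set.inter_subset_right)
  · rintro ⟨f, i⟩ ⟨⟨hfE, h0, m, h1, h2, h3, h4, h5⟩, hi⟩
    have hi : i ≤ K := hi
    refine ⟨hE f _ ⟨1, 2 * (i : ℤ), 0, 1, by ring, rfl⟩ hfE, ?_, ?_⟩
    · simpa [cact_zero] using h0
    · have hk : (2 * (i : ℝ)) ≤ κ ^ 2 / τ ^ 2 := by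
        have : (i : ℝ) ≤ κ ^ 2 / (2 * τ ^ 2) :=
          (Nat.cast_le.mpr hi).trans (Nat.floor_le (by positivity))
        calc (2 * (i : ℝ)) ≤ 2 * (κ ^ 2 / (2 * τ ^ 2)) := by gcongr
          _ = _ := by field_simp
      obtain ⟨b1, b2⟩ := mact_unip_bound h2 hτ h3 h4 (by positivity) hk h5
      have hb := abs_cubeMap_le (by positivity) (by positivity) b1 b2
      have hf : toR (cact 1 (2 * (i : ℤ)) 0 1 f) = cubeMap (mact 1 (2 * (i : ℝ)) 0 1 m) := by
        rw [toR_cact, cubeMap_mact, h1]; push_cast; rfl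
      rw [← hf] at hb
      obtain ⟨c0, c1, c2, c3⟩ := hb
      refine ⟨c0.trans_eq (by ring), c1.trans_eq ?_, c2.trans_eq ?_, c3.trans_eq ?_⟩ <;>
        field_simp <;> ring
  · rintro ⟨f, i⟩ ⟨⟨-, -, m, h1, h2, h3, h4, h5⟩, -⟩ ⟨f', i'⟩ ⟨⟨-, -, m', h1', h2', -⟩, -⟩ h
    have h : cact 1 (2 * (i : ℤ)) 0 1 f = cact 1 (2 * (i' : ℤ)) 0 1 f' := h
    have hm : mact 1 (2 * (i : ℝ)) 0 1 m = mact 1 (2 * (i' : ℝ)) 0 1 m' := by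
      apply cubeMap_injOn
      · change 0 < mdet _
        rw [mdet_mact]; simpa using h2.2.2
      · change 0 < mdet _
        rw [mdet_mact]; simpa using h2'.2.2
      · have := congrArg toR h
        rw [toR_cact, toR_cact, h1, h1', ← cubeMap_mact, ← cubeMap_mact] at this
        push_cast at this
        exact this
    have hA := congrArg mA hm
    have hB := congrArg mB hm
    rw [mA_mact, mA_mact] at hA
    rw [mB_mact, mB_mact] at hB
    have hA : mA m = mA m' := by linarith
    have hApos := mA_pos h2.2.2
    have b1 := abs_le.mp h2.1
    have b2 := abs_le.mp h2'.1
    rw [← hA] at hB b2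
    have hii : i = i' := by
      have u1 : (i : ℝ) - i' < 1 := by
        by_contra hcon
        push Not at hcon
        nlinarith
      have u2 : (i' : ℝ) - i < 1 := by
        by_contra hcon
        push Not at hcon
        nlinarith
      have v1 : (i : ℤ) - i' < 1 := by exact_mod_cast u1
      have v2 : (i' : ℤ) - i < 1 := by exact_mod_cast u2
      omega
    subst hii
    have := congrArg (cact 1 (-(2 * (i : ℤ))) 0 1) h
    simp only [cact_cact] at this
    simp only [mul_one, one_mul, mul_zero, add_zero, zero_mul, zero_add, neg_add_cancel,
      cact_id] at this
    rw [this]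

/-- Reduced forms with `mA < η κ²`. -/
def redLt (κ η : ℝ) : Set ℤ⁴ :=
  {f | f 0 ≠ 0 ∧ ∃ m, toR f = cubeMap m ∧ RedC m ∧ mdet m < κ ^ 2 ∧ mA m < η * κ ^ 2}

lemma redSet_subset_redLt (κ : ℝ) : redSet κ ⊆ redLt κ 2 := by
  rintro f ⟨h0, m, h1, h2, h3⟩
  refine ⟨h0, m, h1, h2, h3, ?_⟩
  have := h2.mul_le.2
  have h4 := mA_pos h2.2.2
  have h5 := h2.2.2
  by_contra hcon
  push Not at hcon
  nlinarith

lemma redSet_subset_union (κ η : ℝ) : redSet κ ⊆ redForms κ η ∪ redLt κ η := by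
  rintro f ⟨h0, m, h1, h2, h3⟩
  rcases le_or_gt (η * κ ^ 2) (mA m) with h | h
  · exact Or.inl ⟨m, h1, h2, h3, h⟩
  · exact Or.inr ⟨h0, m, h1, h2, h3, h⟩

lemma redLt_card_le (hE : SLInv E) {κ η M : ℝ} (hκ : 0 < κ)
    (hη : η ≤ 2) (hη0 : 0 < η)
    (hM0 : 0 ≤ M) (hM : ∀ τ, 1 ≤ τ → τ ^ 2 ≤ 2 * κ ^ 2 → ((E ∩ ubox κ τ).ncard : ℝ) ≤ M) :
    ((E ∩ redLt κ η).ncard : ℝ) ≤ 3 * η * M := by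
  rcases lt_or_ge (η * κ ^ 2) 1 with h | h
  · have : E ∩ redLt κ η = ∅ := by
      rw [Set.eq_empty_iff_forall_notMem]
      rintro f ⟨-, h0, m, h1, h2, h3, h4⟩
      have := toR_zero_bound h1 h0
      linarith
    rw [this]
    simp
    positivity
  · obtain ⟨J, hJ1, hJ2⟩ := exists_nat_pow_near h (by norm_num : (1 : ℝ) < 4)
    have hsub : E ∩ redLt κ η ⊆ ⋃ j ∈ Finset.range (J + 1), E ∩ redAt κ (2 ^ j) := by
      rintro f ⟨hE, h0, m, h1, h2, h3, h4⟩
      obtain ⟨j, hj1, hj2⟩ := exists_nat_pow_near (toR_zero_bound h1 h0)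
        (by norm_num : (1 : ℝ) < 4)
      have e : ((2 : ℝ) ^ j) ^ 2 = 4 ^ j := by rw [← pow_mul, mul_comm, pow_mul]; norm_num
      simp only [mem_iUnion]
      refine ⟨j, ?_, hE, h0, m, h1, h2, h3, ?_, ?_⟩
      · rw [Finset.mem_range]
        exact (pow_lt_pow_iff_right₀ (by norm_num : (1 : ℝ) < 4)).mp
          ((hj1.trans_lt h4).trans hJ2)
      · rw [e]; exact hj1
      · rw [e]; rw [pow_succ] at hj2; linarith
    have hfin : ∀ j, (E ∩ redAt κ (2 ^ j)).Finite := fun j =>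
      (redSet_finite hκ).subset fun f hf => by
        obtain ⟨-, h0, m, h1, h2, h3, -⟩ := hf
        exact ⟨h0, m, h1, h2, h3⟩
    have h1 := ncard_le_ncard hsub (Set.Finite.biUnion (finite_toSet _) fun j _ => hfin j)
    have h2 := h1.trans (set_ncard_biUnion_le _ _)
    have h3 : ∀ j ∈ Finset.range (J + 1),
        ((E ∩ redAt κ (2 ^ j)).ncard : ℝ) ≤ 2 * M / κ ^ 2 * 4 ^ j := by
      intro j hj
      have e : ((2 : ℝ) ^ j) ^ 2 = 4 ^ j := by rw [← pow_mul, mul_comm, pow_mul]; norm_num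
      have hj' : (4 : ℝ) ^ j ≤ 2 * κ ^ 2 := by
        calc (4 : ℝ) ^ j ≤ 4 ^ J :=
              pow_le_pow_right₀ (by norm_num) (by rw [Finset.mem_range] at hj; omega)
          _ ≤ η * κ ^ 2 := hJ1
          _ ≤ _ := by gcongr
      have k1 := hM (2 ^ j) (one_le_pow₀ (by norm_num)) (by rw [e]; exact hj')
      have k2 := redAt_card_mul_le hE (κ := κ) (τ := 2 ^ j) (by positivity)
      have k3 : κ ^ 2 / (2 * ((2 : ℝ) ^ j) ^ 2) ≤
          ((⌊κ ^ 2 / (2 * ((2 : ℝ) ^ j) ^ 2)⌋₊ + 1 : ℕ) : ℝ) := by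
        push_cast
        exact (Nat.lt_floor_add_one _).le
      have k4 : ((E ∩ redAt κ (2 ^ j)).ncard : ℝ) * (κ ^ 2 / (2 * ((2 : ℝ) ^ j) ^ 2)) ≤ M := by
        refine le_trans ?_ k1
        refine le_trans (mul_le_mul_of_nonneg_left k3 (by positivity)) ?_
        exact_mod_cast k2
      rw [e] at k4
      have h4 : (0 : ℝ) < 4 ^ j := by positivity
      rw [mul_div_assoc', div_le_iff₀ (by positivity)] at k4
      rw [div_mul_eq_mul_div, le_div_iff₀ (by positivity)]
      linarith
    calc ((E ∩ redLt κ η).ncard : ℝ)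
        ≤ ∑ j ∈ Finset.range (J + 1), ((E ∩ redAt κ (2 ^ j)).ncard : ℝ) := by exact_mod_cast h2
      _ ≤ ∑ j ∈ Finset.range (J + 1), 2 * M / κ ^ 2 * 4 ^ j := sum_le_sum h3
      _ = 2 * M / κ ^ 2 * ((4 ^ (J + 1) - 1) / (4 - 1)) := by
        rw [← mul_sum, geom_sum_eq (by norm_num)]
      _ ≤ 2 * M / κ ^ 2 * (4 / 3 * (η * κ ^ 2)) := by
        gcongr
        rw [pow_succ]
        linarith
      _ = 8 / 3 * (η * M) := by field_simp; ring
      _ ≤ _ := by nlinarith [mul_nonneg hη0.le hM0]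

/-! ### Elementary counting of integer points -/

lemma ncard_int_interval_le {u v : ℝ} (h : u ≤ v + 1) (T : Set ℤ)
    (hT : ∀ x ∈ T, u ≤ x ∧ (x : ℝ) ≤ v) : (T.ncard : ℝ) ≤ v - u + 1 := by
  have h1 : T ⊆ Set.Icc ⌈u⌉ ⌊v⌋ := fun x hx =>
    ⟨Int.ceil_le.mpr (hT x hx).1, Int.le_floor.mpr (hT x hx).2⟩
  have h2 := ncard_le_ncard h1 (finite_Icc _ _)
  rw [← coe_Icc, ncard_coe_finset, Int.card_Icc] at h2
  have h3 : (T.ncard : ℝ) ≤ ((⌊v⌋ + 1 - ⌈u⌉).toNat : ℝ) := by exact_mod_cast h2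
  refine h3.trans ?_
  rcases le_total (⌊v⌋ + 1 - ⌈u⌉) 0 with h4 | h4
  · rw [Int.toNat_of_nonpos h4]; push_cast; linarith
  · have : ((⌊v⌋ + 1 - ⌈u⌉).toNat : ℝ) = ((⌊v⌋ + 1 - ⌈u⌉ : ℤ) : ℝ) := by
      rw [← Int.cast_natCast, Int.toNat_of_nonneg h4]
    rw [this]
    push_cast
    have := Int.floor_le v
    have := Int.le_ceil u
    linarith

lemma ncard_congr_le {R : ℝ} (hR : 0 ≤ R) (hp : 0 < p) (T : Set ℤ)
    (hT : ∀ x ∈ T, |(x : ℝ)| ≤ R) (hc : ∀ x ∈ T, ∀ y ∈ T, (p : ℤ) ∣ x - y) :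
    (T.ncard : ℝ) ≤ 2 * R / p + 1 := by
  have hp' : (0 : ℝ) < p := by exact_mod_cast hp
  rcases T.eq_empty_or_nonempty with rfl | ⟨r, hr⟩
  · simp; positivity
  have hinj : InjOn (fun x : ℤ => (x - r) / p) T := by
    intro x hx y hy h
    have h : (x - r) / p = (y - r) / p := h
    have e1 := Int.ediv_mul_cancel (hc x hx r hr)
    have e2 := Int.ediv_mul_cancel (hc y hy r hr)
    rw [h] at e1
    linarith
  rw [← hinj.ncard_image]
  have hr' := abs_le.mp (hT r hr)
  have := ncard_int_interval_le (u := (-R - r) / p) (v := (R - r) / p) (by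
    have : (-R - r) / p ≤ (R - r) / p := by gcongr; linarith
    linarith) ((fun x : ℤ => (x - r) / p) '' T) (by
    rintro _ ⟨x, hx, rfl⟩
    have hx' := abs_le.mp (hT x hx)
    have e1 : (((x - r) / p : ℤ) : ℝ) * p = x - r := by
      have := Int.ediv_mul_cancel (hc x hx r hr)
      exact_mod_cast this
    rw [div_le_iff₀ hp', le_div_iff₀ hp', e1]
    constructor <;> linarith)
  refine this.trans_eq ?_
  field_simp
  ring

lemma ncard_abs_le {R : ℝ} (hR : 0 ≤ R) (T : Set ℤ) (hT : ∀ x ∈ T, |(x : ℝ)| ≤ R) :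
    (T.ncard : ℝ) ≤ 2 * R + 1 := by
  simpa using ncard_congr_le hR one_pos T hT (by simp)

lemma ncard_ne_zero_le {R : ℝ} (hR : 0 ≤ R) (hp : 0 < p) (T : Set ℤ)
    (hT : ∀ x ∈ T, |(x : ℝ)| ≤ R) (h0 : ∀ x ∈ T, x ≠ 0) (hc : ∀ x ∈ T, (p : ℤ) ∣ x) :
    (T.ncard : ℝ) ≤ 2 * R / p := by
  have h1 : (0 : ℤ) ∉ T := fun h => h0 0 h rfl
  have hfin : T.Finite := (finite_abs_le R).subset hT
  have := ncard_congr_le hR hp (insert 0 T) (by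
    rintro x (rfl | hx)
    · simpa using hR
    · exact hT x hx) (by
    rintro x (rfl | hx) y (rfl | hy)
    · simp
    · simpa using hc y hy
    · simpa using hc x hx
    · exact dvd_sub (hc x hx) (hc y hy))
  rw [ncard_insert_of_notMem h1 hfin] at this
  push_cast at this
  linarith

lemma ncard_le_mul_of_fiber {α β : Type*} {A : Set α} (hA : A.Finite) (g : α → β) {c b : ℝ}
    (hc0 : 0 ≤ c) (hb : ((g '' A).ncard : ℝ) ≤ b)
    (hc : ∀ y, (({x ∈ A | g x = y}).ncard : ℝ) ≤ c) : (A.ncard : ℝ) ≤ b * c := by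
  classical
  have hsub : A ⊆ ⋃ y ∈ (hA.image g).toFinset, {x ∈ A | g x = y} := by
    intro x hx
    simp only [mem_iUnion]
    exact ⟨g x, by simpa using ⟨x, hx, rfl⟩, hx, rfl⟩
  have h1 := (ncard_le_ncard hsub
    (Set.Finite.biUnion (finite_toSet _) fun y _ => hA.subset (sep_subset _ _))).trans
    (set_ncard_biUnion_le _ _)
  calc (A.ncard : ℝ) ≤ ∑ y ∈ (hA.image g).toFinset, (({x ∈ A | g x = y}).ncard : ℝ) := by
        exact_mod_cast h1
    _ ≤ ∑ y ∈ (hA.image g).toFinset, c := sum_le_sum fun y _ => hc y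
    _ = ((g '' A).ncard : ℝ) * c := by
      rw [sum_const, nsmul_eq_mul, ncard_eq_toFinset_card _ (hA.image g)]
    _ ≤ b * c := by gcongr

/-- Counting integral forms coefficient by coefficient. -/
lemma ncard_forms_le {A : Set ℤ⁴} (hA : A.Finite) {α β γ δ : ℝ}
    (hβ : 0 ≤ β) (hγ : 0 ≤ γ) (hδ : 0 ≤ δ)
    (h0 : (((fun f => f 0) '' A).ncard : ℝ) ≤ α)
    (h1 : ∀ x, (((fun f => f 1) '' {f ∈ A | f 0 = x}).ncard : ℝ) ≤ β)
    (h2 : ∀ x y, (((fun f => f 2) '' {f ∈ A | f 0 = x ∧ f 1 = y}).ncard : ℝ) ≤ γ)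
    (h3 : ∀ x y z, (((fun f => f 3) '' {f ∈ A | f 0 = x ∧ f 1 = y ∧ f 2 = z}).ncard : ℝ) ≤ δ) :
    (A.ncard : ℝ) ≤ α * (β * (γ * δ)) := by
  refine ncard_le_mul_of_fiber hA (fun f => f 0) (by positivity) h0 fun x => ?_
  refine ncard_le_mul_of_fiber (hA.subset (sep_subset _ _)) (fun f => f 1) (by positivity)
    (h1 x) fun y => ?_
  refine ncard_le_mul_of_fiber (hA.subset fun f hf => hf.1.1) (fun f => f 2) (by positivity)
    ?_ fun z => ?_
  · convert h2 x y using 4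
    ext f; simp [and_assoc]
  · have hinj : InjOn (fun f : ℤ⁴ => f 3)
        {f ∈ {f ∈ {f ∈ A | f 0 = x} | f 1 = y} | f 2 = z} := by
      rintro f ⟨⟨⟨-, a0⟩, a1⟩, a2⟩ g ⟨⟨⟨-, b0⟩, b1⟩, b2⟩ h
      exact form_ext (a0.trans b0.symm) (a1.trans b1.symm) (a2.trans b2.symm) h
    rw [← hinj.ncard_image]
    convert h3 x y z using 4
    ext f; simp [and_assoc]

/-! ### Points in the unipotent boxes -/

section Box
variable {κ τ : ℝ}

lemma tau_le (hκ : 1 ≤ κ) (h : τ ^ 2 ≤ 2 * κ ^ 2) : τ ≤ 2 * κ := by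
  apply le_of_sq_le_sq _ (by positivity)
  nlinarith

lemma tau_cube_le (hκ : 1 ≤ κ) (hτ : 1 ≤ τ) (h : τ ^ 2 ≤ 2 * κ ^ 2) : τ ^ 3 ≤ 4 * κ ^ 3 := by
  have := tau_le hκ h
  calc τ ^ 3 = τ ^ 2 * τ := by ring
    _ ≤ 2 * κ ^ 2 * (2 * κ) := by gcongr
    _ = _ := by ring

lemma ubox_sub {A : Set ℤ⁴} (hA : A ⊆ ubox κ τ) (hκ : 1 ≤ κ) (hτ : 1 ≤ τ)
    (h : τ ^ 2 ≤ 2 * κ ^ 2) :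
    (∀ B : Set ℤ⁴, B ⊆ A → (((fun f => f 1) '' B).ncard : ℝ) ≤ 33 * (τ * κ ^ 2)) ∧
    (∀ B : Set ℤ⁴, B ⊆ A → (((fun f => f 2) '' B).ncard : ℝ) ≤ 66 * (κ ^ 4 / τ)) ∧
    (∀ B : Set ℤ⁴, B ⊆ A → (((fun f => f 3) '' B).ncard : ℝ) ≤ 132 * (κ ^ 6 / τ ^ 3)) ∧
    (((fun f => f 0) '' A).ncard : ℝ) ≤ 16 * τ ^ 3 := by
  have hτ0 : 0 < τ := by linarith
  have hκ0 : 0 < κ := by linarith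
  refine ⟨fun B hB => ?_, fun B hB => ?_, fun B hB => ?_, ?_⟩
  · have := ncard_abs_le (R := 16 * τ * κ ^ 2) (by positivity) ((fun f => f 1) '' B) (by
      rintro _ ⟨f, hf, rfl⟩
      exact (hA (hB hf)).2.2.1)
    have : 1 ≤ τ * κ ^ 2 := one_le_mul_of_one_le_of_one_le hτ (one_le_pow₀ hκ)
    linarith
  · have := ncard_abs_le (R := 32 * κ ^ 4 / τ) (by positivity) ((fun f => f 2) '' B) (by
      rintro _ ⟨f, hf, rfl⟩
      exact (hA (hB hf)).2.2.2.1)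
    have h1 : 1 ≤ 2 * (κ ^ 4 / τ) := by
      rw [mul_div_assoc', le_div_iff₀ hτ0]
      have := tau_le hκ h
      have : κ ≤ κ ^ 4 := le_self_pow₀ hκ (by norm_num)
      linarith
    have e : 32 * κ ^ 4 / τ = 32 * (κ ^ 4 / τ) := by ring
    linarith
  · have := ncard_abs_le (R := 64 * κ ^ 6 / τ ^ 3) (by positivity) ((fun f => f 3) '' B) (by
      rintro _ ⟨f, hf, rfl⟩
      exact (hA (hB hf)).2.2.2.2)
    have h1 : 1 ≤ 4 * (κ ^ 6 / τ ^ 3) := by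
      rw [mul_div_assoc', le_div_iff₀ (by positivity)]
      have := tau_cube_le hκ hτ h
      have : κ ^ 3 ≤ κ ^ 6 := pow_le_pow_right₀ hκ (by norm_num)
      linarith
    have e : 64 * κ ^ 6 / τ ^ 3 = 64 * (κ ^ 6 / τ ^ 3) := by ring
    linarith
  · have := ncard_ne_zero_le (R := 8 * τ ^ 3) (by positivity) one_pos ((fun f => f 0) '' A) (by
      rintro _ ⟨f, hf, rfl⟩
      exact (hA hf).2.1) (by
      rintro _ ⟨f, hf, rfl⟩
      exact (hA hf).1) (by simp)
    simp only [Nat.cast_one, _root_.div_one] at this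
    linarith

lemma ubox_ncard_le (hκ : 1 ≤ κ) (hτ : 1 ≤ τ) (h : τ ^ 2 ≤ 2 * κ ^ 2) :
    ((ubox κ τ).ncard : ℝ) ≤ 10 ^ 7 * κ ^ 12 := by
  have hτ0 : 0 < τ := by linarith
  have hκ0 : 0 < κ := by linarith
  obtain ⟨h1, h2, h3, h0⟩ := ubox_sub (subset_refl (ubox κ τ)) hκ hτ h
  refine (ncard_forms_le (ubox_finite κ τ) (by positivity) (by positivity) (by positivity) h0
    (fun x => h1 _ (sep_subset _ _)) (fun x y => h2 _ (sep_subset _ _))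
    (fun x y z => h3 _ (sep_subset _ _))).trans ?_
  have e : 16 * τ ^ 3 * (33 * (τ * κ ^ 2) * (66 * (κ ^ 4 / τ) * (132 * (κ ^ 6 / τ ^ 3)))) =
      (16 * 33 * 66 * 132) * κ ^ 12 := by
    field_simp
  rw [e]
  have : 0 < κ ^ 12 := by positivity
  nlinarith

/-- The Hessian is divisible by `p`. -/
def HessDvd (p : ℤ) (f : ℤ⁴) : Prop := p ∣ hA f ∧ p ∣ hB f ∧ p ∣ hC f

lemma HessDvd.of_equiv {p : ℤ} (h : SLEquiv f g) (hf : HessDvd p f) :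
    HessDvd p g := by
  obtain ⟨a, b, c, d, -, rfl⟩ := h
  obtain ⟨h1, h2, h3⟩ := hf
  refine ⟨?_, ?_, ?_⟩
  · rw [hA_cact]
    exact Dvd.dvd.mul_left (dvd_add (dvd_add (h1.mul_right _) ((h2.mul_right _).mul_right _))
      (h3.mul_right _)) _
  · rw [hB_cact]
    refine Dvd.dvd.mul_left (dvd_add (dvd_add ?_ (h2.mul_right _)) ?_) _
    · exact ((h1.mul_left 2).mul_right _).mul_right _
    · exact ((h3.mul_left 2).mul_right _).mul_right _
  · rw [hC_cact]
    exact Dvd.dvd.mul_left (dvd_add (dvd_add (h1.mul_right _) ((h2.mul_right _).mul_right _))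
      (h3.mul_right _)) _

lemma HessDvd.third (hp : p.Prime) (hf : HessDvd p f) (hg : HessDvd p g)
    (h : ¬ (p : ℤ) ∣ f 0) (h0 : f 0 = g 0) (h1 : f 1 = g 1) : (p : ℤ) ∣ f 2 - g 2 := by
  have hp' := Nat.prime_iff_prime_int.mp hp
  have := dvd_sub hg.1 hf.1
  simp only [hA, ← h0, ← h1] at this
  rw [show f 1 ^ 2 - f 0 * g 2 - (f 1 ^ 2 - f 0 * f 2) = f 0 * (f 2 - g 2) by ring] at this
  exact (hp'.dvd_or_dvd this).resolve_left h

lemma HessDvd.fourth (hp : p.Prime) (hf : HessDvd p f)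
    (hg : HessDvd p g) (h : ¬ (p : ℤ) ∣ f 0) (h0 : f 0 = g 0) (h1 : f 1 = g 1) (h2 : f 2 = g 2) :
    (p : ℤ) ∣ f 3 - g 3 := by
  have hp' := Nat.prime_iff_prime_int.mp hp
  have := dvd_sub hg.2.1 hf.2.1
  simp only [hB, ← h0, ← h1, ← h2] at this
  rw [show f 1 * f 2 - f 0 * g 3 - (f 1 * f 2 - f 0 * f 3) = f 0 * (f 3 - g 3) by ring] at this
  exact (hp'.dvd_or_dvd this).resolve_left h

lemma ubox_hess_not_dvd (hκ : 1 ≤ κ) (hτ : 1 ≤ τ) (h : τ ^ 2 ≤ 2 * κ ^ 2) (hp : p.Prime)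
    (hpk : (p : ℝ) ≤ 32 * κ ^ 3) :
    (({f | HessDvd p f ∧ ¬ (p : ℤ) ∣ f 0} ∩ ubox κ τ).ncard : ℝ) ≤ 10 ^ 8 * κ ^ 12 / p ^ 2 := by
  have hτ0 : 0 < τ := by linarith
  have hκ0 : 0 < κ := by linarith
  have hp0 : (0 : ℝ) < p := by exact_mod_cast hp.pos
  set A := {f | HessDvd p f ∧ ¬ (p : ℤ) ∣ f 0} ∩ ubox κ τ with hAdef
  have hsub : A ⊆ ubox κ τ := Set.inter_subset_right
  obtain ⟨h1, -, -, h0⟩ := ubox_sub hsub hκ hτ h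
  have h2 : ∀ x y, (((fun f => f 2) '' {f ∈ A | f 0 = x ∧ f 1 = y}).ncard : ℝ) ≤
      128 * (κ ^ 4 / (τ * p)) := by
    intro x y
    have := ncard_congr_le (R := 32 * κ ^ 4 / τ) (by positivity) hp.pos
      ((fun f => f 2) '' {f ∈ A | f 0 = x ∧ f 1 = y}) (by
      rintro _ ⟨f, hf, rfl⟩
      exact (hsub hf.1).2.2.2.1) (by
      rintro _ ⟨f, hf, rfl⟩ _ ⟨g, hg, rfl⟩
      exact hf.1.1.1.third hp hg.1.1.1 hf.1.1.2 (hf.2.1.trans hg.2.1.symm)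
        (hf.2.2.trans hg.2.2.symm))
    have h1 : 1 ≤ 64 * (κ ^ 4 / (τ * p)) := by
      rw [mul_div_assoc', le_div_iff₀ (by positivity), one_mul]
      calc τ * p ≤ (2 * κ) * (32 * κ ^ 3) :=
            mul_le_mul (tau_le hκ h) hpk hp0.le (by positivity)
        _ = _ := by ring
    have e : 2 * (32 * κ ^ 4 / τ) / p = 64 * (κ ^ 4 / (τ * p)) := by field_simp; ring
    linarith
  have h3 : ∀ x y z, (((fun f => f 3) '' {f ∈ A | f 0 = x ∧ f 1 = y ∧ f 2 = z}).ncard : ℝ) ≤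
      256 * (κ ^ 6 / (τ ^ 3 * p)) := by
    intro x y z
    have := ncard_congr_le (R := 64 * κ ^ 6 / τ ^ 3) (by positivity) hp.pos
      ((fun f => f 3) '' {f ∈ A | f 0 = x ∧ f 1 = y ∧ f 2 = z}) (by
      rintro _ ⟨f, hf, rfl⟩
      exact (hsub hf.1).2.2.2.2) (by
      rintro _ ⟨f, hf, rfl⟩ _ ⟨g, hg, rfl⟩
      exact hf.1.1.1.fourth hp hg.1.1.1 hf.1.1.2 (hf.2.1.trans hg.2.1.symm)
        (hf.2.2.1.trans hg.2.2.1.symm) (hf.2.2.2.trans hg.2.2.2.symm))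
    have h1 : 1 ≤ 128 * (κ ^ 6 / (τ ^ 3 * p)) := by
      rw [mul_div_assoc', le_div_iff₀ (by positivity), one_mul]
      calc τ ^ 3 * p ≤ (4 * κ ^ 3) * (32 * κ ^ 3) :=
            mul_le_mul (tau_cube_le hκ hτ h) hpk hp0.le (by positivity)
        _ = _ := by ring
    have e : 2 * (64 * κ ^ 6 / τ ^ 3) / p = 128 * (κ ^ 6 / (τ ^ 3 * p)) := by field_simp; ring
    linarith
  refine (ncard_forms_le ((ubox_finite κ τ).subset hsub) (by positivity) (by positivity)
    (by positivity) h0 (fun x => h1 _ (sep_subset _ _)) h2 h3).trans ?_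
  have e : 16 * τ ^ 3 * (33 * (τ * κ ^ 2) * (128 * (κ ^ 4 / (τ * p)) *
      (256 * (κ ^ 6 / (τ ^ 3 * p))))) = (16 * 33 * 128 * 256) * κ ^ 12 / p ^ 2 := by
    field_simp
  rw [e]
  gcongr
  norm_num

lemma ubox_hess_dvd (hκ : 1 ≤ κ) (hτ : 1 ≤ τ) (h : τ ^ 2 ≤ 2 * κ ^ 2) (hp : p.Prime) :
    (({f | HessDvd p f ∧ (p : ℤ) ∣ f 0} ∩ ubox κ τ).ncard : ℝ) ≤ 10 ^ 8 * κ ^ 12 / p ^ 2 := by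
  have hτ0 : 0 < τ := by linarith
  have hκ0 : 0 < κ := by linarith
  have hp0 : (0 : ℝ) < p := by exact_mod_cast hp.pos
  have hpi := Nat.prime_iff_prime_int.mp hp
  set A := {f | HessDvd p f ∧ (p : ℤ) ∣ f 0} ∩ ubox κ τ with hAdef
  have hsub : A ⊆ ubox κ τ := Set.inter_subset_right
  rcases A.eq_empty_or_nonempty with hemp | ⟨f₀, hf₀⟩
  · rw [hemp]; simp; positivity
  have hpt : (p : ℝ) ≤ 8 * τ ^ 3 := by
    have h1 := Int.le_of_dvd (abs_pos.mpr (hsub hf₀).1) ((dvd_abs _ _).mpr hf₀.1.2)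
    have h2 := (hsub hf₀).2.1
    have h3 : ((p : ℤ) : ℝ) ≤ ((|f₀ 0| : ℤ) : ℝ) := by exact_mod_cast h1
    push_cast at h3
    linarith
  obtain ⟨-, -, h3, -⟩ := ubox_sub hsub hκ hτ h
  have d1 : ∀ f ∈ A, (p : ℤ) ∣ f 1 := by
    rintro f ⟨⟨⟨ha, -, -⟩, h0⟩, -⟩
    apply hpi.dvd_of_dvd_pow (n := 2)
    have := dvd_add ha (h0.mul_right (f 2))
    simpa [hA] using this
  have d2 : ∀ f ∈ A, (p : ℤ) ∣ f 2 := by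
    rintro f hf
    apply hpi.dvd_of_dvd_pow (n := 2)
    have := dvd_add hf.1.1.2.2 ((d1 f hf).mul_right (f 3))
    simpa [hC] using this
  have h0 : (((fun f => f 0) '' A).ncard : ℝ) ≤ 16 * (τ ^ 3 / p) := by
    refine (ncard_ne_zero_le (R := 8 * τ ^ 3) (by positivity) hp.pos _ ?_ ?_ ?_).trans_eq
      (by ring)
    · rintro _ ⟨f, hf, rfl⟩
      exact (hsub hf).2.1
    · rintro _ ⟨f, hf, rfl⟩
      exact (hsub hf).1
    · rintro _ ⟨f, hf, rfl⟩
      exact hf.1.2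
  have h1 : ∀ x, (((fun f => f 1) '' {f ∈ A | f 0 = x}).ncard : ℝ) ≤ 48 * (τ * κ ^ 2 / p) := by
    intro x
    have := ncard_congr_le (R := 16 * τ * κ ^ 2) (by positivity) hp.pos
      ((fun f => f 1) '' {f ∈ A | f 0 = x}) (by
      rintro _ ⟨f, hf, rfl⟩
      exact (hsub hf.1).2.2.1) (by
      rintro _ ⟨f, hf, rfl⟩ _ ⟨g, hg, rfl⟩
      exact dvd_sub (d1 f hf.1) (d1 g hg.1))
    have h1 : 1 ≤ 16 * (τ * κ ^ 2 / p) := by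
      rw [mul_div_assoc', le_div_iff₀ (by positivity), one_mul]
      nlinarith
    have e : 2 * (16 * τ * κ ^ 2) / p = 32 * (τ * κ ^ 2 / p) := by field_simp; ring
    linarith
  have h2 : ∀ x y, (((fun f => f 2) '' {f ∈ A | f 0 = x ∧ f 1 = y}).ncard : ℝ) ≤
      96 * (κ ^ 4 / (τ * p)) := by
    intro x y
    have := ncard_congr_le (R := 32 * κ ^ 4 / τ) (by positivity) hp.pos
      ((fun f => f 2) '' {f ∈ A | f 0 = x ∧ f 1 = y}) (by
      rintro _ ⟨f, hf, rfl⟩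
      exact (hsub hf.1).2.2.2.1) (by
      rintro _ ⟨f, hf, rfl⟩ _ ⟨g, hg, rfl⟩
      exact dvd_sub (d2 f hf.1) (d2 g hg.1))
    have h1 : 1 ≤ 32 * (κ ^ 4 / (τ * p)) := by
      rw [mul_div_assoc', le_div_iff₀ (by positivity), one_mul]
      calc τ * p ≤ τ * (8 * τ ^ 3) := by gcongr
        _ = 8 * (τ ^ 2) ^ 2 := by ring
        _ ≤ 8 * (2 * κ ^ 2) ^ 2 := by gcongr
        _ = _ := by ring
    have e : 2 * (32 * κ ^ 4 / τ) / p = 64 * (κ ^ 4 / (τ * p)) := by field_simp; ring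
    linarith
  refine (ncard_forms_le ((ubox_finite κ τ).subset hsub) (by positivity) (by positivity)
    (by positivity) h0 h1 h2 (fun x y z => h3 _ (sep_subset _ _))).trans ?_
  have e : 16 * (τ ^ 3 / p) * (48 * (τ * κ ^ 2 / p) * (96 * (κ ^ 4 / (τ * p)) *
      (132 * (κ ^ 6 / τ ^ 3)))) = (16 * 48 * 96 * 132 * (1 / p)) * κ ^ 12 / p ^ 2 := by
    field_simp
  rw [e]
  gcongr
  have : 1 / (p : ℝ) ≤ 1 := by
    rw [div_le_one hp0]; exact_mod_cast hp.one_lt.le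
  linarith

end Box

/-! ### Forms whose Hessian is divisible by a large prime -/

section Box
variable {κ τ : ℝ}

lemma ubox_hA_zero (hκ : 1 ≤ κ) (hτ : 1 ≤ τ) (h : τ ^ 2 ≤ 2 * κ ^ 2) :
    (({f | hA f = 0} ∩ ubox κ τ).ncard : ℝ) ≤ 10 ^ 6 * κ ^ 9 := by
  have hτ0 : 0 < τ := by linarith
  have hκ0 : 0 < κ := by linarith
  set A := {f : ℤ⁴ | hA f = 0} ∩ ubox κ τ with hAdef
  have hsub : A ⊆ ubox κ τ := Set.inter_subset_right
  obtain ⟨h1, -, h3, h0⟩ := ubox_sub hsub hκ hτ h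
  have h2 : ∀ x y, (((fun f => f 2) '' {f ∈ A | f 0 = x ∧ f 1 = y}).ncard : ℝ) ≤ 1 := by
    intro x y
    have : ((fun f : ℤ⁴ => f 2) '' {f ∈ A | f 0 = x ∧ f 1 = y}).ncard ≤ 1 := by
      rw [ncard_le_one ((((ubox_finite κ τ).subset hsub).subset (sep_subset _ _)).image _)]
      rintro _ ⟨f, ⟨⟨e1, n1⟩, a0, a1⟩, rfl⟩ _ ⟨g, ⟨⟨e2, n2⟩, b0, b1⟩, rfl⟩
      have e1 : f 1 ^ 2 - f 0 * f 2 = 0 := e1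
      have e2 : g 1 ^ 2 - g 0 * g 2 = 0 := e2
      have n1 := n1.1
      rw [b0, b1, ← a0, ← a1] at e2
      exact mul_left_cancel₀ n1 (by linarith)
    exact_mod_cast this
  refine (ncard_forms_le ((ubox_finite κ τ).subset hsub) (by positivity) (by positivity)
    (by positivity) h0 (fun x => h1 _ (sep_subset _ _)) h2
    (fun x y z => h3 _ (sep_subset _ _))).trans ?_
  have e : 16 * τ ^ 3 * (33 * (τ * κ ^ 2) * (1 * (132 * (κ ^ 6 / τ ^ 3)))) =
      (16 * 33 * 132) * (τ * κ ^ 8) := by field_simp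
  rw [e]
  have : τ * κ ^ 8 ≤ 2 * κ * κ ^ 8 := by gcongr; exact tau_le hκ h
  have e2 : 2 * κ * κ ^ 8 = 2 * κ ^ 9 := by ring
  have : 0 < κ ^ 9 := by positivity
  nlinarith

lemma ubox_large_prime (hκ : 1 ≤ κ) (hτ : 1 ≤ τ) (h : τ ^ 2 ≤ 2 * κ ^ 2) :
    (({f | hA f ≠ 0 ∧ ∃ p : ℕ, p.Prime ∧ 32 * κ ^ 3 < p ∧ HessDvd p f} ∩ ubox κ τ).ncard : ℝ) ≤
      10 ^ 7 * κ ^ 9 := by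
  have hτ0 : 0 < τ := by linarith
  have hκ0 : 0 < κ := by linarith
  set A := {f | hA f ≠ 0 ∧ ∃ p : ℕ, p.Prime ∧ 32 * κ ^ 3 < p ∧ HessDvd p f} ∩ ubox κ τ with hAdef
  have hsub : A ⊆ ubox κ τ := Set.inter_subset_right
  obtain ⟨h1, h2, -, h0⟩ := ubox_sub hsub hκ hτ h
  have hnd : ∀ f ∈ A, ∀ p : ℕ, 32 * κ ^ 3 < p → ¬ (p : ℤ) ∣ f 0 := by
    intro f hf p hp hd
    have h1 := Int.le_of_dvd (abs_pos.mpr (hsub hf).1) ((dvd_abs _ _).mpr hd)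
    have h2 := (hsub hf).2.1
    have h3 : ((p : ℤ) : ℝ) ≤ ((|f 0| : ℤ) : ℝ) := by exact_mod_cast h1
    push_cast at h3
    have := tau_cube_le hκ hτ h
    linarith
  have hbound : ∀ f ∈ A, |((hA f : ℤ) : ℝ)| ≤ (32 * κ ^ 3) ^ 2 := by
    intro f hf
    obtain ⟨-, b0, b1, b2, -⟩ := hsub hf
    simp only [hA]
    push_cast
    calc |(f 1 : ℝ) ^ 2 - f 0 * f 2| ≤ |(f 1 : ℝ) ^ 2| + |(f 0 : ℝ) * f 2| := abs_sub _ _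
      _ = |(f 1 : ℝ)| ^ 2 + |(f 0 : ℝ)| * |(f 2 : ℝ)| := by rw [abs_mul, abs_pow]
      _ ≤ (16 * τ * κ ^ 2) ^ 2 + 8 * τ ^ 3 * (32 * κ ^ 4 / τ) := by gcongr
      _ = 512 * τ ^ 2 * κ ^ 4 := by field_simp; ring
      _ ≤ 512 * (2 * κ ^ 2) * κ ^ 4 := by gcongr
      _ = _ := by ring
  have h3 : ∀ x y z, (((fun f => f 3) '' {f ∈ A | f 0 = x ∧ f 1 = y ∧ f 2 = z}).ncard : ℝ) ≤
      8 * (κ ^ 3 / τ ^ 3) := by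
    intro x y z
    rcases Set.eq_empty_or_nonempty {f ∈ A | f 0 = x ∧ f 1 = y ∧ f 2 = z} with he | ⟨f₀, hf₀⟩
    · rw [he]; simp; positivity
    obtain ⟨hfA, a0, a1, a2⟩ := hf₀
    obtain ⟨⟨hne, p, hp, hpk, hpd⟩, hfu⟩ := hfA
    have hk : ∀ g ∈ {f ∈ A | f 0 = x ∧ f 1 = y ∧ f 2 = z}, HessDvd p g := by
      rintro g ⟨⟨⟨-, q, hq, hqk, hqd⟩, -⟩, b0, b1, b2⟩
      have e : hA g = hA f₀ := by simp only [hA]; rw [b0, b1, b2, a0, a1, a2]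
      suffices p = q by rw [this]; exact hqd
      by_contra hpq
      have hcop : IsCoprime (p : ℤ) q := Nat.isCoprime_iff_coprime.mpr
        ((Nat.coprime_primes hp hq).mpr hpq)
      have hd := hcop.mul_dvd hpd.1 (e ▸ hqd.1)
      have l1 := Int.le_of_dvd (abs_pos.mpr hne) ((dvd_abs _ _).mpr hd)
      have l2 : (((p * q : ℤ)) : ℝ) ≤ ((|hA f₀| : ℤ) : ℝ) := by exact_mod_cast l1
      have l3 := hbound f₀ ⟨⟨hne, p, hp, hpk, hpd⟩, hfu⟩
      push_cast at l2
      have : (32 * κ ^ 3) ^ 2 < (p : ℝ) * q := by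
        rw [sq]; exact mul_lt_mul'' hpk hqk (by positivity) (by positivity)
      linarith
    have := ncard_congr_le (R := 64 * κ ^ 6 / τ ^ 3) (by positivity) hp.pos
      ((fun f => f 3) '' {f ∈ A | f 0 = x ∧ f 1 = y ∧ f 2 = z}) (by
      rintro _ ⟨f, hf, rfl⟩
      exact (hsub hf.1).2.2.2.2) (by
      rintro _ ⟨f, hf, rfl⟩ _ ⟨g, hg, rfl⟩
      exact (hk f hf).fourth hp (hk g hg) (hnd f hf.1 p hpk) (hf.2.1.trans hg.2.1.symm)
        (hf.2.2.1.trans hg.2.2.1.symm) (hf.2.2.2.trans hg.2.2.2.symm))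
    refine this.trans ?_
    have h1 : 1 ≤ 4 * (κ ^ 3 / τ ^ 3) := by
      rw [mul_div_assoc', le_div_iff₀ (by positivity), one_mul]
      exact tau_cube_le hκ hτ h
    have h2 : 2 * (64 * κ ^ 6 / τ ^ 3) / p ≤ 4 * (κ ^ 3 / τ ^ 3) := by
      rw [div_le_iff₀ (by exact_mod_cast hp.pos)]
      calc 2 * (64 * κ ^ 6 / τ ^ 3) = 4 * (κ ^ 3 / τ ^ 3) * (32 * κ ^ 3) := by ring
        _ ≤ _ := by gcongr
    linarith
  refine (ncard_forms_le ((ubox_finite κ τ).subset hsub) (by positivity) (by positivity)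
    (by positivity) h0 (fun x => h1 _ (sep_subset _ _))
    (fun x y => h2 _ (sep_subset _ _)) h3).trans ?_
  have e : 16 * τ ^ 3 * (33 * (τ * κ ^ 2) * (66 * (κ ^ 4 / τ) * (8 * (κ ^ 3 / τ ^ 3)))) =
      (16 * 33 * 66 * 8) * κ ^ 9 := by field_simp
  rw [e]
  gcongr
  norm_num

/-- Forms with Hessian divisible by some prime larger than `Y`. -/
def hessGt (Y : ℕ) : Set ℤ⁴ := {f | ∃ p : ℕ, p.Prime ∧ Y < p ∧ HessDvd p f}

lemma hessGt_inv (Y : ℕ) : SLInv (hessGt Y) := by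
  rintro f g h ⟨p, h1, h2, h3⟩
  exact ⟨p, h1, h2, h3.of_equiv h⟩

lemma ubox_hessGt (hκ : 1 ≤ κ) (hτ : 1 ≤ τ) (h : τ ^ 2 ≤ 2 * κ ^ 2) {Y : ℕ} (hY : 0 < Y) :
    ((hessGt Y ∩ ubox κ τ).ncard : ℝ) ≤ 10 ^ 9 * (κ ^ 12 / Y + κ ^ 9) := by
  have hκ0 : 0 < κ := by linarith
  set P := ⌊32 * κ ^ 3⌋₊ with hP
  set B : ℕ → Set ℤ⁴ := fun p => {f | p.Prime ∧ (p : ℝ) ≤ 32 * κ ^ 3 ∧ HessDvd p f} ∩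
    ubox κ τ with hB
  set A0 := {f : ℤ⁴ | hA f = 0} ∩ ubox κ τ
  set A1 := {f | hA f ≠ 0 ∧ ∃ p : ℕ, p.Prime ∧ 32 * κ ^ 3 < p ∧ HessDvd p f} ∩ ubox κ τ
  have hfin : ∀ C, (C ∩ ubox κ τ).Finite := fun C =>
    (ubox_finite κ τ).subset Set.inter_subset_right
  have hsub : hessGt Y ∩ ubox κ τ ⊆ (⋃ p ∈ Finset.Ioc Y P, B p) ∪ (A0 ∪ A1) := by
    rintro f ⟨⟨p, h1, h2, h3⟩, hu⟩
    rcases le_or_gt (p : ℝ) (32 * κ ^ 3) with hp | hp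
    · left
      simp only [mem_iUnion]
      exact ⟨p, Finset.mem_Ioc.mpr ⟨h2, Nat.le_floor hp⟩, ⟨h1, hp, h3⟩, hu⟩
    · right
      by_cases h0 : hA f = 0
      · exact Or.inl ⟨h0, hu⟩
      · exact Or.inr ⟨⟨h0, p, h1, hp, h3⟩, hu⟩
  have hBle : ∀ p ∈ Finset.Ioc Y P, ((B p).ncard : ℝ) ≤ 2 * 10 ^ 8 * κ ^ 12 * ((p : ℝ) ^ 2)⁻¹ := by
    intro p hp
    by_cases hpp : p.Prime ∧ (p : ℝ) ≤ 32 * κ ^ 3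
    · have hs : B p ⊆ ({f | HessDvd p f ∧ ¬ (p : ℤ) ∣ f 0} ∩ ubox κ τ) ∪
          ({f | HessDvd p f ∧ (p : ℤ) ∣ f 0} ∩ ubox κ τ) := by
        rintro f ⟨⟨-, -, h3⟩, hu⟩
        by_cases hd : (p : ℤ) ∣ f 0
        · exact Or.inr ⟨⟨h3, hd⟩, hu⟩
        · exact Or.inl ⟨⟨h3, hd⟩, hu⟩
      have l1 := (ncard_le_ncard hs ((hfin _).union (hfin _))).trans (ncard_union_le _ _)
      have l2 : ((B p).ncard : ℝ) ≤ _ := Nat.cast_le.mpr l1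
      push_cast at l2
      have l3 := ubox_hess_not_dvd hκ hτ h hpp.1 hpp.2
      have l4 := ubox_hess_dvd hκ hτ h hpp.1
      rw [div_eq_mul_inv] at l3 l4
      linarith
    · have : B p = ∅ := by
        rw [Set.eq_empty_iff_forall_notMem]
        rintro f ⟨⟨h1, h2, -⟩, -⟩
        exact hpp ⟨h1, h2⟩
      rw [this]; simp; positivity
  have hsum : ((⋃ p ∈ Finset.Ioc Y P, B p).ncard : ℝ) ≤ 2 * 10 ^ 8 * κ ^ 12 * (1 / Y) := by
    calc ((⋃ p ∈ Finset.Ioc Y P, B p).ncard : ℝ)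
        ≤ ∑ p ∈ Finset.Ioc Y P, ((B p).ncard : ℝ) := by
          exact_mod_cast set_ncard_biUnion_le _ _
      _ ≤ ∑ p ∈ Finset.Ioc Y P, 2 * 10 ^ 8 * κ ^ 12 * ((p : ℝ) ^ 2)⁻¹ := sum_le_sum hBle
      _ = 2 * 10 ^ 8 * κ ^ 12 * ∑ p ∈ Finset.Ioc Y P, ((p : ℝ) ^ 2)⁻¹ := by rw [mul_sum]
      _ ≤ _ := by
        gcongr
        rcases le_total Y P with hYP | hYP
        · have := sum_Ioc_inv_sq_le_sub (α := ℝ) hY.ne' hYP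
          have : (0 : ℝ) ≤ (P : ℝ)⁻¹ := by positivity
          rw [one_div]; linarith
        · rw [Finset.Ioc_eq_empty (by omega)]; simp
  have hfinU : (⋃ p ∈ Finset.Ioc Y P, B p).Finite :=
    Set.Finite.biUnion (finite_toSet _) fun p _ => hfin _
  have l1 := (ncard_le_ncard hsub (hfinU.union ((hfin _).union (hfin _)))).trans
    ((ncard_union_le _ _).trans (Nat.add_le_add_left (ncard_union_le _ _) _))
  have l2 : ((hessGt Y ∩ ubox κ τ).ncard : ℝ) ≤ _ := Nat.cast_le.mpr l1
  push_cast at l2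
  have l3 := ubox_hA_zero hκ hτ h
  have l4 := ubox_large_prime hκ hτ h
  have p1 : 0 ≤ κ ^ 12 / Y := by positivity
  have p2 : 0 ≤ κ ^ 9 := by positivity
  have e : 2 * 10 ^ 8 * κ ^ 12 * (1 / Y) = 2 * 10 ^ 8 * (κ ^ 12 / Y) := by ring
  rw [e] at hsum
  linarith

end Box

lemma redLt_ncard_le {κ η : ℝ} (hκ : 1 ≤ κ) (hη : η ≤ 2) (hη0 : 0 < η) :
    ((redLt κ η).ncard : ℝ) ≤ 10 ^ 8 * η * κ ^ 12 := by
  have hκ0 : 0 < κ := by linarith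
  have := redLt_card_le (E := Set.univ) (fun _ _ _ _ => trivial) hκ0 hη hη0
    (M := 10 ^ 7 * κ ^ 12) (by positivity) fun τ h1 h2 => by
      rw [Set.univ_inter]; exact ubox_ncard_le hκ h1 h2
  rw [Set.univ_inter] at this
  have : 0 ≤ η * κ ^ 12 := by positivity
  linarith

lemma irrCls_ncard_le (hE : SLInv E) {κ : ℝ} (hκ : 1 ≤ κ) :
    ((irrCls E (κ ^ 12)).ncard : ℝ) ≤ 10 ^ 8 * κ ^ 12 := by
  have hκ0 : 0 < κ := by linarith
  have h1 := two_mul_irrCls_le hE hκ0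
  have hfin : (redLt κ 2).Finite := (redSet_finite hκ0).subset
    fun f ⟨h0, m, h1, h2, h3, _⟩ => ⟨h0, m, h1, h2, h3⟩
  have h2 := ncard_le_ncard (Set.inter_subset_right.trans (redSet_subset_redLt κ) :
    E ∩ redSet κ ⊆ redLt κ 2) hfin
  have h3 := redLt_ncard_le hκ le_rfl two_pos
  have h4 : ((2 * (irrCls E (κ ^ 12)).ncard : ℕ) : ℝ) ≤ _ := Nat.cast_le.mpr (h1.trans h2)
  push_cast at h4
  linarith

lemma irrCls_hessGt_le {κ : ℝ} (hκ : 1 ≤ κ) {Y : ℕ} (hY : 0 < Y) :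
    ((irrCls (hessGt Y) (κ ^ 12)).ncard : ℝ) ≤ 10 ^ 10 * (κ ^ 12 / Y + κ ^ 9) := by
  have hκ0 : 0 < κ := by linarith
  have h1 := two_mul_irrCls_le (hessGt_inv Y) hκ0
  have hfin : (hessGt Y ∩ redLt κ 2).Finite := (redSet_finite hκ0).subset
    fun f ⟨_, h0, m, h1, h2, h3, _⟩ => ⟨h0, m, h1, h2, h3⟩
  have h2 := ncard_le_ncard (Set.inter_subset_inter_right _ (redSet_subset_redLt κ) :
    hessGt Y ∩ redSet κ ⊆ hessGt Y ∩ redLt κ 2) hfin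
  have h3 := redLt_card_le (hessGt_inv Y) hκ0 le_rfl two_pos
    (M := 10 ^ 9 * (κ ^ 12 / Y + κ ^ 9)) (by positivity) fun τ h1 h2 => ubox_hessGt hκ h1 h2 hY
  have h4 : ((2 * (irrCls (hessGt Y) (κ ^ 12)).ncard : ℕ) : ℝ) ≤ _ := Nat.cast_le.mpr (h1.trans h2)
  push_cast at h4
  have : 0 ≤ κ ^ 12 / Y + κ ^ 9 := by positivity
  linarith

/-! ### Reducible forms in a box -/

lemma Reducible.exists_coprime (h : Reducible f) :
    ∃ x y, IsCoprime x y ∧ ceval f x y = 0 := by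
  obtain ⟨g, ⟨p, q, r, s, h1, rfl⟩, h0⟩ := h.exists_zero
  refine ⟨p, r, ⟨s, -q, by linarith⟩, ?_⟩
  rw [← h0, cact_zero, ceval]

/-- Pairs of a nonzero integer of size at most `M` and a divisor of it. -/
def divPairs (M : ℝ) : Set (ℤ × ℤ) := {x | x.1 ≠ 0 ∧ |(x.1 : ℝ)| ≤ M ∧ x.2 ∣ x.1}

lemma divPairs_bound {M : ℝ} (hM : 1 ≤ M) :
    (divPairs M).Finite ∧ ((divPairs M).ncard : ℝ) ≤ 4 * M * (1 + Real.log M) := by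
  have hM0 : 0 ≤ M := by linarith
  set T : ℕ → Set ℤ := fun k => {a | a ≠ 0 ∧ |(a : ℝ)| ≤ M ∧ (k : ℤ) ∣ a} with hT
  have hTf : ∀ k, (T k).Finite := fun k => (finite_abs_le M).subset fun a ha => ha.2.1
  have hsub : divPairs M ⊆ ⋃ k ∈ Finset.Icc 1 ⌊M⌋₊,
      ((fun a => (a, (k : ℤ))) '' T k ∪ (fun a => (a, -(k : ℤ))) '' T k) := by
    rintro ⟨a, s⟩ ⟨h0, h1, h2⟩
    simp only [mem_iUnion]
    have hs : s ≠ 0 := by rintro rfl; exact h0 (by simpa using h2)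
    have hle : s.natAbs ≤ a.natAbs := Int.natAbs_le_of_dvd_ne_zero h2 h0
    refine ⟨s.natAbs, Finset.mem_Icc.mpr ⟨Int.natAbs_pos.mpr hs, Nat.le_floor ?_⟩, ?_⟩
    · refine le_trans (Nat.cast_le.mpr hle) ?_
      rw [Nat.cast_natAbs]
      simpa using h1
    · rcases Int.natAbs_eq s with h | h
      · left
        refine ⟨a, ⟨h0, h1, by rwa [← h]⟩, by simp [← h]⟩
      · right
        have hs' : -((s.natAbs : ℕ) : ℤ) = s := h.symm
        refine ⟨a, ⟨h0, h1, ?_⟩, Prod.ext rfl hs'⟩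
        rw [Int.natAbs_dvd]
        exact h2
  have hfin : (⋃ k ∈ Finset.Icc 1 ⌊M⌋₊,
      ((fun a => (a, (k : ℤ))) '' T k ∪ (fun a => (a, -(k : ℤ))) '' T k)).Finite :=
    Set.Finite.biUnion (finite_toSet _) fun k _ =>
      ((hTf k).image _).union ((hTf k).image _)
  refine ⟨hfin.subset hsub, ?_⟩
  have h1 := (ncard_le_ncard hsub hfin).trans (set_ncard_biUnion_le _ _)
  have h2 : ∀ k ∈ Finset.Icc 1 ⌊M⌋₊, ((((fun a => (a, (k : ℤ))) '' T k ∪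
      (fun a => (a, -(k : ℤ))) '' T k).ncard : ℕ) : ℝ) ≤ 4 * M * (k : ℝ)⁻¹ := by
    intro k hk
    have hk0 : 0 < k := (Finset.mem_Icc.mp hk).1
    have a1 := ncard_union_le ((fun a => (a, (k : ℤ))) '' T k) ((fun a => (a, -(k : ℤ))) '' T k)
    have a2 := ncard_image_le (f := fun a => (a, (k : ℤ))) (hTf k)
    have a3 := ncard_image_le (f := fun a => (a, -(k : ℤ))) (hTf k)
    have a4 := ncard_ne_zero_le hM0 hk0 (T k) (fun x hx => hx.2.1) (fun x hx => hx.1)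
      (fun x hx => hx.2.2)
    have a5 : ((((fun a => (a, (k : ℤ))) '' T k ∪
      (fun a => (a, -(k : ℤ))) '' T k).ncard : ℕ) : ℝ) ≤ ((T k).ncard + (T k).ncard : ℕ) :=
      Nat.cast_le.mpr (a1.trans (by omega))
    push_cast at a5
    calc _ ≤ _ := a5
      _ ≤ 2 * M / k + 2 * M / k := by gcongr
      _ = _ := by ring
  have h3 : (((divPairs M).ncard : ℕ) : ℝ) ≤ _ := Nat.cast_le.mpr h1
  push_cast at h3
  have h4 := h3.trans (sum_le_sum h2)
  rw [← mul_sum] at h4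
  have h5 := harmonic_le_one_add_log ⌊M⌋₊
  rw [harmonic_eq_sum_Icc] at h5
  push_cast at h5
  have h6 : Real.log ⌊M⌋₊ ≤ Real.log M :=
    Real.log_le_log (by exact_mod_cast Nat.floor_pos.mpr hM) (Nat.floor_le hM0)
  refine h4.trans ?_
  gcongr
  linarith

/-- Integral forms with coefficients bounded by `M`. -/
def formBox (M : ℝ) : Set ℤ⁴ := {f | ∀ i, |(f i : ℝ)| ≤ M}

lemma formBox_finite (M : ℝ) : (formBox M).Finite := finite_box fun _ => M

lemma ncard_image_formBox_le {M : ℝ} (hM : 1 ≤ M) {i : Fin 4} {A : Set ℤ⁴} (hA : A ⊆ formBox M) :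
    (((fun f => f i) '' A).ncard : ℝ) ≤ 3 * M :=
  (ncard_abs_le (by linarith) _ (by rintro _ ⟨f, hf, rfl⟩; exact hA hf i)).trans (by linarith)

lemma formBox_zero_le {M : ℝ} (hM : 1 ≤ M) :
    (({f ∈ formBox M | f 0 = 0}).ncard : ℝ) ≤ 27 * M ^ 3 := by
  have key := fun i A => ncard_image_formBox_le hM (i := i) (A := A)
  have := ncard_forms_le (A := {f ∈ formBox M | f 0 = 0}) ((formBox_finite M).subset
    (sep_subset _ _)) (α := 1) (β := 3 * M) (γ := 3 * M) (δ := 3 * M) (by positivity)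
    (by positivity) (by positivity) ?_ (fun x => key 1 _ fun f hf => hf.1.1)
    (fun x y => key 2 _ fun f hf => hf.1.1) (fun x y z => key 3 _ fun f hf => hf.1.1)
  · linarith
  · have : ((fun f : ℤ⁴ => f 0) '' {f ∈ formBox M | f 0 = 0}).ncard ≤ 1 := by
      rw [ncard_le_one (((formBox_finite M).subset (sep_subset _ _)).image _)]
      rintro _ ⟨f, hf, rfl⟩ _ ⟨g, hg, rfl⟩
      exact hf.2.trans hg.2.symm
    exact_mod_cast this

lemma formBox_three_le {M : ℝ} (hM : 1 ≤ M) :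
    (({f ∈ formBox M | f 3 = 0}).ncard : ℝ) ≤ 27 * M ^ 3 := by
  have key := fun i A => ncard_image_formBox_le hM (i := i) (A := A)
  have := ncard_forms_le (A := {f ∈ formBox M | f 3 = 0}) ((formBox_finite M).subset
    (sep_subset _ _)) (α := 3 * M) (β := 3 * M) (γ := 3 * M) (δ := 1) (by positivity)
    (by positivity) (by positivity) (key 0 _ fun f hf => hf.1) (fun x => key 1 _ fun f hf => hf.1.1)
    (fun x y => key 2 _ fun f hf => hf.1.1) ?_
  · linarith
  · intro x y z
    have : ((fun f : ℤ⁴ => f 3) ''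
        {f ∈ {f ∈ formBox M | f 3 = 0} | f 0 = x ∧ f 1 = y ∧ f 2 = z}).ncard ≤ 1 := by
      rw [ncard_le_one (((formBox_finite M).subset fun f hf => hf.1.1).image _)]
      rintro _ ⟨f, hf, rfl⟩ _ ⟨g, hg, rfl⟩
      exact hf.1.2.trans hg.1.2.symm
    exact_mod_cast this

lemma formBox_reducible_le {M : ℝ} (hM : 1 ≤ M) :
    (({f ∈ formBox M | Reducible f}).ncard : ℝ) ≤
      48 * M ^ 3 * (1 + Real.log M) ^ 2 + 54 * M ^ 3 := by
  have hM0 : 0 ≤ M := by linarith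
  have hfb := formBox_finite M
  set R : Set ℤ⁴ := {f ∈ formBox M | Reducible f ∧ f 0 ≠ 0 ∧ f 3 ≠ 0} with hR
  have hRr : ∀ f ∈ R, ∃ x : ℤ × ℤ, x.1 ≠ 0 ∧ x.2 ≠ 0 ∧ x.2 ∣ f 0 ∧ x.1 ∣ f 3 ∧
      ceval f x.1 x.2 = 0 := by
    rintro f ⟨-, h1, h2, h3⟩
    obtain ⟨r, s, hc, h⟩ := h1.exists_coprime
    have hr : r ≠ 0 := by
      rintro rfl
      have hs : s ≠ 0 := by rintro rfl; exact not_isCoprime_zero_zero hc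
      simp [ceval] at h
      tauto
    have hs : s ≠ 0 := by
      rintro rfl
      simp [ceval] at h
      tauto
    refine ⟨(r, s), hr, hs, ?_, ?_, h⟩
    · have : s ∣ f 0 * r ^ 3 :=
        ⟨-(3 * f 1 * r ^ 2 + 3 * f 2 * r * s + f 3 * s ^ 2), by
          unfold ceval at h; linear_combination h⟩
      exact (hc.symm.pow_right (n := 3)).dvd_of_dvd_mul_right this
    · have : r ∣ f 3 * s ^ 3 :=
        ⟨-(f 0 * r ^ 2 + 3 * f 1 * r * s + 3 * f 2 * s ^ 2), by
          unfold ceval at h; linear_combination h⟩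
      exact (hc.pow_right (n := 3)).dvd_of_dvd_mul_right this
  choose! x hx1 hx2 hx3 hx4 hx5 using hRr
  obtain ⟨hDf, hD⟩ := divPairs_bound hM
  have hI := ncard_abs_le hM0 {a : ℤ | |(a : ℝ)| ≤ M} (fun a ha => ha)
  have hIf := finite_abs_le M
  have hinj : InjOn (fun f : ℤ⁴ => (((f 0, (x f).2), (f 3, (x f).1)), f 1)) R := by
    intro f hf g hg h
    simp only [Prod.mk.injEq] at h
    obtain ⟨⟨⟨h0, hs⟩, h3, hr⟩, h1⟩ := h
    refine form_ext h0 h1 ?_ h3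
    have e1 := hx5 f hf
    have e2 := hx5 g hg
    rw [← hs, ← hr] at e2
    have : (f 2 - g 2) * ((x f).1 * (x f).2 ^ 2) = 0 := by
      unfold ceval at e1 e2
      rw [← h0, ← h1, ← h3] at e2
      linarith
    have hne : (x f).1 * (x f).2 ^ 2 ≠ 0 := mul_ne_zero (hx1 f hf) (pow_ne_zero _ (hx2 f hf))
    have := (mul_eq_zero.mp this).resolve_right hne
    omega
  have hmaps : (fun f : ℤ⁴ => (((f 0, (x f).2), (f 3, (x f).1)), f 1)) '' R ⊆
      (divPairs M ×ˢ divPairs M) ×ˢ {a : ℤ | |(a : ℝ)| ≤ M} := by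
    rintro _ ⟨f, hf, rfl⟩
    exact ⟨⟨⟨hf.2.2.1, hf.1 0, hx3 f hf⟩, ⟨hf.2.2.2, hf.1 3, hx4 f hf⟩⟩, hf.1 1⟩
  have h1 := ncard_le_ncard hmaps ((hDf.prod hDf).prod hIf)
  rw [hinj.ncard_image, ncard_prod, ncard_prod] at h1
  have h2 : ((R.ncard : ℕ) : ℝ) ≤ _ := Nat.cast_le.mpr h1
  push_cast at h2
  have hL : 0 ≤ 1 + Real.log M := by have := log_nonneg hM; linarith
  have h3 : (R.ncard : ℝ) ≤ 48 * M ^ 3 * (1 + Real.log M) ^ 2 := by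
    calc (R.ncard : ℝ) ≤ _ := h2
      _ ≤ (4 * M * (1 + Real.log M)) * (4 * M * (1 + Real.log M)) * (3 * M) := by
        gcongr
        linarith
      _ = _ := by ring
  have hsub : {f ∈ formBox M | Reducible f} ⊆
      R ∪ ({f ∈ formBox M | f 0 = 0} ∪ {f ∈ formBox M | f 3 = 0}) := by
    rintro f ⟨hf, hr⟩
    by_cases h0 : f 0 = 0
    · exact Or.inr (Or.inl ⟨hf, h0⟩)
    by_cases h3 : f 3 = 0
    · exact Or.inr (Or.inr ⟨hf, h3⟩)
    exact Or.inl ⟨hf, hr, h0, h3⟩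
  have h4 := ncard_le_ncard hsub ((hfb.subset (sep_subset _ _)).union
    ((hfb.subset (sep_subset _ _)).union (hfb.subset (sep_subset _ _))))
  have h5 := ncard_union_le R ({f ∈ formBox M | f 0 = 0} ∪ {f ∈ formBox M | f 3 = 0})
  have h6 := ncard_union_le {f ∈ formBox M | f 0 = 0} {f ∈ formBox M | f 3 = 0}
  have h7 : (({f ∈ formBox M | Reducible f}.ncard : ℕ) : ℝ) ≤
    ((R.ncard + ({f ∈ formBox M | f 0 = 0}.ncard + {f ∈ formBox M | f 3 = 0}.ncard) : ℕ) : ℝ) :=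
    Nat.cast_le.mpr (by omega)
  push_cast at h7
  have h8 := formBox_zero_le hM
  have h9 := formBox_three_le hM
  linarith

lemma eventually_formBox_reducible_le {ε : ℝ} (hε : 0 < ε) :
    ∀ᶠ M : ℝ in atTop, (({f ∈ formBox M | Reducible f}).ncard : ℝ) ≤ ε * M ^ 4 := by
  have h1 := (isLittleO_pow_log_id_atTop (n := 2)).bound (c := ε / 384) (by positivity)
  filter_upwards [h1, eventually_ge_atTop 3, eventually_ge_atTop (108 / ε)] with M a1 a2 a3
  have hM0 : 0 < M := by linarith
  have hl : 1 ≤ Real.log M := by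
    rw [le_log_iff_exp_le hM0]
    exact Real.exp_one_lt_three.le.trans a2
  rw [id, norm_of_nonneg (by positivity), norm_of_nonneg hM0.le] at a1
  refine (formBox_reducible_le (by linarith)).trans ?_
  have h2 : (1 + Real.log M) ^ 2 ≤ 4 * (ε / 384 * M) := by nlinarith
  rw [div_le_iff₀ hε] at a3
  calc _ ≤ 48 * M ^ 3 * (4 * (ε / 384 * M)) + 54 * M ^ 3 := by gcongr
    _ = ε / 2 * M ^ 4 + 54 * M ^ 3 := by ring
    _ ≤ ε / 2 * M ^ 4 + (M * ε / 2) * M ^ 3 := by gcongr; linarith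
    _ = _ := by ring

lemma openForms_subset_formBox {η : ℝ} (hη : 0 < η) :
    ∃ C : ℝ, 0 < C ∧ ∀ κ : ℝ, 0 < κ → openForms κ η ⊆ formBox (C * κ ^ 3) := by
  set c : ℝ := 2 + 4 / (3 * η) with hc
  have hc2 : 2 ≤ c := by have : 0 < 4 / (3 * η) := by positivity
                         linarith
  refine ⟨c ^ 3, by positivity, fun κ hκ => ?_⟩
  rintro f ⟨m, hm, hr, hd, hA⟩
  have hA0 := mA_pos hr.2.2
  obtain ⟨h1, h2⟩ := hr.redC.mul_le
  have hdp := hr.2.2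
  have hd2 : mdet m ^ 2 ≤ (κ ^ 2) ^ 2 := by gcongr
  have hκ2 : 0 < κ ^ 2 := by positivity
  have e1 : mA m ≤ (c * κ) ^ 2 := by
    have : mA m ≤ 2 * κ ^ 2 := by
      apply le_of_sq_le_sq _ (by positivity)
      nlinarith
    rw [mul_pow]
    exact this.trans (by gcongr; nlinarith)
  have e2 : mC m ≤ (c * κ) ^ 2 := by
    have h3 : 3 * (η * κ ^ 2 * mC m) ≤ 4 * (κ ^ 2) ^ 2 := by
      have : 0 ≤ mC m := by unfold mC; positivity
      have : η * κ ^ 2 * mC m ≤ mA m * mC m := by gcongr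
      linarith
    have h4 : mC m ≤ 4 / (3 * η) * κ ^ 2 := by
      rw [div_mul_eq_mul_div, le_div_iff₀ (by positivity)]
      have : κ ^ 2 * (mC m * (3 * η)) ≤ κ ^ 2 * (4 * κ ^ 2) := by linarith
      exact le_of_mul_le_mul_left this hκ2
    have : 4 / (3 * η) ≤ c := by linarith
    calc mC m ≤ _ := h4
      _ ≤ c * κ ^ 2 := by gcongr
      _ ≤ c ^ 2 * κ ^ 2 := by gcongr; nlinarith
      _ = _ := by ring
  obtain ⟨b0, b1, b2, b3⟩ := abs_cubeMap_le (P := c * κ) (Q := c * κ) (by positivity) (by positivity) e1 e2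
  have hfi : ∀ i, (f i : ℝ) = cubeMap m i := fun i => congrFun hm i
  intro i
  rw [hfi, ← mul_pow]
  fin_cases i
  · exact b0
  · exact b1.trans_eq (by ring)
  · exact b2.trans_eq (by ring)
  · exact b3

/-- Almost no reduced forms in the main body are reducible. -/
lemma eventually_openForms_reducible_le {η ε : ℝ} (hη : 0 < η) (hε : 0 < ε) :
    ∀ᶠ κ : ℝ in atTop,
      ((openForms κ η ∩ {f | Reducible f}).ncard : ℝ) ≤ ε * κ ^ 12 := by
  obtain ⟨C, hC, hsub⟩ := openForms_subset_formBox hη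
  have ht : Tendsto (fun κ : ℝ => C * κ ^ 3) atTop atTop :=
    (tendsto_pow_atTop (by norm_num)).const_mul_atTop hC
  filter_upwards [ht.eventually (eventually_formBox_reducible_le (ε := ε / C ^ 4) (by positivity)),
    eventually_gt_atTop 0] with κ h1 h2
  have h3 := ncard_le_ncard (Set.inter_subset_inter_left {f | Reducible f} (hsub κ h2))
    ((formBox_finite _).subset Set.inter_subset_left)
  calc _ ≤ (((formBox (C * κ ^ 3) ∩ {f | Reducible f}).ncard : ℕ) : ℝ) := Nat.cast_le.mpr h3
    _ ≤ _ := h1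
    _ = _ := by field_simp

/-! ### Forms whose discriminant is divisible by the square of a large prime -/

/-- Forms with discriminant divisible by `p²` whose Hessian is not divisible by `p`. -/
def discSq (p : ℕ) : Set ℤ⁴ := {f | (p : ℤ) ^ 2 ∣ cdisc f ∧ ¬ HessDvd p f}

lemma discSq_inv (p : ℕ) : SLInv (discSq p) := by
  rintro f g h ⟨h1, h2⟩
  exact ⟨by rwa [h.cdisc_eq], fun h3 => h2 (h3.of_equiv h.symm)⟩

lemma not_dvd_two (hp : p.Prime) (hp2 : p ≠ 2) : ¬ (p : ℤ) ∣ 2 := fun h =>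
  hp2 ((Nat.prime_dvd_prime_iff_eq hp Nat.prime_two).mp (by exact_mod_cast h))

lemma exists_degenerate (hp : p.Prime) (hp2 : p ≠ 2) (hf : f ∈ discSq p) :
    ∃ g, SLEquiv f g ∧ (p : ℤ) ∣ hA g ∧ (p : ℤ) ∣ hB g := by
  have hpi : Prime (p : ℤ) := Nat.prime_iff_prime_int.mp hp
  have h2 := not_dvd_two hp hp2
  have hd : (p : ℤ) ∣ cdisc f := (dvd_pow_self _ two_ne_zero).trans hf.1
  by_cases hAf : (p : ℤ) ∣ hA f
  · refine ⟨f, SLEquiv.refl f, hAf, hpi.dvd_of_dvd_pow (n := 2) ?_⟩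
    have : hB f ^ 2 = cdisc f + hA f * (4 * hC f) := by unfold cdisc; ring
    rw [this]
    exact dvd_add hd (hAf.mul_right _)
  · have hcop : IsCoprime (2 * hA f) (p : ℤ) := by
      rw [isCoprime_comm, hpi.coprime_iff_not_dvd]
      exact fun h => (hpi.dvd_or_dvd h).elim h2 hAf
    obtain ⟨u, v, huv⟩ := hcop
    set t : ℤ := -(u * hB f) with ht
    have e1 : (p : ℤ) ∣ 2 * hA f * t + hB f := ⟨v * hB f, by
      rw [ht]; linear_combination -(hB f) * huv⟩
    refine ⟨cact t (-1) 1 0 f, ⟨t, -1, 1, 0, by norm_num, rfl⟩, ?_, ?_⟩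
    · have e2 : (p : ℤ) ∣ (2 * hA f) * (2 * hA (cact t (-1) 1 0 f)) := by
        have : (2 * hA f) * (2 * hA (cact t (-1) 1 0 f)) =
            (2 * hA f * t + hB f) * (2 * hA f * t + hB f) - cdisc f := by
          rw [hA_cact]; unfold cdisc; ring
        rw [this]
        exact dvd_sub (e1.mul_right _) hd
      rcases hpi.dvd_or_dvd e2 with h | h
      · exact absurd h fun h => (hpi.dvd_or_dvd h).elim h2 hAf
      · exact (hpi.dvd_or_dvd h).resolve_left h2
    · have : hB (cact t (-1) 1 0 f) = -(2 * hA f * t + hB f) := by rw [hB_cact]; ring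
      rw [this]
      exact e1.neg_right

/-- The relation between a form with square-divisible discriminant and its overform. -/
def OverForm (p : ℕ) (f g : ℤ⁴) : Prop :=
  f 0 = p ^ 2 * g 0 ∧ f 1 = p * g 1 ∧ f 2 = g 2 ∧ p * f 3 = g 3

lemma exists_overForm (hp : p.Prime) (hp2 : p ≠ 2) (hf : f ∈ discSq p) :
    ∃ f' g, SLEquiv f f' ∧ OverForm p f' g ∧ ¬ (p : ℤ) ∣ g 2 := by
  have hpi : Prime (p : ℤ) := Nat.prime_iff_prime_int.mp hp
  have h2 := not_dvd_two hp hp2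
  obtain ⟨f', he, hA', hB'⟩ := exists_degenerate hp hp2 hf
  obtain ⟨hd, hnd⟩ := discSq_inv p _ _ he hf
  have hC' : ¬ (p : ℤ) ∣ hC f' := fun h => hnd ⟨hA', hB', h⟩
  have hb : (p : ℤ) ∣ f' 1 := by
    have : (p : ℤ) ∣ f' 1 * hC f' := by
      have e : f' 1 * hC f' = f' 2 * hB f' - f' 3 * hA f' := by unfold hA hB hC; ring
      rw [e]
      exact dvd_sub (hB'.mul_left _) (hA'.mul_left _)
    exact (hpi.dvd_or_dvd this).resolve_right hC'
  have hc : ¬ (p : ℤ) ∣ f' 2 := by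
    intro h
    apply hC'
    unfold hC
    exact dvd_sub (h.pow two_ne_zero) (hb.mul_right _)
  have ha : (p : ℤ) ∣ f' 0 := by
    have : (p : ℤ) ∣ f' 0 * f' 2 := by
      have e : f' 0 * f' 2 = f' 1 ^ 2 - hA f' := by unfold hA; ring
      rw [e]
      exact dvd_sub (hb.pow two_ne_zero) hA'
    exact (hpi.dvd_or_dvd this).resolve_right hc
  obtain ⟨b, hb⟩ := hb
  obtain ⟨a, ha⟩ := ha
  have ha2 : (p : ℤ) ∣ a := by
    have hp0 : (p : ℤ) ≠ 0 := hpi.ne_zero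
    have : (p : ℤ) * p ∣ p * (2 * (2 * (a * (f' 2 * hC f')))) := by
      have e : p * (2 * (2 * (a * (f' 2 * hC f')))) = cdisc f' - (p * p : ℤ) *
          ((b * f' 2 - a * f' 3) ^ 2 - 4 * b ^ 2 * hC f') := by
        unfold cdisc hB hA
        rw [ha, hb]; ring
      rw [e, ← sq]
      exact dvd_sub hd (dvd_mul_right _ _)
    rw [mul_dvd_mul_iff_left hp0] at this
    have := (hpi.dvd_or_dvd this).resolve_left h2
    have := (hpi.dvd_or_dvd this).resolve_left h2
    exact (hpi.dvd_or_dvd this).resolve_right fun h => (hpi.dvd_or_dvd h).elim hc hC'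
  obtain ⟨a, rfl⟩ := ha2
  exact ⟨f', ![a, b, f' 2, p * f' 3], he, ⟨by rw [ha]; simp; ring, by simp [hb], by simp, by simp⟩,
    by simpa using hc⟩

lemma OverForm.cdisc (h : OverForm p f g) :
    cdisc f = p ^ 2 * cdisc g := by
  obtain ⟨h0, h1, h2, h3⟩ := h
  unfold _root_.cdisc hA hB hC
  rw [h0, h1, h2, ← h3]; ring

lemma OverForm.reducible (hp : p.Prime) (h : OverForm p f g)
    (hg : Reducible g) : Reducible f := by
  obtain ⟨h0, h1, h2, h3⟩ := h
  obtain ⟨x, y, hxy, he⟩ := hg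
  have hp0 : (p : ℤ) ≠ 0 := by exact_mod_cast hp.ne_zero
  refine ⟨x, p * y, by simpa [hp.ne_zero] using hxy, ?_⟩
  unfold ceval at *
  rw [h0, h1, h2]
  rw [← h3] at he
  linear_combination (p : ℤ) ^ 2 * he

lemma OverForm.equiv (hp : p.Prime) {f g f' g' : ℤ⁴} (h : OverForm p f g)
    (h' : OverForm p f' g') {P Q R S : ℤ} (hdet : P * S - Q * R = 1) (hg : g' = cact P Q R S g)
    (hQ : (p : ℤ) ∣ Q) : SLEquiv f f' := by
  obtain ⟨h0, h1, h2, h3⟩ := h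
  obtain ⟨h0', h1', h2', h3'⟩ := h'
  obtain ⟨q, rfl⟩ := hQ
  have hp0 : (p : ℤ) ≠ 0 := by exact_mod_cast hp.ne_zero
  refine ⟨P, q, p * R, S, by linarith, ?_⟩
  rw [hg] at h0' h1' h2' h3'
  apply form_ext
  · rw [h0', cact_zero, cact_zero, h0, h1, h2, ← h3]; ring
  · rw [h1', cact_one, cact_one, h0, h1, h2, ← h3]; ring
  · rw [h2', cact_two, cact_two, h0, h1, h2, ← h3]; ring
  · apply mul_left_cancel₀ hp0
    rw [h3', cact_three, cact_three, h0, h1, h2, ← h3]; ring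

/-- The root lines of a cubic form modulo `p`. -/
def rootLines (p : ℕ) (g : ℤ⁴) : Set (Option (ZMod p)) :=
  insert none (some '' {t : ZMod p | ceval (redMod p g) t 1 = 0})

lemma rootLines_ncard_le (hp : p.Prime) (hp3 : p ≠ 3) {g : ℤ⁴}
    (hg : ∃ i, ¬ (p : ℤ) ∣ g i) : (rootLines p g).Finite ∧ (rootLines p g).ncard ≤ 4 := by
  have : Fact p.Prime := ⟨hp⟩
  open Polynomial in
  set P : (ZMod p)[X] := C (redMod p g 0) * X ^ 3 + C (3 * redMod p g 1) * X ^ 2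
    + C (3 * redMod p g 2) * X + C (redMod p g 3) with hP
  have h3 : (3 : ZMod p) ≠ 0 := by
    intro h
    have : ((3 : ℕ) : ZMod p) = 0 := by exact_mod_cast h
    rw [natCast_eq_zero_iff] at this
    exact hp3 ((Nat.prime_dvd_prime_iff_eq hp Nat.prime_three).mp this)
  have hP0 : P ≠ 0 := by
    intro h0
    obtain ⟨i, hi⟩ := hg
    apply hi
    rw [← intCast_zmod_eq_zero_iff_dvd]
    have c0 : P.coeff 3 = redMod p g 0 := by
      simp only [hP, coeff_add, coeff_C_mul, coeff_X_pow,
        coeff_X, coeff_C]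
      norm_num
    have c1 : P.coeff 2 = 3 * redMod p g 1 := by
      simp only [hP, coeff_add, coeff_C_mul, coeff_X_pow,
        coeff_X, coeff_C]
      norm_num
    have c2 : P.coeff 1 = 3 * redMod p g 2 := by
      simp only [hP, coeff_add, coeff_C_mul, coeff_X_pow,
        coeff_X, coeff_C]
      norm_num
    have c3 : P.coeff 0 = redMod p g 3 := by
      simp only [hP, coeff_add, coeff_C_mul, coeff_X_pow,
        coeff_X, coeff_C]
      norm_num
    rw [h0, coeff_zero] at c0 c1 c2 c3
    have c1 := (mul_eq_zero.mp c1.symm).resolve_left h3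
    have c2 := (mul_eq_zero.mp c2.symm).resolve_left h3
    fin_cases i
    · exact c0.symm
    · exact c1
    · exact c2
    · exact c3.symm
  have hdeg : P.natDegree ≤ 3 := by rw [hP]; compute_degree
  have hsub : {t : ZMod p | ceval (redMod p g) t 1 = 0} ⊆ (P.roots.toFinset : Set (ZMod p)) := by
    intro t ht
    have ht : ceval (redMod p g) t 1 = 0 := ht
    simp only [Finset.mem_coe, Multiset.mem_toFinset, mem_roots hP0,
      Polynomial.IsRoot.def]
    rw [← ht, hP]
    simp [ceval]
  have hfin : {t : ZMod p | ceval (redMod p g) t 1 = 0}.Finite := toFinite _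
  refine ⟨(hfin.image _).insert _, (ncard_insert_le _ _).trans ?_⟩
  have a1 := ncard_image_le (f := (some : ZMod p → Option (ZMod p))) hfin
  have a2 := ncard_le_ncard hsub (finite_toSet _)
  rw [ncard_coe_finset] at a2
  have a3 := (Multiset.toFinset_card_le P.roots).trans (card_roots' P)
  omega

/-- The line spanned by `(Q, S)` modulo `p`. -/
noncomputable def lineOf (p : ℕ) (Q S : ℤ) : Option (ZMod p) :=
  open Classical in if (S : ZMod p) = 0 then none else some ((Q : ZMod p) * (S : ZMod p)⁻¹)

lemma lineOf_mem (hp : p.Prime) {g : ℤ⁴} {Q S : ℤ} (h : (p : ℤ) ∣ ceval g Q S) :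
    lineOf p Q S ∈ rootLines p g := by
  have : Fact p.Prime := ⟨hp⟩
  unfold lineOf
  split_ifs with hS
  · exact Set.mem_insert _ _
  · refine Set.mem_insert_of_mem _ ⟨_, ?_, rfl⟩
    have h1 : ((ceval g Q S : ℤ) : ZMod p) = 0 := (intCast_zmod_eq_zero_iff_dvd _ _).mpr h
    have h2 : ceval (redMod p g) ((Q : ZMod p) * (S : ZMod p)⁻¹) 1 * (S : ZMod p) ^ 3 = 0 := by
      rw [← h1]
      unfold ceval redMod
      push_cast
      have hs : (S : ZMod p) * (S : ZMod p)⁻¹ = 1 := mul_inv_cancel₀ hS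
      generalize (S : ZMod p)⁻¹ = w at hs
      linear_combination ((g 0 : ZMod p) * Q ^ 3 * ((S * w) ^ 2 + S * w + 1) +
        3 * (g 1 : ZMod p) * Q ^ 2 * S * (S * w + 1) + 3 * (g 2 : ZMod p) * Q * S ^ 2) * hs
    exact (mul_eq_zero.mp h2).resolve_right (pow_ne_zero _ hS)

lemma lineOf_eq (hp : p.Prime) {Q S Q' S' : ℤ} (h : lineOf p Q S = lineOf p Q' S') :
    (p : ℤ) ∣ S * Q' - Q * S' := by
  have : Fact p.Prime := ⟨hp⟩
  rw [← intCast_zmod_eq_zero_iff_dvd]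
  push_cast
  unfold lineOf at h
  split_ifs at h with h1 h2 h2
  · rw [h1, h2]; ring
  · have := Option.some.inj h
    have hs : (S : ZMod p) * (S : ZMod p)⁻¹ = 1 := mul_inv_cancel₀ h1
    have hs' : (S' : ZMod p) * (S' : ZMod p)⁻¹ = 1 := mul_inv_cancel₀ h2
    generalize (S : ZMod p)⁻¹ = w at *
    generalize (S' : ZMod p)⁻¹ = w' at *
    linear_combination (Q * S' : ZMod p) * hs - (Q' * S : ZMod p) * hs' - (S * S' : ZMod p) * this

/-- Classes with discriminant divisible by `p²` are at most four times those of
discriminant smaller by a factor `p²`. -/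
lemma irrCls_discSq_le (hp : p.Prime) (hp2 : p ≠ 2) (hp3 : p ≠ 3) {κ : ℝ} (hκ : 0 < κ)
    (hfin : (irrCls Set.univ (κ ^ 12 / p ^ 2)).Finite) :
    ((irrCls (discSq p) (κ ^ 12)).ncard : ℝ) ≤ (irrCls Set.univ (κ ^ 12 / p ^ 2)).ncard * 4 := by
  have hp0 : 0 < (p : ℤ) := by exact_mod_cast hp.pos
  have hpR : 0 < (p : ℝ) := by exact_mod_cast hp.pos
  have key : ∀ c ∈ irrCls (discSq p) (κ ^ 12), ∃ x : (ℤ⁴ × ℤ⁴),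
      Quotient.mk formSetoid x.1 = c ∧ OverForm p x.1 x.2 ∧ ¬ (p : ℤ) ∣ x.2 2 ∧
      Quotient.mk formSetoid x.2 ∈ irrCls Set.univ (κ ^ 12 / p ^ 2) := by
    rintro _ ⟨f, ⟨hf, hir, hpos, hlt⟩, rfl⟩
    obtain ⟨f', g, he, ho, h2⟩ := exists_overForm hp hp2 hf
    refine ⟨(f', g), Quotient.sound (s := formSetoid) he.symm, ho, h2, g, ⟨trivial, ?_, ?_, ?_⟩, rfl⟩
    · intro h
      exact hir (he.reducible_iff.mpr (ho.reducible hp h))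
    · rw [← he.cdisc_eq, ho.cdisc] at hpos
      exact pos_of_mul_pos_right hpos (by positivity)
    · rw [← he.cdisc_eq, ho.cdisc] at hlt
      push_cast at hlt
      rw [lt_div_iff₀ (by positivity)]
      linarith
  choose! x hx1 hx2 hx3 hx4 using key
  have hout : ∀ c, SLEquiv (Quotient.out (Quotient.mk formSetoid (x c).2)) (x c).2 := fun c =>
    Quotient.exact (s := formSetoid) (Quotient.out_eq _)
  choose P Q R S hdet hact using hout
  refine ncard_le_mul_of_fiber (irrCls_finite (discSq_inv p) hκ)
    (fun c => Quotient.mk formSetoid (x c).2) (by norm_num) ?_ fun y => ?_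
  · have hsub : (fun c => Quotient.mk formSetoid (x c).2) '' irrCls (discSq p) (κ ^ 12) ⊆
        irrCls Set.univ (κ ^ 12 / p ^ 2) := by
      rintro _ ⟨c, hc, rfl⟩
      exact hx4 c hc
    exact_mod_cast ncard_le_ncard hsub hfin
  · set T := {c ∈ irrCls (discSq p) (κ ^ 12) | Quotient.mk formSetoid (x c).2 = y} with hT
    rcases T.eq_empty_or_nonempty with he | ⟨c0, hc0⟩
    · rw [he]; simp
    have hact' : ∀ c ∈ T, (x c).2 = cact (P c) (Q c) (R c) (S c) (Quotient.out y) := by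
      intro c hc
      conv_lhs => rw [hact c, hc.2]
    have hne : ∃ i, ¬ (p : ℤ) ∣ Quotient.out y i := by
      by_contra hcon
      push Not at hcon
      apply hx3 c0 hc0.1
      rw [hact' c0 hc0, cact_two]
      exact dvd_add (dvd_add (dvd_add (((hcon 0).mul_right _).mul_right _)
        ((hcon 1).mul_right _)) ((hcon 2).mul_right _)) (((hcon 3).mul_right _).mul_right _)
    obtain ⟨hrf, hr⟩ := rootLines_ncard_le hp hp3 hne
    have hinj : InjOn (fun c => lineOf p (Q c) (S c)) T := by
      intro c hc c' hc' h
      have h := lineOf_eq hp h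
      have e : (x c').2 = cact (S c * P c' + -Q c * R c') (S c * Q c' + -Q c * S c')
          (-R c * P c' + P c * R c') (-R c * Q c' + P c * S c') (x c).2 := by
        have h1 : Quotient.out y = cact (S c) (-Q c) (-R c) (P c) (x c).2 := by
          rw [hact' c hc, cact_cact, show P c * S c + Q c * -R c = 1 by linarith [hdet c],
            show P c * -Q c + Q c * P c = 0 by ring, show R c * S c + S c * -R c = 0 by ring,
            show R c * -Q c + S c * P c = 1 by linarith [hdet c], cact_id]
        rw [hact' c' hc', h1, cact_cact]
      rw [← hx1 c hc.1, ← hx1 c' hc'.1]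
      refine Quotient.sound (s := formSetoid) ((hx2 c hc.1).equiv hp (hx2 c' hc'.1) ?_ e ?_)
      · linear_combination (P c' * S c' - Q c' * R c') * hdet c + hdet c'
      · convert h using 1; ring
    have hmaps : (fun c => lineOf p (Q c) (S c)) '' T ⊆ rootLines p (Quotient.out y) := by
      rintro _ ⟨c, hc, rfl⟩
      apply lineOf_mem hp
      have h3 := (hx2 c hc.1).2.2.2
      rw [hact' c hc, cact_three] at h3
      exact ⟨(x c).1 3, by rw [h3]; unfold ceval; ring⟩
    have := ncard_le_ncard hmaps hrf
    rw [hinj.ncard_image] at this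
    exact_mod_cast this.trans hr

lemma irrCls_empty {X : ℝ} (hX : X ≤ 1) : irrCls E X = ∅ := by
  rw [Set.eq_empty_iff_forall_notMem]
  rintro _ ⟨f, ⟨-, -, h1, h2⟩, rfl⟩
  have : (1 : ℝ) ≤ cdisc f := by exact_mod_cast h1
  linarith

lemma irrCls_bound (hE : SLInv E) {X : ℝ} (hX : 0 ≤ X) :
    (irrCls E X).Finite ∧ ((irrCls E X).ncard : ℝ) ≤ 10 ^ 8 * X := by
  rcases le_total X 1 with h | h
  · rw [irrCls_empty h]
    simpa using hX
  · have h1 : (X ^ (1 / 12 : ℝ)) ^ 12 = X := by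
      rw [← Real.rpow_natCast, ← Real.rpow_mul hX]; norm_num
    have h2 : 1 ≤ X ^ (1 / 12 : ℝ) := Real.one_le_rpow h (by norm_num)
    have h3 := irrCls_finite hE (κ := X ^ (1 / 12 : ℝ)) (by linarith)
    have h4 := irrCls_ncard_le hE h2
    rw [h1] at h3 h4
    exact ⟨h3, h4⟩

/-- Forms with discriminant divisible by the square of a prime `p > Y` not dividing the Hessian. -/
def discSqGt (Y : ℕ) : Set ℤ⁴ := {f | ∃ p : ℕ, p.Prime ∧ Y < p ∧ f ∈ discSq p}

lemma discSqGt_inv (Y : ℕ) : SLInv (discSqGt Y) := by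
  rintro f g h ⟨p, hp, hY, hf⟩
  exact ⟨p, hp, hY, discSq_inv p f g h hf⟩

lemma irrCls_discSqGt_le {κ : ℝ} (hκ : 0 < κ) {Y : ℕ} (hY : 3 ≤ Y) :
    ((irrCls (discSqGt Y) (κ ^ 12)).ncard : ℝ) ≤ 10 ^ 10 * (κ ^ 12 / Y) := by
  set X := κ ^ 12 with hX
  have hX0 : 0 < X := by positivity
  set I := (Finset.Ioo Y (⌊X⌋₊ + 1)).filter Nat.Prime with hI
  have hsub : irrCls (discSqGt Y) X ⊆ ⋃ p ∈ I, irrCls (discSq p) X := by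
    rintro _ ⟨f, ⟨⟨p, hp, hYp, hf⟩, hir, hpos, hlt⟩, rfl⟩
    simp only [mem_iUnion]
    refine ⟨p, ?_, f, ⟨hf, hir, hpos, hlt⟩, rfl⟩
    rw [hI, mem_filter, Finset.mem_Ioo]
    refine ⟨⟨hYp, Nat.lt_succ_of_le (Nat.le_floor ?_)⟩, hp⟩
    have h1 := Int.le_of_dvd hpos hf.1
    have h2 : (p : ℤ) ≤ p ^ 2 := by
      have : (1 : ℤ) ≤ p := by exact_mod_cast hp.one_lt.le
      nlinarith
    have h3 : (p : ℝ) ≤ cdisc f := by exact_mod_cast h2.trans h1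
    linarith
  have hfin : (⋃ p ∈ I, irrCls (discSq p) X).Finite := Set.Finite.biUnion (finite_toSet _)
    fun p _ => irrCls_finite (discSq_inv p) hκ
  have h1 := (ncard_le_ncard hsub hfin).trans (set_ncard_biUnion_le _ _)
  have h2 : (((irrCls (discSqGt Y) X).ncard : ℕ) : ℝ) ≤ _ := Nat.cast_le.mpr h1
  push_cast at h2
  have h3 : ∀ p ∈ I, ((irrCls (discSq p) X).ncard : ℝ) ≤ 4 * 10 ^ 8 * X * ((p : ℝ) ^ 2)⁻¹ := by
    intro p hp
    rw [hI, mem_filter, Finset.mem_Ioo] at hp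
    obtain ⟨b1, b2⟩ := irrCls_bound (E := Set.univ) (fun _ _ _ _ => trivial)
      (X := X / p ^ 2) (by positivity)
    have b3 := irrCls_discSq_le hp.2 (by omega) (by omega) hκ b1
    calc _ ≤ _ := b3
      _ ≤ 10 ^ 8 * (X / p ^ 2) * 4 := by gcongr
      _ = _ := by ring
  have h4 := h2.trans (sum_le_sum h3)
  rw [← mul_sum] at h4
  have h5 : ∑ p ∈ I, ((p : ℝ) ^ 2)⁻¹ ≤ 2 / (Y + 1) :=
    (sum_le_sum_of_subset_of_nonneg (filter_subset _ _)
      fun _ _ _ => by positivity).trans (sum_Ioo_inv_sq_le Y _)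
  have hY0 : (0 : ℝ) < Y := by exact_mod_cast (by omega : 0 < Y)
  calc _ ≤ _ := h4
    _ ≤ 4 * 10 ^ 8 * X * (2 / (Y + 1)) := by gcongr
    _ ≤ 4 * 10 ^ 8 * X * (2 / Y) := by gcongr; linarith
    _ ≤ _ := by
      have : 0 ≤ X / Y := by positivity
      rw [mul_div_assoc']
      calc 4 * 10 ^ 8 * X * 2 / Y = 8 * 10 ^ 8 * (X / Y) := by ring
        _ ≤ _ := by gcongr; norm_num

/-! ### The sieve -/

lemma exists_crt_pair {m n : ℕ} (h : m.Coprime n) (S : Set (Fin 4 → ZMod m))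
    (T : Set (Fin 4 → ZMod n)) : ∃ U : Set (Fin 4 → ZMod (m * n)),
      (∀ f, redMod (m * n) f ∈ U ↔ redMod m f ∈ S ∧ redMod n f ∈ T) ∧
      U.ncard = S.ncard * T.ncard := by
  set e : (Fin 4 → ZMod (m * n)) ≃ (Fin 4 → ZMod m) × (Fin 4 → ZMod n) :=
    ((Equiv.refl (Fin 4)).arrowCongr (chineseRemainder h).toEquiv).trans
      (Equiv.arrowProdEquivProdArrow _ _ _) with he
  refine ⟨e ⁻¹' (S ×ˢ T), fun f => ?_, ?_⟩
  · have h1 : e (redMod (m * n) f) = (redMod m f, redMod n f) := by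
      have h2 : ∀ i, chineseRemainder h (f i : ZMod (m * n)) = (f i : ZMod m × ZMod n) :=
        fun i => map_intCast _ _
      refine Prod.ext ?_ ?_ <;> funext i
      · exact congrArg Prod.fst (h2 i)
      · exact congrArg Prod.snd (h2 i)
    rw [Set.mem_preimage, h1, Set.mem_prod]
  · rw [← ncard_prod, ← Equiv.image_symm_eq_preimage,
      ncard_image_of_injective _ e.symm.injective]

lemma mem_insert_of_dvd_pow_mul {m k q : ℕ} {s : Finset ℕ} (hp : p.Prime)
    (hd : ∀ q : ℕ, q.Prime → q ∣ m → q ∈ s) (hq : q.Prime) (h : q ∣ p ^ k * m) :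
    q ∈ insert p s := by
  rcases (Nat.Prime.dvd_mul hq).mp h with h | h
  · exact Finset.mem_insert.2 (.inl ((Nat.prime_dvd_prime_iff_eq hq hp).mp (hq.dvd_of_dvd_pow h)))
  · exact Finset.mem_insert_of_mem (hd q hq h)

lemma exists_crt (S : ∀ p : ℕ, Set (Fin 4 → ZMod (p ^ 2))) (s : Finset ℕ)
    (hs : ∀ p ∈ s, p.Prime) : ∃ (m : ℕ) (U : Set (Fin 4 → ZMod m)), 0 < m ∧
      (∀ q : ℕ, q.Prime → q ∣ m → q ∈ s) ∧
      (∀ f, redMod m f ∈ U ↔ ∀ p ∈ s, redMod (p ^ 2) f ∈ S p) ∧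
      (U.ncard : ℝ) / (m : ℝ) ^ 4 = ∏ p ∈ s, ((S p).ncard : ℝ) / (p : ℝ) ^ 8 := by
  classical
  induction s using Finset.induction_on with
  | empty =>
    refine ⟨1, Set.univ, one_pos, fun q hq h => absurd (Nat.dvd_one.mp h) hq.ne_one, by simp, ?_⟩
    rw [ncard_univ]
    simp
  | insert p s hp ih =>
    obtain ⟨m, U, hm, hd, hU, hc⟩ := ih fun q hq => hs q (Finset.mem_insert_of_mem hq)
    have hpp := hs p (mem_insert_self _ _)
    have hcop : Nat.Coprime (p ^ 2) m :=
      Nat.Coprime.pow_left 2 ((Nat.Prime.coprime_iff_not_dvd hpp).mpr fun h => hp (hd p hpp h))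
    obtain ⟨V, hV, hVc⟩ := exists_crt_pair hcop (S p) U
    refine ⟨p ^ 2 * m, V, by have := hpp.pos; positivity, ?_, ?_, ?_⟩
    · exact fun q => mem_insert_of_dvd_pow_mul hpp hd
    · intro f
      rw [hV, hU, Finset.forall_mem_insert]
    · rw [Finset.prod_insert hp, ← hc, hVc]
      push_cast
      rw [mul_pow, ← pow_mul, div_mul_div_comm]

section Sieve

variable (S : ∀ p : ℕ, Set (Fin 4 → ZMod (p ^ 2)))

/-- Forms satisfying the local conditions at all primes. -/
def locForms : Set ℤ⁴ := {f | ∀ p : ℕ, p.Prime → redMod (p ^ 2) f ∈ S p}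

/-- Forms satisfying the local conditions at all primes up to `Y`. -/
def locFormsLe (Y : ℕ) : Set ℤ⁴ :=
  {f | ∀ p ∈ (Finset.Icc 1 Y).filter Nat.Prime, redMod (p ^ 2) f ∈ S p}

/-- The density of the local conditions at primes up to `Y`. -/
noncomputable def locDens (Y : ℕ) : ℝ :=
  ∏ p ∈ (Finset.Icc 1 Y).filter Nat.Prime, ((S p).ncard : ℝ) / (p : ℝ) ^ 8

variable {S}

lemma locForms_inv (hS : ∀ p : ℕ, p.Prime → SLInv {f | redMod (p ^ 2) f ∈ S p}) :
    SLInv (locForms S) := fun f g h hf p hp => hS p hp f g h (hf p hp)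

lemma locFormsLe_inv (hS : ∀ p : ℕ, p.Prime → SLInv {f | redMod (p ^ 2) f ∈ S p}) (Y : ℕ) :
    SLInv (locFormsLe S Y) := fun f g h hf p hp =>
  hS p (Finset.mem_filter.mp hp).2 f g h (hf p hp)

lemma locForms_subset (Y : ℕ) : locForms S ⊆ locFormsLe S Y := fun _ hf p hp =>
  hf p (Finset.mem_filter.mp hp).2

lemma irrCls_locForms_upper (hS : ∀ p : ℕ, p.Prime → SLInv {f | redMod (p ^ 2) f ∈ S p})
    (Y : ℕ) {ε : ℝ} (hε : 0 < ε) : ∀ᶠ κ : ℝ in atTop,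
      ((irrCls (locForms S) (κ ^ 12)).ncard : ℝ) ≤ (Real.pi ^ 2 / 4 * locDens S Y + ε) * κ ^ 12 := by
  obtain ⟨m, U, hm, -, hU, hc⟩ := exists_crt S ((Finset.Icc 1 Y).filter Nat.Prime)
    fun p hp => (Finset.mem_filter.mp hp).2
  set η : ℝ := min 2 (ε / 10 ^ 8) with hη
  have hη0 : 0 < η := by positivity
  have hη1 : 10 ^ 8 * η ≤ ε := by
    have : η ≤ ε / 10 ^ 8 := min_le_right _ _
    linarith
  filter_upwards [eventually_redForms_le hm U hη0 hε, eventually_ge_atTop 1] with κ h1 h2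
  have hκ : 0 < κ := by linarith
  have h3 := two_mul_irrCls_le (locForms_inv hS) hκ
  have h4 : ((redLt κ η).ncard : ℝ) ≤ 10 ^ 8 * η * κ ^ 12 :=
    redLt_ncard_le h2 (min_le_left _ _ : η ≤ 2) hη0
  have hsub : locForms S ∩ redSet κ ⊆ ({f | redMod m f ∈ U} ∩ redForms κ η) ∪ redLt κ η := by
    rintro f ⟨hf, hr⟩
    rcases redSet_subset_union κ η hr with h | h
    · exact Or.inl ⟨(hU f).mpr (locForms_subset Y hf), h⟩
    · exact Or.inr h
  have hfin : (redLt κ η).Finite := (redSet_finite hκ).subset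
    fun f ⟨h0, m, h1, h2, h3, _⟩ => ⟨h0, m, h1, h2, h3⟩
  have h5 := (ncard_le_ncard hsub (((redForms_finite hκ hη0).subset
    Set.inter_subset_right).union hfin)).trans (ncard_union_le _ _)
  have h6 : ((2 * (irrCls (locForms S) (κ ^ 12)).ncard : ℕ) : ℝ) ≤ _ := Nat.cast_le.mpr (h3.trans h5)
  push_cast at h6
  have h7 : locDens S Y = (U.ncard : ℝ) / (m : ℝ) ^ 4 := hc.symm
  rw [← h7] at h1
  have h8 : 0 < κ ^ 12 := by positivity
  have h9 : 10 ^ 8 * η * κ ^ 12 ≤ ε * κ ^ 12 := by gcongr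
  linarith

lemma irrCls_locForms_lower (hS : ∀ p : ℕ, p.Prime → SLInv {f | redMod (p ^ 2) f ∈ S p})
    {Y : ℕ} (hY : 3 ≤ Y)
    (hd : ∀ p : ℕ, p.Prime → Y < p → ∀ f, redMod (p ^ 2) f ∉ S p → (p : ℤ) ^ 2 ∣ cdisc f)
    {ε : ℝ} (hε : 0 < ε) : ∀ᶠ κ : ℝ in atTop,
      (Real.pi ^ 2 / 4 * locDens S Y - ε - 10 ^ 11 / Y) * κ ^ 12 ≤
        ((irrCls (locForms S) (κ ^ 12)).ncard : ℝ) := by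
  obtain ⟨m, U, hm, -, hU, hc⟩ := exists_crt S ((Finset.Icc 1 Y).filter Nat.Prime)
    fun p hp => (Finset.mem_filter.mp hp).2
  obtain ⟨η, hη0, hη⟩ := exists_eventually_le_openForms (ε := ε / 2) (by positivity)
  filter_upwards [hη m hm U, eventually_ge_atTop 1,
    eventually_openForms_reducible_le hη0 (ε := ε / 2) (by positivity),
    eventually_ge_atTop (2 * 10 ^ 10 / ε)] with κ h1 h2 h3 hκε
  have hκ : 0 < κ := by linarith
  have hκ12 : 0 < κ ^ 12 := by positivity
  have h4 := openForms_le_two_mul (locFormsLe_inv hS Y) hκ hη0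
  have hcov : irrCls (locFormsLe S Y) (κ ^ 12) ⊆ irrCls (locForms S) (κ ^ 12) ∪
      (irrCls (hessGt Y) (κ ^ 12) ∪ irrCls (discSqGt Y) (κ ^ 12)) := by
    rintro _ ⟨f, ⟨hf, hr⟩, rfl⟩
    by_cases hfl : f ∈ locForms S
    · exact Or.inl ⟨f, ⟨hfl, hr⟩, rfl⟩
    · right
      have : ∃ p : ℕ, p.Prime ∧ redMod (p ^ 2) f ∉ S p := by
        by_contra hcon
        push Not at hcon
        exact hfl hcon
      obtain ⟨p, hp, hpf⟩ := this
      have hpY : Y < p := by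
        by_contra hcon
        exact hpf (hf p (Finset.mem_filter.mpr ⟨Finset.mem_Icc.mpr ⟨hp.one_lt.le, by omega⟩, hp⟩))
      by_cases hh : HessDvd p f
      · exact Or.inl ⟨f, ⟨⟨p, hp, hpY, hh⟩, hr⟩, rfl⟩
      · exact Or.inr ⟨f, ⟨⟨p, hp, hpY, hd p hp hpY f hpf, hh⟩, hr⟩, rfl⟩
  have h5 := ncard_le_ncard hcov ((irrCls_finite (locForms_inv hS) hκ).union
    ((irrCls_finite (hessGt_inv Y) hκ).union (irrCls_finite (discSqGt_inv Y) hκ)))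
  have h6 := ncard_union_le (irrCls (locForms S) (κ ^ 12))
    (irrCls (hessGt Y) (κ ^ 12) ∪ irrCls (discSqGt Y) (κ ^ 12))
  have h7 := ncard_union_le (irrCls (hessGt Y) (κ ^ 12)) (irrCls (discSqGt Y) (κ ^ 12))
  have h8 := irrCls_hessGt_le h2 (by omega : 0 < Y)
  have h9 := irrCls_discSqGt_le hκ hY
  have hE : {f | redMod m f ∈ U} = locFormsLe S Y := by
    ext f; exact hU f
  rw [hE] at h1
  have h10 : locFormsLe S Y ∩ openForms κ η ⊆
      (locFormsLe S Y ∩ openForms κ η ∩ {f | ¬ Reducible f}) ∪ (openForms κ η ∩ {f | Reducible f}) := by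
    rintro f hf
    by_cases hr : Reducible f
    · exact Or.inr ⟨hf.2, hr⟩
    · exact Or.inl ⟨hf, hr⟩
  have hof : (openForms κ η).Finite := (redForms_finite hκ hη0).subset (openForms_subset κ η)
  have h11 := (ncard_le_ncard h10 ((hof.subset fun f hf => hf.1.2).union
    (hof.subset fun f hf => hf.1))).trans (ncard_union_le _ _)
  have h12 : (((locFormsLe S Y ∩ openForms κ η).ncard : ℕ) : ℝ) ≤
      ((2 * ((irrCls (locForms S) (κ ^ 12)).ncard + ((irrCls (hessGt Y) (κ ^ 12)).ncard +
        (irrCls (discSqGt Y) (κ ^ 12)).ncard)) + (openForms κ η ∩ {f | Reducible f}).ncard : ℕ) : ℝ) :=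
    Nat.cast_le.mpr (by omega)
  push_cast at h12
  have h13 : locDens S Y = (U.ncard : ℝ) / (m : ℝ) ^ 4 := hc.symm
  rw [← h13] at h1
  have h14 : 10 ^ 10 * κ ^ 9 ≤ ε / 2 * κ ^ 12 := by
    rw [div_le_iff₀ hε] at hκε
    have : κ ^ 9 * κ ≤ κ ^ 9 * κ ^ 3 := by
      gcongr
      calc κ = κ ^ 1 := (pow_one _).symm
        _ ≤ κ ^ 3 := pow_le_pow_right₀ h2 (by norm_num)
    have h15 : 2 * 10 ^ 10 * κ ^ 9 ≤ κ * ε * κ ^ 9 := by gcongr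
    nlinarith
  have hYp : (0 : ℝ) < Y := by exact_mod_cast (by omega : 0 < Y)
  have h16 : 2 * 10 ^ 10 * (κ ^ 12 / Y) ≤ 10 ^ 11 / Y * κ ^ 12 := by
    rw [div_mul_eq_mul_div, mul_div_assoc]
    have : 0 ≤ κ ^ 12 / Y := by positivity
    linarith
  linarith

/-- The number of irreducible classes satisfying prescribed local conditions. -/
theorem tendsto_irrCls_locForms (hS : ∀ p : ℕ, p.Prime → SLInv {f | redMod (p ^ 2) f ∈ S p})
    {Y₀ : ℕ}
    (hd : ∀ p : ℕ, p.Prime → Y₀ < p → ∀ f, redMod (p ^ 2) f ∉ S p → (p : ℤ) ^ 2 ∣ cdisc f)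
    {ρ : ℝ} (hρ : Tendsto (locDens S) atTop (nhds ρ)) :
    Tendsto (fun X : ℝ => ((irrCls (locForms S) X).ncard : ℝ) / X) atTop
      (nhds (Real.pi ^ 2 / 4 * ρ)) := by
  have hmain : Tendsto (fun κ : ℝ => ((irrCls (locForms S) (κ ^ 12)).ncard : ℝ) / κ ^ 12) atTop
      (nhds (Real.pi ^ 2 / 4 * ρ)) := by
    rw [Metric.tendsto_nhds]
    intro δ hδ
    have hρ' := hρ.const_mul (Real.pi ^ 2 / 4)
    have hinv : Tendsto (fun Y : ℕ => (10 ^ 11 : ℝ) / Y) atTop (nhds 0) :=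
      tendsto_const_div_atTop_nhds_zero_nat _
    obtain ⟨Y, h1, h2, h3, h4⟩ := ((Metric.tendsto_nhds.mp hρ' (δ / 4) (by positivity)).and
      ((hinv.eventually (gt_mem_nhds (by positivity : (0 : ℝ) < δ / 4))).and
        ((eventually_ge_atTop 3).and (eventually_ge_atTop Y₀)))).exists
    rw [Real.dist_eq, abs_lt] at h1
    filter_upwards [irrCls_locForms_upper hS Y (ε := δ / 4) (by positivity),
      irrCls_locForms_lower hS h3 (fun p hp hY => hd p hp (by omega)) (ε := δ / 4) (by positivity),
      eventually_gt_atTop 0] with κ h5 h6 h7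
    have h8 : 0 < κ ^ 12 := by positivity
    rw [← div_le_iff₀ h8] at h5
    rw [← le_div_iff₀ h8] at h6
    rw [Real.dist_eq, abs_lt]
    constructor <;> linarith
  have ht : Tendsto (fun X : ℝ => X ^ (1 / 12 : ℝ)) atTop atTop := tendsto_rpow_atTop (by norm_num)
  refine (hmain.comp ht).congr' ?_
  filter_upwards [eventually_ge_atTop 0] with X hX
  have h1 : (X ^ (1 / 12 : ℝ)) ^ 12 = X := by
    rw [← Real.rpow_natCast, ← Real.rpow_mul hX]; norm_num
  simp only [Function.comp, h1]

end Sieve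

/-! ### Local conditions -/

/-- The condition at `p` on `d > 0` to be the discriminant of a real quadratic field (or `1`)
in which the primes of `S` split. -/
def LocD (S : Finset ℕ) (p : ℕ) (d : ℤ) : Prop :=
  if p = 2 then (if 2 ∈ S then d % 8 = 1 else d % 4 = 1 ∨ d % 16 = 8 ∨ d % 16 = 12)
  else if p ∈ S then ∃ t : ℤ, ¬ (p : ℤ) ∣ t ∧ (p : ℤ) ∣ t ^ 2 - d else ¬ (p : ℤ) ^ 2 ∣ d

/-- The condition at `p` on a cubic form to have Hessian divisible by the part of `∏ T` at `p`
and reduced discriminant satisfying `LocD`. -/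
def locE (S T : Finset ℕ) (p : ℕ) : Set ℤ⁴ :=
  {f | if p ∈ T then HessDvd p f ∧ ∃ d, cdisc f = p ^ 2 * d ∧ LocD S p d else LocD S p (cdisc f)}

/-- The residues of `locE`. -/
def locS (S T : Finset ℕ) (p : ℕ) : Set (Fin 4 → ZMod (p ^ 2)) := redMod (p ^ 2) '' locE S T p

lemma locE_inv (S T : Finset ℕ) (p : ℕ) : SLInv (locE S T p) := by
  intro f g h hf
  simp only [locE, mem_setOf_eq] at hf ⊢
  rw [h.cdisc_eq]
  split_ifs at hf ⊢
  · exact ⟨hf.1.of_equiv h, hf.2⟩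
  · exact hf

lemma LocD_two_congr {a b c a' b' c' : ℤ} (ha : (4 : ℤ) ∣ a' - a)
    (hb : (4 : ℤ) ∣ b' - b) (hc : (4 : ℤ) ∣ c' - c) (h : LocD S 2 (b ^ 2 - 4 * a * c)) :
    LocD S 2 (b' ^ 2 - 4 * a' * c') := by
  obtain ⟨x, hx⟩ := ha
  obtain ⟨y, hy⟩ := hb
  obtain ⟨z, hz⟩ := hc
  obtain rfl : a' = a + 4 * x := by linarith
  obtain rfl : b' = b + 4 * y := by linarith
  obtain rfl : c' = c + 4 * z := by linarith
  have key : (b + 4 * y) ^ 2 - 4 * (a + 4 * x) * (c + 4 * z) =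
      b ^ 2 - 4 * a * c + 8 * (b * y) + 16 * (y ^ 2 - a * z - x * c - 4 * x * z) := by ring
  rw [key]
  generalize y ^ 2 - a * z - x * c - 4 * x * z = w
  simp only [LocD, if_true] at h ⊢
  split_ifs at h ⊢ with hS
  · omega
  · rcases h with h | h
    · left; omega
    · right
      have hb : b % 2 = 0 := by
        by_contra hb
        have h1 : b ^ 2 % 4 = 1 := by
          obtain ⟨k, hk⟩ : ∃ k, b = 2 * k + 1 := ⟨b / 2, by omega⟩
          rw [hk, show (2 * k + 1) ^ 2 = 4 * (k ^ 2 + k) + 1 by ring]; omega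
        rw [show 4 * a * c = 4 * (a * c) by ring] at h
        omega
      obtain ⟨k, hk⟩ : ∃ k, b = 2 * k := ⟨b / 2, by omega⟩
      rw [hk, show 8 * (2 * k * y) = 16 * (k * y) by ring]
      rw [hk] at h
      generalize (2 * k) ^ 2 - 4 * a * c = D at h ⊢
      generalize k * y = z at h ⊢
      omega

lemma LocD_congr (hp2 : p ≠ 2) {d d' : ℤ} (h : (p : ℤ) ^ 2 ∣ d' - d)
    (hd : LocD S p d) : LocD S p d' := by
  simp only [LocD, if_neg hp2] at hd ⊢
  split_ifs at hd ⊢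
  · obtain ⟨t, h1, h2⟩ := hd
    refine ⟨t, h1, ?_⟩
    have : t ^ 2 - d' = t ^ 2 - d - (d' - d) := by ring
    rw [this]
    exact dvd_sub h2 ((Dvd.intro_left _ (by ring : (p : ℤ) * p = _)).trans h)
  · intro h3
    exact hd ((dvd_sub_right h3).mp h |> fun h4 => by simpa using h4)

lemma LocD_congr' (hp2 : p ≠ 2) (hpS : p ∈ S) {d d' : ℤ}
    (h : (p : ℤ) ∣ d' - d) (hd : LocD S p d) : LocD S p d' := by
  simp only [LocD, if_neg hp2, if_pos hpS] at hd ⊢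
  obtain ⟨t, h1, h2⟩ := hd
  refine ⟨t, h1, ?_⟩
  rw [show t ^ 2 - d' = t ^ 2 - d - (d' - d) by ring]
  exact dvd_sub h2 h

lemma hess_congr {m : ℕ} (h : redMod m f = redMod m g) :
    (m : ℤ) ∣ hA g - hA f ∧ (m : ℤ) ∣ hB g - hB f ∧ (m : ℤ) ∣ hC g - hC f := by
  have h' : ∀ i, ((f i : ℤ) : ZMod m) = ((g i : ℤ) : ZMod m) := fun i => congrFun h i
  refine ⟨?_, ?_, ?_⟩ <;> rw [← intCast_eq_intCast_iff_dvd_sub] <;> simp [hA, hB, hC, h']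

lemma locE_congr (hT : T ⊆ S) (hp : p.Prime)
    (h : redMod (p ^ 2) f = redMod (p ^ 2) g) (hf : f ∈ locE S T p) : g ∈ locE S T p := by
  obtain ⟨hA', hB', hC'⟩ := hess_congr h
  push_cast at hA' hB' hC'
  simp only [locE, mem_setOf_eq] at hf ⊢
  obtain ⟨x, hx⟩ := hA'
  obtain ⟨y, hy⟩ := hB'
  obtain ⟨z, hz⟩ := hC'
  have hx' : hA g = hA f + p ^ 2 * x := by linarith
  have hy' : hB g = hB f + p ^ 2 * y := by linarith
  have hz' : hC g = hC f + p ^ 2 * z := by linarith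
  split_ifs at hf ⊢ with hpT
  · obtain ⟨⟨⟨a, ha⟩, ⟨b, hb⟩, ⟨c, hc⟩⟩, d, hd, hl⟩ := hf
    refine ⟨⟨⟨a + p * x, by rw [hx', ha]; ring⟩, ⟨b + p * y, by rw [hy', hb]; ring⟩,
      ⟨c + p * z, by rw [hz', hc]; ring⟩⟩, (b + p * y) ^ 2 - 4 * (a + p * x) * (c + p * z), ?_, ?_⟩
    · rw [cdisc, hx', hy', hz', ha, hb, hc]; ring
    · have hp0 : (p : ℤ) ^ 2 ≠ 0 := by exact_mod_cast (pow_pos hp.pos 2).ne'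
      have hd' : d = b ^ 2 - 4 * a * c := by
        apply mul_left_cancel₀ hp0
        rw [← hd, cdisc, ha, hb, hc]; ring
      rw [hd'] at hl
      by_cases hp2 : p = 2
      · subst hp2
        have h2S : 2 ∈ S := hT hpT
        simp only [LocD, if_true, if_pos h2S] at hl ⊢
        push_cast
        have hbo : b % 2 = 1 := by
          by_contra hbo
          obtain ⟨k, hk⟩ : ∃ k, b = 2 * k := ⟨b / 2, by omega⟩
          rw [hk, show (2 * k) ^ 2 - 4 * a * c = 4 * (k ^ 2 - a * c) by ring] at hl
          omega
        have h1 : ∃ k, b * y + y ^ 2 = 2 * k := by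
          have := Int.emod_two_eq_zero_or_one y
          rcases this with h | h
          · exact ⟨(b + y) * (y / 2), by
              have : y = 2 * (y / 2) := by omega
              linear_combination (b + y) * this⟩
          · exact ⟨y * ((b + y) / 2), by
              have : b + y = 2 * ((b + y) / 2) := by omega
              linear_combination y * this⟩
        obtain ⟨k, hk⟩ := h1
        rw [show (b + 2 * y) ^ 2 - 4 * (a + 2 * x) * (c + 2 * z) = b ^ 2 - 4 * a * c +
          4 * (b * y + y ^ 2) - 8 * (a * z + x * c + 2 * x * z) by ring, hk]
        omega
      · refine LocD_congr' hp2 (hT hpT) ?_ hl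
        exact ⟨2 * b * y + p * y ^ 2 - 4 * (a * z + x * c + p * x * z), by ring⟩
  · by_cases hp2 : p = 2
    · subst hp2
      rw [cdisc] at hf ⊢
      exact LocD_two_congr ⟨x, by rw [hx']; push_cast; ring⟩ ⟨y, by rw [hy']; push_cast; ring⟩
        ⟨z, by rw [hz']; push_cast; ring⟩ hf
    · refine LocD_congr hp2 ?_ hf
      rw [cdisc, cdisc, hx', hy', hz']
      exact ⟨2 * hB f * y + p ^ 2 * y ^ 2 - 4 * (hA f * z + x * hC f + p ^ 2 * x * z), by ring⟩

lemma redMod_mem_locS (hT : T ⊆ S) (hp : p.Prime) :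
    redMod (p ^ 2) f ∈ locS S T p ↔ f ∈ locE S T p := by
  constructor
  · rintro ⟨g, hg, h⟩
    exact locE_congr hT hp h hg
  · exact fun h => ⟨f, h, rfl⟩

lemma locS_inv (hT : T ⊆ S) (hp : p.Prime) :
    SLInv {f | redMod (p ^ 2) f ∈ locS S T p} := by
  simp only [redMod_mem_locS hT hp]
  exact locE_inv S T p

/-- A lift of a residue. -/
def liftMod {m : ℕ} (v : Fin 4 → ZMod m) : ℤ⁴ := fun i => ((v i).val : ℤ)

lemma redMod_liftMod {m : ℕ} [NeZero m] (v : Fin 4 → ZMod m) : redMod m (liftMod v) = v := by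
  funext i; simp [redMod, liftMod]

lemma redMod_surjective (m : ℕ) : Function.Surjective (redMod m) := fun v => by
  choose w hw using fun i => intCast_surjective (v i)
  exact ⟨w, funext hw⟩

lemma mem_locS_iff (hT : T ⊆ S) (hp : p.Prime) {v : Fin 4 → ZMod (p ^ 2)} :
    v ∈ locS S T p ↔ liftMod v ∈ locE S T p := by
  have : NeZero (p ^ 2) := ⟨(pow_pos hp.pos 2).ne'⟩
  rw [← redMod_mem_locS hT hp, redMod_liftMod]

/-! #### Counting at the prime two -/

lemma ncard_forms_four (P : ℤ → ℤ → ℤ → ℤ → Prop) [∀ a b c d, Decidable (P a b c d)] :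
    {v : Fin 4 → ZMod (2 ^ 2) | P (v 0).val (v 1).val (v 2).val (v 3).val}.ncard =
      ((Finset.univ : Finset (Fin 4 × Fin 4 × Fin 4 × Fin 4)).filter
        fun x => P x.1 x.2.1 x.2.2.1 x.2.2.2).card := by
  rw [← ncard_coe_finset]
  apply ncard_congr (fun v _ => (v 0, v 1, v 2, v 3))
  · intro v hv
    exact Finset.mem_coe.mpr (Finset.mem_filter.mpr ⟨Finset.mem_univ _, hv⟩)
  · intro v w _ _ h
    exact form_ext (congrArg (·.1) h) (congrArg (·.2.1) h)
      (congrArg (·.2.2.1) h) (congrArg (·.2.2.2) h)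
  · rintro ⟨a, b, c, d⟩ h
    exact ⟨![a, b, c, d], (Finset.mem_filter.mp (Finset.mem_coe.mp h)).2, rfl⟩

lemma ncard_locS_two_of_mem (hT : T ⊆ S) (h2 : 2 ∈ T) :
    (locS S T 2).ncard = 24 := by
  have h : locS S T 2 = {v : Fin 4 → ZMod (2 ^ 2) |
      (fun a b c e : ℤ => (b ^ 2 - a * c) % 2 = 0 ∧ (b * c - a * e) % 2 = 0 ∧
        (c ^ 2 - b * e) % 2 = 0 ∧ (((b * c - a * e) / 2) ^ 2 -
          4 * ((b ^ 2 - a * c) / 2) * ((c ^ 2 - b * e) / 2)) % 8 = 1)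
        (v 0).val (v 1).val (v 2).val (v 3).val} := by
    ext v
    rw [mem_locS_iff hT Nat.prime_two]
    simp only [locE, mem_setOf_eq, if_pos h2, HessDvd, LocD, if_true, if_pos (hT h2), cdisc]
    change (_ ∧ _) ↔ hA (liftMod v) % 2 = 0 ∧ hB (liftMod v) % 2 = 0 ∧ hC (liftMod v) % 2 = 0 ∧
      ((hB (liftMod v) / 2) ^ 2 - 4 * (hA (liftMod v) / 2) * (hC (liftMod v) / 2)) % 8 = 1
    generalize hA (liftMod v) = A
    generalize hB (liftMod v) = B
    generalize hC (liftMod v) = C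
    constructor
    · rintro ⟨⟨⟨a, ha⟩, ⟨b, hb⟩, ⟨c, hc⟩⟩, d, hd, h⟩
      push_cast at *
      subst ha hb hc
      refine ⟨by omega, by omega, by omega, ?_⟩
      simp only [Int.mul_ediv_cancel_left _ (two_ne_zero)]
      have : d = b ^ 2 - 4 * a * c := by linarith
      rwa [← this]
    · rintro ⟨ha, hb, hc, h⟩
      push_cast
      refine ⟨⟨by omega, by omega, by omega⟩, _, ?_, h⟩
      have ha' : A = 2 * (A / 2) := by omega
      have hb' : B = 2 * (B / 2) := by omega
      have hc' : C = 2 * (C / 2) := by omega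
      rw [ha', hb', hc']
      simp only [Int.mul_ediv_cancel_left _ (two_ne_zero)]
      ring
  rw [h, ncard_forms_four (fun a b c e : ℤ => (b ^ 2 - a * c) % 2 = 0 ∧ (b * c - a * e) % 2 = 0 ∧
    (c ^ 2 - b * e) % 2 = 0 ∧ (((b * c - a * e) / 2) ^ 2 -
      4 * ((b ^ 2 - a * c) / 2) * ((c ^ 2 - b * e) / 2)) % 8 = 1)]
  decide +kernel

lemma ncard_locS_two (hT : T ⊆ S) (h2 : 2 ∉ T) :
    (locS S T 2).ncard = if 2 ∈ S then 48 else 144 := by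
  have h : locS S T 2 = {v : Fin 4 → ZMod (2 ^ 2) | (fun a b c e : ℤ => LocD S 2
      ((b * c - a * e) ^ 2 - 4 * (b ^ 2 - a * c) * (c ^ 2 - b * e)))
        (v 0).val (v 1).val (v 2).val (v 3).val} := by
    ext v
    rw [mem_locS_iff hT Nat.prime_two]
    simp only [locE, mem_setOf_eq, if_neg h2]
    rfl
  rw [h]
  simp only [LocD, if_true]
  split_ifs with hS
  · rw [ncard_forms_four (fun a b c e : ℤ =>
      ((b * c - a * e) ^ 2 - 4 * (b ^ 2 - a * c) * (c ^ 2 - b * e)) % 8 = 1)]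
    decide +kernel
  · rw [ncard_forms_four (fun a b c e : ℤ =>
      ((b * c - a * e) ^ 2 - 4 * (b ^ 2 - a * c) * (c ^ 2 - b * e)) % 4 = 1 ∨
      ((b * c - a * e) ^ 2 - 4 * (b ^ 2 - a * c) * (c ^ 2 - b * e)) % 16 = 8 ∨
      ((b * c - a * e) ^ 2 - 4 * (b ^ 2 - a * c) * (c ^ 2 - b * e)) % 16 = 12)]
    decide +kernel

/-! #### Counting tools for residues -/

lemma ncard_preimage_mul {G H : Type*} [AddCommGroup G] [AddCommGroup H] [Finite G] [Finite H]
    (φ : G →+ H) (hφ : Function.Surjective φ) (S : Set H) :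
    (φ ⁻¹' S).ncard * Nat.card H = Nat.card G * S.ncard := by
  choose σ hσ using hφ
  let e : G ≃ H × φ.ker :=
    { toFun := fun g => (φ g, ⟨g - σ (φ g), by simp [AddMonoidHom.mem_ker, hσ]⟩)
      invFun := fun x => σ x.1 + x.2
      left_inv := fun g => by simp
      right_inv := fun x => by
        have h : φ (x.2 : G) = 0 := x.2.2
        ext <;> simp [hσ, h] }
  have h1 : φ ⁻¹' S = e ⁻¹' (S ×ˢ Set.univ) := by
    ext g; simp [e]
  rw [h1, ← Equiv.image_symm_eq_preimage, ncard_image_of_injective _ e.symm.injective,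
    ncard_prod, ncard_univ, Nat.card_congr e, Nat.card_prod]
  ring

lemma ncard_sq_pairs {α F : Type*} [Finite α] [Field F] [Finite F] (h2 : (2 : F) ≠ 0) (g : α → F) :
    {x : α × F | x.2 ≠ 0 ∧ g x.1 = x.2 ^ 2}.ncard = 2 * {x : α | ∃ t, t ≠ 0 ∧ g x = t ^ 2}.ncard := by
  classical
  set s := {x : α × F | x.2 ≠ 0 ∧ g x.1 = x.2 ^ 2} with hs
  have hsf : s.Finite := toFinite _
  have himg : {x : α | ∃ t, t ≠ 0 ∧ g x = t ^ 2} = Prod.fst '' s := by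
    ext x
    constructor
    · rintro ⟨t, h⟩
      exact ⟨(x, t), h, rfl⟩
    · rintro ⟨y, h, rfl⟩
      exact ⟨y.2, h⟩
  have key := card_eq_sum_card_image Prod.fst hsf.toFinset
  have h3 : ∀ b ∈ hsf.toFinset.image Prod.fst,
      (hsf.toFinset.filter fun a => a.1 = b).card = 2 := by
    intro b hb
    obtain ⟨⟨c, t⟩, hy, rfl⟩ := Finset.mem_image.mp hb
    rw [Set.Finite.mem_toFinset] at hy
    have h4 : hsf.toFinset.filter (fun a => a.1 = c) = {(c, t), (c, -t)} := by
      ext ⟨x, u⟩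
      simp only [mem_filter, Set.Finite.mem_toFinset, Finset.mem_insert,
        Finset.mem_singleton, Prod.mk.injEq, hs, mem_setOf_eq]
      constructor
      · rintro ⟨⟨h5, h6⟩, rfl⟩
        have h7 := hy.2
        simp only at h6 h7
        rw [h6] at h7
        rcases sq_eq_sq_iff_eq_or_eq_neg.mp h7 with h | h
        · exact Or.inl ⟨rfl, h⟩
        · exact Or.inr ⟨rfl, h⟩
      · rintro (⟨rfl, rfl⟩ | ⟨rfl, rfl⟩)
        · exact ⟨hy, rfl⟩
        · exact ⟨⟨neg_ne_zero.mpr hy.1, by rw [neg_sq]; exact hy.2⟩, rfl⟩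
    change (hsf.toFinset.filter fun a => a.1 = c).card = 2
    rw [h4, card_pair]
    intro h
    have h5 : t = -t := (Prod.mk.inj h).2
    have h6 : (2 : F) * t = 0 := by linear_combination h5
    exact hy.1 ((mul_eq_zero.mp h6).resolve_left h2)
  rw [sum_congr rfl h3, sum_const, smul_eq_mul] at key
  rw [himg, ncard_eq_toFinset_card s hsf, key, mul_comm, ← ncard_coe_finset]
  congr 2
  rw [coe_image, Set.Finite.coe_toFinset]

lemma ncard_forms_prod {R : Type*} (A B C D : Set R) :
    {v : Fin 4 → R | v 0 ∈ A ∧ v 1 ∈ B ∧ v 2 ∈ C ∧ v 3 ∈ D}.ncard =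
      A.ncard * (B.ncard * (C.ncard * D.ncard)) := by
  rw [← ncard_prod, ← ncard_prod, ← ncard_prod]
  apply ncard_congr (fun v _ => (v 0, v 1, v 2, v 3))
  · exact fun v hv => hv
  · intro v w _ _ h
    exact form_ext (congrArg (·.1) h) (congrArg (·.2.1) h)
      (congrArg (·.2.2.1) h) (congrArg (·.2.2.2) h)
  · rintro ⟨a, b, c, d⟩ h
    exact ⟨![a, b, c, d], h, rfl⟩

/-- The cubic covariant evaluated at `(1, 0)`. -/
def covU {R : Type*} [CommRing R] (f : Fin 4 → R) : R :=
  f 0 ^ 2 * f 3 - 3 * f 0 * f 1 * f 2 + 2 * f 1 ^ 3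

lemma sq_mul_cdisc {R : Type*} [CommRing R] (f : Fin 4 → R) :
    f 0 ^ 2 * cdisc f = covU f ^ 2 - 4 * hA f ^ 3 := by
  simp only [cdisc, covU, hA, hB, hC]; ring

lemma ncard_unit_forms {R : Type*} [CommRing R] (h2 : IsUnit (2 : R)) (Q : Set (Fin 4 → R))
    (P : R → R → Prop)
    (hQ : ∀ v c e, IsUnit (v 0) → hA v = v 0 ^ 2 * c → covU v = 2 * v 0 ^ 3 * e → (v ∈ Q ↔ P c e)) :
    {v | IsUnit (v 0) ∧ v ∈ Q}.ncard =
      {x : R | IsUnit x}.ncard * (Nat.card R * {x : R × R | P x.1 x.2}.ncard) := by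
  rw [← ncard_univ, ← ncard_prod, ← ncard_prod]
  apply ncard_congr (fun v _ => (v 0, v 1, Ring.inverse (v 0 ^ 2) * hA v,
    Ring.inverse (2 * v 0 ^ 3) * covU v))
  · rintro v ⟨hv, hvQ⟩
    refine ⟨hv, trivial, ?_⟩
    refine (hQ v _ _ hv ?_ ?_).mp hvQ
    · rw [Ring.mul_inverse_cancel_left _ _ (hv.pow 2)]
    · rw [Ring.mul_inverse_cancel_left _ _ (h2.mul (hv.pow 3))]
  · rintro v w ⟨hv, -⟩ ⟨hw, -⟩ h
    have e0 : v 0 = w 0 := congrArg (·.1) h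
    have e1 : v 1 = w 1 := congrArg (·.2.1) h
    have e2 : Ring.inverse (v 0 ^ 2) * hA v = Ring.inverse (w 0 ^ 2) * hA w :=
      congrArg (·.2.2.1) h
    have e3 : Ring.inverse (2 * v 0 ^ 3) * covU v = Ring.inverse (2 * w 0 ^ 3) * covU w :=
      congrArg (·.2.2.2) h
    have f2 : hA v = hA w := by
      have := congrArg (v 0 ^ 2 * ·) e2
      beta_reduce at this
      rwa [Ring.mul_inverse_cancel_left _ _ (hv.pow 2), e0,
        Ring.mul_inverse_cancel_left _ _ (hw.pow 2)] at this
    have f3 : covU v = covU w := by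
      have := congrArg (2 * v 0 ^ 3 * ·) e3
      beta_reduce at this
      rwa [Ring.mul_inverse_cancel_left _ _ (h2.mul (hv.pow 3)), e0,
        Ring.mul_inverse_cancel_left _ _ (h2.mul (hw.pow 3))] at this
    have g2 : v 2 = w 2 := by
      apply hw.mul_left_cancel
      simp only [hA, e0, e1] at f2
      linear_combination -f2
    refine form_ext e0 e1 g2 ?_
    apply (hw.pow 2).mul_left_cancel
    simp only [covU, e0, e1, g2] at f3
    linear_combination f3
  · rintro ⟨u, b, c, e⟩ ⟨hu, -, hP⟩
    change IsUnit u at hu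
    change P c e at hP
    set C := Ring.inverse u * (b ^ 2 - u ^ 2 * c) with hC'
    set E := Ring.inverse (u ^ 2) * (2 * u ^ 3 * e + 3 * u * b * C - 2 * b ^ 3) with hE'
    have hC1 : u * C = b ^ 2 - u ^ 2 * c := by rw [hC', Ring.mul_inverse_cancel_left _ _ hu]
    have hE1 : u ^ 2 * E = 2 * u ^ 3 * e + 3 * u * b * C - 2 * b ^ 3 := by
      rw [hE', Ring.mul_inverse_cancel_left _ _ (hu.pow 2)]
    have ha : hA ![u, b, C, E] = u ^ 2 * c := by
      change b ^ 2 - u * C = _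
      rw [hC1]; ring
    have hw : covU ![u, b, C, E] = 2 * u ^ 3 * e := by
      change u ^ 2 * E - 3 * u * b * C + 2 * b ^ 3 = _
      rw [hE1]; ring
    refine ⟨![u, b, C, E], ⟨hu, (hQ _ c e hu ha hw).mpr hP⟩, ?_⟩
    rw [ha, hw]
    change (u, b, Ring.inverse (u ^ 2) * (u ^ 2 * c), Ring.inverse (2 * u ^ 3) * (2 * u ^ 3 * e)) = _
    rw [Ring.inverse_mul_cancel_left _ _ (hu.pow 2),
      Ring.inverse_mul_cancel_left _ _ (h2.mul (hu.pow 3))]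

lemma cdisc_of_unit {R : Type*} [CommRing R] {v : Fin 4 → R} {c e : R} (hv : IsUnit (v 0))
    (h1 : hA v = v 0 ^ 2 * c) (h2 : covU v = 2 * v 0 ^ 3 * e) :
    cdisc v = (2 * v 0 ^ 2) ^ 2 * (e ^ 2 - c ^ 3) := by
  apply (hv.pow 2).mul_left_cancel
  rw [sq_mul_cdisc, h1, h2]; ring

lemma cdisc_expand {R : Type*} [CommRing R] (f : Fin 4 → R) :
    cdisc f = f 0 ^ 2 * f 3 ^ 2 + (4 * f 1 ^ 3 - 6 * f 0 * f 1 * f 2) * f 3 +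
      (4 * f 0 * f 2 ^ 3 - 3 * f 1 ^ 2 * f 2 ^ 2) := by
  simp only [cdisc, hA, hB, hC]; ring

/-! #### Forms with nonzero square discriminant over a finite field -/

section FiniteField

variable {F : Type*} [Field F] [Finite F]

lemma ncard_ne_zero_field : {x : F | x ≠ 0}.ncard = Nat.card F - 1 := by
  have := ncard_compl ({0} : Set F)
  rw [ncard_singleton] at this
  exact this

lemma ncard_nonzero_sq (h2 : (2 : F) ≠ 0) :
    2 * {x : F | ∃ t, t ≠ 0 ∧ x = t ^ 2}.ncard = Nat.card F - 1 := by
  rw [← ncard_sq_pairs h2 (fun x => x), ← ncard_ne_zero_field]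
  symm
  apply ncard_congr (fun t _ => (t ^ 2, t))
  · exact fun t ht => ⟨ht, rfl⟩
  · intro t u _ _ h
    exact (Prod.mk.inj h).2
  · rintro ⟨x, t⟩ ⟨h, h'⟩
    exact ⟨t, h, Prod.ext h'.symm rfl⟩

lemma ncard_sq_sub_cube (h2 : (2 : F) ≠ 0) :
    2 * {x : F × F | ∃ t, t ≠ 0 ∧ x.2 ^ 2 - x.1 ^ 3 = t ^ 2}.ncard =
      Nat.card F * (Nat.card F - 1) := by
  rw [← ncard_sq_pairs h2 (fun x : F × F => x.2 ^ 2 - x.1 ^ 3)]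
  have hu : {x : (F × F) × F | x.2 ≠ 0 ∧ x.1.2 ^ 2 - x.1.1 ^ 3 = x.2 ^ 2} =
      {x | x.2 ≠ 0 ∧ x.1.2 ^ 2 - x.1.1 ^ 3 = x.2 ^ 2 ∧ x.1.2 + x.2 ≠ 0} ∪
      {x | x.2 ≠ 0 ∧ x.1.2 ^ 2 - x.1.1 ^ 3 = x.2 ^ 2 ∧ x.1.2 + x.2 = 0} := by
    ext x; simp only [mem_setOf_eq, Set.mem_union]; tauto
  have hd : Disjoint {x : (F × F) × F | x.2 ≠ 0 ∧ x.1.2 ^ 2 - x.1.1 ^ 3 = x.2 ^ 2 ∧ x.1.2 + x.2 ≠ 0}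
      {x | x.2 ≠ 0 ∧ x.1.2 ^ 2 - x.1.1 ^ 3 = x.2 ^ 2 ∧ x.1.2 + x.2 = 0} := by
    rw [Set.disjoint_left]; rintro x ⟨-, -, h⟩ ⟨-, -, h'⟩; exact h h'
  rw [hu, ncard_union_eq hd (toFinite _) (toFinite _)]
  have c2 : {x : (F × F) × F | x.2 ≠ 0 ∧ x.1.2 ^ 2 - x.1.1 ^ 3 = x.2 ^ 2 ∧ x.1.2 + x.2 = 0}.ncard =
      Nat.card F - 1 := by
    rw [← ncard_ne_zero_field]
    symm
    apply ncard_congr (fun t _ => ((0, -t), t))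
    · intro t ht
      exact ⟨ht, by ring, by ring⟩
    · intro t u _ _ h
      exact (Prod.mk.inj h).2
    · rintro ⟨⟨c, e⟩, t⟩ ⟨h, h', h''⟩
      simp only at h h' h''
      have he : e = -t := by linear_combination h''
      have hc : c = 0 := by
        rw [he] at h'
        exact pow_eq_zero_iff (n := 3) (by norm_num) |>.mp (by linear_combination -h')
      exact ⟨t, h, by rw [he, hc]⟩
  have c1 : {x : (F × F) × F | x.2 ≠ 0 ∧ x.1.2 ^ 2 - x.1.1 ^ 3 = x.2 ^ 2 ∧ x.1.2 + x.2 ≠ 0}.ncard =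
      (Nat.card F - 1) * (Nat.card F - 1) := by
    have e1 : {x : F × F | x.1 ≠ 0 ∧ x.1 ^ 2 = x.2 ^ 3}.ncard = Nat.card F - 1 := by
      rw [← ncard_ne_zero_field]
      symm
      apply ncard_congr (fun s _ => (s ^ 3, s ^ 2))
      · intro s hs
        exact ⟨pow_ne_zero 3 hs, by ring⟩
      · intro s t hs ht h
        obtain ⟨h3, h2⟩ := Prod.mk.inj h
        have hs : s ≠ 0 := hs
        apply mul_left_cancel₀ (pow_ne_zero 2 hs)
        linear_combination h3 - t * h2
      · rintro ⟨u, c⟩ ⟨hu, h⟩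
        simp only at hu h
        have hc : c ≠ 0 := by
          rintro rfl
          apply hu
          exact pow_eq_zero_iff (n := 2) (by norm_num) |>.mp (by rw [h]; ring)
        refine ⟨u / c, div_ne_zero hu hc, Prod.ext ?_ ?_⟩
        · simp only
          rw [div_pow, div_eq_iff (pow_ne_zero 3 hc)]
          linear_combination u * h
        · simp only
          rw [div_pow, div_eq_iff (pow_ne_zero 2 hc)]
          linear_combination h
    have e2 : {x : F × F | x.1 ≠ 0}.ncard = (Nat.card F - 1) * Nat.card F := by
      have : {x : F × F | x.1 ≠ 0} = {x : F | x ≠ 0} ×ˢ (Set.univ : Set F) := by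
        ext x; simp
      rw [this, ncard_prod, ncard_ne_zero_field, ncard_univ]
    have e3 : {x : F × F | x.1 ≠ 0 ∧ x.1 ^ 2 ≠ x.2 ^ 3}.ncard = (Nat.card F - 1) * (Nat.card F - 1) := by
      have h1 : {x : F × F | x.1 ≠ 0 ∧ x.1 ^ 2 ≠ x.2 ^ 3} =
          {x : F × F | x.1 ≠ 0} \ {x : F × F | x.1 ≠ 0 ∧ x.1 ^ 2 = x.2 ^ 3} := by
        ext x; simp only [mem_setOf_eq, mem_diff]; tauto
      rw [h1, ncard_diff (fun x hx => hx.1) (toFinite _), e1, e2, Nat.mul_sub, mul_one]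
    rw [← e3]
    symm
    apply ncard_congr (fun x _ => ((x.2, (x.1 + x.2 ^ 3 / x.1) / 2), (x.1 - x.2 ^ 3 / x.1) / 2))
    · rintro ⟨u, c⟩ ⟨hu, h⟩
      simp only at hu h
      refine ⟨?_, ?_, ?_⟩
      · simp only
        intro h0
        apply h
        field_simp at h0
        linear_combination h0
      · simp only
        field_simp
        ring
      · simp only
        intro h0
        apply hu
        field_simp at h0
        have : 2 * u ^ 2 = 0 := by linear_combination h0
        simpa [h2] using this
    · rintro ⟨u, c⟩ ⟨u', c'⟩ ⟨hu, -⟩ ⟨hu', -⟩ h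
      have h1 : c = c' := congrArg (·.1.1) h
      have h3 : (u + c ^ 3 / u) / 2 = (u' + c' ^ 3 / u') / 2 := congrArg (·.1.2) h
      have h4 : (u - c ^ 3 / u) / 2 = (u' - c' ^ 3 / u') / 2 := congrArg (·.2) h
      refine Prod.ext ?_ h1
      have e : ∀ x y : F, x = (x + y) / 2 + (x - y) / 2 := fun x y => by field_simp; ring
      calc u = _ := e u (c ^ 3 / u)
        _ = _ := by rw [h3, h4]
        _ = u' := (e u' _).symm
    · rintro ⟨⟨c, e⟩, t⟩ ⟨h, h', h''⟩
      simp only at h h' h''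
      have hv : c ^ 3 / (e + t) = e - t := by
        rw [div_eq_iff h'']; linear_combination -h'
      refine ⟨(e + t, c), ⟨h'', ?_⟩, ?_⟩
      · simp only
        intro h0
        have : (e + t) * (2 * t) = 0 := by linear_combination h0 - h'
        simp [h'', h2, h] at this
      · simp only [hv, Prod.mk.injEq, true_and]
        constructor <;> field_simp <;> ring
  rw [c1, c2]
  have : 1 ≤ Nat.card F := Nat.card_pos
  obtain ⟨k, hk⟩ : ∃ k, Nat.card F = k + 1 := ⟨Nat.card F - 1, by omega⟩
  rw [hk]; simp; ring

end FiniteField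

/-! #### Local densities at odd primes -/

lemma ncard_sq_cdisc {F : Type*} [Field F] [Finite F] (h2 : (2 : F) ≠ 0) :
    2 * {v : Fin 4 → F | ∃ t, t ≠ 0 ∧ cdisc v = t ^ 2}.ncard =
      Nat.card F * (Nat.card F - 1) ^ 2 * (Nat.card F + 1) := by
  set Q := {v : Fin 4 → F | ∃ t, t ≠ 0 ∧ cdisc v = t ^ 2} with hQ
  have hu : Q = {v | IsUnit (v 0) ∧ v ∈ Q} ∪ {v | v 0 = 0 ∧ v ∈ Q} := by
    ext v
    simp only [isUnit_iff_ne_zero, Set.mem_union, mem_setOf_eq]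
    tauto
  have hd : Disjoint {v | IsUnit (v 0) ∧ v ∈ Q} {v | v 0 = 0 ∧ v ∈ Q} := by
    rw [Set.disjoint_left]
    rintro x ⟨h, -⟩ ⟨h', -⟩
    exact h.ne_zero h'
  have c1 := ncard_unit_forms (isUnit_iff_ne_zero.mpr h2) Q
    (fun c e => ∃ t, t ≠ 0 ∧ e ^ 2 - c ^ 3 = t ^ 2) (by
      intro v c e hv h3 h4
      have h5 := cdisc_of_unit hv h3 h4
      have h6 : 2 * v 0 ^ 2 ≠ 0 := mul_ne_zero h2 (pow_ne_zero 2 hv.ne_zero)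
      constructor
      · rintro ⟨t, ht, h⟩
        refine ⟨t / (2 * v 0 ^ 2), div_ne_zero ht h6, ?_⟩
        rw [div_pow, eq_div_iff (pow_ne_zero 2 h6), ← h, h5]; ring
      · rintro ⟨t, ht, h⟩
        refine ⟨2 * v 0 ^ 2 * t, mul_ne_zero h6 ht, ?_⟩
        rw [h5, h]; ring)
  have c2 : {v | v 0 = 0 ∧ v ∈ Q}.ncard = {x : F | x ≠ 0}.ncard *
      (Nat.card F * {x : F | ∃ t, t ≠ 0 ∧ x = t ^ 2}.ncard) := by
    rw [← ncard_univ, ← ncard_prod, ← ncard_prod]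
    have h4 : (4 : F) ≠ 0 := by
      have := mul_ne_zero h2 h2; norm_num at this; exact this
    have hz : ∀ v : Fin 4 → F, v 0 = 0 → cdisc v = v 1 ^ 2 * (4 * v 1 * v 3 - 3 * v 2 ^ 2) := by
      intro v hv
      rw [cdisc_expand, hv]; ring
    apply ncard_congr (fun v _ => (v 1, v 2, 4 * v 1 * v 3 - 3 * v 2 ^ 2))
    · rintro v ⟨hv, t, ht, h⟩
      rw [hz v hv] at h
      have h1 : v 1 ≠ 0 := by
        intro h1
        rw [h1] at h
        apply ht
        exact pow_eq_zero_iff (n := 2) (by norm_num) |>.mp (by rw [← h]; ring)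
      refine ⟨h1, trivial, t / v 1, div_ne_zero ht h1, ?_⟩
      rw [div_pow, eq_div_iff (pow_ne_zero 2 h1), ← h]; ring
    · rintro v w ⟨hv, t, ht, hvt⟩ ⟨hw, -⟩ h
      have e1 : v 1 = w 1 := congrArg (·.1) h
      have e2 : v 2 = w 2 := congrArg (·.2.1) h
      have e3 : 4 * v 1 * v 3 - 3 * v 2 ^ 2 = 4 * w 1 * w 3 - 3 * w 2 ^ 2 :=
        congrArg (·.2.2) h
      have h1 : v 1 ≠ 0 := by
        intro h1
        rw [hz v hv, h1] at hvt
        apply ht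
        exact pow_eq_zero_iff (n := 2) (by norm_num) |>.mp (by rw [← hvt]; ring)
      refine form_ext (hv.trans hw.symm) e1 e2 ?_
      apply mul_left_cancel₀ (mul_ne_zero h4 h1)
      rw [← e1, ← e2] at e3
      linear_combination e3
    · rintro ⟨b, c, s⟩ ⟨hb, -, t, ht, rfl⟩
      have hb : b ≠ 0 := hb
      have h5 : 4 * b * ((t ^ 2 + 3 * c ^ 2) / (4 * b)) - 3 * c ^ 2 = t ^ 2 := by
        field_simp; ring
      refine ⟨![0, b, c, (t ^ 2 + 3 * c ^ 2) / (4 * b)], ⟨rfl, b * t, mul_ne_zero hb ht, ?_⟩, ?_⟩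
      · rw [hz _ rfl]
        change b ^ 2 * (4 * b * ((t ^ 2 + 3 * c ^ 2) / (4 * b)) - 3 * c ^ 2) = _
        rw [h5]; ring
      · change (b, c, 4 * b * ((t ^ 2 + 3 * c ^ 2) / (4 * b)) - 3 * c ^ 2) = _
        rw [h5]
  have n1 := ncard_sq_sub_cube h2
  have n2 := ncard_nonzero_sq h2
  have n3 : {x : F | IsUnit x}.ncard = Nat.card F - 1 := by
    simp only [isUnit_iff_ne_zero]
    exact ncard_ne_zero_field
  rw [n3] at c1
  rw [ncard_ne_zero_field] at c2
  rw [hu, ncard_union_eq hd (toFinite _) (toFinite _), c1, c2]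
  have : 1 ≤ Nat.card F := Nat.card_pos
  obtain ⟨k, hk⟩ : ∃ k, Nat.card F = k + 1 := ⟨Nat.card F - 1, by omega⟩
  rw [hk] at n1 n2 ⊢
  simp only [Nat.add_sub_cancel] at n1 n2 ⊢
  linear_combination k * (k + 1) * n1 + k * (k + 1) * n2

section OddPrime

variable {p : ℕ} [Fact p.Prime]

/-- Reduction modulo `p`. -/
noncomputable abbrev redHom (p k : ℕ) [NeZero k] : ZMod (p ^ k) →+* ZMod p :=
  castHom (dvd_pow_self p (NeZero.ne k)) (ZMod p)

lemma redHom_intCast (k : ℕ) [NeZero k] (x : ℤ) : redHom p k (x : ZMod (p ^ k)) = x :=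
  map_intCast _ x

lemma redHom_surjective (k : ℕ) [NeZero k] : Function.Surjective (redHom p k) := fun y => by
  obtain ⟨x, rfl⟩ := intCast_surjective y
  exact ⟨x, redHom_intCast k x⟩

lemma isUnit_iff_redHom (k : ℕ) [NeZero k] (x : ZMod (p ^ k)) : IsUnit x ↔ redHom p k x ≠ 0 := by
  have hp : p.Prime := Fact.out
  have : NeZero (p ^ k) := ⟨(pow_pos hp.pos k).ne'⟩
  obtain ⟨n, rfl⟩ := natCast_zmod_surjective x
  rw [isUnit_iff_coprime, map_natCast, Ne, natCast_eq_zero_iff,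
    Nat.coprime_pow_right_iff (Nat.pos_of_ne_zero (NeZero.ne k)), Nat.coprime_comm,
    Nat.Prime.coprime_iff_not_dvd hp]

lemma mul_eq_zero_of_redHom {x y : ZMod (p ^ 2)} (hx : redHom p 2 x = 0) (hy : redHom p 2 y = 0) :
    x * y = 0 := by
  obtain ⟨x, rfl⟩ := intCast_surjective x
  obtain ⟨y, rfl⟩ := intCast_surjective y
  rw [redHom_intCast, intCast_zmod_eq_zero_iff_dvd] at hx hy
  rw [← Int.cast_mul, intCast_zmod_eq_zero_iff_dvd]
  push_cast
  rw [pow_two]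
  exact mul_dvd_mul hx hy

lemma ncard_redHom_preimage (k : ℕ) [NeZero k] (S : Set (ZMod p)) :
    (redHom p k ⁻¹' S).ncard * p = p ^ k * S.ncard := by
  have hp : p.Prime := Fact.out
  have : NeZero (p ^ k) := ⟨(pow_pos hp.pos k).ne'⟩
  have := ncard_preimage_mul (redHom p k).toAddMonoidHom (redHom_surjective k) S
  rwa [Nat.card_zmod, Nat.card_zmod] at this

lemma ncard_ker : {x : ZMod (p ^ 2) | redHom p 2 x = 0}.ncard = p := by
  have hp : p.Prime := Fact.out
  have h := ncard_redHom_preimage 2 ({0} : Set (ZMod p))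
  rw [ncard_singleton] at h
  have h' : {x : ZMod (p ^ 2) | redHom p 2 x = 0}.ncard * p = p ^ 2 * 1 := h
  exact Nat.eq_of_mul_eq_mul_right hp.pos (by linarith [h'])

lemma ncard_unit : {x : ZMod (p ^ 2) | IsUnit x}.ncard = p * (p - 1) := by
  have hp : p.Prime := Fact.out
  have h := ncard_redHom_preimage 2 {x : ZMod p | x ≠ 0}
  rw [ncard_ne_zero_field, Nat.card_zmod] at h
  simp only [isUnit_iff_redHom]
  have h' : {x : ZMod (p ^ 2) | redHom p 2 x ≠ 0}.ncard * p = p ^ 2 * (p - 1) := h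
  exact Nat.eq_of_mul_eq_mul_right hp.pos (by rw [h']; ring)

lemma ncard_ker_ne_zero : {x : ZMod (p ^ 2) | redHom p 2 x = 0 ∧ x ≠ 0}.ncard = p - 1 := by
  have hp : p.Prime := Fact.out
  have h : {x : ZMod (p ^ 2) | redHom p 2 x = 0 ∧ x ≠ 0} =
      {x : ZMod (p ^ 2) | redHom p 2 x = 0} \ {0} := by
    ext x; simp
  rw [h, ncard_diff (by simp) (toFinite _), ncard_ker, ncard_singleton]

lemma zmod_two_ne_zero (hp2 : p ≠ 2) : (2 : ZMod p) ≠ 0 := fun h =>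
  hp2 ((Nat.prime_dvd_prime_iff_eq Fact.out Nat.prime_two).mp
    ((natCast_eq_zero_iff 2 p).mp (by exact_mod_cast h)))

lemma exists_sq_modEq_iff (d : ℤ) : (∃ t : ℤ, ¬ (p : ℤ) ∣ t ∧ (p : ℤ) ∣ t ^ 2 - d) ↔
    ∃ t : ZMod p, t ≠ 0 ∧ (d : ZMod p) = t ^ 2 := by
  simp only [ZMod.intCast_surjective.exists, Ne, intCast_zmod_eq_zero_iff_dvd,
    ← Int.cast_pow, intCast_eq_intCast_iff_dvd_sub]

lemma map_cdisc {R R' : Type*} [CommRing R] [CommRing R'] (φ : R →+* R') (f : Fin 4 → R) :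
    cdisc (fun i => φ (f i)) = φ (cdisc f) := by
  have : φ 4 = 4 := map_ofNat φ 4
  simp [cdisc, hA, hB, hC, this]

lemma cdisc_redMod (m : ℕ) (f : ℤ⁴) : cdisc (redMod m f) = ((cdisc f : ℤ) : ZMod m) :=
  map_cdisc (Int.castRingHom (ZMod m)) f

lemma redHom_redMod (f : ℤ⁴) : (fun i => redHom p 2 (redMod (p ^ 2) f i)) = redMod p f :=
  funext fun i => redHom_intCast 2 (f i)

lemma ncard_locS_split (hT : T ⊆ S) (hp2 : p ≠ 2) (hpS : p ∈ S) (hpT : p ∉ T) :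
    2 * (locS S T p).ncard = p ^ 4 * (p * (p - 1) ^ 2 * (p + 1)) := by
  have hp : p.Prime := Fact.out
  have h2 : (2 : ZMod p) ≠ 0 := zmod_two_ne_zero hp2
  let Φ : (Fin 4 → ZMod (p ^ 2)) →+ (Fin 4 → ZMod p) :=
    { toFun := fun v i => redHom p 2 (v i)
      map_zero' := by funext i; simp
      map_add' := fun v w => by funext i; simp }
  have hΦ : Function.Surjective Φ := fun w => by
    choose v hv using fun i => redHom_surjective 2 (w i)
    exact ⟨v, funext hv⟩
  have hpre : locS S T p = Φ ⁻¹' {v | ∃ t, t ≠ 0 ∧ cdisc v = t ^ 2} := by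
    ext v
    obtain ⟨f, rfl⟩ := redMod_surjective _ v
    rw [redMod_mem_locS hT hp, Set.mem_preimage]
    change _ ↔ ∃ t, t ≠ 0 ∧ cdisc (fun i => redHom p 2 (redMod (p ^ 2) f i)) = t ^ 2
    rw [redHom_redMod, cdisc_redMod]
    simp only [locE, LocD, mem_setOf_eq, if_neg hpT, if_neg hp2, if_pos hpS]
    exact exists_sq_modEq_iff _
  have h := ncard_preimage_mul Φ hΦ {v | ∃ t, t ≠ 0 ∧ cdisc v = t ^ 2}
  rw [← hpre, Nat.card_pi, Nat.card_pi] at h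
  simp only [Nat.card_zmod, prod_const, card_univ, Fintype.card_fin] at h
  have h3 := ncard_sq_cdisc h2
  rw [Nat.card_zmod] at h3
  have hp4 : 0 < p ^ 4 := pow_pos hp.pos 4
  apply Nat.eq_of_mul_eq_mul_right hp4
  rw [← h3]
  linear_combination 2 * h

lemma locE_ramified_iff (hT : T ⊆ S) (hp2 : p ≠ 2) (hpT : p ∈ T)
    (f : ℤ⁴) : f ∈ locE S T p ↔
      (¬ (p : ℤ) ∣ f 0 ∧ (p : ℤ) ∣ hA f ∧ (p : ℤ) ∣ covU f ∧ ¬ (p : ℤ) ^ 2 ∣ covU f) ∨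
      ((p : ℤ) ∣ f 0 ∧ ¬ (p : ℤ) ^ 2 ∣ f 0 ∧ (p : ℤ) ∣ f 1 ∧ (p : ℤ) ∣ f 2 ∧ ¬ (p : ℤ) ∣ f 3) := by
  have hp : p.Prime := Fact.out
  have hpi : Prime (p : ℤ) := Nat.prime_iff_prime_int.mp hp
  have hp0 : (p : ℤ) ≠ 0 := hpi.ne_zero
  simp only [locE, mem_setOf_eq, if_pos hpT, LocD, if_neg hp2, if_pos (hT hpT), HessDvd]
  have hcov : covU f = 2 * f 1 * hA f - f 0 * hB f := by simp only [covU, hA, hB]; ring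
  have hsyz : f 0 * hC f = f 1 * hB f - hA f * f 2 := by simp only [hC, hA, hB]; ring
  have hdisc := sq_mul_cdisc f
  constructor
  · rintro ⟨⟨h1, h2, h3⟩, d, hd, t, ht, htd⟩
    by_cases h0 : (p : ℤ) ∣ f 0
    · right
      have e1 : (p : ℤ) ∣ f 1 := by
        have : f 1 ^ 2 = hA f + f 0 * f 2 := by simp only [hA]; ring
        exact hpi.dvd_of_dvd_pow (this ▸ dvd_add h1 (h0.mul_right _))
      have e2 : (p : ℤ) ∣ f 2 := by
        have : f 2 ^ 2 = hC f + f 1 * f 3 := by simp only [hC]; ring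
        exact hpi.dvd_of_dvd_pow (this ▸ dvd_add h3 (e1.mul_right _))
      obtain ⟨a, ha⟩ := h0
      obtain ⟨b, hb⟩ := e1
      obtain ⟨c, hc⟩ := e2
      have hd' : d = (a * f 3) ^ 2 + p * ((4 * b ^ 3 - 6 * a * b * c) * f 3 +
          p * (4 * a * c ^ 3 - 3 * b ^ 2 * c ^ 2)) := by
        apply mul_left_cancel₀ (pow_ne_zero 2 hp0)
        rw [← hd, cdisc_expand, ha, hb, hc]; ring
      have hnd : ¬ (p : ℤ) ∣ a * f 3 := by
        intro h
        apply ht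
        have : t ^ 2 = (t ^ 2 - d) + ((a * f 3) * (a * f 3) +
          p * ((4 * b ^ 3 - 6 * a * b * c) * f 3 + p * (4 * a * c ^ 3 - 3 * b ^ 2 * c ^ 2))) := by
          rw [hd']; ring
        refine hpi.dvd_of_dvd_pow (n := 2) ?_
        rw [this]
        exact dvd_add htd (dvd_add (h.mul_right _) (dvd_mul_right _ _))
      refine ⟨⟨a, ha⟩, ?_, ⟨b, hb⟩, ⟨c, hc⟩, fun h => hnd (h.mul_left _)⟩
      intro h
      apply hnd
      rw [ha, pow_two] at h
      exact ((mul_dvd_mul_iff_left hp0).mp h).mul_right _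
    · left
      refine ⟨h0, h1, hcov ▸ dvd_sub (h1.mul_left _) (h2.mul_left _), ?_⟩
      rintro ⟨w, hw⟩
      obtain ⟨h, hh⟩ := h1
      apply h0
      rw [hd, hw, hh] at hdisc
      have h4 : f 0 ^ 2 * d = p * (p * w ^ 2 - 4 * h ^ 3) := by
        apply mul_left_cancel₀ (pow_ne_zero 2 hp0)
        linear_combination hdisc
      have h5 : (p : ℤ) ∣ f 0 ^ 2 * d := ⟨_, h4⟩
      rcases hpi.dvd_or_dvd h5 with h6 | h6
      · exact hpi.dvd_of_dvd_pow h6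
      · refine absurd (hpi.dvd_of_dvd_pow (n := 2) ?_) ht
        rw [show t ^ 2 = (t ^ 2 - d) + d by ring]
        exact dvd_add htd h6
  · rintro (⟨h0, h1, h2, h3⟩ | ⟨h0, h0', h1, h2, h3⟩)
    · have e2 : (p : ℤ) ∣ hB f := by
        have : f 0 * hB f = 2 * f 1 * hA f - covU f := by rw [hcov]; ring
        exact (hpi.dvd_or_dvd (this ▸ dvd_sub (h1.mul_left _) h2 : (p : ℤ) ∣ f 0 * hB f)).resolve_left h0
      have e3 : (p : ℤ) ∣ hC f :=
        (hpi.dvd_or_dvd (hsyz ▸ dvd_sub (e2.mul_left _) (h1.mul_right _) :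
          (p : ℤ) ∣ f 0 * hC f)).resolve_left h0
      refine ⟨⟨h1, e2, e3⟩, ?_⟩
      obtain ⟨a, ha⟩ := h1
      obtain ⟨b, hb⟩ := e2
      obtain ⟨c, hc⟩ := e3
      obtain ⟨w, hw⟩ := h2
      refine ⟨b ^ 2 - 4 * a * c, by rw [cdisc, ha, hb, hc]; ring, ?_⟩
      have h4 : f 0 ^ 2 * (b ^ 2 - 4 * a * c) = w ^ 2 - 4 * p * a ^ 3 := by
        apply mul_left_cancel₀ (pow_ne_zero 2 hp0)
        rw [cdisc, hw, ha, hb, hc] at hdisc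
        linear_combination hdisc
      have hcop : IsCoprime (f 0) (p : ℤ) := (hpi.coprime_iff_not_dvd.mpr h0).symm
      obtain ⟨u, v, huv⟩ := hcop
      refine ⟨u * w, ?_, ?_⟩
      · intro h
        rcases hpi.dvd_or_dvd h with h | h
        · exact hpi.not_unit (isUnit_of_dvd_one (huv ▸ dvd_add (h.mul_right _) (dvd_mul_left _ _)))
        · apply h3
          rw [hw, pow_two]
          exact mul_dvd_mul_left _ h
      · refine ⟨4 * a ^ 3 * u ^ 2 - v * (b ^ 2 - 4 * a * c) * (u * f 0 + 1), ?_⟩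
        have h6 : u * f 0 = 1 - v * p := by linear_combination huv
        linear_combination (-u ^ 2) * h4 + (b ^ 2 - 4 * a * c) * (u * f 0 + 1) * huv
    · obtain ⟨a, ha⟩ := h0
      obtain ⟨b, hb⟩ := h1
      obtain ⟨c, hc⟩ := h2
      refine ⟨⟨⟨p * b ^ 2 - p * a * c, by simp only [hA, ha, hb, hc]; ring⟩,
        ⟨p * b * c - a * f 3, by simp only [hB, ha, hb, hc]; ring⟩,
        ⟨p * c ^ 2 - b * f 3, by simp only [hC, hb, hc]; ring⟩⟩,
        (a * f 3) ^ 2 + p * ((4 * b ^ 3 - 6 * a * b * c) * f 3 +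
          p * (4 * a * c ^ 3 - 3 * b ^ 2 * c ^ 2)), ?_, a * f 3, ?_, ?_⟩
      · rw [cdisc_expand, ha, hb, hc]; ring
      · intro h
        rcases hpi.dvd_or_dvd h with h | h
        · apply h0'
          rw [ha, pow_two]
          exact mul_dvd_mul_left _ h
        · exact h3 h
      · exact ⟨-((4 * b ^ 3 - 6 * a * b * c) * f 3 +
          p * (4 * a * c ^ 3 - 3 * b ^ 2 * c ^ 2)), by ring⟩

lemma isUnit_two (hp2 : p ≠ 2) : IsUnit (2 : ZMod (p ^ 2)) := by
  have hp : p.Prime := Fact.out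
  rw [isUnit_iff_redHom, map_ofNat]
  intro h
  have := (natCast_eq_zero_iff 2 p).mp (by exact_mod_cast h)
  exact hp2 ((Nat.prime_dvd_prime_iff_eq hp Nat.prime_two).mp this)

lemma redHom_intCast_eq_zero (x : ℤ) : redHom p 2 (x : ZMod (p ^ 2)) = 0 ↔ (p : ℤ) ∣ x := by
  rw [redHom_intCast, intCast_zmod_eq_zero_iff_dvd]

lemma sq_dvd_iff_cast (x : ℤ) : (x : ZMod (p ^ 2)) = 0 ↔ (p : ℤ) ^ 2 ∣ x := by
  rw [intCast_zmod_eq_zero_iff_dvd]; push_cast; rfl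

lemma hA_redMod (m : ℕ) (f : ℤ⁴) : hA (redMod m f) = ((hA f : ℤ) : ZMod m) := by
  simp [hA, redMod]

lemma covU_redMod (m : ℕ) (f : ℤ⁴) : covU (redMod m f) = ((covU f : ℤ) : ZMod m) := by
  simp [covU, redMod]

lemma ncard_locS_ramified (hT : T ⊆ S) (hp2 : p ≠ 2) (hpT : p ∈ T) :
    (locS S T p).ncard = p ^ 3 * (p - 1) ^ 2 * (p + 1) := by
  have hp : p.Prime := Fact.out
  set Q : Set (Fin 4 → ZMod (p ^ 2)) := {v | redHom p 2 (hA v) = 0 ∧ redHom p 2 (covU v) = 0 ∧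
    covU v ≠ 0} with hQ
  set V : Set (Fin 4 → ZMod (p ^ 2)) := {v |
      v 0 ∈ {x : ZMod (p ^ 2) | redHom p 2 x = 0 ∧ x ≠ 0} ∧
      v 1 ∈ {x : ZMod (p ^ 2) | redHom p 2 x = 0} ∧ v 2 ∈ {x : ZMod (p ^ 2) | redHom p 2 x = 0} ∧
      v 3 ∈ {x : ZMod (p ^ 2) | IsUnit x}} with hV
  have hu : locS S T p = {v | IsUnit (v 0) ∧ v ∈ Q} ∪ V := by
    ext v
    obtain ⟨f, rfl⟩ := redMod_surjective _ v
    rw [redMod_mem_locS hT hp, locE_ramified_iff hT hp2 hpT]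
    simp only [hQ, hV, Set.mem_union, mem_setOf_eq, isUnit_iff_redHom, hA_redMod, covU_redMod, redMod,
      redHom_intCast_eq_zero, sq_dvd_iff_cast, ne_eq]
    tauto
  have hd : Disjoint {v | IsUnit (v 0) ∧ v ∈ Q} V := by
    rw [Set.disjoint_left]
    rintro v ⟨h, -⟩ ⟨h', -⟩
    exact (isUnit_iff_redHom 2 _).mp h h'.1
  have c1 := ncard_unit_forms (isUnit_two hp2) Q
    (fun c e => redHom p 2 c = 0 ∧ redHom p 2 e = 0 ∧ e ≠ 0) (by
      intro v c e hv h3 h4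
      have hφ := (isUnit_iff_redHom 2 _).mp hv
      have h2 := (isUnit_iff_redHom 2 _).mp (isUnit_two hp2)
      simp only [hQ, mem_setOf_eq, h3, h4, map_mul, map_pow, mul_eq_zero, pow_eq_zero_iff,
        hφ, h2, ne_eq, OfNat.ofNat_ne_zero, not_false_eq_true, false_or,
        IsUnit.mul_right_eq_zero ((isUnit_two hp2).mul (hv.pow 3))])
  have c3 : {x : ZMod (p ^ 2) × ZMod (p ^ 2) | redHom p 2 x.1 = 0 ∧ redHom p 2 x.2 = 0 ∧ x.2 ≠ 0}.ncard
      = p * (p - 1) := by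
    have h : {x : ZMod (p ^ 2) × ZMod (p ^ 2) | redHom p 2 x.1 = 0 ∧ redHom p 2 x.2 = 0 ∧ x.2 ≠ 0} =
        {x : ZMod (p ^ 2) | redHom p 2 x = 0} ×ˢ {x : ZMod (p ^ 2) | redHom p 2 x = 0 ∧ x ≠ 0} := rfl
    rw [h, ncard_prod, ncard_ker, ncard_ker_ne_zero]
  rw [c3, ncard_unit, Nat.card_zmod] at c1
  rw [hu, ncard_union_eq hd (toFinite _) (toFinite _), c1, ncard_forms_prod, ncard_unit,
    ncard_ker_ne_zero, ncard_ker]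
  ring

lemma ncard_cusp : {x : ZMod (p ^ 2) × ZMod (p ^ 2) | x.2 ^ 2 = x.1 ^ 3}.ncard =
    p * (p - 1) + p * p := by
  have hp : p.Prime := Fact.out
  have hu : {x : ZMod (p ^ 2) × ZMod (p ^ 2) | x.2 ^ 2 = x.1 ^ 3} =
      {x | IsUnit x.1 ∧ x.2 ^ 2 = x.1 ^ 3} ∪
        {x : ZMod (p ^ 2) | redHom p 2 x = 0} ×ˢ {x : ZMod (p ^ 2) | redHom p 2 x = 0} := by
    ext ⟨c, e⟩
    simp only [mem_setOf_eq, Set.mem_union, Set.mem_prod, isUnit_iff_redHom]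
    constructor
    · intro h
      by_cases hc : redHom p 2 c = 0
      · right
        refine ⟨hc, ?_⟩
        have := congrArg (redHom p 2) h
        simpa [map_pow, hc] using this
      · exact Or.inl ⟨hc, h⟩
    · rintro (h | h)
      · exact h.2
      · rw [pow_two e, pow_succ c 2, pow_two c, mul_eq_zero_of_redHom h.2 h.2,
          mul_eq_zero_of_redHom h.1 h.1, zero_mul]
  have hd : Disjoint {x : ZMod (p ^ 2) × ZMod (p ^ 2) | IsUnit x.1 ∧ x.2 ^ 2 = x.1 ^ 3}
      ({x : ZMod (p ^ 2) | redHom p 2 x = 0} ×ˢ {x : ZMod (p ^ 2) | redHom p 2 x = 0}) := by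
    rw [Set.disjoint_left]
    rintro x ⟨h, -⟩ ⟨h', -⟩
    exact (isUnit_iff_redHom 2 _).mp h h'
  rw [hu, ncard_union_eq hd (toFinite _) (toFinite _), ncard_prod, ncard_ker,
    ← ncard_unit]
  congr 1
  symm
  apply ncard_congr (fun t _ => (t ^ 2, t ^ 3))
  · intro t ht
    exact ⟨IsUnit.pow 2 ht, by ring⟩
  · intro s t hs ht h
    obtain ⟨h2, h3⟩ := Prod.mk.inj h
    apply (IsUnit.pow 2 hs).mul_left_cancel
    linear_combination h3 - t * h2
  · rintro ⟨c, e⟩ ⟨hc, h⟩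
    simp only at hc h
    have he : IsUnit e := by
      rw [isUnit_iff_redHom] at hc ⊢
      intro he
      have := congrArg (redHom p 2) h
      rw [map_pow, map_pow, he] at this
      exact hc (pow_eq_zero_iff (n := 3) (by norm_num) |>.mp (by rw [← this]; ring))
    obtain ⟨u, rfl⟩ := hc
    refine ⟨e * ↑u⁻¹, he.mul (Units.isUnit _), Prod.ext ?_ ?_⟩
    · simp only
      rw [mul_pow, h, ← Units.val_pow_eq_pow_val, ← Units.val_pow_eq_pow_val, ← Units.val_mul]
      congr 1
      group
    · simp only
      rw [mul_pow, pow_succ e 2, h, ← Units.val_pow_eq_pow_val, ← Units.val_pow_eq_pow_val, mul_right_comm,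
        ← Units.val_mul]
      have : u ^ 3 * u⁻¹ ^ 3 = 1 := by group
      rw [this]; simp

lemma ncard_cdisc_eq_zero (hp2 : p ≠ 2) :
    {v : Fin 4 → ZMod (p ^ 2) | cdisc v = 0}.ncard = p ^ 4 * (2 * p ^ 2 - 1) := by
  have hp : p.Prime := Fact.out
  have h2 := isUnit_two hp2
  set K := {x : ZMod (p ^ 2) | redHom p 2 x = 0} with hK
  set U := {x : ZMod (p ^ 2) | IsUnit x} with hU
  set Q := {v : Fin 4 → ZMod (p ^ 2) | cdisc v = 0} with hQ
  set Q1 := {v : Fin 4 → ZMod (p ^ 2) | IsUnit (v 0) ∧ v ∈ Q} with hQ1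
  set Q2 := {v : Fin 4 → ZMod (p ^ 2) | v 0 ∈ K ∧ v 1 ∈ U ∧ v ∈ Q} with hQ2
  set Q3 := {v : Fin 4 → ZMod (p ^ 2) | v 0 ∈ ({0} : Set (ZMod (p ^ 2))) ∧ v 1 ∈ K ∧ v 2 ∈ U ∧
    v 3 ∈ (Set.univ : Set (ZMod (p ^ 2)))} with hQ3
  set Q4 := {v : Fin 4 → ZMod (p ^ 2) | v 0 ∈ K ∧ v 1 ∈ K ∧ v 2 ∈ K ∧
    v 3 ∈ (Set.univ : Set (ZMod (p ^ 2)))} with hQ4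
  have hUK : ∀ x, x ∈ U ↔ x ∉ K := fun x => isUnit_iff_redHom 2 x
  have hkk : ∀ v : Fin 4 → ZMod (p ^ 2), v 0 ∈ K → v 1 ∈ K → cdisc v = 4 * v 0 * v 2 ^ 3 := by
    intro v h0 h1
    have e0 : v 0 ^ 2 = 0 := by rw [pow_two (v 0)]; exact mul_eq_zero_of_redHom h0 h0
    have e1 : v 1 ^ 2 = 0 := by rw [pow_two (v 1)]; exact mul_eq_zero_of_redHom h1 h1
    have e2 : v 0 * v 1 = 0 := mul_eq_zero_of_redHom h0 h1
    rw [cdisc_expand]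
    linear_combination v 3 ^ 2 * e0 + (4 * v 1 * v 3 - 3 * v 2 ^ 2) * e1 - 6 * v 2 * v 3 * e2
  have h4 : IsUnit (4 : ZMod (p ^ 2)) := by
    have := h2.mul h2; norm_num at this; exact this
  have hu : Q = Q1 ∪ (Q2 ∪ (Q3 ∪ Q4)) := by
    ext v
    constructor
    · intro hv
      by_cases h0 : v 0 ∈ K
      · right
        by_cases h1 : v 1 ∈ K
        · right
          by_cases hc : v 2 ∈ K
          · exact Or.inr ⟨h0, h1, hc, trivial⟩
          · left
            have hv' : cdisc v = 0 := hv
            rw [hkk v h0 h1] at hv'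
            have hcu : IsUnit (v 2) := (hUK _).mpr hc
            refine ⟨?_, h1, (hUK _).mpr hc, trivial⟩
            have : (4 * v 2 ^ 3) * v 0 = 0 := by linear_combination hv'
            exact (IsUnit.mul_right_eq_zero (h4.mul (hcu.pow 3))).mp this
        · exact Or.inl ⟨h0, (hUK _).mpr h1, hv⟩
      · exact Or.inl ⟨(hUK _).mpr h0, hv⟩
    · rintro (h | h | ⟨h0, h1, -⟩ | ⟨h0, h1, hc, -⟩)
      · exact h.2
      · exact h.2.2
      · have h0 : v 0 = 0 := h0
        change cdisc v = 0
        rw [hkk v (by rw [h0]; simp [hK]) h1, h0]; ring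
      · change cdisc v = 0
        rw [hkk v h0 h1, pow_succ (v 2) 2, pow_two (v 2), mul_eq_zero_of_redHom hc hc]; ring
  have d1 : Disjoint Q1 (Q2 ∪ (Q3 ∪ Q4)) := by
    rw [Set.disjoint_left]
    rintro v ⟨h, -⟩ h'
    apply (hUK _).mp h
    rcases h' with h' | h' | h'
    · exact h'.1
    · have : v 0 = 0 := h'.1
      rw [this]; simp [hK]
    · exact h'.1
  have d2 : Disjoint Q2 (Q3 ∪ Q4) := by
    rw [Set.disjoint_left]
    rintro v ⟨-, h, -⟩ h'
    apply (hUK _).mp h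
    rcases h' with h' | h'
    · exact h'.2.1
    · exact h'.2.1
  have d3 : Disjoint Q3 Q4 := by
    rw [Set.disjoint_left]
    rintro v ⟨-, -, h, -⟩ h'
    exact (hUK _).mp h h'.2.2.1
  have c1 : Q1.ncard = _ := ncard_unit_forms h2 Q (fun c e => e ^ 2 = c ^ 3) (by
      intro v c e hv h3 h5
      change cdisc v = 0 ↔ _
      rw [cdisc_of_unit hv h3 h5, IsUnit.mul_right_eq_zero ((h2.mul (hv.pow 2)).pow 2), sub_eq_zero])
  have c2 : Q2.ncard = K.ncard * (U.ncard * Nat.card (ZMod (p ^ 2))) := by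
    rw [← ncard_univ, ← ncard_prod, ← ncard_prod]
    have hκ : ∀ a b c : ZMod (p ^ 2), a ∈ K → b ∈ U → IsUnit (4 * b ^ 3 - 6 * a * b * c) := by
      intro a b c ha hb
      have ha : redHom p 2 a = 0 := ha
      rw [isUnit_iff_redHom, map_sub, map_mul, map_mul, map_mul, map_mul, ha]
      have := (isUnit_iff_redHom 2 _).mp (h4.mul (IsUnit.pow 3 hb))
      rw [map_mul] at this
      simpa using this
    have hexp : ∀ v : Fin 4 → ZMod (p ^ 2), v 0 ∈ K → cdisc v =
        (4 * v 1 ^ 3 - 6 * v 0 * v 1 * v 2) * v 3 +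
          (4 * v 0 * v 2 ^ 3 - 3 * v 1 ^ 2 * v 2 ^ 2) := by
      intro v h0
      have e0 : v 0 ^ 2 = 0 := by rw [pow_two (v 0)]; exact mul_eq_zero_of_redHom h0 h0
      rw [cdisc_expand, e0]; ring
    apply ncard_congr (fun v _ => (v 0, v 1, v 2))
    · rintro v ⟨h0, h1, -⟩
      exact ⟨h0, h1, trivial⟩
    · rintro v w ⟨h0, h1, hv⟩ ⟨h0', h1', hw⟩ h
      have e0 : v 0 = w 0 := congrArg (·.1) h
      have e1 : v 1 = w 1 := congrArg (·.2.1) h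
      have e2 : v 2 = w 2 := congrArg (·.2.2) h
      refine form_ext e0 e1 e2 ?_
      have hv : cdisc v = 0 := hv
      have hw : cdisc w = 0 := hw
      rw [hexp _ h0, e0, e1, e2] at hv
      rw [hexp _ h0'] at hw
      apply (hκ _ _ (w 2) h0' h1').mul_left_cancel
      linear_combination hv - hw
    · rintro ⟨a, b, c⟩ ⟨ha, hb, -⟩
      refine ⟨![a, b, c, Ring.inverse (4 * b ^ 3 - 6 * a * b * c) *
        (3 * b ^ 2 * c ^ 2 - 4 * a * c ^ 3)], ⟨ha, hb, ?_⟩, rfl⟩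
      change cdisc _ = 0
      rw [hexp _ ha]
      change (4 * b ^ 3 - 6 * a * b * c) * (Ring.inverse (4 * b ^ 3 - 6 * a * b * c) *
        (3 * b ^ 2 * c ^ 2 - 4 * a * c ^ 3)) + (4 * a * c ^ 3 - 3 * b ^ 2 * c ^ 2) = 0
      rw [Ring.mul_inverse_cancel_left _ _ (hκ a b c ha hb)]; ring
  have c3 : Q3.ncard = 1 * (K.ncard * (U.ncard * Nat.card (ZMod (p ^ 2)))) := by
    rw [hQ3, ncard_forms_prod, ncard_singleton, ncard_univ]
  have c4 : Q4.ncard = K.ncard * (K.ncard * (K.ncard * Nat.card (ZMod (p ^ 2)))) := by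
    rw [hQ4, ncard_forms_prod, ncard_univ]
  rw [hu, ncard_union_eq d1 (toFinite _) (toFinite _),
    ncard_union_eq d2 (toFinite _) (toFinite _),
    ncard_union_eq d3 (toFinite _) (toFinite _), c1, c2, c3, c4, ncard_cusp, ncard_unit,
    ncard_ker, Nat.card_zmod]
  obtain ⟨k, hk⟩ : ∃ k, p = k + 1 := ⟨p - 1, by have := hp.pos; omega⟩
  have : 2 * p ^ 2 - 1 = 2 * k ^ 2 + 4 * k + 1 := by
    rw [hk]
    have : 2 * (k + 1) ^ 2 = 2 * k ^ 2 + 4 * k + 1 + 1 := by ring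
    omega
  rw [this, hk, Nat.add_sub_cancel]
  ring

lemma ncard_locS_generic (hT : T ⊆ S) (hp2 : p ≠ 2) (hpS : p ∉ S) :
    (locS S T p).ncard + p ^ 4 * (2 * p ^ 2 - 1) = p ^ 8 := by
  have hp : p.Prime := Fact.out
  have hc : locS S T p = {v : Fin 4 → ZMod (p ^ 2) | cdisc v = 0}ᶜ := by
    ext v
    obtain ⟨f, rfl⟩ := redMod_surjective _ v
    rw [redMod_mem_locS hT hp]
    simp only [locE, LocD, mem_setOf_eq, if_neg (fun h => hpS (hT h) : p ∉ T), if_neg hp2,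
      if_neg hpS, mem_compl_iff, cdisc_redMod, sq_dvd_iff_cast]
  rw [hc, ← ncard_cdisc_eq_zero hp2, add_comm, ncard_add_ncard_compl, Nat.card_pi]
  simp only [Nat.card_zmod, prod_const, card_univ, Fintype.card_fin]
  ring

end OddPrime

/-- The density of `LocD` at `p`. -/
noncomputable def nuD (S : Finset ℕ) (p : ℕ) : ℝ :=
  if p = 2 then (if 2 ∈ S then 1 / 8 else 3 / 8)
  else if p ∈ S then (1 - 1 / p) / 2 else 1 - 1 / p ^ 2

/-- The density of the local conditions at `p`. -/
lemma locS_density (hT : T ⊆ S) (hp : p.Prime) :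
    ((locS S T p).ncard : ℝ) / (p : ℝ) ^ 8 = (1 - 1 / (p : ℝ) ^ 2) * nuD S p *
      ((if p = 2 then 2 else 1) * if p ∈ T then 2 / (p : ℝ) ^ 2 else 1) := by
  have hF : Fact p.Prime := ⟨hp⟩
  have hp0 : (p : ℝ) ≠ 0 := by exact_mod_cast hp.ne_zero
  by_cases hp2 : p = 2
  · subst hp2
    by_cases hpT : 2 ∈ T
    · rw [ncard_locS_two_of_mem hT hpT]
      simp only [nuD, if_pos (hT hpT), if_pos hpT, if_true]
      norm_num
    · rw [ncard_locS_two hT hpT]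
      simp only [nuD, if_neg hpT, if_true]
      split_ifs <;> norm_num
  · simp only [nuD, if_neg hp2]
    by_cases hpT : p ∈ T
    · rw [ncard_locS_ramified hT hp2 hpT, if_pos hpT, if_pos (hT hpT)]
      push_cast [Nat.cast_sub hp.one_lt.le]
      field_simp
      ring
    · rw [if_neg hpT]
      by_cases hpS : p ∈ S
      · have h := ncard_locS_split hT hp2 hpS hpT
        have h' : (2 * ((locS S T p).ncard : ℝ)) = p ^ 4 * (p * (p - 1) ^ 2 * (p + 1)) := by
          have := congrArg (Nat.cast : ℕ → ℝ) h
          push_cast [Nat.cast_sub hp.one_lt.le] at this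
          exact this
        rw [if_pos hpS, show ((locS S T p).ncard : ℝ) = p ^ 4 * (p * (p - 1) ^ 2 * (p + 1)) / 2 by linarith]
        field_simp
        ring
      · have h := ncard_locS_generic hT hp2 hpS
        have h1 : 1 ≤ 2 * p ^ 2 := by have := pow_pos hp.pos 2; omega
        have h' : ((locS S T p).ncard : ℝ) = p ^ 8 - p ^ 4 * (2 * p ^ 2 - 1) := by
          have := congrArg (Nat.cast : ℕ → ℝ) h
          push_cast [Nat.cast_sub h1] at this
          linarith
        rw [if_neg hpS, h']
        field_simp
        ring

/-! ### Products of local densities -/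

/-- The primes up to `Y`. -/
def primesTo (Y : ℕ) : Finset ℕ := (Finset.Icc 1 Y).filter Nat.Prime

lemma mem_primesTo {Y p : ℕ} : p ∈ primesTo Y ↔ p ≤ Y ∧ p.Prime := by
  simp only [primesTo, mem_filter, Finset.mem_Icc]
  exact ⟨fun h => ⟨h.1.2, h.2⟩, fun h => ⟨⟨h.2.one_lt.le, h.1⟩, h.2⟩⟩

lemma one_sub_inv_sq_pos (hp : p.Prime) : 0 < 1 - 1 / (p : ℝ) ^ 2 := by
  have : (2 : ℝ) ≤ p := by exact_mod_cast hp.two_le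
  rw [sub_pos, div_lt_one (by positivity)]
  nlinarith

lemma tendsto_prod_one_sub_inv_sq :
    Tendsto (fun Y : ℕ => ∏ p ∈ primesTo Y, (1 - 1 / (p : ℝ) ^ 2)) atTop (nhds (6 / Real.pi ^ 2)) := by
  have h := riemannZeta_eulerProduct (s := 2) (by norm_num)
  rw [riemannZeta_two] at h
  have h2 := (Complex.continuous_re.tendsto _).comp ((tendsto_add_atTop_iff_nat 1).mpr h)
  have e : ((Real.pi : ℂ) ^ 2 / 6).re = Real.pi ^ 2 / 6 := by
    have : (Real.pi : ℂ) ^ 2 / 6 = ((Real.pi ^ 2 / 6 : ℝ) : ℂ) := by push_cast; rfl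
    rw [this, ofReal_re]
  rw [e] at h2
  have h3 := h2.inv₀ (by positivity)
  rw [inv_div] at h3
  refine h3.congr fun Y => ?_
  have hset : (Y + 1).primesBelow = primesTo Y := by
    ext p
    rw [Nat.mem_primesBelow, mem_primesTo, Nat.lt_succ_iff]
  simp only [Function.comp, hset]
  have : ∏ p ∈ primesTo Y, (1 - (p : ℂ) ^ (-2 : ℂ))⁻¹ =
      (((∏ p ∈ primesTo Y, (1 - 1 / (p : ℝ) ^ 2))⁻¹ : ℝ) : ℂ) := by
    rw [← Finset.prod_inv_distrib, ofReal_prod]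
    refine prod_congr rfl fun p hp => ?_
    rw [cpow_neg]
    norm_num
  rw [this, ofReal_re, inv_inv]

/-- The density of the integers satisfying `LocD S p` for all primes `p`. -/
noncomputable def phiD (S : Finset ℕ) : ℝ :=
  6 / Real.pi ^ 2 * ∏ p ∈ insert 2 S, nuD S p / (1 - 1 / (p : ℝ) ^ 2)

lemma nuD_pos (S : Finset ℕ) (hp : p.Prime) : 0 < nuD S p := by
  have : (2 : ℝ) ≤ p := by exact_mod_cast hp.two_le
  rw [nuD]
  split_ifs
  · norm_num
  · norm_num
  · have : 1 / (p : ℝ) < 1 := by rw [div_lt_one (by positivity)]; linarith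
    linarith
  · exact one_sub_inv_sq_pos hp

lemma prime_of_mem_insert (hS : ∀ p ∈ S, p.Prime) (hp : p ∈ insert 2 S) :
    p.Prime := by
  rcases Finset.mem_insert.mp hp with rfl | h
  · exact Nat.prime_two
  · exact hS p h

lemma phiD_pos (hS : ∀ p ∈ S, p.Prime) : 0 < phiD S := by
  apply _root_.mul_pos (by positivity)
  exact prod_pos fun p hp => div_pos (nuD_pos S (prime_of_mem_insert hS hp))
    (one_sub_inv_sq_pos (prime_of_mem_insert hS hp))

lemma eventually_subset_primesTo (hS : ∀ p ∈ S, p.Prime) :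
    ∀ᶠ Y in atTop, S ⊆ primesTo Y := by
  filter_upwards [eventually_ge_atTop (S.sup id)] with Y hY p hp
  exact mem_primesTo.mpr ⟨(le_sup (f := id) hp).trans hY, hS p hp⟩

lemma prod_primesTo_ite {Y : ℕ} (h : S ⊆ primesTo Y) (g : ℕ → ℝ)
    (hg : ∀ p, p ∉ S → g p = 1) : ∏ p ∈ primesTo Y, g p = ∏ p ∈ S, g p :=
  (prod_subset h fun p _ hp => hg p hp).symm

lemma tendsto_prod_nuD (hS : ∀ p ∈ S, p.Prime) :
    Tendsto (fun Y : ℕ => ∏ p ∈ primesTo Y, nuD S p) atTop (nhds (phiD S)) := by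
  refine (tendsto_prod_one_sub_inv_sq.mul_const _).congr' ?_
  filter_upwards [eventually_subset_primesTo fun p hp => prime_of_mem_insert hS hp] with Y hY
  rw [prod_subset (f := fun p => nuD S p / (1 - 1 / (p : ℝ) ^ 2)) hY,
    ← prod_mul_distrib]
  · refine prod_congr rfl fun p hp => ?_
    have := one_sub_inv_sq_pos (mem_primesTo.mp hp).2
    field_simp
  · intro p hp hpS
    rw [Finset.mem_insert, not_or] at hpS
    have := one_sub_inv_sq_pos (mem_primesTo.mp hp).2
    rw [nuD, if_neg hpS.1, if_neg hpS.2, div_self this.ne']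

lemma tendsto_locDens (hS : ∀ p ∈ S, p.Prime) (hT : T ⊆ S) :
    Tendsto (locDens (locS S T)) atTop
      (nhds (6 / Real.pi ^ 2 * phiD S * (2 * ∏ p ∈ T, 2 / (p : ℝ) ^ 2))) := by
  refine ((tendsto_prod_one_sub_inv_sq.mul (tendsto_prod_nuD hS)).mul_const _).congr' ?_
  filter_upwards [eventually_subset_primesTo fun p hp => hS p (hT hp),
    eventually_subset_primesTo (S := {2}) (by simp [Nat.prime_two])] with Y hY hY2
  change _ = ∏ p ∈ primesTo Y, _
  rw [prod_congr rfl fun p hp => locS_density hT (mem_primesTo.mp hp).2,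
    prod_mul_distrib, prod_mul_distrib, prod_mul_distrib]
  congr 2
  · rw [prod_primesTo_ite hY2]
    · simp
    · intro p hp
      rw [Finset.mem_singleton] at hp
      rw [if_neg hp]
  · rw [prod_primesTo_ite hY _ fun p hp => if_neg hp]
    exact (prod_congr rfl fun p hp => if_pos hp).symm

lemma sq_dvd_of_not_mem_locS (hT : T ⊆ S) (hp : p.Prime)
    (h : max 2 (S.sup id) < p) (f : ℤ⁴) (hf : redMod (p ^ 2) f ∉ locS S T p) :
    (p : ℤ) ^ 2 ∣ cdisc f := by
  have hpS : p ∉ S := fun hp' => by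
    have := le_sup (f := id) hp'
    simp only [id] at this
    have := le_max_right 2 (S.sup id)
    omega
  have hp2 : p ≠ 2 := by
    have := le_max_left 2 (S.sup id)
    omega
  rw [redMod_mem_locS hT hp] at hf
  simpa only [locE, LocD, mem_setOf_eq, if_neg (fun h => hpS (hT h) : p ∉ T), if_neg hp2,
    if_neg hpS, not_not] using hf

lemma tendsto_irrCls_locS (hS : ∀ p ∈ S, p.Prime) (hT : T ⊆ S) :
    Tendsto (fun X : ℝ => ((irrCls (locForms (locS S T)) X).ncard : ℝ) / X) atTop
      (nhds (3 * (∏ p ∈ T, 2 / (p : ℝ) ^ 2) * phiD S)) := by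
  have h := tendsto_irrCls_locForms (S := locS S T) (fun p hp => locS_inv hT hp)
    (fun p hp h => sq_dvd_of_not_mem_locS hT hp h) (tendsto_locDens hS hT)
  convert h using 2
  have := pi_pos
  field_simp
  ring

/-! ### Counting integers satisfying local conditions -/

/-- The elements of `E` in `(0, X)`. -/
def intsBelow (E : Set ℤ) (X : ℝ) : Set ℤ := {d | d ∈ E ∧ 0 < d ∧ (d : ℝ) < X}

lemma intsBelow_eq (E : Set ℤ) (X : ℝ) :
    intsBelow E X = {d | d ∈ E ∧ d ∈ Finset.Ioc 0 (⌈X⌉ - 1)} := by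
  ext d
  simp only [intsBelow, mem_setOf_eq, Finset.mem_Ioc, Int.le_sub_one_iff, Int.lt_ceil]

lemma intsBelow_finite (E : Set ℤ) (X : ℝ) : (intsBelow E X).Finite := by
  rw [intsBelow_eq]
  exact (finite_toSet (Finset.Ioc 0 (⌈X⌉ - 1))).subset fun d hd => hd.2

lemma abs_max_floor_sub_le {b : ℤ} {v : ℤ} {m : ℕ} (hm : 0 < m) {X : ℝ} (hX : 0 ≤ X)
    (h1 : (b : ℝ) < X) (h2 : X ≤ b + 1) :
    |((max (⌊((b : ℚ) - v) / ((m : ℤ) : ℚ)⌋ - ⌊((0 : ℤ) - v : ℚ) / ((m : ℤ) : ℚ)⌋) 0 : ℤ) : ℝ) - X / m| ≤ 2 := by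
  set s := ⌊((b : ℚ) - v) / ((m : ℤ) : ℚ)⌋ with hs
  set t := ⌊((0 : ℤ) - v : ℚ) / ((m : ℤ) : ℚ)⌋ with ht
  have hm' : (0 : ℝ) < m := by exact_mod_cast hm
  have hm1 : (1 : ℝ) ≤ m := by exact_mod_cast hm
  have f1 : ∀ q : ℚ, ((⌊q⌋ : ℤ) : ℝ) ≤ (q : ℝ) := fun q => by exact_mod_cast Int.floor_le q
  have f2 : ∀ q : ℚ, (q : ℝ) < ((⌊q⌋ : ℤ) : ℝ) + 1 := fun q => by exact_mod_cast Int.lt_floor_add_one q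
  have s1 := f1 (((b : ℚ) - v) / ((m : ℤ) : ℚ))
  have s2 := f2 (((b : ℚ) - v) / ((m : ℤ) : ℚ))
  have t1 := f1 (((0 : ℤ) - v : ℚ) / ((m : ℤ) : ℚ))
  have t2 := f2 (((0 : ℤ) - v : ℚ) / ((m : ℤ) : ℚ))
  rw [← hs] at s1 s2
  rw [← ht] at t1 t2
  push_cast at s1 s2 t1 t2
  have e : ((b : ℝ) - v) / m - (0 - v) / m = b / m := by ring
  have h3 : X / m ≤ b / m + 1 := by
    rw [div_add_one hm'.ne']; gcongr; linarith
  have h4 : (b : ℝ) / m ≤ X / m := by gcongr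
  have h5 : 0 ≤ X / m := by positivity
  push_cast
  rw [abs_le]
  constructor
  · have := le_max_left ((s : ℝ) - t) 0
    linarith
  · have : max ((s : ℝ) - t) 0 ≤ X / m + 2 := max_le (by linarith) (by linarith)
    linarith

lemma abs_ncard_modEq_sub_le {m : ℕ} (hm : 0 < m) (v : ℤ) {X : ℝ} (hX : 0 ≤ X) :
    |(((Finset.Ioc 0 (⌈X⌉ - 1)).filter (fun x => x ≡ v [ZMOD m])).card : ℝ) - X / m| ≤ 2 := by
  have h := Int.Ioc_filter_modEq_card 0 (⌈X⌉ - 1) (r := m) (by exact_mod_cast hm) v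
  have h' : (((Finset.Ioc 0 (⌈X⌉ - 1)).filter (fun x => x ≡ v [ZMOD m])).card : ℝ) =
    ((max (⌊(((⌈X⌉ - 1 : ℤ) : ℚ) - v) / ((m : ℤ) : ℚ)⌋ - ⌊((0 : ℤ) - v : ℚ) / ((m : ℤ) : ℚ)⌋) 0 : ℤ) : ℝ) := by
    rw [← h]; simp
  rw [h']
  apply abs_max_floor_sub_le hm hX
  · push_cast; linarith [Int.ceil_lt_add_one X]
  · push_cast; linarith [Int.le_ceil X]

lemma abs_ncard_resid_sub_le {m : ℕ} (hm : 0 < m) (U : Set (ZMod m)) {X : ℝ} (hX : 0 ≤ X) :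
    |((intsBelow {d | ((d : ℤ) : ZMod m) ∈ U} X).ncard : ℝ) - U.ncard / m * X| ≤ 2 * m := by
  classical
  have : NeZero m := ⟨hm.ne'⟩
  set F := Finset.Ioc 0 (⌈X⌉ - 1) with hF
  set V := U.toFinite.toFinset with hV
  have h1 : intsBelow {d | ((d : ℤ) : ZMod m) ∈ U} X = ↑(F.filter fun d : ℤ => (d : ZMod m) ∈ V) := by
    rw [intsBelow_eq]; ext d; simp [hV, and_comm, hF]
  have h2 : U.ncard = V.card := ncard_eq_toFinset_card _ _
  have h3 : (F.filter fun d : ℤ => (d : ZMod m) ∈ V).card =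
      ∑ u ∈ V, (F.filter fun d : ℤ => (d : ZMod m) = u).card := by
    rw [card_eq_sum_card_fiberwise (f := fun d : ℤ => (d : ZMod m)) (t := V)]
    · refine sum_congr rfl fun u hu => ?_
      congr 1
      ext d
      simp only [mem_filter]
      exact ⟨fun h => ⟨h.1.1, h.2⟩, fun h => ⟨⟨h.1, by rw [h.2]; exact hu⟩, h.2⟩⟩
    · intro d hd
      exact (Finset.mem_filter.mp hd).2
  rw [h1, ncard_coe_finset, h2, h3]
  have h4 : ((∑ u ∈ V, (F.filter fun d : ℤ => (d : ZMod m) = u).card : ℕ) : ℝ) - V.card / m * X =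
      ∑ u ∈ V, (((F.filter fun d : ℤ => (d : ZMod m) = u).card : ℝ) - X / m) := by
    rw [sum_sub_distrib, sum_const, nsmul_eq_mul]; push_cast; ring
  rw [h4]
  refine (abs_sum_le_sum_abs _ _).trans ?_
  have h5 : ∀ u ∈ V, |(((F.filter fun d : ℤ => (d : ZMod m) = u).card : ℝ) - X / m)| ≤ 2 := by
    intro u _
    obtain ⟨v, rfl⟩ := intCast_surjective u
    have := abs_ncard_modEq_sub_le hm v hX
    simpa only [intCast_eq_intCast_iff] using this
  refine (sum_le_card_nsmul _ _ _ h5).trans ?_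
  rw [nsmul_eq_mul, mul_comm]
  have : V.card ≤ m := by
    have := card_le_univ V
    rwa [ZMod.card] at this
  have : (V.card : ℝ) ≤ m := by exact_mod_cast this
  linarith

lemma ncard_sq_dvd_le (hp : 0 < p) {X : ℝ} (hX : 0 ≤ X) :
    ((intsBelow {d | (p : ℤ) ^ 2 ∣ d} X).ncard : ℝ) ≤ X * ((p : ℝ) ^ 2)⁻¹ := by
  have h1 : intsBelow {d | (p : ℤ) ^ 2 ∣ d} X ⊆
      (fun x : ℤ => (p : ℤ) ^ 2 * x) '' ↑(Finset.Icc (1 : ℤ) ⌊X * ((p : ℝ) ^ 2)⁻¹⌋) := by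
    rintro _ ⟨⟨x, rfl⟩, h0, hx⟩
    refine ⟨x, ?_, rfl⟩
    have hp0 : (0 : ℤ) < p ^ 2 := by positivity
    have hp1 : (0 : ℝ) < p ^ 2 := by positivity
    rw [Finset.mem_coe, Finset.mem_Icc, Int.le_floor, ← div_eq_mul_inv, le_div_iff₀ hp1]
    refine ⟨by have := pos_of_mul_pos_right h0 hp0.le; omega, ?_⟩
    push_cast at hx
    linarith
  have h2 := ncard_le_ncard h1 (Set.Finite.image _ (finite_toSet _))
  have h3 := ncard_image_le (f := fun x : ℤ => (p : ℤ) ^ 2 * x)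
    (finite_toSet (Finset.Icc (1 : ℤ) ⌊X * ((p : ℝ) ^ 2)⁻¹⌋))
  rw [ncard_coe_finset, Int.card_Icc] at h3
  have h4 : 0 ≤ ⌊X * ((p : ℝ) ^ 2)⁻¹⌋ := Int.floor_nonneg.mpr (by positivity)
  have h5 : (((intsBelow {d | (p : ℤ) ^ 2 ∣ d} X).ncard : ℤ)) ≤ ⌊X * ((p : ℝ) ^ 2)⁻¹⌋ := by omega
  calc _ ≤ ((⌊X * ((p : ℝ) ^ 2)⁻¹⌋ : ℤ) : ℝ) := by exact_mod_cast h5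
    _ ≤ _ := Int.floor_le _

lemma ncard_sq_dvd_gt_le {X : ℝ} (hX : 0 ≤ X) (Y : ℕ) :
    ((intsBelow {d | ∃ p : ℕ, p.Prime ∧ Y < p ∧ (p : ℤ) ^ 2 ∣ d} X).ncard : ℝ) ≤ X * (2 / (Y + 1)) := by
  set I := Finset.Ioo Y (⌊X⌋₊ + 1) with hI
  have hsub : intsBelow {d | ∃ p : ℕ, p.Prime ∧ Y < p ∧ (p : ℤ) ^ 2 ∣ d} X ⊆
      ⋃ p ∈ I, intsBelow {d | (p : ℤ) ^ 2 ∣ d} X := by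
    rintro d ⟨⟨p, hp, hYp, hd⟩, hpos, hlt⟩
    simp only [mem_iUnion]
    refine ⟨p, ?_, hd, hpos, hlt⟩
    rw [hI, Finset.mem_Ioo]
    refine ⟨hYp, Nat.lt_succ_of_le (Nat.le_floor ?_)⟩
    have h1 := Int.le_of_dvd hpos hd
    have h2 : (p : ℤ) ≤ p ^ 2 := by
      have : (1 : ℤ) ≤ p := by exact_mod_cast hp.one_lt.le
      nlinarith
    have h3 : (p : ℝ) ≤ d := by exact_mod_cast h2.trans h1
    linarith
  have hfin : (⋃ p ∈ I, intsBelow {d | (p : ℤ) ^ 2 ∣ d} X).Finite :=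
    Set.Finite.biUnion (finite_toSet _) fun p _ => intsBelow_finite _ _
  have h1 := (ncard_le_ncard hsub hfin).trans (set_ncard_biUnion_le _ _)
  have h2 : (((intsBelow {d | ∃ p : ℕ, p.Prime ∧ Y < p ∧ (p : ℤ) ^ 2 ∣ d} X).ncard : ℕ) : ℝ) ≤ _ :=
    Nat.cast_le.mpr h1
  push_cast at h2
  refine h2.trans ?_
  calc _ ≤ ∑ p ∈ I, X * ((p : ℝ) ^ 2)⁻¹ := sum_le_sum fun p hp =>
        ncard_sq_dvd_le (by have := (Finset.mem_Ioo.mp hp).1; omega) hX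
    _ = X * ∑ p ∈ I, ((p : ℝ) ^ 2)⁻¹ := by rw [mul_sum]
    _ ≤ _ := by
      gcongr
      exact sum_Ioo_inv_sq_le Y _

/-! ### The density of real quadratic discriminants -/

/-- The exponent of a modulus for `LocD`. -/
def kD (p : ℕ) : ℕ := if p = 2 then 4 else 2

/-- The residues modulo `p ^ k` of the integers satisfying `LocD`. -/
def resD (S : Finset ℕ) (p k : ℕ) : Set (ZMod (p ^ k)) :=
  (fun d : ℤ => (d : ZMod (p ^ k))) '' {d | LocD S p d}

lemma mem_resD_two (d : ℤ) : (d : ZMod (2 ^ 4)) ∈ resD S 2 4 ↔ LocD S 2 d := by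
  refine ⟨?_, fun h => ⟨d, h, rfl⟩⟩
  rintro ⟨e, he, h⟩
  have h2 : (e : ZMod (2 ^ 4)) = d := h
  rw [intCast_eq_intCast_iff_dvd_sub] at h2
  have h3 : (16 : ℤ) ∣ d - e := by exact_mod_cast h2
  have he : LocD S 2 e := he
  simp only [LocD, if_true] at he ⊢
  split_ifs at he ⊢ <;> omega

lemma mem_resD_odd (hp2 : p ≠ 2) (d : ℤ) :
    (d : ZMod (p ^ 2)) ∈ resD S p 2 ↔ LocD S p d := by
  refine ⟨?_, fun h => ⟨d, h, rfl⟩⟩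
  rintro ⟨e, he, h⟩
  have h2 : (e : ZMod (p ^ 2)) = d := h
  rw [intCast_eq_intCast_iff_dvd_sub] at h2
  exact LocD_congr hp2 (by exact_mod_cast h2) he

lemma mem_resD (d : ℤ) :
    (d : ZMod (p ^ kD p)) ∈ resD S p (kD p) ↔ LocD S p d := by
  by_cases hp2 : p = 2
  · subst hp2; exact mem_resD_two d
  · rw [show kD p = 2 from if_neg hp2]; exact mem_resD_odd hp2 d

lemma resD_two_density (S : Finset ℕ) : ((resD S 2 4).ncard : ℝ) / (2 : ℝ) ^ 4 = nuD S 2 := by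
  have hmem : ∀ x : ZMod (2 ^ 4), x ∈ resD S 2 4 ↔ LocD S 2 (x.val : ℤ) := by
    intro x
    rw [← mem_resD_two]
    simp
  by_cases h : 2 ∈ S
  · have : resD S 2 4 = ↑((Finset.univ : Finset (ZMod 16)).filter fun x => (x.val : ℤ) % 8 = 1) := by
      ext x
      rw [hmem]
      simp only [LocD, if_true, if_pos h, coe_filter, Finset.mem_univ, true_and, mem_setOf_eq]
    have h2 : (resD S 2 4).ncard = 2 := by
      rw [this, ncard_coe_finset]; decide +kernel
    rw [h2]; simp only [nuD, if_pos h, if_true]; norm_num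
  · have : resD S 2 4 = ↑((Finset.univ : Finset (ZMod 16)).filter fun x =>
        (x.val : ℤ) % 4 = 1 ∨ (x.val : ℤ) % 16 = 8 ∨ (x.val : ℤ) % 16 = 12) := by
      ext x
      rw [hmem]
      simp only [LocD, if_true, if_neg h, coe_filter, Finset.mem_univ, true_and, mem_setOf_eq]
    have h2 : (resD S 2 4).ncard = 6 := by
      rw [this, ncard_coe_finset]; decide +kernel
    rw [h2]; simp only [nuD, if_neg h, if_true]; norm_num

lemma resD_split_card [Fact p.Prime] (hp2 : p ≠ 2) (hpS : p ∈ S) :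
    2 * (resD S p 2).ncard = p * (p - 1) := by
  have hp : p.Prime := Fact.out
  have h2 : (2 : ZMod p) ≠ 0 := zmod_two_ne_zero hp2
  have hpre : resD S p 2 = redHom p 2 ⁻¹' {x | ∃ t, t ≠ 0 ∧ x = t ^ 2} := by
    ext v
    obtain ⟨d, rfl⟩ := intCast_surjective v
    rw [mem_resD_odd hp2, Set.mem_preimage, redHom_intCast]
    simp only [LocD, mem_setOf_eq, if_neg hp2, if_pos hpS]
    exact exists_sq_modEq_iff _
  have h := ncard_redHom_preimage (p := p) 2 {x | ∃ t, t ≠ 0 ∧ x = t ^ 2}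
  rw [← hpre] at h
  have h3 := ncard_nonzero_sq h2
  rw [Nat.card_zmod] at h3
  apply Nat.eq_of_mul_eq_mul_right hp.pos
  rw [← h3]
  linear_combination 2 * h

lemma resD_generic_card [Fact p.Prime] (hp2 : p ≠ 2) (hpS : p ∉ S) :
    (resD S p 2).ncard + 1 = p ^ 2 := by
  have hp : p.Prime := Fact.out
  have hc : resD S p 2 = {0}ᶜ := by
    ext v
    obtain ⟨d, rfl⟩ := intCast_surjective v
    rw [mem_resD_odd hp2]
    simp only [LocD, if_neg hp2, if_neg hpS, mem_compl_iff, mem_singleton_iff,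
      sq_dvd_iff_cast]
  have h := ncard_add_ncard_compl ({0} : Set (ZMod (p ^ 2)))
  rw [ncard_singleton, Nat.card_zmod, ← hc] at h
  omega

lemma resD_density (hp : p.Prime) :
    ((resD S p (kD p)).ncard : ℝ) / (p : ℝ) ^ kD p = nuD S p := by
  have hF : Fact p.Prime := ⟨hp⟩
  have hp0 : (p : ℝ) ≠ 0 := by exact_mod_cast hp.ne_zero
  by_cases hp2 : p = 2
  · subst hp2; exact_mod_cast resD_two_density S
  · rw [show kD p = 2 from if_neg hp2, nuD, if_neg hp2]
    split_ifs with hpS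
    · have h' : (2 * ((resD S p 2).ncard : ℝ)) = p * (p - 1) := by
        have := congrArg (Nat.cast : ℕ → ℝ) (resD_split_card hp2 hpS)
        push_cast [Nat.cast_sub hp.one_lt.le] at this
        exact this
      rw [show ((resD S p 2).ncard : ℝ) = p * (p - 1) / 2 by linarith]
      field_simp
    · have h' : ((resD S p 2).ncard : ℝ) + 1 = p ^ 2 := by
        exact_mod_cast resD_generic_card hp2 hpS
      rw [show ((resD S p 2).ncard : ℝ) = p ^ 2 - 1 by linarith]
      field_simp

lemma exists_crt_one {M : ℕ → ℕ} (S : ∀ p : ℕ, Set (ZMod (p ^ M p))) (s : Finset ℕ)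
    (hs : ∀ p ∈ s, p.Prime) : ∃ (m : ℕ) (U : Set (ZMod m)), 0 < m ∧
      (∀ q : ℕ, q.Prime → q ∣ m → q ∈ s) ∧
      (∀ d : ℤ, (d : ZMod m) ∈ U ↔ ∀ p ∈ s, (d : ZMod (p ^ M p)) ∈ S p) ∧
      (U.ncard : ℝ) / (m : ℝ) = ∏ p ∈ s, ((S p).ncard : ℝ) / (p : ℝ) ^ M p := by
  classical
  induction s using Finset.induction_on with
  | empty =>
    refine ⟨1, Set.univ, one_pos, fun q hq h => absurd (Nat.dvd_one.mp h) hq.ne_one, by simp, ?_⟩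
    rw [ncard_univ]
    simp
  | insert p s hp ih =>
    obtain ⟨m, U, hm, hd, hU, hc⟩ := ih fun q hq => hs q (Finset.mem_insert_of_mem hq)
    have hpp := hs p (mem_insert_self _ _)
    have hcop : Nat.Coprime (p ^ M p) m :=
      Nat.Coprime.pow_left _ ((Nat.Prime.coprime_iff_not_dvd hpp).mpr fun h => hp (hd p hpp h))
    refine ⟨p ^ M p * m, chineseRemainder hcop ⁻¹' (S p ×ˢ U), by have := hpp.pos; positivity,
      ?_, ?_, ?_⟩
    · exact fun q => mem_insert_of_dvd_pow_mul hpp hd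
    · intro d
      rw [Finset.forall_mem_insert, ← hU, Set.mem_preimage, map_intCast]
      rfl
    · have : (chineseRemainder hcop ⁻¹' (S p ×ˢ U)).ncard = (S p).ncard * U.ncard := by
        rw [← ncard_prod]
        have := ncard_image_of_injective (S p ×ˢ U) (chineseRemainder hcop).symm.injective
        rw [← this]
        congr 1
        exact ((chineseRemainder hcop).toEquiv.image_symm_eq_preimage _).symm
      rw [Finset.prod_insert hp, ← hc, this]
      push_cast
      rw [div_mul_div_comm]

/-- The integers satisfying `LocD S p` for all primes `p`. -/
def goodD (S : Finset ℕ) : Set ℤ := {d | ∀ p : ℕ, p.Prime → LocD S p d}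

theorem tendsto_goodD (hS : ∀ p ∈ S, p.Prime) :
    Tendsto (fun X : ℝ => ((intsBelow (goodD S) X).ncard : ℝ) / X) atTop (nhds (phiD S)) := by
  rw [Metric.tendsto_atTop]
  intro ε hε
  have h1 := (Metric.tendsto_nhds.mp (tendsto_prod_nuD hS) (ε / 4) (by positivity))
  have h2 : Tendsto (fun Y : ℕ => (2 : ℝ) / (Y + 1)) atTop (nhds 0) := by
    have := (tendsto_one_div_add_atTop_nhds_zero_nat (𝕜 := ℝ)).const_mul 2
    simpa [div_eq_mul_inv] using this
  obtain ⟨Y, hY1, hY2, hY3⟩ := (h1.and ((h2.eventually (gt_mem_nhds (show 0 < ε / 4 by positivity))).and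
    (eventually_ge_atTop (max 2 (S.sup id))))).exists
  obtain ⟨m, U, hm, -, hU, hc⟩ := exists_crt_one (M := kD) (fun p => resD S p (kD p)) (primesTo Y)
    fun p hp => (mem_primesTo.mp hp).2
  rw [prod_congr rfl fun p hp => resD_density (mem_primesTo.mp hp).2] at hc
  have hU' : ∀ d : ℤ, (d : ZMod m) ∈ U ↔ ∀ p ∈ primesTo Y, LocD S p d := fun d => by
    rw [hU]; exact forall₂_congr fun p _ => mem_resD d
  refine ⟨max 1 (2 * m / (ε / 4)), fun X hX => ?_⟩
  have hX1 : 1 ≤ X := (le_max_left _ _).trans hX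
  have hX0 : 0 < X := by linarith
  have hX2 : 2 * m ≤ ε / 4 * X := by
    have := (le_max_right _ _).trans hX
    rw [div_le_iff₀ (by positivity)] at this
    linarith
  have a1 := abs_ncard_resid_sub_le hm U hX0.le
  have a2 := ncard_sq_dvd_gt_le hX0.le Y
  have a3 : (intsBelow (goodD S) X).ncard ≤ (intsBelow {d | ((d : ℤ) : ZMod m) ∈ U} X).ncard := by
    refine ncard_le_ncard ?_ (intsBelow_finite _ _)
    rintro d ⟨hd, h⟩
    exact ⟨(hU' d).mpr fun p hp => hd p (mem_primesTo.mp hp).2, h⟩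
  have a4 : (intsBelow {d | ((d : ℤ) : ZMod m) ∈ U} X).ncard ≤ (intsBelow (goodD S) X).ncard +
      (intsBelow {d | ∃ p : ℕ, p.Prime ∧ Y < p ∧ (p : ℤ) ^ 2 ∣ d} X).ncard := by
    refine le_trans (ncard_le_ncard ?_ ((intsBelow_finite _ _).union (intsBelow_finite _ _)))
      (ncard_union_le _ _)
    rintro d ⟨hd, h⟩
    have hd := (hU' d).mp hd
    by_cases hg : d ∈ goodD S
    · exact Or.inl ⟨hg, h⟩
    · right
      refine ⟨?_, h⟩
      simp only [goodD, mem_setOf_eq, not_forall] at hg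
      obtain ⟨p, hp, hl⟩ := hg
      have hpY : Y < p := by
        by_contra hpY
        exact hl (hd p (mem_primesTo.mpr ⟨not_lt.mp hpY, hp⟩))
      refine ⟨p, hp, hpY, ?_⟩
      have hpS : p ∉ S := fun hp' => by
        have := le_sup (f := id) hp'
        simp only [id] at this
        have := le_max_right 2 (S.sup id)
        omega
      have hp2 : p ≠ 2 := by
        have := le_max_left 2 (S.sup id)
        omega
      simpa only [LocD, if_neg hp2, if_neg hpS, not_not] using hl
  have b3 : ((intsBelow (goodD S) X).ncard : ℝ) ≤ (intsBelow {d | ((d : ℤ) : ZMod m) ∈ U} X).ncard := by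
    exact_mod_cast a3
  have b4 : ((intsBelow {d | ((d : ℤ) : ZMod m) ∈ U} X).ncard : ℝ) ≤ (intsBelow (goodD S) X).ncard +
      (intsBelow {d | ∃ p : ℕ, p.Prime ∧ Y < p ∧ (p : ℤ) ^ 2 ∣ d} X).ncard := by
    exact_mod_cast a4
  rw [hc] at a1
  rw [Real.dist_eq] at hY1 ⊢
  rw [abs_lt] at hY1
  rw [abs_le] at a1
  have b5 : X * (2 / (Y + 1)) ≤ X * (ε / 4) := by gcongr
  have c1 : (∏ p ∈ primesTo Y, nuD S p) * X ≤ (phiD S + ε / 4) * X := by gcongr; linarith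
  have c2 : (phiD S - ε / 4) * X ≤ (∏ p ∈ primesTo Y, nuD S p) * X := by gcongr; linarith
  have c3 : 0 < ε * X := by positivity
  rw [abs_lt]
  constructor
  · rw [lt_sub_iff_add_lt, lt_div_iff₀ hX0]
    linarith
  · rw [sub_lt_iff_lt_add, div_lt_iff₀ hX0]
    linarith

/-! ### Coordinates on real quadratic fields -/

/-- `d` is the discriminant of a real quadratic field. -/
class RealFund (d : ℤ) : Prop where
  fund : IsFundamentalDiscriminant d
  pos : 0 < d

lemma exists_int_of_squarefree_mul_sq {m z : ℤ} (hm : Squarefree m) {w : ℚ}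
    (h : (m : ℚ) * w ^ 2 = z) : ∃ k : ℤ, w = k := by
  have hd : (w.den : ℚ) ≠ 0 := by exact_mod_cast w.den_nz
  have h1 : m * w.num ^ 2 = z * (w.den : ℤ) ^ 2 := by
    have : (m : ℚ) * (w.num : ℚ) ^ 2 = z * (w.den : ℚ) ^ 2 := by
      rw [← h, ← Rat.mul_den_eq_num w]; ring
    exact_mod_cast this
  have hc : IsCoprime ((w.den : ℤ) ^ 2) (w.num ^ 2) := by
    refine IsCoprime.pow ?_
    rw [Int.isCoprime_iff_gcd_eq_one, Int.gcd_comm]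
    exact w.reduced
  have h2 : (w.den : ℤ) ^ 2 ∣ m := hc.dvd_of_dvd_mul_right ⟨z, by linarith⟩
  have h3 := hm (w.den : ℤ) (by rwa [← pow_two])
  have h4 : w.den = 1 := by
    rcases Int.isUnit_iff.1 h3 with h | h <;> omega
  exact ⟨w.num, by conv_lhs => rw [← Rat.num_div_den w, h4]
                   simp⟩

lemma RealFund.not_sq {d : ℤ} [h : RealFund d] (w : ℚ) : w ^ 2 ≠ d := by
  intro hw
  have hpos := h.pos
  obtain ⟨k, rfl⟩ := exists_int_of_squarefree_mul_sq (m := 1) (z := d) squarefree_one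
    (w := w) (by simpa using hw)
  have hk : k ^ 2 = d := by exact_mod_cast hw
  rcases h.fund with ⟨h1, ⟨h2, h3⟩ | ⟨m, rfl, h2, h3⟩⟩
  · have := h3 k ⟨1, by rw [← hk]; ring⟩
    rcases Int.isUnit_iff.1 this with rfl | rfl <;> norm_num at hk <;> omega
  · obtain ⟨j, rfl⟩ : (2 : ℤ) ∣ k := Int.prime_two.dvd_of_dvd_pow ⟨2 * m, by rw [hk]; ring⟩
    have hj : j ^ 2 = m := by linarith
    have := h3 j ⟨1, by rw [← hj]; ring⟩
    rcases Int.isUnit_iff.1 this with rfl | rfl <;> norm_num at hj <;> omega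

instance {d : ℤ} [RealFund d] : Fact (∀ r : ℚ, r ^ 2 ≠ (d : ℚ) + 0 * r) :=
  ⟨fun r => by simpa using RealFund.not_sq r⟩

section Quad

variable {d : ℤ} [RealFund d]

/-- The square root of `d` in `ℚ(√d)`. -/
noncomputable def qd (d : ℤ) : Kd d := ⟨sqrtD d, mem_adjoin_simple_self ℚ _⟩

lemma qd_sq (d : ℤ) : qd d * qd d = (d : Kd d) := by
  apply Subtype.ext
  have := sqrtD_sq d
  rw [pow_two] at this
  simpa [qd] using this

/-- The map `u + v√d ↦ u + v√d` from the abstract quadratic algebra. -/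
noncomputable def qlift (d : ℤ) : QuadraticAlgebra ℚ (d : ℚ) 0 →ₐ[ℚ] Kd d :=
  QuadraticAlgebra.lift ⟨qd d, by rw [qd_sq]; simp [Algebra.smul_def]⟩

lemma qlift_mk (u v : ℚ) : qlift d ⟨u, v⟩ = (u : Kd d) + v * qd d := by
  simp [qlift, QuadraticAlgebra.lift, Algebra.smul_def]

lemma qlift_bijective : Function.Bijective (qlift d) := by
  refine ⟨(qlift d).toRingHom.injective, ?_⟩
  rintro ⟨x, hx⟩
  have hx' : x ∈ Algebra.adjoin ℚ {sqrtD d} := by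
    rw [← adjoin_simple_toSubalgebra_of_isAlgebraic]
    · exact hx
    · refine ⟨Polynomial.X ^ 2 - Polynomial.C (d : ℚ), ?_, ?_⟩
      · exact X_pow_sub_C_ne_zero (by norm_num) _
      · simp [sqrtD_sq d]
  have : x ∈ ((Kd d).val.comp (qlift d)).range := by
    refine (Algebra.adjoin_le (S := ((Kd d).val.comp (qlift d)).range) ?_) hx'
    rintro _ rfl
    refine ⟨⟨0, 1⟩, ?_⟩
    change (Kd d).val (qlift d ⟨0, 1⟩) = sqrtD d
    simp [qlift_mk, qd]
  obtain ⟨y, hy⟩ := this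
  exact ⟨y, Subtype.ext hy⟩

/-- The identification of `ℚ(√d)` with the abstract quadratic algebra. -/
noncomputable def qc (d : ℤ) [RealFund d] : Kd d ≃ₐ[ℚ] QuadraticAlgebra ℚ (d : ℚ) 0 :=
  (AlgEquiv.ofBijective (qlift d) qlift_bijective).symm

/-- The rational part. -/
noncomputable def qre (x : Kd d) : ℚ := (qc d x).re
/-- The coefficient of `√d`. -/
noncomputable def qim (x : Kd d) : ℚ := (qc d x).im

lemma qc_lift (y : QuadraticAlgebra ℚ (d : ℚ) 0) : qc d (qlift d y) = y :=
  (AlgEquiv.ofBijective (qlift d) qlift_bijective).symm_apply_apply y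

/-- The element `u + v√d`. -/
noncomputable def qmk (d : ℤ) (u v : ℚ) : Kd d := qlift d ⟨u, v⟩

@[simp] lemma qre_mk (u v : ℚ) : qre (qmk d u v) = u := by simp [qre, qmk, qc_lift]
@[simp] lemma qim_mk (u v : ℚ) : qim (qmk d u v) = v := by simp [qim, qmk, qc_lift]

lemma quad_ext {x y : Kd d} (h : qre x = qre y) (h' : qim x = qim y) : x = y :=
  (qc d).injective (QuadraticAlgebra.ext h h')

@[simp] lemma qre_add (x y : Kd d) : qre (x + y) = qre x + qre y := by simp [qre]
@[simp] lemma qim_add (x y : Kd d) : qim (x + y) = qim x + qim y := by simp [qim]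
@[simp] lemma qre_sub (x y : Kd d) : qre (x - y) = qre x - qre y := by simp [qre]
@[simp] lemma qim_sub (x y : Kd d) : qim (x - y) = qim x - qim y := by simp [qim]
@[simp] lemma qre_neg (x : Kd d) : qre (-x) = -qre x := by simp [qre]
@[simp] lemma qim_neg (x : Kd d) : qim (-x) = -qim x := by simp [qim]
@[simp] lemma qre_mul (x y : Kd d) : qre (x * y) = qre x * qre y + d * qim x * qim y := by
  simp [qre, qim]
@[simp] lemma qim_mul (x y : Kd d) : qim (x * y) = qre x * qim y + qim x * qre y := by
  simp [qre, qim]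
@[simp] lemma qre_zero : qre (0 : Kd d) = 0 := by simp [qre]
@[simp] lemma qim_zero : qim (0 : Kd d) = 0 := by simp [qim]
@[simp] lemma qre_one : qre (1 : Kd d) = 1 := by unfold qre; rw [map_one]; rfl
@[simp] lemma qim_one : qim (1 : Kd d) = 0 := by unfold qim; rw [map_one]; rfl
@[simp] lemma qre_intCast (n : ℤ) : qre (n : Kd d) = n := by simp [qre]
@[simp] lemma qim_intCast (n : ℤ) : qim (n : Kd d) = 0 := by simp [qim]
@[simp] lemma qre_ratCast (r : ℚ) : qre (r : Kd d) = r := by unfold qre; rw [map_ratCast]; rfl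
@[simp] lemma qim_ratCast (r : ℚ) : qim (r : Kd d) = 0 := by unfold qim; rw [map_ratCast]; rfl

/-- The norm of `u + v√d`. -/
noncomputable def nrm (x : Kd d) : ℚ := qre x ^ 2 - d * qim x ^ 2

lemma nrm_mul (x y : Kd d) : nrm (x * y) = nrm x * nrm y := by
  simp only [nrm, qre_mul, qim_mul]; ring

lemma nrm_eq_norm (x : Kd d) : Algebra.norm ℚ x = nrm x := by
  rw [Algebra.norm_eq_of_algEquiv (qc d) x |>.symm, Algebra.norm_apply]
  have := QuadraticAlgebra.det_toLinearMap_eq_norm (qc d x)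
  rw [QuadraticAlgebra.norm_def] at this
  simp only [nrm, qre, qim]
  rw [show LinearMap.det ((Algebra.lmul ℚ _) (qc d x)) = _ from this]
  ring

lemma finrank_Kd : Module.finrank ℚ (Kd d) = 2 := by
  rw [(qc d).toLinearEquiv.finrank_eq, QuadraticAlgebra.finrank_eq_two]

lemma RealFund.four_dvd (d : ℤ) [h : RealFund d] : (4 : ℤ) ∣ d ^ 2 - d := by
  rcases h.fund with ⟨-, ⟨h2, -⟩ | ⟨m, h2, -, -⟩⟩
  · obtain ⟨k, hk⟩ : ∃ k, d = 4 * k + 1 := ⟨d / 4, by omega⟩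
    exact ⟨4 * k ^ 2 + k, by rw [hk]; ring⟩
  · exact ⟨4 * m ^ 2 - m, by rw [h2]; ring⟩

lemma qtrace_eq (x : Kd d) : Algebra.trace ℚ (Kd d) x = 2 * qre x := by
  rw [← Algebra.trace_eq_of_algEquiv (qc d) x,
    Algebra.trace_eq_matrix_trace (QuadraticAlgebra.basis (d : ℚ) 0), Matrix.trace,
    Fin.sum_univ_two]
  simp only [Matrix.diag, Algebra.leftMulMatrix_eq_repr_mul]
  have h0 : QuadraticAlgebra.basis (d : ℚ) 0 0 = ⟨1, 0⟩ := by
    apply (QuadraticAlgebra.basis (d : ℚ) 0).repr.injective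
    ext i; fin_cases i <;> simp [QuadraticAlgebra.basis_repr_apply]
  have h1 : QuadraticAlgebra.basis (d : ℚ) 0 1 = ⟨0, 1⟩ := by
    apply (QuadraticAlgebra.basis (d : ℚ) 0).repr.injective
    ext i; fin_cases i <;> simp [QuadraticAlgebra.basis_repr_apply]
  rw [h0, h1]
  simp [QuadraticAlgebra.basis_repr_apply, qre]
  ring

/-- The integers of `ℚ(√d)` are the `m + k(d + √d)/2`. -/
lemma isInt_iff (x : Kd d) : IsIntegral ℤ x ↔
    ∃ m k : ℤ, qre x = m + k * d / 2 ∧ qim x = k / 2 := by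
  obtain ⟨g, hg⟩ := RealFund.four_dvd d
  have hgq : (d : ℚ) ^ 2 - d = 4 * g := by exact_mod_cast hg
  constructor
  · intro hx
    obtain ⟨t, ht⟩ := IsIntegrallyClosed.isIntegral_iff.1 (Algebra.isIntegral_trace (L := ℚ) hx)
    obtain ⟨n, hn⟩ := IsIntegrallyClosed.isIntegral_iff.1 (Algebra.isIntegral_norm ℚ hx)
    rw [qtrace_eq] at ht
    rw [nrm_eq_norm, nrm] at hn
    simp only [algebraMap_int_eq, eq_intCast] at ht hn
    have hre : qre x = t / 2 := by linarith
    rw [hre] at hn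
    obtain ⟨k, hk, hpar⟩ : ∃ k : ℤ, 2 * qim x = k ∧ (2 : ℤ) ∣ t - k * d := by
      rcases (‹RealFund d›).fund with ⟨-, ⟨h2, h3⟩ | ⟨m, h1, h2, h3⟩⟩
      · obtain ⟨k, hk⟩ := exists_int_of_squarefree_mul_sq (m := d) (z := t ^ 2 - 4 * n) h3
          (w := 2 * qim x) (by push_cast; linarith)
        refine ⟨k, hk, ?_⟩
        have e : d * k ^ 2 = t ^ 2 - 4 * n := by
          have : (d : ℚ) * (k : ℚ) ^ 2 = t ^ 2 - 4 * n := by rw [← hk]; linarith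
          exact_mod_cast this
        rcases Int.even_or_odd' t with ⟨a, rfl | rfl⟩ <;>
        rcases Int.even_or_odd' k with ⟨b, rfl | rfl⟩ <;>
        rcases Int.even_or_odd' d with ⟨c, rfl | rfl⟩ <;> ring_nf at e ⊢ <;> omega
      · have h1q : (d : ℚ) = 4 * m := by exact_mod_cast h1
        obtain ⟨w, hw⟩ := exists_int_of_squarefree_mul_sq (m := m) (z := t ^ 2 - 4 * n) h3
          (w := 4 * qim x) (by rw [h1q] at hn; push_cast; linarith)
        have e : m * w ^ 2 = t ^ 2 - 4 * n := by
          have : (m : ℚ) * (w : ℚ) ^ 2 = t ^ 2 - 4 * n := by rw [← hw]; rw [h1q] at hn; linarith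
          exact_mod_cast this
        have ht2 : (2 : ℤ) ∣ w ∧ (2 : ℤ) ∣ t := by
          have e4 := congrArg (fun z : ℤ => (z : ZMod 4)) e
          have hm4 : (m : ZMod 4) = 2 ∨ (m : ZMod 4) = 3 := by
            rw [show (2 : ZMod 4) = ((2 : ℤ) : ZMod 4) by norm_num,
              show (3 : ZMod 4) = ((3 : ℤ) : ZMod 4) by norm_num,
              intCast_eq_intCast_iff', intCast_eq_intCast_iff']
            omega
          push_cast at e4
          rw [show (4 : ZMod 4) = 0 by decide, zero_mul, sub_zero] at e4
          have key : ∀ a b c : ZMod 4, (a = 2 ∨ a = 3) → a * b ^ 2 = c ^ 2 →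
              2 * b = 0 ∧ 2 * c = 0 := by decide
          have := key _ _ _ hm4 e4
          have h2 : ∀ z : ℤ, (2 : ZMod 4) * z = 0 → (2 : ℤ) ∣ z := by
            intro z hz
            have : ((2 * z : ℤ) : ZMod 4) = 0 := by push_cast; exact hz
            rw [intCast_zmod_eq_zero_iff_dvd] at this
            omega
          exact ⟨h2 _ this.1, h2 _ this.2⟩
        obtain ⟨⟨k, rfl⟩, c, rfl⟩ := ht2
        refine ⟨k, by push_cast at hw; linarith, c - 2 * k * m, by rw [h1]; ring⟩
    obtain ⟨m, hm⟩ := hpar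
    have hmq : (t : ℚ) - k * d = 2 * m := by exact_mod_cast hm
    exact ⟨m, k, by rw [hre]; linarith, by linarith⟩
  · rintro ⟨m, k, h1, h2⟩
    obtain ⟨u, hu⟩ : ∃ u : ℤ, u = 2 * m + k * d := ⟨_, rfl⟩
    obtain ⟨v, hv⟩ : ∃ v : ℤ, v = m ^ 2 + m * k * d + k ^ 2 * g := ⟨_, rfl⟩
    refine ⟨Polynomial.X ^ 2 - Polynomial.C u * Polynomial.X + Polynomial.C v, by monicity!, ?_⟩
    simp only [eval₂_add, eval₂_sub, eval₂_mul,
      eval₂_pow, eval₂_X, eval₂_C, algebraMap_int_eq]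
    simp only [eq_intCast]
    apply quad_ext
    · simp only [qre_add, qre_sub, qre_mul, pow_two, qre_intCast, qim_intCast, h1, h2, qre_zero,
        hu, hv]
      push_cast
      linear_combination (-(k : ℚ) ^ 2 / 4) * hgq
    · simp only [qim_add, qim_sub, qim_mul, qre_mul, pow_two, qre_intCast, qim_intCast, h1, h2,
        qim_zero, hu, hv]
      push_cast
      ring

@[simp] lemma coe_int_Od (d n : ℤ) : (((n : Od d)) : Kd d) = (n : Kd d) :=
  map_intCast (algebraMap (Od d) (Kd d)) n

/-- The generator `(d + √d)/2` of the integers. -/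
noncomputable def om (d : ℤ) [RealFund d] : Od d :=
  ⟨qmk d (d / 2) (1 / 2), (isInt_iff _).2 ⟨0, 1, by simp, by simp⟩⟩

@[simp] lemma qre_om : qre ((om d : Od d) : Kd d) = d / 2 := qre_mk _ _
@[simp] lemma qim_om : qim ((om d : Od d) : Kd d) = 1 / 2 := qim_mk _ _

lemma int_coord (x : Od d) : ∃ m k : ℤ, x = m + k * om d := by
  obtain ⟨m, k, h1, h2⟩ := (isInt_iff (x : Kd d)).1 x.isIntegral_coe
  refine ⟨m, k, ?_⟩
  apply RingOfIntegers.ext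
  push_cast
  apply quad_ext
  · simp [h1]; ring
  · simp [h2]; ring

lemma int_coord_inj {m k m' k' : ℤ} (h : (m + k * om d : Od d) = m' + k' * om d) :
    m = m' ∧ k = k' := by
  have h0 := congrArg (fun x : Od d => (x : Kd d)) h
  push_cast at h0
  have h1 := congrArg qim h0
  have h2 := congrArg qre h0
  simp only [qre_add, qim_add, qre_mul, qim_mul, qre_intCast, qim_intCast, qre_om, qim_om,
    coe_int_Od] at h1 h2
  have e : (k : ℚ) = k' := by linarith
  rw [e] at h2
  have e' : (m : ℚ) = m' := by linarith
  exact ⟨by exact_mod_cast e', by exact_mod_cast e⟩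

lemma om_sq {g : ℤ} (hg : d ^ 2 - d = 4 * g) : om d * om d = d * om d - (g : Od d) := by
  have hgq : (d : ℚ) ^ 2 - d = 4 * g := by exact_mod_cast hg
  apply RingOfIntegers.ext
  push_cast
  apply quad_ext
  · simp; linear_combination -hgq / 4
  · simp; ring

end Quad

/-! ### Cubic forms attached to ideals of real quadratic fields -/

/-- Nonzero or zero fractional ideals of `ℚ(√d)`. -/
abbrev FI (d : ℤ) := FractionalIdeal (Od d)⁰ (Kd d)

section Quad

variable {d : ℤ} [RealFund d] {I : FI d}

/-- Twice the coefficient of `√d`. -/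
noncomputable def tim (x : Kd d) : ℚ := 2 * qim x

/-- The oriented covolume of `ℤα + ℤβ`. -/
noncomputable def wedge (α β : Kd d) : ℚ := 2 * (qre α * qim β - qim α * qre β)

/-- `α, β` span the fractional ideal `I` over `ℤ`. -/
def LatB (I : FI d) (α β : Kd d) : Prop := ∀ x, x ∈ I ↔ ∃ m k : ℤ, x = m * α + k * β

/-- The form `f` represents the trilinear map `(x,y,z) ↦ tim (ωxyz)` on `I`. -/
def FRep (n : ℤ) (f : ℤ⁴) (I : FI d) (ω : Kd d) : Prop :=
  ∃ α β : Kd d, LatB I α β ∧ (f 0 : ℚ) = tim (ω * α ^ 3) ∧ (f 1 : ℚ) = tim (ω * α ^ 2 * β) ∧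
    (f 2 : ℚ) = tim (ω * α * β ^ 2) ∧ (f 3 : ℚ) = tim (ω * β ^ 3) ∧ nrm ω * wedge α β ^ 3 = n

lemma wedge_mul (κ α β : Kd d) : wedge (κ * α) (κ * β) = nrm κ * wedge α β := by
  simp only [wedge, nrm, qre_mul, qim_mul]; ring

lemma LatB.mul {α β : Kd d} (h : LatB I α β) {κ : Kd d} (hκ : κ ≠ 0) :
    LatB (spanSingleton _ κ * I) (κ * α) (κ * β) := by
  intro x
  rw [mem_singleton_mul]
  constructor
  · rintro ⟨y, hy, rfl⟩
    obtain ⟨m, k, rfl⟩ := (h y).1 hy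
    exact ⟨m, k, by ring⟩
  · rintro ⟨m, k, rfl⟩
    exact ⟨m * α + k * β, (h _).2 ⟨m, k, rfl⟩, by ring⟩

lemma FRep.scale {n : ℤ} {ω : Kd d} (h : FRep n f I ω) {κ : Kd d}
    (hκ : κ ≠ 0) : FRep n f (spanSingleton _ κ * I) (ω / κ ^ 3) := by
  obtain ⟨α, β, hI, h0, h1, h2, h3, hn⟩ := h
  refine ⟨κ * α, κ * β, hI.mul hκ, ?_, ?_, ?_, ?_, ?_⟩
  · rw [h0]; congr 1; field_simp
  · rw [h1]; congr 1; field_simp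
  · rw [h2]; congr 1; field_simp
  · rw [h3]; congr 1; field_simp
  · rw [wedge_mul, ← hn]
    have e : nrm ω = nrm (ω / κ ^ 3) * nrm κ ^ 3 := by
      conv_lhs => rw [show ω = ω / κ ^ 3 * (κ * (κ * κ)) by field_simp]
      simp only [nrm_mul]; ring
    rw [e]; ring

lemma LatB.act {α β : Kd d} (h : LatB I α β) {p q r s : ℤ} (hd : p * s - q * r = 1) :
    LatB I (p * α + r * β) (q * α + s * β) := by
  intro x
  have hdK : (p : Kd d) * s - q * r = 1 := by exact_mod_cast hd
  rw [h]
  constructor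
  · rintro ⟨m, k, rfl⟩
    refine ⟨m * s - k * q, k * p - m * r, ?_⟩
    push_cast
    linear_combination (-(m * α) - k * β : Kd d) * hdK
  · rintro ⟨m, k, rfl⟩
    exact ⟨m * p + k * q, m * r + k * s, by push_cast; ring⟩

lemma tim_lin (u v : ℤ) (x y : Kd d) : tim ((u : Kd d) * x + (v : Kd d) * y) = u * tim x + v * tim y := by
  simp [tim]; ring

lemma tim_int_mul (u : ℤ) (x : Kd d) : tim ((u : Kd d) * x) = u * tim x := by
  simp [tim]; ring

lemma tim_add (x y : Kd d) : tim (x + y) = tim x + tim y := by simp [tim]; ring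

lemma wedge_lin (p q r s : ℤ) (α β : Kd d) : wedge ((p : Kd d) * α + (r : Kd d) * β) ((q : Kd d) * α + (s : Kd d) * β) =
    (p * s - q * r) * wedge α β := by
  simp [wedge]; ring

lemma tim_tri (ω α β : Kd d) (m k m' k' m'' k'' : ℤ) :
    tim (ω * ((m : Kd d) * α + (k : Kd d) * β) * ((m' : Kd d) * α + (k' : Kd d) * β) *
      ((m'' : Kd d) * α + (k'' : Kd d) * β)) =
      m * m' * m'' * tim (ω * α ^ 3) +
      (m * m' * k'' + m * k' * m'' + k * m' * m'') * tim (ω * α ^ 2 * β) +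
      (m * k' * k'' + k * m' * k'' + k * k' * m'') * tim (ω * α * β ^ 2) +
      k * k' * k'' * tim (ω * β ^ 3) := by
  rw [show ω * (m * α + k * β) * (m' * α + k' * β) * (m'' * α + k'' * β) =
    ((m * m' * m'' : ℤ) : Kd d) * (ω * α ^ 3) +
      ((m * m' * k'' + m * k' * m'' + k * m' * m'' : ℤ) : Kd d) * (ω * α ^ 2 * β) +
      ((m * k' * k'' + k * m' * k'' + k * k' * m'' : ℤ) : Kd d) * (ω * α * β ^ 2) +
      ((k * k' * k'' : ℤ) : Kd d) * (ω * β ^ 3) by push_cast; ring]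
  simp only [tim_add, tim_int_mul]
  push_cast; ring

/-- Change of basis acts on forms by substitution. -/
lemma rep_basis {ω α β : Kd d} (h0 : (f 0 : ℚ) = tim (ω * α ^ 3))
    (h1 : (f 1 : ℚ) = tim (ω * α ^ 2 * β)) (h2 : (f 2 : ℚ) = tim (ω * α * β ^ 2))
    (h3 : (f 3 : ℚ) = tim (ω * β ^ 3)) (p q r s : ℤ) :
    ((cact p q r s f 0 : ℤ) : ℚ) = tim (ω * ((p : Kd d) * α + (r : Kd d) * β) ^ 3) ∧
    ((cact p q r s f 1 : ℤ) : ℚ) = tim (ω * ((p : Kd d) * α + (r : Kd d) * β) ^ 2 *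
      ((q : Kd d) * α + (s : Kd d) * β)) ∧
    ((cact p q r s f 2 : ℤ) : ℚ) = tim (ω * ((p : Kd d) * α + (r : Kd d) * β) * ((q : Kd d) * α + (s : Kd d) * β) ^ 2) ∧
    ((cact p q r s f 3 : ℤ) : ℚ) = tim (ω * ((q : Kd d) * α + (s : Kd d) * β) ^ 3) := by
  simp only [pow_succ, pow_zero, one_mul, ← mul_assoc, tim_tri]
  simp only [pow_succ, pow_zero, one_mul, ← mul_assoc] at h0 h1 h2 h3
  simp only [← h0, ← h1, ← h2, ← h3, cact_zero, cact_one, cact_two, cact_three]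
  push_cast
  refine ⟨?_, ?_, ?_, ?_⟩ <;> ring

lemma FRep.act {n : ℤ} {ω : Kd d} (h : FRep n f I ω)
    (hg : SLEquiv f g) : FRep n g I ω := by
  obtain ⟨α, β, hI, h0, h1, h2, h3, hn⟩ := h
  obtain ⟨p, q, r, s, hd, rfl⟩ := hg
  obtain ⟨e0, e1, e2, e3⟩ := rep_basis h0 h1 h2 h3 p q r s
  refine ⟨_, _, hI.act hd, e0, e1, e2, e3, ?_⟩
  rw [wedge_lin, ← hn]
  have : (p : ℚ) * s - q * r = 1 := by exact_mod_cast hd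
  rw [this, one_mul]

lemma FRep.equiv {n : ℤ} (hn0 : n ≠ 0) {ω : Kd d} (h : FRep n f I ω)
    (h' : FRep n g I ω) : SLEquiv f g := by
  obtain ⟨α, β, hI, h0, h1, h2, h3, hn⟩ := h
  obtain ⟨α', β', hI', h0', h1', h2', h3', hn'⟩ := h'
  obtain ⟨p, r, rfl⟩ := (hI α').1 ((hI' α').2 ⟨1, 0, by simp⟩)
  obtain ⟨q, s, rfl⟩ := (hI β').1 ((hI' β').2 ⟨0, 1, by simp⟩)
  obtain ⟨e0, e1, e2, e3⟩ := rep_basis h0 h1 h2 h3 p q r s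
  have hnq : (n : ℚ) ≠ 0 := by exact_mod_cast hn0
  have hdet : ((p * s - q * r : ℤ) : ℚ) ^ 3 = 1 := by
    rw [wedge_lin] at hn'
    have : (n : ℚ) * (((p * s - q * r : ℤ) : ℚ) ^ 3 - 1) = 0 := by
      push_cast
      linear_combination hn' - ((p * s - q * r : ℚ) ^ 3) * hn
    rcases mul_eq_zero.1 this with h | h
    · exact absurd h hnq
    · linarith
  have hdet1 : p * s - q * r = 1 := by
    have h3 : (p * s - q * r) ^ 3 = 1 := by exact_mod_cast hdet
    nlinarith [sq_nonneg (p * s - q * r + 1), sq_nonneg (p * s - q * r),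
      sq_nonneg (p * s - q * r - 1)]
  refine ⟨p, q, r, s, hdet1, ?_⟩
  apply form_ext
  · exact_mod_cast h0'.trans e0.symm
  · exact_mod_cast h1'.trans e1.symm
  · exact_mod_cast h2'.trans e2.symm
  · exact_mod_cast h3'.trans e3.symm

/-- The Hessian of a represented form. -/
lemma rep_hess {ω α β : Kd d} (h0 : (f 0 : ℚ) = tim (ω * α ^ 3))
    (h1 : (f 1 : ℚ) = tim (ω * α ^ 2 * β)) (h2 : (f 2 : ℚ) = tim (ω * α * β ^ 2))
    (h3 : (f 3 : ℚ) = tim (ω * β ^ 3)) :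
    ((hA f : ℤ) : ℚ) = nrm ω * wedge α β ^ 2 * nrm α ∧
    ((hB f : ℤ) : ℚ) = nrm ω * wedge α β ^ 2 * (2 * (qre α * qre β - d * qim α * qim β)) ∧
    ((hC f : ℤ) : ℚ) = nrm ω * wedge α β ^ 2 * nrm β := by
  simp only [hA, hB, hC]
  push_cast
  rw [h0, h1, h2, h3]
  simp only [tim, nrm, wedge, pow_succ, pow_zero, one_mul, qim_mul, qre_mul]
  refine ⟨?_, ?_, ?_⟩ <;> ring

/-- Every representation can be normalised. -/
lemma FRep.unique {n : ℤ} (hn0 : n ≠ 0) {I I' : FI d} {ω ω' : Kd d}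
    (h : FRep n f I ω) (h' : FRep n f I' ω') :
    ∃ κ : Kd d, κ ≠ 0 ∧ I' = spanSingleton _ κ * I ∧ ω = ω' * κ ^ 3 := by
  have hnq : (n : ℚ) ≠ 0 := by exact_mod_cast hn0
  have key : ∀ {I : FI d} {ω : Kd d}, FRep n f I ω → ∃ α θ : Kd d, α ≠ 0 ∧
      LatB (spanSingleton _ α⁻¹ * I) 1 θ ∧
      ((hA f : ℤ) : ℚ) * (2 * qre θ) = hB f ∧ ((hA f : ℤ) : ℚ) * (2 * qim θ) = n ∧
      2 * qim (ω * α ^ 3) = f 0 ∧ qre (ω * α ^ 3) * (2 * qim θ) = f 1 - f 0 * qre θ := by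
    intro I ω h
    obtain ⟨α, β, hI, h0, h1, h2, h3, hn⟩ := h
    have hα : α ≠ 0 := by
      rintro rfl
      simp [wedge] at hn
      exact hnq hn.symm
    have hi : α⁻¹ ≠ 0 := inv_ne_zero hα
    have e1 : α⁻¹ * α = 1 := inv_mul_cancel₀ hα
    have hI1 := hI.mul hi
    rw [e1] at hI1
    have g0 : (f 0 : ℚ) = tim (ω * α ^ 3 * 1 ^ 3) := by rw [h0]; congr 1; ring
    have g1 : (f 1 : ℚ) = tim (ω * α ^ 3 * 1 ^ 2 * (α⁻¹ * β)) := by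
      rw [h1]; congr 1; field_simp
    have g2 : (f 2 : ℚ) = tim (ω * α ^ 3 * 1 * (α⁻¹ * β) ^ 2) := by
      rw [h2]; congr 1; field_simp
    have g3 : (f 3 : ℚ) = tim (ω * α ^ 3 * (α⁻¹ * β) ^ 3) := by
      rw [h3]; congr 1; field_simp
    obtain ⟨eA, eB, -⟩ := rep_hess g0 g1 g2 g3
    have hn1 : nrm (ω * α ^ 3) * wedge 1 (α⁻¹ * β) ^ 3 = n := by
      rw [← hn, show wedge α β = nrm α * wedge 1 (α⁻¹ * β) by
        rw [← wedge_mul, mul_one, mul_inv_cancel_left₀ hα]]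
      rw [show ω * α ^ 3 = ω * (α * (α * α)) by ring]
      simp only [nrm_mul]; ring
    simp only [nrm, wedge, qre_one, qim_one] at eA eB hn1
    refine ⟨α, α⁻¹ * β, hα, hI1, ?_, ?_, ?_, ?_⟩
    · rw [eA, eB]; ring
    · rw [eA, ← hn1]; ring
    · rw [g0]; simp [tim]
    · rw [g0, g1]; simp only [one_pow, mul_one, tim, qim_mul (ω * α ^ 3) (α⁻¹ * β)]; ring
  obtain ⟨α, θ, hα, hI, a1, a2, a3, a4⟩ := key h
  obtain ⟨α', θ', hα', hI', b1, b2, b3, b4⟩ := key h'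
  have hA0 : ((hA f : ℤ) : ℚ) ≠ 0 := by rintro h; rw [h, zero_mul] at a2; exact hnq a2.symm
  have hθi : qim θ = qim θ' := by
    have := mul_left_cancel₀ hA0 (a2.trans b2.symm); linarith
  have hθr : qre θ = qre θ' := by
    have := mul_left_cancel₀ hA0 (a1.trans b1.symm); linarith
  have hθ : θ = θ' := quad_ext hθr hθi
  subst hθ
  have hi0 : 2 * qim θ ≠ 0 := by rintro h; rw [h, mul_zero] at a2; exact hnq a2.symm
  have hω : ω * α ^ 3 = ω' * α' ^ 3 := by
    apply quad_ext
    · exact mul_right_cancel₀ hi0 (a4.trans b4.symm)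
    · linarith
  have hII : spanSingleton (Od d)⁰ α⁻¹ * I =
      spanSingleton (Od d)⁰ α'⁻¹ * I' := by
    ext x; rw [hI x, hI' x]
  refine ⟨α' / α, div_ne_zero hα' hα, ?_, ?_⟩
  · rw [div_eq_mul_inv, ← spanSingleton_mul_spanSingleton, mul_assoc, hII,
      ← mul_assoc, spanSingleton_mul_spanSingleton, mul_inv_cancel₀ hα',
      spanSingleton_one, one_mul]
  · field_simp
    linear_combination hω

/-- The basis `1, (d + √d)/2` of the integers. -/
noncomputable def ob (d : ℤ) [RealFund d] : Module.Basis (Fin 2) ℤ (Od d) :=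
  Module.Basis.mk (v := ![1, om d])
    (by
      rw [LinearIndependent.pair_iff]
      intro s t h
      have : (s + t * om d : Od d) = (0 : ℤ) + (0 : ℤ) * om d := by simpa [zsmul_eq_mul] using h
      exact int_coord_inj this)
    (by
      rintro x -
      obtain ⟨m, k, rfl⟩ := int_coord x
      rw [show (m + k * om d : Od d) = m • 1 + k • om d by simp [zsmul_eq_mul]]
      have h : m • (1 : Od d) + k • om d ∈ Submodule.span ℤ {1, om d} :=
        Submodule.mem_span_pair.2 ⟨m, k, rfl⟩
      simpa [Matrix.range_cons, Set.pair_comm] using h)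

lemma finrank_Od : Module.finrank ℤ (Od d) = 2 := by
  rw [Module.finrank_eq_card_basis (ob d), Fintype.card_fin]

lemma det_ob (v : Fin 2 → Kd d) :
    ((ob d).localizationLocalization ℚ ℤ⁰ (Kd d)).det v = wedge (v 0) (v 1) := by
  have hc : ∀ x : Kd d,
      qim x = ((ob d).localizationLocalization ℚ ℤ⁰ (Kd d)).repr x 1 / 2 ∧
      qre x = ((ob d).localizationLocalization ℚ ℤ⁰ (Kd d)).repr x 0 +
        ((ob d).localizationLocalization ℚ ℤ⁰ (Kd d)).repr x 1 * d / 2 := by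
    intro x
    have h := ((ob d).localizationLocalization ℚ ℤ⁰ (Kd d)).sum_repr x
    rw [Fin.sum_univ_two] at h
    simp only [Module.Basis.localizationLocalization_apply, Algebra.smul_def, eq_ratCast] at h
    have h0 : algebraMap (Od d) (Kd d) (ob d 0) = 1 := by simp [ob]
    have h1 : algebraMap (Od d) (Kd d) (ob d 1) = ((om d : Od d) : Kd d) := by simp [ob]
    rw [h0, h1] at h
    constructor
    · conv_lhs => rw [← h]
      simp; ring
    · conv_lhs => rw [← h]
      simp; ring
  rw [Module.Basis.det_apply, Matrix.det_fin_two]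
  simp only [Module.Basis.toMatrix_apply, wedge, (hc _).1, (hc _).2]
  ring

lemma LatB.left_mem {α β : Kd d} (h : LatB I α β) : α ∈ I := (h _).2 ⟨1, 0, by simp⟩
lemma LatB.right_mem {α β : Kd d} (h : LatB I α β) : β ∈ I := (h _).2 ⟨0, 1, by simp⟩

lemma LatB.absNorm {α β : Kd d} (h : LatB I α β) (hw : wedge α β ≠ 0) :
    FractionalIdeal.absNorm I = |wedge α β| := by
  have key : ∀ s t : ℤ, (s : Kd d) * α + (t : Kd d) * β = 0 → s = 0 ∧ t = 0 := by
    intro s t e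
    have e1 := congrArg qre e
    have e2 := congrArg qim e
    simp only [qre_add, qim_add, qre_mul, qim_mul, qre_intCast, qim_intCast, qre_zero,
      qim_zero, mul_zero, zero_mul, add_zero] at e1 e2
    have f1 : (s : ℚ) * wedge α β = 0 := by
      unfold wedge; linear_combination 2 * qim β * e1 - 2 * qre β * e2
    have f2 : (t : ℚ) * wedge α β = 0 := by
      unfold wedge; linear_combination -2 * qim α * e1 + 2 * qre α * e2
    constructor
    · exact_mod_cast (mul_eq_zero.1 f1).resolve_right hw
    · exact_mod_cast (mul_eq_zero.1 f2).resolve_right hw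
  let bI : Module.Basis (Fin 2) ℤ I := Module.Basis.mk
    (v := ![(⟨α, h.left_mem⟩ : I), ⟨β, h.right_mem⟩])
    (by
      rw [LinearIndependent.pair_iff]
      intro s t e
      apply key
      have := congrArg (fun x : I => (x : Kd d)) e
      simpa [zsmul_eq_mul] using this)
    (by
      rintro ⟨x, hx⟩ -
      obtain ⟨m, k, rfl⟩ := (h x).1 hx
      rw [Matrix.range_cons, Matrix.range_cons, Matrix.range_empty, Set.union_empty,
        Set.singleton_union]
      exact Submodule.mem_span_pair.2 ⟨m, k, by apply Subtype.ext; simp [zsmul_eq_mul]⟩)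
  rw [← abs_det_basis_change (ob d) I bI, det_ob]
  simp [bI]

lemma exists_LatB (I : (FI d)ˣ) : ∃ α β, LatB (I : FI d) α β ∧ wedge α β ≠ 0 := by
  have hcard : Nat.card (Module.Free.ChooseBasisIndex ℤ I) = 2 := by
    rw [Nat.card_eq_fintype_card, ← Module.finrank_eq_card_basis (basisOfFractionalIdeal _ I),
      finrank_Kd]
  let e : Module.Free.ChooseBasisIndex ℤ I ≃ Fin 2 := Finite.equivFinOfCardEq hcard
  let b := (basisOfFractionalIdeal (Kd d) I).reindex e
  refine ⟨b 0, b 1, ?_, ?_⟩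
  · intro x
    have h := mem_span_basisOfFractionalIdeal (Kd d) (I := I) (x := x)
    have hr : Set.range (basisOfFractionalIdeal (Kd d) I) = {b 0, b 1} := by
      rw [← Module.Basis.range_reindex _ e]
      ext y
      simp only [Set.mem_range, Fin.exists_fin_two, mem_insert_iff, mem_singleton_iff,
        eq_comm (a := y)]
      rfl
    rw [hr, Submodule.mem_span_pair] at h
    simp only [zsmul_eq_mul, eq_comm (b := x)] at h
    exact h.symm
  · have hu := b.isUnit_det ((ob d).localizationLocalization ℚ ℤ⁰ (Kd d))
    have := ((ob d).localizationLocalization ℚ ℤ⁰ (Kd d)).isUnit_det b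
    rw [det_ob] at this
    exact this.ne_zero

lemma om_mul_mem {x : Kd d} (hx : x ∈ I) : ((om d : Od d) : Kd d) * x ∈ I := by
  have := Submodule.smul_mem (I : Submodule (Od d) (Kd d)) (om d) hx
  rwa [Algebra.smul_def] at this

lemma isIntegral_of_tim {x : Kd d} {u v : ℤ} (h1 : tim x = u)
    (h2 : tim (((om d : Od d) : Kd d) * x) = v) : IsIntegral ℤ x := by
  rw [isInt_iff]
  simp only [tim, qim_mul, qre_om, qim_om] at h1 h2
  refine ⟨v - u * d, u, ?_, by linarith⟩
  push_cast
  rw [← h1, ← h2]; ring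

/-- Properties of represented forms. -/
lemma FRep.good {n : ℤ} (hn0 : 0 < n) {ω : Kd d} (h : FRep n f I ω) :
    HessDvd n f ∧ cdisc f = n ^ 2 * d ∧ ω ≠ 0 ∧ I ≠ 0 ∧
      spanSingleton _ ω * I ^ 3 ≤ 1 ∧
      FractionalIdeal.absNorm (spanSingleton (Od d)⁰ ω * I ^ 3) = n := by
  obtain ⟨α, β, hI, h0, h1, h2, h3, hn⟩ := h
  have hnq : (n : ℚ) ≠ 0 := by exact_mod_cast hn0.ne'
  have hw : wedge α β ≠ 0 := by rintro e; rw [e] at hn; simp at hn; exact hnq hn.symm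
  have hα : α ≠ 0 := by rintro rfl; exact hw (by simp [wedge])
  have hω : ω ≠ 0 := by rintro rfl; simp [nrm] at hn; exact hnq hn.symm
  have hI0 : I ≠ 0 := by
    rintro rfl; exact hα ((mem_zero_iff _).1 hI.left_mem)
  obtain ⟨m, k, e1⟩ := (hI _).1 (om_mul_mem hI.left_mem)
  obtain ⟨m', k', e2⟩ := (hI _).1 (om_mul_mem hI.right_mem)
  have e1r := congrArg qre e1
  have e1i := congrArg qim e1
  have e2r := congrArg qre e2
  have e2i := congrArg qim e2
  simp only [qre_add, qim_add, qre_mul, qim_mul, qre_intCast, qim_intCast, qre_om, qim_om,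
    mul_zero, zero_mul, add_zero] at e1r e1i e2r e2i
  have n1 : nrm α = k * wedge α β := by
    unfold nrm wedge; linear_combination 2 * qre α * e1i - 2 * qim α * e1r
  have n2 : nrm β = -m' * wedge α β := by
    unfold nrm wedge; linear_combination 2 * qre β * e2i - 2 * qim β * e2r
  have n3 : 2 * (qre α * qre β - d * qim α * qim β) = (2 * k' - d) * wedge α β := by
    unfold wedge; linear_combination 4 * (qre α * e2i - qim α * e2r)
  obtain ⟨gA, gB, gC⟩ := rep_hess h0 h1 h2 h3
  rw [n1] at gA
  rw [n3] at gB
  rw [n2] at gC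
  have hhA : hA f = n * k := by
    have : ((hA f : ℤ) : ℚ) = n * k := by rw [gA, ← hn]; ring
    exact_mod_cast this
  have hhB : hB f = n * (2 * k' - d) := by
    have : ((hB f : ℤ) : ℚ) = n * (2 * k' - d) := by rw [gB, ← hn]; ring
    exact_mod_cast this
  have hhC : hC f = n * -m' := by
    have : ((hC f : ℤ) : ℚ) = n * -m' := by rw [gC, ← hn]; ring
    exact_mod_cast this
  have htr : ∀ x ∈ I, ∀ y ∈ I, ∀ z ∈ I, ∃ u : ℤ, tim (ω * x * y * z) = u := by
    intro x hx y hy z hz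
    obtain ⟨a, b, rfl⟩ := (hI _).1 hx
    obtain ⟨a', b', rfl⟩ := (hI _).1 hy
    obtain ⟨a'', b'', rfl⟩ := (hI _).1 hz
    rw [tim_tri, ← h0, ← h1, ← h2, ← h3]
    exact ⟨a * a' * a'' * f 0 + (a * a' * b'' + a * b' * a'' + b * a' * a'') * f 1 +
      (a * b' * b'' + b * a' * b'' + b * b' * a'') * f 2 + b * b' * b'' * f 3, by push_cast; ring⟩
  refine ⟨⟨⟨k, hhA⟩, ⟨_, hhB⟩, ⟨_, hhC⟩⟩, ?_, hω, hI0, ?_, ?_⟩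
  · have : ((cdisc f : ℤ) : ℚ) = n ^ 2 * d := by
      unfold cdisc
      push_cast
      rw [gA, gB, gC, ← hn]
      have hid : ((2 * k' - d) * wedge α β) ^ 2 - 4 * (k * wedge α β) * (-m' * wedge α β) =
          d * wedge α β ^ 2 := by
        rw [← n1, ← n2, ← n3]; unfold nrm wedge; ring
      linear_combination nrm ω ^ 2 * wedge α β ^ 4 * hid
    exact_mod_cast this
  · rw [FractionalIdeal.mul_le]
    intro w hw x hx
    obtain ⟨c, rfl⟩ := (mem_spanSingleton _).1 hw
    have hle : I ^ 3 ≤ spanSingleton (Od d)⁰ ω⁻¹ := by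
      rw [pow_succ, pow_two, FractionalIdeal.mul_le]
      intro y hy z hz
      have : I * I ≤ spanSingleton (Od d)⁰ (ω * z)⁻¹ ∨ z = 0 := by
        by_cases hz0 : z = 0
        · exact Or.inr hz0
        left
        rw [FractionalIdeal.mul_le]
        intro x1 hx1 x2 hx2
        obtain ⟨u, hu⟩ := htr x1 hx1 x2 hx2 z hz
        obtain ⟨v, hv⟩ := htr _ (om_mul_mem hx1) x2 hx2 z hz
        have hint := isIntegral_of_tim hu (v := v) (by rw [← hv]; congr 1; ring)
        rw [mem_spanSingleton]
        refine ⟨⟨_, hint⟩, ?_⟩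
        change (ω * x1 * x2 * z) * _ = _
        field_simp
      rcases this with hh | rfl
      · obtain ⟨c, rfl⟩ := (mem_spanSingleton _).1 (hh hy)
        rw [mem_spanSingleton]
        by_cases hz0 : z = 0
        · exact ⟨0, by simp [hz0]⟩
        refine ⟨c, ?_⟩
        simp only [Algebra.smul_def]
        field_simp
      · rw [mul_zero]; exact zero_mem _
    obtain ⟨c', rfl⟩ := (mem_spanSingleton _).1 (hle hx)
    rw [mem_one_iff]
    refine ⟨c * c', ?_⟩
    simp only [Algebra.smul_def, map_mul]
    field_simp
  · rw [map_mul, map_pow, FractionalIdeal.absNorm_span_singleton, nrm_eq_norm, hI.absNorm hw,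
      ← abs_pow, ← abs_mul, hn, abs_of_pos (by exact_mod_cast hn0)]

/-- Existence of a represented form. -/
lemma exists_FRep {n : ℤ} {I : (FI d)ˣ} {ω : Kd d}
    (h1 : spanSingleton _ ω * (I : FI d) ^ 3 ≤ 1)
    (h2 : FractionalIdeal.absNorm (spanSingleton (Od d)⁰ ω * (I : FI d) ^ 3) = n) :
    ∃ f, FRep n f I ω := by
  have key : ∀ α β, LatB (I : FI d) α β → nrm ω * wedge α β ^ 3 = n → ∃ f, FRep n f I ω := by
    intro α β hI hn
    have hint : ∀ x ∈ (I : FI d), ∀ y ∈ (I : FI d), ∀ z ∈ (I : FI d),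
        ∃ u : ℤ, (u : ℚ) = tim (ω * (x * y * z)) := by
      intro x hx y hy z hz
      have : ω * (x * y * z) ∈ (1 : FI d) := by
        refine h1 (FractionalIdeal.mul_mem_mul (mem_spanSingleton_self _ _) ?_)
        rw [pow_succ, pow_two]
        exact FractionalIdeal.mul_mem_mul (FractionalIdeal.mul_mem_mul hx hy) hz
      obtain ⟨c, hc⟩ := (mem_one_iff _).1 this
      rw [← hc]
      obtain ⟨m, k, -, hk⟩ := (isInt_iff _).1 c.isIntegral_coe
      exact ⟨k, by unfold tim; rw [show algebraMap (Od d) (Kd d) c = (c : Kd d) from rfl, hk]; ring⟩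
    have ha := hI.left_mem
    have hb := hI.right_mem
    obtain ⟨f0, g0⟩ := hint α ha α ha α ha
    obtain ⟨f1, g1⟩ := hint α ha α ha β hb
    obtain ⟨f2, g2⟩ := hint α ha β hb β hb
    obtain ⟨f3, g3⟩ := hint β hb β hb β hb
    refine ⟨![f0, f1, f2, f3], α, β, hI, ?_, ?_, ?_, ?_, hn⟩
    · refine g0.trans ?_; congr 1; ring
    · refine g1.trans ?_; congr 1; ring
    · refine g2.trans ?_; congr 1; ring
    · refine g3.trans ?_; congr 1; ring
  obtain ⟨α, β, hI, hw⟩ := exists_LatB I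
  rw [map_mul, map_pow, FractionalIdeal.absNorm_span_singleton, nrm_eq_norm, hI.absNorm hw,
      ← abs_pow, ← abs_mul] at h2
  rcases abs_choice (nrm ω * wedge α β ^ 3) with h | h
  · exact key α β hI (by rw [← h2, h])
  · refine key α (-β) ?_ ?_
    · intro x
      rw [hI x]
      constructor
      · rintro ⟨m, k, rfl⟩; exact ⟨m, -k, by push_cast; ring⟩
      · rintro ⟨m, k, rfl⟩; exact ⟨m, -k, by push_cast; ring⟩
    · rw [← h2, h]; simp only [wedge, qre_neg, qim_neg]; ring

/-- Every form with content-`n` Hessian and discriminant `n²d` is represented. -/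
lemma exists_rep_of_good {n : ℤ} (hn : 0 < n) (hf : HessDvd n f)
    (hd : cdisc f = n ^ 2 * d) : ∃ (I : FI d) (ω : Kd d), FRep n f I ω := by
  obtain ⟨⟨A, gA⟩, ⟨B, gB⟩, ⟨C, gC⟩⟩ := hf
  have hdisc : B ^ 2 - 4 * A * C = d := by
    unfold cdisc at hd
    rw [gA, gB, gC] at hd
    have hn2 : n ^ 2 ≠ 0 := by positivity
    apply mul_left_cancel₀ hn2
    linear_combination hd
  have hA0 : A ≠ 0 := by
    rintro rfl
    apply RealFund.not_sq (d := d) (B : ℚ)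
    exact_mod_cast (by simpa using hdisc : B ^ 2 = d)
  have hAq : (A : ℚ) ≠ 0 := by exact_mod_cast hA0
  have hAK : (A : Kd d) ≠ 0 := by
    intro h
    have := congrArg qre h
    simp at this; exact hA0 this
  obtain ⟨t, ht⟩ : ∃ t, d - B = 2 * t := by
    obtain ⟨g, hg⟩ := RealFund.four_dvd d
    have h4 : (d - B) * (d + B) = 4 * (g - A * C) := by linear_combination hg - hdisc
    have hev : Even ((d - B) * (d + B)) := ⟨2 * (g - A * C), by rw [h4]; ring⟩
    rcases Int.even_mul.1 hev with ⟨s, hs⟩ | ⟨s, hs⟩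
    · exact ⟨s, by omega⟩
    · exact ⟨s - B, by omega⟩
  have hdq : (B : ℚ) ^ 2 - 4 * A * C = d := by exact_mod_cast hdisc
  have htq : (d : ℚ) - B = 2 * t := by exact_mod_cast ht
  set θ : Kd d := qmk d (B / (2 * A)) (1 / (2 * A)) with hθ
  set ω : Kd d := qmk d (f 1 * A - f 0 * B / 2) (f 0 / 2) with hω
  have r1 : (A : Kd d) * (θ * θ) = B * θ - C := by
    apply quad_ext
    · simp only [hθ, qre_mul, qre_sub, qre_mk, qim_mk, qre_intCast, qim_intCast, qim_mul]
      field_simp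
      linear_combination (-A : ℚ) * hdq
    · simp only [hθ, qim_mul, qim_sub, qre_mk, qim_mk, qre_intCast, qim_intCast, qre_mul]
      field_simp
      ring
  have r2 : ((om d : Od d) : Kd d) = (t : Kd d) + A * θ := by
    apply quad_ext
    · simp only [hθ, qre_mul, qre_add, qre_mk, qim_mk, qre_intCast, qim_intCast, qre_om]
      field_simp
      linear_combination (A : ℚ) * htq
    · simp only [hθ, qim_mul, qim_add, qre_mk, qim_mk, qre_intCast, qim_intCast, qim_om]
      field_simp
      ring
  have r3 : ((om d : Od d) : Kd d) * θ = ((t + B : ℤ) : Kd d) * θ - C := by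
    rw [r2]; push_cast; linear_combination r1
  have s1 : (f 0 : ℚ) * C - f 1 * B + f 2 * A = 0 := by
    have : n * (f 0 * C - f 1 * B + f 2 * A) = 0 := by
      have : n * (f 0 * C - f 1 * B + f 2 * A) = f 0 * (n * C) - f 1 * (n * B) + f 2 * (n * A) := by ring
      rw [this, ← gA, ← gB, ← gC]; unfold hA hB hC; ring
    exact_mod_cast (mul_eq_zero.1 this).resolve_left hn.ne'
  have s2 : (f 1 : ℚ) * C - f 2 * B + f 3 * A = 0 := by
    have : n * (f 1 * C - f 2 * B + f 3 * A) = 0 := by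
      have : n * (f 1 * C - f 2 * B + f 3 * A) = f 1 * (n * C) - f 2 * (n * B) + f 3 * (n * A) := by ring
      rw [this, ← gA, ← gB, ← gC]; unfold hA hB hC; ring
    exact_mod_cast (mul_eq_zero.1 this).resolve_left hn.ne'
  have t0 : tim ω = f 0 := by simp only [tim, hω, qim_mk]; ring
  have t1 : tim (ω * θ) = f 1 := by
    simp only [tim, hω, hθ, qim_mul, qre_mk, qim_mk]
    field_simp; ring
  have t2 : tim (ω * (θ * θ)) = f 2 := by
    have h : (A : ℚ) * tim (ω * (θ * θ)) = B * tim (ω * θ) - C * tim ω := by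
      rw [← tim_int_mul, show (A : Kd d) * (ω * (θ * θ)) = (B : Kd d) * (ω * θ) + ((-C : ℤ) : Kd d) * ω by
        push_cast; linear_combination ω * r1, tim_lin]
      push_cast; ring
    apply mul_left_cancel₀ hAq
    rw [h, t0, t1]; linear_combination -s1
  have t3 : tim (ω * (θ * θ * θ)) = f 3 := by
    have h : (A : ℚ) * tim (ω * (θ * θ * θ)) = B * tim (ω * (θ * θ)) - C * tim (ω * θ) := by
      rw [← tim_int_mul, show (A : Kd d) * (ω * (θ * θ * θ)) =
        (B : Kd d) * (ω * (θ * θ)) + ((-C : ℤ) : Kd d) * (ω * θ) by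
        push_cast; linear_combination ω * θ * r1, tim_lin]
      push_cast; ring
    apply mul_left_cancel₀ hAq
    rw [h, t1, t2]; linear_combination -s2
  refine ⟨1 + spanSingleton _ θ, ω, 1, θ, ?_, ?_, ?_, ?_, ?_, ?_⟩
  · intro x
    rw [← FractionalIdeal.mem_coe, FractionalIdeal.coe_add, Submodule.add_eq_sup, Submodule.mem_sup]
    constructor
    · rintro ⟨y, hy, z, hz, rfl⟩
      obtain ⟨u, rfl⟩ := (mem_one_iff _).1 hy
      obtain ⟨v, rfl⟩ := (mem_spanSingleton _).1 hz
      obtain ⟨m, k, rfl⟩ := int_coord u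
      obtain ⟨m', k', rfl⟩ := int_coord v
      refine ⟨m + k * t - k' * C, m' + k * A + k' * (t + B), ?_⟩
      change ((m + k * om d : Od d) : Kd d) + ((m' + k' * om d : Od d) : Kd d) * θ = _
      simp only [map_add, map_mul, coe_int_Od]
      push_cast at r3 ⊢
      linear_combination (k : Kd d) * r2 + (k' : Kd d) * r3
    · rintro ⟨m, k, rfl⟩
      refine ⟨(m : Kd d) * 1, (mem_one_iff _).2 ⟨(m : Od d), by simp⟩, (k : Kd d) * θ,
        (mem_spanSingleton _).2 ⟨(k : Od d), by simp [Algebra.smul_def]⟩, rfl⟩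
  · rw [one_pow, mul_one, t0]
  · rw [one_pow, mul_one, t1]
  · rw [mul_one, pow_two, t2]
  · rw [pow_succ, pow_two, t3]
  · have e1 : wedge (1 : Kd d) θ = 1 / A := by
      simp only [wedge, hθ, qre_one, qim_one, qre_mk, qim_mk]; field_simp; ring
    have e2 : nrm ω = n * A ^ 3 := by
      have gA' : (f 1 : ℚ) ^ 2 - f 0 * f 2 = n * A := by
        rw [hA] at gA; exact_mod_cast gA
      simp only [nrm, hω, qre_mk, qim_mk]
      rw [← hdq]
      linear_combination (A : ℚ) * f 0 * s1 + (A : ℚ) ^ 2 * gA'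
    rw [e1, e2]; field_simp

end Quad

lemma units_cube_index (K : Type*) [Field K] [NumberField K] (hr : Units.rank K = 1)
    (h3K : ∀ x : K, x ^ 3 = 1 → x = 1) : (powMonoidHom 3 : (𝓞 K)ˣ →* (𝓞 K)ˣ).range.index = 3 := by
  have i0 : Fin (Units.rank K) := ⟨0, by rw [hr]; norm_num⟩
  have hi : ∀ i, i = i0 := by
    have : Subsingleton (Fin (Units.rank K)) := by rw [hr]; infer_instance
    exact fun i => Subsingleton.elim _ _
  have hp : ∀ e : Fin (Units.rank K) → ℤ,
      ∏ i, Units.fundSystem K i ^ e i = Units.fundSystem K i0 ^ e i0 := by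
    intro e
    rw [prod_eq_single i0]
    · intro j _ hj; exact absurd (hi j) hj
    · simp
  choose ζe hζe huniq using Units.exist_unique_eq_mul_prod K
  simp only [hp] at hζe huniq
  have hu : ∀ (u : (𝓞 K)ˣ) (ζ : Units.torsion K) (k : ℤ), u = ζ * Units.fundSystem K i0 ^ k →
      (ζe u).2 i0 = k := by
    intro u ζ k h
    have := huniq u (ζ, fun _ => k) h
    rw [← this]
  let χ : (𝓞 K)ˣ →* Multiplicative (ZMod 3) :=
    MonoidHom.mk' (fun u => Multiplicative.ofAdd (((ζe u).2 i0 : ℤ) : ZMod 3)) (by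
      intro u v
      rw [hu (u * v) ((ζe u).1 * (ζe v).1) ((ζe u).2 i0 + (ζe v).2 i0), Int.cast_add, ofAdd_add]
      rw [zpow_add, Subgroup.coe_mul]
      nth_rw 1 [hζe u, hζe v]
      exact mul_mul_mul_comm _ _ _ _)
  have hχ : ∀ u, χ u = Multiplicative.ofAdd (((ζe u).2 i0 : ℤ) : ZMod 3) := fun u => rfl
  have hsurj : Function.Surjective χ := by
    intro y
    obtain ⟨k, hk⟩ := intCast_surjective y.toAdd
    refine ⟨Units.fundSystem K i0 ^ k, ?_⟩
    rw [hχ, hu _ 1 k (by simp), hk]; rfl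
  have hker : χ.ker = (powMonoidHom 3 : (𝓞 K)ˣ →* (𝓞 K)ˣ).range := by
    ext u
    rw [MonoidHom.mem_ker, MonoidHom.mem_range]
    constructor
    · intro h
      rw [hχ, ofAdd_eq_one, intCast_zmod_eq_zero_iff_dvd] at h
      obtain ⟨k, hk⟩ := h
      have hinj : Function.Injective (powMonoidHom 3 : Units.torsion K →* Units.torsion K) := by
        rw [injective_iff_map_eq_one]
        intro z hz
        have h2 : (((z : (𝓞 K)ˣ) : 𝓞 K) : K) ^ 3 = 1 := by
          have := congrArg (fun z : Units.torsion K => (((z : (𝓞 K)ˣ) : 𝓞 K) : K)) hz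
          simpa using this
        have h3 := h3K _ h2
        apply Subtype.ext; apply Units.ext; apply RingOfIntegers.ext
        simpa using h3
      obtain ⟨z, hz⟩ := Finite.surjective_of_injective hinj (ζe u).1
      refine ⟨z * Units.fundSystem K i0 ^ k, ?_⟩
      rw [hζe u, hk, ← hz]
      simp only [powMonoidHom_apply, mul_pow, Subgroup.coe_pow]
      rw [← zpow_natCast (_ ^ k), ← zpow_mul, mul_comm k]
    · rintro ⟨w, rfl⟩
      rw [powMonoidHom_apply, map_pow]
      apply Multiplicative.toAdd.injective
      rw [toAdd_pow, toAdd_one, nsmul_eq_mul]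
      have : ((3 : ℕ) : ZMod 3) = 0 := by decide
      rw [this, zero_mul]
  rw [← hker, Subgroup.index_ker, MonoidHom.range_eq_top.2 hsurj, Subgroup.card_top]
  simp

section Quad

variable {d : ℤ} [RealFund d] {I : FI d}

instance : NumberField.IsTotallyReal (Kd d) := by
  refine ⟨fun v => ?_⟩
  rw [InfinitePlace.isReal_iff, ComplexEmbedding.isReal_iff]
  set φ := v.embedding
  have hd : φ (qd d) * φ (qd d) = ((d : ℝ) : ℂ) := by rw [← map_mul, qd_sq]; simp
  have hr : (starRingEnd ℂ) (φ (qd d)) = φ (qd d) := by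
    have him : (φ (qd d)).im = 0 := by
      have e1 := congrArg Complex.re hd
      have e2 := congrArg Complex.im hd
      simp only [mul_re, mul_im, ofReal_re, ofReal_im] at e1 e2
      have hp : (0 : ℝ) < d := by exact_mod_cast RealFund.pos (d := d)
      by_contra h
      have : (φ (qd d)).re = 0 := by
        have : (φ (qd d)).re * (φ (qd d)).im = 0 := by linarith
        exact (mul_eq_zero.1 this).resolve_right h
      rw [this] at e1
      nlinarith [sq_nonneg (φ (qd d)).im]
    exact Complex.conj_eq_iff_im.2 him
  ext x
  obtain ⟨⟨u, w⟩, rfl⟩ := qlift_bijective.2 x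
  rw [qlift_mk]
  simp [ComplexEmbedding.conjugate_coe_eq, hr]

lemma units_rank : Units.rank (Kd d) = 1 := by
  rw [Units.rank, InfinitePlace.card_eq_nrRealPlaces_add_nrComplexPlaces,
    IsTotallyReal.nrComplexPlaces_eq_zero, ← IsTotallyReal.finrank, finrank_Kd]

lemma eq_one_of_cube_eq_one {x : Kd d} (h : x ^ 3 = 1) : x = 1 := by
  have h1 : (x - 1) * (x ^ 2 + x + 1) = 0 := by linear_combination h
  rcases mul_eq_zero.1 h1 with h2 | h2
  · linear_combination h2
  · have h3 := congrArg qre h2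
    simp only [qre_add, qre_mul, qre_one, qre_zero, pow_two] at h3
    have hd : (0 : ℚ) < d := by exact_mod_cast RealFund.pos (d := d)
    nlinarith [mul_nonneg hd.le (sq_nonneg (qim x)), sq_nonneg (2 * qre x + 1)]

end Quad

/-- Sizes of preimages under a group homomorphism. -/
lemma ncard_preimage_hom {A B : Type*} [Group A] [Group B] (φ : A →* B) (T : Set B) :
    (φ ⁻¹' T).ncard = Nat.card φ.ker * (T ∩ Set.range φ).ncard := by
  choose s hs using fun b : (T ∩ Set.range φ : Set B) => b.2.2
  rw [← Nat.card_coe_set_eq, ← Nat.card_coe_set_eq, ← Nat.card_prod]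
  symm
  refine Nat.card_congr (Equiv.ofBijective (fun x => ⟨s x.2 * x.1, ?_⟩) ⟨?_, ?_⟩)
  · rw [Set.mem_preimage, map_mul, hs, x.1.2, mul_one]; exact x.2.2.1
  · rintro ⟨k, b⟩ ⟨k', b'⟩ h
    have h' : s b * k = s b' * k' := congrArg Subtype.val h
    have hb : b = b' := by
      have := congrArg φ h'
      rw [map_mul, map_mul, hs, hs, k.2, k'.2, mul_one, mul_one] at this
      exact Subtype.ext this
    subst hb
    have := mul_left_cancel h'
    rw [Subtype.ext this]
  · rintro ⟨a, ha⟩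
    refine ⟨(⟨(s ⟨φ a, ha, a, rfl⟩)⁻¹ * a, ?_⟩, ⟨φ a, ha, a, rfl⟩), ?_⟩
    · rw [MonoidHom.mem_ker, map_mul, map_inv, hs]; simp
    · simp

section Quad

variable {d : ℤ} [RealFund d] {I : FI d}

/-- Pairs of a fractional ideal and a nonzero twist. -/
abbrev TwId (d : ℤ) := (FI d)ˣ × (Kd d)ˣ

/-- The map `(I, ω) ↦ ωI³`. -/
noncomputable def cubeId (d : ℤ) : TwId d →* (FI d)ˣ :=
  ((toPrincipalIdeal (Od d) (Kd d)).comp (MonoidHom.snd _ _)) *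
    ((powMonoidHom 3).comp (MonoidHom.fst _ _))

/-- The map `κ ↦ ((κ), κ⁻³)`. -/
noncomputable def scaleId (d : ℤ) : (Kd d)ˣ →* TwId d :=
  (toPrincipalIdeal (Od d) (Kd d)).prod (zpowGroupHom (-3))

lemma cubeId_apply (m : TwId d) :
    cubeId d m = toPrincipalIdeal (Od d) (Kd d) m.2 * m.1 ^ 3 := rfl

lemma scaleId_apply (κ : (Kd d)ˣ) :
    scaleId d κ = (toPrincipalIdeal (Od d) (Kd d) κ, κ ^ (-3 : ℤ)) := rfl

lemma cubeId_scaleId (κ : (Kd d)ˣ) : cubeId d (scaleId d κ) = 1 := by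
  rw [cubeId_apply, scaleId_apply]
  simp only
  rw [map_zpow, zpow_neg, inv_mul_eq_one]; rfl

lemma mk_eq_one_iff_principal (I : (FI d)ˣ) :
    ClassGroup.mk (Kd d) I = 1 ↔ I ∈ (toPrincipalIdeal (Od d) (Kd d)).range := by
  rw [← (equiv (R := Od d) (Kd d)).injective.eq_iff, equiv_mk, map_one,
    QuotientGroup.mk'_apply, QuotientGroup.eq_one_iff]
  rw [canonicalEquiv_self]
  rfl

lemma mk_surj : Function.Surjective (ClassGroup.mk (R := Od d) (Kd d)) := by
  intro c
  obtain ⟨I, rfl⟩ := mk0_surjective c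
  exact ⟨_, mk_mk0 (Kd d) I⟩

/-- Units embedded as twists of the trivial ideal. -/
noncomputable def unitTw (d : ℤ) : (Od d)ˣ →* TwId d :=
  (1 : (Od d)ˣ →* (FI d)ˣ).prod (Units.map (algebraMap (Od d) (Kd d)).toMonoidHom)

lemma principal_eq_one_iff (κ : (Kd d)ˣ) : toPrincipalIdeal (Od d) (Kd d) κ = 1 ↔
    ∃ u : (Od d)ˣ, Units.map (algebraMap (Od d) (Kd d)).toMonoidHom u = κ := by
  rw [toPrincipalIdeal_eq_iff]
  constructor
  · intro h
    have h1 : (κ : Kd d) ∈ (1 : FI d) := by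
      rw [← Units.val_one, ← h]; exact mem_spanSingleton_self _ _
    have h2 : (κ⁻¹ : Kd d) ∈ (1 : FI d) := by
      have : (1 : Kd d) ∈ spanSingleton (Od d)⁰ (κ : Kd d) := by
        rw [h]; exact FractionalIdeal.one_mem_one _
      obtain ⟨c, hc⟩ := (mem_spanSingleton _).1 this
      rw [Algebra.smul_def] at hc
      exact (mem_one_iff _).2 ⟨c, eq_inv_of_mul_eq_one_left hc⟩
    obtain ⟨a, ha⟩ := (mem_one_iff _).1 h1
    obtain ⟨b, hb⟩ := (mem_one_iff _).1 h2
    have hab : a * b = 1 := by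
      apply RingOfIntegers.ext
      change algebraMap (Od d) (Kd d) (a * b) = _
      rw [map_mul, ha, hb]; exact (mul_inv_cancel₀ κ.ne_zero).trans (map_one _).symm
    exact ⟨⟨a, b, hab, by rw [mul_comm, hab]⟩, Units.ext ha⟩
  · rintro ⟨u, rfl⟩
    have e : (Units.map (algebraMap (Od d) (Kd d)).toMonoidHom u : Kd d) = algebraMap (Od d) (Kd d) u :=
      rfl
    rw [Units.val_one, e, ← coeIdeal_span_singleton,
      Ideal.span_singleton_eq_top.2 u.isUnit, coeIdeal_top]

/-- The number of twisted ideals with trivial cube, up to scaling. -/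
lemma relIndex_cubeId : (scaleId d).range.relIndex (cubeId d).ker =
    3 * Nat.card {c : ClassGroup (Od d) // c ^ 3 = 1} := by
  set φ : TwId d →* ClassGroup (Od d) := (ClassGroup.mk (Kd d)).comp (MonoidHom.fst _ _) with hφ
  have hle : (scaleId d).range ≤ (cubeId d).ker ⊓ φ.ker := by
    rintro _ ⟨κ, rfl⟩
    refine ⟨cubeId_scaleId κ, ?_⟩
    exact (mk_eq_one_iff_principal _).2 ⟨κ, rfl⟩
  have h1 : (cubeId d).ker ⊓ φ.ker = (unitTw d).range ⊔ (scaleId d).range := by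
    apply le_antisymm
    · rintro ⟨I, ω⟩ ⟨hc, hp⟩
      obtain ⟨κ, rfl⟩ := (mk_eq_one_iff_principal _).1 hp
      have : toPrincipalIdeal (Od d) (Kd d) (ω * κ ^ 3) = 1 := by rw [map_mul, map_pow]; exact hc
      obtain ⟨u, hu⟩ := (principal_eq_one_iff _).1 this
      have : ((toPrincipalIdeal (Od d) (Kd d) κ, ω) : TwId d) = unitTw d u * scaleId d κ := by
        apply Prod.ext
        · simp [unitTw, scaleId_apply]
        · change ω = Units.map (algebraMap (Od d) (Kd d)).toMonoidHom u * κ ^ (-3 : ℤ)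
          rw [hu, zpow_neg]; symm; exact mul_inv_cancel_right _ _
      rw [this]
      exact Subgroup.mul_mem_sup ⟨u, rfl⟩ ⟨κ, rfl⟩
    · refine sup_le ?_ hle
      rintro _ ⟨u, rfl⟩
      refine ⟨?_, ?_⟩
      · change cubeId d (unitTw d u) = 1
        rw [cubeId_apply]
        simp only [unitTw, MonoidHom.prod_apply, MonoidHom.one_apply, one_pow, mul_one]
        exact (principal_eq_one_iff _).2 ⟨u, rfl⟩
      · simp [hφ, unitTw]
  have h2 : (scaleId d).range.relIndex ((cubeId d).ker ⊓ φ.ker) = 3 := by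
    rw [h1, Subgroup.relIndex_sup_right, ← Subgroup.index_comap]
    rw [← units_cube_index (Kd d) units_rank (fun x => eq_one_of_cube_eq_one)]
    congr 1
    ext u
    constructor
    · rintro ⟨κ, hκ⟩
      have e1 : toPrincipalIdeal (Od d) (Kd d) κ = 1 := congrArg Prod.fst hκ
      have e2 : κ ^ (-3 : ℤ) = Units.map (algebraMap (Od d) (Kd d)).toMonoidHom u :=
        congrArg Prod.snd hκ
      obtain ⟨w, rfl⟩ := (principal_eq_one_iff _).1 e1
      refine ⟨w⁻¹, ?_⟩
      have hinj : Function.Injective (Units.map (algebraMap (Od d) (Kd d)).toMonoidHom) :=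
        Units.map_injective (IsFractionRing.injective (Od d) (Kd d))
      apply hinj
      rw [← e2, ← map_zpow]; congr 1
    · rintro ⟨w, rfl⟩
      refine ⟨Units.map (algebraMap (Od d) (Kd d)).toMonoidHom w⁻¹, Prod.ext ?_ ?_⟩
      · exact (principal_eq_one_iff _).2 ⟨_, rfl⟩
      · change (Units.map (algebraMap (Od d) (Kd d)).toMonoidHom w⁻¹) ^ (-3 : ℤ) =
          Units.map (algebraMap (Od d) (Kd d)).toMonoidHom (w ^ 3)
        rw [← map_zpow]; congr 1
  rw [← Subgroup.relIndex_mul_relIndex _ _ _ hle inf_le_left, h2, Subgroup.inf_relIndex_left,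
    Subgroup.relIndex_ker]
  congr 1
  apply Nat.card_congr
  refine Equiv.subtypeEquivRight fun c => ?_
  constructor
  · rintro ⟨m, hm, rfl⟩
    have := congrArg (ClassGroup.mk (Kd d)) hm
    rw [cubeId_apply, map_mul, (mk_eq_one_iff_principal _).2 ⟨_, rfl⟩, one_mul, map_pow,
      map_one] at this
    exact this
  · intro hc
    obtain ⟨I, rfl⟩ := mk_surj c
    rw [← map_pow, mk_eq_one_iff_principal] at hc
    obtain ⟨κ, hκ⟩ := hc
    refine ⟨(I, κ⁻¹), ?_, rfl⟩
    change cubeId d (I, κ⁻¹) = 1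
    rw [cubeId_apply, map_inv, hκ]
    exact inv_mul_cancel _

/-- The forms with Hessian divisible by `n` and discriminant `n²d`. -/
def hessForms (n d : ℤ) : Set ℤ⁴ := {f | HessDvd n f ∧ cdisc f = n ^ 2 * d}

/-- The classes of forms in `hessForms` correspond to twisted ideals with given cube norm. -/
lemma ncard_hessForms_eq {n : ℤ} (hn : 0 < n) :
    (clsSet (hessForms n d)).ncard =
      ((QuotientGroup.lift (scaleId d).range (cubeId d) (by
        rintro _ ⟨κ, rfl⟩; exact cubeId_scaleId κ)) ⁻¹'
        {J : (FI d)ˣ | (J : FI d) ≤ 1 ∧ FractionalIdeal.absNorm (J : FI d) = n}).ncard := by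
  have hcube : ∀ m : TwId d, ((cubeId d m : (FI d)ˣ) : FI d) =
      spanSingleton _ ((m.2 : (Kd d)ˣ) : Kd d) * (m.1 : FI d) ^ 3 := by
    intro m; rw [cubeId_apply]; simp
  have key : ∀ q ∈ clsSet (hessForms n d), ∃ (m : TwId d) (f : ℤ⁴),
      q = Quotient.mk formSetoid f ∧ FRep n f (m.1 : FI d) (m.2 : Kd d) := by
    rintro _ ⟨f, ⟨h1, h2⟩, rfl⟩
    obtain ⟨I, ω, hr⟩ := exists_rep_of_good hn h1 h2
    obtain ⟨-, -, hω, hI, -⟩ := hr.good hn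
    exact ⟨(Units.mk0 I hI, Units.mk0 ω hω), f, rfl, hr⟩
  choose! m f hq hr using key
  refine ncard_congr (fun q _ => (QuotientGroup.mk (m q) : TwId d ⧸ (scaleId d).range)) ?_ ?_ ?_
  · intro q hqm
    have h := (hr q hqm).good hn
    rw [Set.mem_preimage, QuotientGroup.lift_mk]
    refine ⟨?_, ?_⟩
    · rw [hcube]; exact h.2.2.2.2.1
    · rw [hcube]; exact h.2.2.2.2.2
  · intro q q' hqm hqm' he
    rw [QuotientGroup.eq] at he
    obtain ⟨κ, hκ⟩ := he
    have e1 : (m q').1 = toPrincipalIdeal (Od d) (Kd d) κ * (m q).1 := by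
      have := congrArg Prod.fst hκ
      rw [scaleId_apply] at this
      simp only [Prod.fst_mul, Prod.fst_inv] at this
      rw [this, mul_comm, mul_inv_cancel_left]
    have e2 : (m q').2 = (m q).2 * κ ^ (-3 : ℤ) := by
      have := congrArg Prod.snd hκ
      rw [scaleId_apply] at this
      simp only [Prod.snd_mul, Prod.snd_inv] at this
      rw [this, mul_inv_cancel_left]
    have h1 := (hr q hqm).scale (κ := κ) κ.ne_zero
    have h2 := hr q' hqm'
    rw [e1, e2] at h2
    have e3 : (((m q).2 * κ ^ (-3 : ℤ) : (Kd d)ˣ) : Kd d) = ((m q).2 : Kd d) / (κ : Kd d) ^ 3 := by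
      rw [Units.val_mul, zpow_neg, Units.val_inv_eq_inv_val, div_eq_mul_inv]; rfl
    rw [e3, Units.val_mul, coe_toPrincipalIdeal] at h2
    rw [hq q hqm, hq q' hqm']
    exact Quotient.sound (h1.equiv hn.ne' h2)
  · intro x hx
    obtain ⟨mm, rfl⟩ := QuotientGroup.mk_surjective x
    rw [Set.mem_preimage, QuotientGroup.lift_mk, mem_setOf_eq, hcube] at hx
    obtain ⟨g, hg⟩ := exists_FRep hx.1 hx.2
    have hgood := hg.good hn
    have hmem : (Quotient.mk formSetoid g) ∈ clsSet (hessForms n d) :=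
      ⟨g, ⟨hgood.1, hgood.2.1⟩, rfl⟩
    refine ⟨_, hmem, ?_⟩
    have hs : SLEquiv (f (Quotient.mk formSetoid g)) g := Quotient.exact (hq _ hmem).symm
    obtain ⟨κ, hκ, e1, e2⟩ := FRep.unique hn.ne' ((hr _ hmem).act hs) hg
    rw [QuotientGroup.eq]
    refine ⟨Units.mk0 κ hκ, ?_⟩
    rw [eq_inv_mul_iff_mul_eq]
    apply Prod.ext
    · apply Units.ext
      rw [Prod.fst_mul, Units.val_mul, e1, scaleId_apply, coe_toPrincipalIdeal, mul_comm]; rfl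
    · apply Units.ext
      rw [Prod.snd_mul, Units.val_mul, e2, scaleId_apply]
      change (mm.2 : Kd d) * κ ^ 3 * ((Units.mk0 κ hκ ^ (-3 : ℤ) : (Kd d)ˣ) : Kd d) = mm.2
      rw [zpow_neg, Units.val_inv_eq_inv_val, mul_assoc]
      change (mm.2 : Kd d) * (κ ^ 3 * (κ ^ 3)⁻¹) = _
      rw [mul_inv_cancel₀ (pow_ne_zero _ hκ), mul_one]

/-- Classes of forms with Hessian divisible by `n` count ideals of norm `n` with cube class. -/
lemma ncard_hessForms {n : ℕ} (hn : 0 < n) :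
    (clsSet (hessForms n d)).ncard = 3 * Nat.card {c : ClassGroup (Od d) // c ^ 3 = 1} *
      {J : (Ideal (Od d))⁰ | Ideal.absNorm (J : Ideal (Od d)) = n ∧
        ∃ c, c ^ 3 = ClassGroup.mk0 J}.ncard := by
  rw [ncard_hessForms_eq (by exact_mod_cast hn), ncard_preimage_hom, ← relIndex_cubeId]
  congr 1
  · rw [QuotientGroup.ker_lift, ← Subgroup.relIndex_ker, QuotientGroup.ker_mk']
  · symm
    refine ncard_congr (fun J _ => FractionalIdeal.mk0 (Kd d) J) ?_ ?_ ?_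
    · rintro J ⟨h1, c, hc⟩
      refine ⟨⟨?_, ?_⟩, ?_⟩
      · rw [coe_mk0]; exact coeIdeal_le_one
      · rw [coe_mk0, coeIdeal_absNorm, h1]; rfl
      · obtain ⟨I, rfl⟩ := mk_surj c
        rw [← mk_mk0 (Kd d), ← map_pow, eq_comm, ← div_eq_one, ← _root_.map_div,
          mk_eq_one_iff_principal] at hc
        obtain ⟨κ, hκ⟩ := hc
        refine ⟨QuotientGroup.mk (I, κ), ?_⟩
        rw [QuotientGroup.lift_mk, cubeId_apply]
        simp only [hκ, div_mul_cancel]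
    · intro J J' _ _ h
      exact Subtype.ext (coeIdeal_injective (congrArg Units.val h))
    · rintro J ⟨⟨h1, h2⟩, x, hx⟩
      obtain ⟨I, hI⟩ := FractionalIdeal.le_one_iff_exists_coeIdeal.1 h1
      have hI0 : I ≠ ⊥ := by
        rintro rfl; exact J.ne_zero (by rw [← hI]; exact coeIdeal_bot)
      have hJ : FractionalIdeal.mk0 (Kd d) ⟨I, mem_nonZeroDivisors_of_ne_zero hI0⟩ = J :=
        Units.ext (by rw [coe_mk0]; exact hI)
      refine ⟨⟨I, mem_nonZeroDivisors_of_ne_zero hI0⟩, ⟨?_, ?_⟩, hJ⟩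
      · rw [← hI, coeIdeal_absNorm] at h2
        exact_mod_cast h2
      · obtain ⟨m, rfl⟩ := QuotientGroup.mk_surjective x
        refine ⟨ClassGroup.mk (Kd d) m.1, ?_⟩
        rw [QuotientGroup.lift_mk, cubeId_apply] at hx
        rw [← mk_mk0 (Kd d), hJ, ← hx, map_mul, (mk_eq_one_iff_principal _).2 ⟨_, rfl⟩,
          one_mul, map_pow]

lemma absNorm_natCast (n : ℕ) : Ideal.absNorm (Ideal.span {(n : Od d)}) = n ^ 2 := by
  rw [Ideal.absNorm_span_singleton, Algebra.norm_apply, ← Algebra.norm_apply,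
    show (n : Od d) = algebraMap ℤ (Od d) n by simp, Algebra.norm_algebraMap, finrank_Od]
  simp [Int.natAbs_pow]

lemma SplitsIn.exists_primes (hp : p.Prime) (h : SplitsIn p d) :
    ∃ P Q : Ideal (Od d), P ≠ Q ∧ P.IsPrime ∧ Q.IsPrime ∧ Ideal.span {((p : ℕ) : Od d)} = P * Q ∧
      Ideal.absNorm P = p ∧ Ideal.absNorm Q = p := by
  obtain ⟨P, Q, hne, hP, hQ, he⟩ := h
  have hm : Ideal.absNorm P * Ideal.absNorm Q = p ^ 2 := by
    rw [← map_mul, ← he, absNorm_natCast]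
  have h1 : Ideal.absNorm P ≠ 1 := fun e => hP.ne_top (Ideal.absNorm_eq_one_iff.1 e)
  have h2 : Ideal.absNorm Q ≠ 1 := fun e => hQ.ne_top (Ideal.absNorm_eq_one_iff.1 e)
  obtain ⟨e1, e2⟩ := (Nat.Prime.mul_eq_prime_sq_iff hp h1 h2).1 hm
  exact ⟨P, Q, hne, hP, hQ, he, e1, e2⟩

lemma ne_bot_of_absNorm_ne_zero {P : Ideal (Od d)} (h : Ideal.absNorm P ≠ 0) : P ≠ ⊥ := by
  rintro rfl; exact h Ideal.absNorm_bot

lemma le_or_le_of_dvd_absNorm (hp : p.Prime) {P Q J : Ideal (Od d)} (hP : P.IsPrime)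
    (hQ : Q.IsPrime) (he : Ideal.span {((p : ℕ) : Od d)} = P * Q) (hPn : Ideal.absNorm P = p)
    (hQn : Ideal.absNorm Q = p) (hJ0 : J ≠ ⊥) (hJ : p ∣ Ideal.absNorm J) : J ≤ P ∨ J ≤ Q := by
  by_contra hcon
  push Not at hcon
  have hmax : ∀ R : Ideal (Od d), R.IsPrime → Ideal.absNorm R = p → ¬ J ≤ R → IsCoprime J R := by
    intro R hR hn hle
    have : R.IsMaximal := hR.isMaximal (ne_bot_of_absNorm_ne_zero (by rw [hn]; exact hp.ne_zero))
    rw [isCoprime_iff_sup_eq, sup_comm]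
    exact this.out.2 _ (lt_of_le_of_ne le_sup_left fun e => hle (by rw [e]; exact le_sup_right))
  have hc := (hmax P hP hPn hcon.1).mul_right (hmax Q hQ hQn hcon.2)
  rw [← he, isCoprime_iff_exists] at hc
  obtain ⟨j, hj, y, hy, hjy⟩ := hc
  obtain ⟨x, rfl⟩ := Ideal.mem_span_singleton'.1 hy
  have hfin : Finite (Od d ⧸ J) := finiteQuotientOfFreeOfNeBot J hJ0
  have : Fact p.Prime := ⟨hp⟩
  obtain ⟨z, hz⟩ := exists_prime_addOrderOf_dvd_card' (G := Od d ⧸ J) p hJ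
  have hpz : (p : Od d ⧸ J) * z = 0 := by
    rw [← nsmul_eq_mul, ← hz, addOrderOf_nsmul_eq_zero]
  have hz0 : z = 0 := by
    have h1 : (Ideal.Quotient.mk J x * p : Od d ⧸ J) = 1 := by
      have := congrArg (Ideal.Quotient.mk J) hjy
      rw [map_add, Ideal.Quotient.eq_zero_iff_mem.2 hj, zero_add, map_mul, map_natCast, map_one]
        at this
      exact this
    calc z = (Ideal.Quotient.mk J x * p) * z := by rw [h1, one_mul]
      _ = 0 := by rw [mul_assoc, hpz, mul_zero]
  rw [hz0, addOrderOf_zero] at hz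
  exact hp.one_lt.ne hz

/-- Ideals of norm `n` whose class lies in `X`. -/
def idSet (d : ℤ) (n : ℕ) (X : Set (ClassGroup (Od d))) : Set (Ideal (Od d))⁰ :=
  {J | Ideal.absNorm (J : Ideal (Od d)) = n ∧ ClassGroup.mk0 J ∈ X}

lemma idSet_finite {n : ℕ} (hn : 0 < n) (X : Set (ClassGroup (Od d))) : (idSet d n X).Finite := by
  refine Set.Finite.of_finite_image (f := Subtype.val)
    ((finite_setOf_absNorm_eq (S := Od d) n).subset ?_) Subtype.val_injective.injOn
  rintro _ ⟨J, hJ, rfl⟩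
  exact hJ.1

lemma ncard_idSet_union {n : ℕ} (hn : 0 < n) {X Y : Set (ClassGroup (Od d))} (h : Disjoint X Y) :
    (idSet d n (X ∪ Y)).ncard = (idSet d n X).ncard + (idSet d n Y).ncard := by
  rw [← ncard_union_eq _ (idSet_finite hn X) (idSet_finite hn Y)]
  · congr 1
    ext J
    simp only [idSet, Set.mem_union, mem_setOf_eq]
    tauto
  · rw [Set.disjoint_left]
    exact fun J h1 h2 => Set.disjoint_left.1 h h1.2 h2.2

lemma ncard_idSet_prime_mul (hp : p.Prime) {P Q : (Ideal (Od d))⁰} (hPQ : P ≠ Q)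
    (hP : (P : Ideal (Od d)).IsPrime) (hQ : (Q : Ideal (Od d)).IsPrime)
    (he : Ideal.span {((p : ℕ) : Od d)} = (P : Ideal (Od d)) * Q)
    (hPn : Ideal.absNorm (P : Ideal (Od d)) = p) (hQn : Ideal.absNorm (Q : Ideal (Od d)) = p)
    {n : ℕ} (hn : 0 < n) (hpn : ¬ p ∣ n) (X : Set (ClassGroup (Od d))) :
    (idSet d (p * n) X).ncard = (idSet d n {c | ClassGroup.mk0 P * c ∈ X}).ncard +
      (idSet d n {c | ClassGroup.mk0 Q * c ∈ X}).ncard := by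
  have hinj : ∀ R : (Ideal (Od d))⁰, Function.Injective (fun J : (Ideal (Od d))⁰ => R * J) := by
    intro R J J' h
    have h' : (R : Ideal (Od d)) * J = R * J' := congrArg Subtype.val h
    exact Subtype.ext (mul_left_cancel₀ (nonZeroDivisors.coe_ne_zero R) h')
  rw [← ncard_image_of_injective (idSet d n {c | ClassGroup.mk0 P * c ∈ X}) (hinj P),
    ← ncard_image_of_injective (idSet d n {c | ClassGroup.mk0 Q * c ∈ X}) (hinj Q),
    ← ncard_union_eq _ ((idSet_finite hn _).image _) ((idSet_finite hn _).image _)]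
  · congr 1
    ext J
    constructor
    · rintro ⟨h1, h2⟩
      have key : ∀ R : (Ideal (Od d))⁰, Ideal.absNorm (R : Ideal (Od d)) = p →
          (J : Ideal (Od d)) ≤ R →
          J ∈ (fun J => R * J) '' idSet d n {c | ClassGroup.mk0 R * c ∈ X} := by
        intro R hR hle
        obtain ⟨J', hJ'⟩ := Ideal.dvd_iff_le.2 hle
        have hJ0 : J' ≠ 0 := by
          rintro rfl; rw [mul_zero] at hJ'; exact nonZeroDivisors.coe_ne_zero J hJ'
        have hJR : R * ⟨J', mem_nonZeroDivisors_of_ne_zero hJ0⟩ = J := Subtype.ext hJ'.symm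
        refine ⟨⟨J', mem_nonZeroDivisors_of_ne_zero hJ0⟩, ⟨?_, ?_⟩, hJR⟩
        · rw [hJ', map_mul, hR] at h1
          exact Nat.eq_of_mul_eq_mul_left hp.pos h1
        · rw [mem_setOf_eq, ← map_mul, hJR]; exact h2
      rcases le_or_le_of_dvd_absNorm hp hP hQ he hPn hQn (nonZeroDivisors.coe_ne_zero J)
        (by rw [h1]; exact dvd_mul_right _ _) with h | h
      · exact Or.inl (key P hPn h)
      · exact Or.inr (key Q hQn h)
    · rintro (⟨J', ⟨h1, h2⟩, rfl⟩ | ⟨J', ⟨h1, h2⟩, rfl⟩)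
      · refine ⟨?_, by rw [map_mul]; exact h2⟩
        rw [Submonoid.coe_mul, map_mul, hPn, h1]
      · refine ⟨?_, by rw [map_mul]; exact h2⟩
        rw [Submonoid.coe_mul, map_mul, hQn, h1]
  · rw [Set.disjoint_left]
    rintro _ ⟨J, ⟨h1, -⟩, rfl⟩ ⟨J', ⟨h2, -⟩, e⟩
    have e' : (Q : Ideal (Od d)) * J' = P * J := congrArg Subtype.val e
    have hle : (J' : Ideal (Od d)) ≤ P := by
      have : (Q : Ideal (Od d)) * J' ≤ P := by rw [e']; exact mul_le_left
      rcases hP.mul_le.1 this with h | h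
      · exfalso
        have hmax := hQ.isMaximal (nonZeroDivisors.coe_ne_zero Q)
        exact hPQ (Subtype.ext (hmax.eq_of_le hP.ne_top h).symm)
      · exact h
    apply hpn
    rw [← h2, ← hPn]
    exact absNorm_dvd_absNorm_of_le hle

end Quad

section Groups

variable {G : Type*} [CommGroup G]

lemma coe_sup_zpowers {H : Subgroup G} (hH : ∀ c : G, c ^ 3 ∈ H) (v : G) :
    ((H ⊔ Subgroup.zpowers v : Subgroup G) : Set G) =
      ((H : Set G) ∪ {c | v * c ∈ H}) ∪ {c | v⁻¹ * c ∈ H} := by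
  have hv : v ∈ H ⊔ Subgroup.zpowers v :=
    le_sup_right (a := H) (Subgroup.mem_zpowers v)
  have hle : H ≤ H ⊔ Subgroup.zpowers v := le_sup_left
  ext x
  simp only [SetLike.mem_coe, Set.mem_union, mem_setOf_eq]
  constructor
  · intro hx
    obtain ⟨h, hh, _, ⟨k, rfl⟩, rfl⟩ := Subgroup.mem_sup.1 hx
    have h3 : (v ^ (k / 3)) ^ 3 ∈ H := hH _
    have hk : v ^ k = (v ^ (k / 3)) ^ 3 * v ^ (k % 3) := by
      rw [← zpow_natCast, ← zpow_mul, ← zpow_add]; congr 1; push_cast; omega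
    have h4 : h * (v ^ (k / 3)) ^ 3 ∈ H := H.mul_mem hh h3
    change ((h * v ^ k ∈ H) ∨ v * (h * v ^ k) ∈ H) ∨ v⁻¹ * (h * v ^ k) ∈ H
    rw [hk]
    have : k % 3 = 0 ∨ k % 3 = 1 ∨ k % 3 = 2 := by omega
    rcases this with e | e | e <;> rw [e]
    · left; left; simpa using h4
    · right; convert h4 using 1; rw [zpow_one]
      rw [mul_comm v⁻¹, ← mul_assoc, mul_inv_cancel_right]
    · left; right; convert H.mul_mem h4 (hH v) using 1
      rw [show (2 : ℤ) = ((2 : ℕ) : ℤ) from rfl, zpow_natCast, pow_succ v 2, mul_comm v]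
      simp only [mul_assoc]
  · rintro ((h | h) | h)
    · exact hle h
    · exact (Subgroup.mul_mem_cancel_left _ hv).1 (hle h)
    · exact (Subgroup.mul_mem_cancel_left _ (Subgroup.inv_mem _ hv)).1 (hle h)

lemma disjoint_coset_one {H : Subgroup G} {v : G} (hv : v ∉ H) :
    Disjoint (H : Set G) {c | v * c ∈ H} :=
  Set.disjoint_left.2 fun _ h1 h2 => hv ((Subgroup.mul_mem_cancel_right _ h1).1 h2)

lemma disjoint_coset_two {H : Subgroup G} (hH : ∀ c : G, c ^ 3 ∈ H) {v : G} (hv : v ∉ H) :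
    Disjoint ((H : Set G) ∪ {c | v * c ∈ H}) {c | v⁻¹ * c ∈ H} := by
  rw [Set.disjoint_left]
  rintro x (h1 | h1) h2
  · exact hv (inv_mem_iff.1 ((Subgroup.mul_mem_cancel_right _ h1).1 h2))
  · apply hv
    have h3 := H.mul_mem (hH v) (H.inv_mem (H.mul_mem h1 (H.inv_mem h2)))
    convert h3 using 1
    group

lemma card_sup_zpowers [Finite G] {H : Subgroup G} (hH : ∀ c : G, c ^ 3 ∈ H) {v : G}
    (hv : v ∉ H) : Nat.card (H ⊔ Subgroup.zpowers v : Subgroup G) = 3 * Nat.card H := by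
  have hc : ∀ w : G, {c | w * c ∈ H}.ncard = Nat.card H := fun w => by
    change ((w * ·) ⁻¹' (H : Set G)).ncard = (H : Set G).ncard
    rw [ncard_preimage_of_injective_subset_range (mul_right_injective w)
      fun x _ => ⟨w⁻¹ * x, mul_inv_cancel_left w x⟩]
  change ((H ⊔ Subgroup.zpowers v : Subgroup G) : Set G).ncard = _
  rw [coe_sup_zpowers hH, ncard_union_eq (disjoint_coset_two hH hv),
    ncard_union_eq (disjoint_coset_one hv), hc, hc]
  change Nat.card H + _ + _ = _
  ring

lemma card_quotient_cube [Finite G] (N : Subgroup G) :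
    Nat.card {x : G ⧸ N // x ^ 3 = 1} * Nat.card ((powMonoidHom 3 : G →* G).range ⊔ N : Subgroup G) =
      Nat.card G := by
  have h1 : Nat.card {x : G ⧸ N // x ^ 3 = 1} *
      Nat.card (powMonoidHom 3 : G ⧸ N →* G ⧸ N).range = Nat.card (G ⧸ N) :=
    (powMonoidHom 3 : G ⧸ N →* G ⧸ N).ker.card_mul_index ▸ by
      rw [Subgroup.index_ker]; rfl
  have h2 : (powMonoidHom 3 : G ⧸ N →* G ⧸ N).range =
      (powMonoidHom 3 : G →* G).range.map (QuotientGroup.mk' N) := by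
    ext x
    constructor
    · rintro ⟨y, rfl⟩
      obtain ⟨y, rfl⟩ := QuotientGroup.mk'_surjective N y
      exact ⟨_, ⟨y, rfl⟩, map_pow _ _ _⟩
    · rintro ⟨_, ⟨y, rfl⟩, rfl⟩
      exact ⟨QuotientGroup.mk' N y, (map_pow _ _ _).symm⟩
  have h3 := ncard_preimage_hom (QuotientGroup.mk' N) (powMonoidHom 3 : G ⧸ N →* G ⧸ N).range
  have h4 : (QuotientGroup.mk' N) ⁻¹' ((powMonoidHom 3 : G ⧸ N →* G ⧸ N).range : Set (G ⧸ N)) =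
      ((powMonoidHom 3 : G →* G).range ⊔ N : Subgroup G) := by
    rw [h2, sup_comm, ← QuotientGroup.comap_map_mk', Subgroup.coe_comap]
  rw [h4, QuotientGroup.ker_mk', Set.range_eq_univ.2 (QuotientGroup.mk'_surjective N),
    Set.inter_univ] at h3
  change Nat.card ((powMonoidHom 3 : G →* G).range ⊔ N : Subgroup G) =
    _ * Nat.card (powMonoidHom 3 : G ⧸ N →* G ⧸ N).range at h3
  rw [h3, mul_left_comm, h1, mul_comm, ← Subgroup.index_eq_card, Subgroup.index_mul_card]

end Groups

section Quad

variable {d : ℤ} [RealFund d] {I : FI d}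

lemma absNorm_one_iff {J : (Ideal (Od d))⁰} : Ideal.absNorm (J : Ideal (Od d)) = 1 ↔ J = 1 := by
  rw [absNorm_eq_one_iff, ← one_eq_top]
  exact (Subtype.ext_iff (a2 := (1 : (Ideal (Od d))⁰))).symm

/-- The number of ideals in the classes `X` whose norm divides the product of `S`. -/
noncomputable def wtd (d : ℤ) (S : Finset ℕ) (X : Set (ClassGroup (Od d))) : ℕ :=
  ∑ T ∈ S.powerset, (idSet d (∏ p ∈ T, p) X).ncard

lemma wtd_empty (H : Subgroup (ClassGroup (Od d))) : wtd d ∅ H = 1 := by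
  have : idSet d 1 (H : Set (ClassGroup (Od d))) = {1} := by
    ext J
    rw [mem_singleton_iff, ← absNorm_one_iff]
    refine ⟨fun h => h.1, fun h => ⟨h, ?_⟩⟩
    rw [absNorm_one_iff.1 h, map_one]
    exact H.one_mem
  simp [wtd, this]

lemma wtd_union (hS : ∀ p ∈ S, p.Prime) {X Y : Set (ClassGroup (Od d))}
    (h : Disjoint X Y) : wtd d S (X ∪ Y) = wtd d S X + wtd d S Y := by
  unfold wtd
  rw [← sum_add_distrib]
  refine sum_congr rfl fun T hT => ncard_idSet_union (prod_pos fun p hp => ?_) h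
  exact (hS p (Finset.mem_powerset.1 hT hp)).pos

lemma exists_wtd_insert (hS : ∀ p ∈ S, p.Prime) (hp : p.Prime)
    (hpS : p ∉ S) (h : SplitsIn p d) : ∃ v : ClassGroup (Od d),
      SClassSubgroup (insert p S) d = SClassSubgroup S d ⊔ Subgroup.zpowers v ∧
      ∀ X, wtd d (insert p S) X = wtd d S X + wtd d S {c | v * c ∈ X} +
        wtd d S {c | v⁻¹ * c ∈ X} := by
  obtain ⟨P, Q, hne, hP, hQ, he, hPn, hQn⟩ := h.exists_primes hp
  have h0 : ∀ {R : Ideal (Od d)}, Ideal.absNorm R = p → R ∈ (Ideal (Od d))⁰ := fun e =>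
    mem_nonZeroDivisors_of_ne_zero (ne_bot_of_absNorm_ne_zero (by rw [e]; exact hp.ne_zero))
  obtain ⟨P', rfl⟩ : ∃ P' : (Ideal (Od d))⁰, (P' : Ideal (Od d)) = P := ⟨⟨P, h0 hPn⟩, rfl⟩
  obtain ⟨Q', rfl⟩ : ∃ Q' : (Ideal (Od d))⁰, (Q' : Ideal (Od d)) = Q := ⟨⟨Q, h0 hQn⟩, rfl⟩
  have hinv : ClassGroup.mk0 Q' = (ClassGroup.mk0 P')⁻¹ := by
    rw [eq_comm, inv_eq_iff_mul_eq_one, ← map_mul, mk0_eq_one_iff]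
    exact ⟨⟨(p : Od d), he.symm⟩⟩
  refine ⟨ClassGroup.mk0 P', le_antisymm ?_ ?_, fun X => ?_⟩
  · rw [SClassSubgroup, Subgroup.closure_le]
    rintro _ ⟨R, hR, ⟨q, hq, hqR⟩, rfl⟩
    rcases Finset.mem_insert.1 hq with rfl | hq
    · have hv : ClassGroup.mk0 P' ∈ SClassSubgroup S d ⊔ Subgroup.zpowers (ClassGroup.mk0 P') :=
        le_sup_right (a := SClassSubgroup S d) (Subgroup.mem_zpowers _)
      have hle : (P' : Ideal (Od d)) * Q' ≤ R := by rw [← he, span_singleton_le_iff_mem]; exact hqR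
      rcases hR.mul_le.1 hle with h1 | h1
      · have := (hP.isMaximal (ne_bot_of_absNorm_ne_zero (hPn ▸ hp.ne_zero))).eq_of_le hR.ne_top h1
        rwa [show R = P' from Subtype.ext this.symm]
      · have := (hQ.isMaximal (ne_bot_of_absNorm_ne_zero (hQn ▸ hp.ne_zero))).eq_of_le hR.ne_top h1
        rw [show R = Q' from Subtype.ext this.symm, hinv]
        exact Subgroup.inv_mem _ hv
    · exact le_sup_left (a := SClassSubgroup S d) (Subgroup.subset_closure ⟨R, hR, ⟨q, hq, hqR⟩, rfl⟩)
  · refine sup_le (Subgroup.closure_mono ?_) ?_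
    · rintro _ ⟨R, hR, ⟨q, hq, hqR⟩, rfl⟩
      exact ⟨R, hR, ⟨q, Finset.mem_insert_of_mem hq, hqR⟩, rfl⟩
    · rw [Subgroup.zpowers_le]
      refine Subgroup.subset_closure ⟨P', hP, ⟨p, mem_insert_self _ _, ?_⟩, rfl⟩
      have : ((p : ℕ) : Od d) ∈ (P' : Ideal (Od d)) * Q' := by rw [← he]; exact mem_span_singleton_self _
      exact mul_le_left this
  · unfold wtd
    rw [sum_powerset_insert hpS, add_assoc]
    congr 1
    rw [← sum_add_distrib]
    refine sum_congr rfl fun T hT => ?_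
    have hT' := Finset.mem_powerset.1 hT
    rw [Finset.prod_insert fun h => hpS (hT' h), ncard_idSet_prime_mul hp (P := P') (Q := Q')
      (hne ∘ congrArg Subtype.val) hP hQ he hPn hQn
      (prod_pos fun q hq => (hS q (hT' hq)).pos), hinv]
    rw [hp.prime.dvd_finset_prod_iff]
    rintro ⟨q, hq, hpq⟩
    rw [(Nat.prime_dvd_prime_iff_eq hp (hS q (hT' hq))).1 hpq] at hpS
    exact hpS (hT' hq)

lemma wtd_mul_card (hS : ∀ p ∈ S, p.Prime) (hsp : ∀ p ∈ S, SplitsIn p d) :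
    ∀ H : Subgroup (ClassGroup (Od d)), (∀ c, c ^ 3 ∈ H) →
      wtd d S H * Nat.card (H ⊔ SClassSubgroup S d : Subgroup _) = 3 ^ S.card * Nat.card H := by
  induction S using Finset.induction_on with
  | empty =>
    intro H _
    have : SClassSubgroup ∅ d = ⊥ := by
      rw [SClassSubgroup, Subgroup.closure_eq_bot_iff]
      rintro _ ⟨_, _, ⟨p, hp, _⟩, _⟩
      simp at hp
    rw [this, sup_bot_eq, wtd_empty, Finset.card_empty, pow_zero]
  | insert p S hpS ih =>
    intro H hH
    simp only [Finset.forall_mem_insert] at hS hsp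
    obtain ⟨v, hv, hw⟩ := exists_wtd_insert hS.2 hS.1 hpS hsp.1
    rw [hw, hv, card_insert_of_notMem hpS]
    by_cases hvH : v ∈ H
    · have e : ∀ w ∈ H, {c | w * c ∈ (H : Set (ClassGroup (Od d)))} = H := fun w h => by
        ext c; exact Subgroup.mul_mem_cancel_left _ h
      have hsup : H ⊔ (SClassSubgroup S d ⊔ Subgroup.zpowers v) = H ⊔ SClassSubgroup S d := by
        rw [sup_comm (SClassSubgroup S d), ← sup_assoc,
          sup_eq_left.2 (Subgroup.zpowers_le.2 hvH)]
      rw [e v hvH, e _ (H.inv_mem hvH), hsup]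
      linear_combination 3 * ih hS.2 hsp.2 H hH
    · have hK := ih hS.2 hsp.2 (H ⊔ Subgroup.zpowers v) fun c =>
        le_sup_left (a := H) (hH c)
      rw [coe_sup_zpowers hH, wtd_union hS.2 (disjoint_coset_two hH hvH),
        wtd_union hS.2 (disjoint_coset_one hvH), card_sup_zpowers hH hvH, sup_assoc,
        sup_comm (Subgroup.zpowers v)] at hK
      refine hK.trans ?_
      ring

/-- The forms with triplicate central coefficients over `d` compute the 3-torsion of `ClS`. -/
lemma sum_ncard_hessForms (hS : ∀ p ∈ S, p.Prime) (hsp : ∀ p ∈ S, SplitsIn p d) :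
    ∑ T ∈ S.powerset, (clsSet (hessForms ((∏ p ∈ T, p : ℕ) : ℤ) d)).ncard =
      3 ^ (S.card + 1) * Nat.card {x : ClS S d // x ^ 3 = 1} := by
  set C := (powMonoidHom 3 : ClassGroup (Od d) →* ClassGroup (Od d)).range
  have h1 := wtd_mul_card hS hsp C fun c => ⟨c, rfl⟩
  have h2 : Nat.card {x : ClS S d // x ^ 3 = 1} * Nat.card (C ⊔ SClassSubgroup S d : Subgroup _) =
    Nat.card (ClassGroup (Od d)) := card_quotient_cube (SClassSubgroup S d)
  have h3 : Nat.card {c : ClassGroup (Od d) // c ^ 3 = 1} * Nat.card C =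
      Nat.card (ClassGroup (Od d)) := by
    rw [← (powMonoidHom 3 : ClassGroup (Od d) →* ClassGroup (Od d)).ker.card_mul_index,
      Subgroup.index_ker]
    rfl
  have h4 : ∑ T ∈ S.powerset, (clsSet (hessForms ((∏ p ∈ T, p : ℕ) : ℤ) d)).ncard =
      3 * Nat.card {c : ClassGroup (Od d) // c ^ 3 = 1} * wtd d S C := by
    rw [wtd, mul_sum]
    exact sum_congr rfl fun T hT => ncard_hessForms
      (prod_pos fun q hq => (hS q (Finset.mem_powerset.1 hT hq)).pos)
  have hpos : 0 < Nat.card (C ⊔ SClassSubgroup S d : Subgroup _) := Nat.card_pos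
  refine Nat.eq_of_mul_eq_mul_right hpos ?_
  rw [h4, mul_assoc, h1, mul_assoc (3 ^ _), h2, ← h3]
  ring

lemma dvd_of_intCast_mem (hp : p.Prime) {P : Ideal (Od d)} (hP : P.IsPrime)
    (hpP : ((p : ℕ) : Od d) ∈ P) {m : ℤ} (hm : (m : Od d) ∈ P) : (p : ℤ) ∣ m := by
  by_contra h
  obtain ⟨u, v, huv⟩ := ((Nat.prime_iff_prime_int.1 hp).coprime_iff_not_dvd.2 h)
  apply hP.ne_top
  rw [eq_top_iff_one]
  have : (1 : Od d) = u * (p : ℕ) + v * m := by exact_mod_cast huv.symm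
  rw [this]
  exact P.add_mem (P.mul_mem_left _ hpP) (P.mul_mem_left _ hm)

lemma om_quad {g : ℤ} (hg : d ^ 2 - d = 4 * g) (r : ℤ) :
    (om d - (r : Od d)) * (om d - ((d - r : ℤ) : Od d)) = -((r ^ 2 - d * r + g : ℤ) : Od d) := by
  push_cast
  linear_combination om_sq hg

lemma exists_root (hp : p.Prime) {P : Ideal (Od d)} (hP : P.IsPrime)
    (hPn : Ideal.absNorm P = p) : ∃ r : ℤ, om d - (r : Od d) ∈ P := by
  have : Fact p.Prime := ⟨hp⟩
  obtain ⟨r, hr⟩ := AddSubgroup.mem_zmultiples_iff.1 (mem_zmultiples_of_prime_card (G := Od d ⧸ P)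
    (g := 1) (g' := Ideal.Quotient.mk P (om d)) hPn
    fun h => hP.ne_top ((eq_top_iff_one _).2 (Ideal.Quotient.eq_zero_iff_mem.1 h)))
  refine ⟨r, Ideal.Quotient.eq_zero_iff_mem.1 ?_⟩
  rw [map_sub, ← hr, map_intCast, zsmul_one, sub_self]

lemma SplitsIn.exists_simple_root (hp : p.Prime) (h : SplitsIn p d) {g : ℤ}
    (hg : d ^ 2 - d = 4 * g) : ∃ r : ℤ, (p : ℤ) ∣ r ^ 2 - d * r + g ∧ ¬ (p : ℤ) ∣ 2 * r - d := by
  obtain ⟨P, Q, hne, hP, hQ, he, hPn, hQn⟩ := h.exists_primes hp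
  have hpPQ : ((p : ℕ) : Od d) ∈ P * Q := by rw [← he]; exact mem_span_singleton_self _
  have hpP : ((p : ℕ) : Od d) ∈ P := mul_le_left hpPQ
  have hpQ : ((p : ℕ) : Od d) ∈ Q := mul_le_right hpPQ
  obtain ⟨r, hr⟩ := exists_root hp hP hPn
  obtain ⟨s, hs⟩ := exists_root hp hQ hQn
  have hroot : ∀ {R : Ideal (Od d)} {t : ℤ}, R.IsPrime → ((p : ℕ) : Od d) ∈ R →
      om d - (t : Od d) ∈ R → (p : ℤ) ∣ t ^ 2 - d * t + g := fun {R t} hR hpR ht => by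
    refine dvd_of_intCast_mem hp hR hpR ?_
    rw [← neg_mem_iff, ← om_quad hg]
    exact R.mul_mem_right _ ht
  refine ⟨r, hroot hP hpP hr, fun h2 => hne ?_⟩
  have hrs : (p : ℤ) ∣ r - s := by
    have h3 : (p : ℤ) ∣ (r - s) * (r + s - d) := by
      obtain ⟨u, hu⟩ := hroot hP hpP hr
      obtain ⟨v, hv⟩ := hroot hQ hpQ hs
      exact ⟨u - v, by linear_combination hu - hv⟩
    rcases (Nat.prime_iff_prime_int.1 hp).dvd_or_dvd h3 with h3 | h3
    · exact h3
    · exact (dvd_sub h2 h3).trans (by rw [show 2 * r - d - (r + s - d) = r - s by ring])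
  refine (hP.isMaximal (ne_bot_of_absNorm_ne_zero (hPn ▸ hp.ne_zero))).eq_of_le hQ.ne_top ?_
  intro x hx
  obtain ⟨m, k, rfl⟩ := int_coord x
  have h1 : ((m + k * r : ℤ) : Od d) ∈ P := by
    have := P.sub_mem hx (P.mul_mem_left (k : Od d) hr)
    convert this using 1; push_cast; ring
  obtain ⟨u, hu⟩ := dvd_of_intCast_mem hp hP hpP h1
  obtain ⟨v, hv⟩ := hrs
  have h3 := Q.add_mem (Q.mul_mem_left ((u - k * v : ℤ) : Od d) hpQ) (Q.mul_mem_left (k : Od d) hs)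
  convert h3 using 1
  have h4 : m + k * s = p * (u - k * v) := by linear_combination hu - k * hv
  have h5 : (m : Od d) + k * s = p * (u - k * v) := by exact_mod_cast h4
  push_cast
  linear_combination h5

lemma span_root_ne_top (hp : p.Prime) {g r : ℤ} (hg : d ^ 2 - d = 4 * g)
    (hr : (p : ℤ) ∣ r ^ 2 - d * r + g) : Ideal.span {((p : ℕ) : Od d), om d - (r : Od d)} ≠ ⊤ := by
  rw [Ne, eq_top_iff_one, mem_span_pair]
  rintro ⟨x, y, hxy⟩
  obtain ⟨u, hu⟩ := hr
  have h1 := om_quad hg r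
  rw [hu] at h1
  obtain ⟨m, k, hmk⟩ := int_coord (x * (om d - ((d - r : ℤ) : Od d)) - y * (u : Od d))
  have h2 : ((-(d - r) : ℤ) : Od d) + ((1 : ℤ) : Od d) * om d =
      ((p * m : ℤ) : Od d) + ((p * k : ℤ) : Od d) * om d := by
    push_cast at *
    linear_combination (p : Od d) * hmk - (om d - (d - r)) * hxy + y * h1
  have h3 : (p : ℤ) ∣ 1 := ⟨k, (int_coord_inj h2).2⟩
  exact hp.one_lt.ne' (Nat.dvd_one.1 (by exact_mod_cast h3))

lemma splitsIn_of_simple_root (hp : p.Prime) {g r : ℤ} (hg : d ^ 2 - d = 4 * g)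
    (hr : (p : ℤ) ∣ r ^ 2 - d * r + g) (h2 : ¬ (p : ℤ) ∣ 2 * r - d) : SplitsIn p d := by
  have hP := span_root_ne_top hp hg hr
  have hQ := span_root_ne_top (r := d - r) hp hg (by convert hr using 1; ring)
  obtain ⟨a, b, hab⟩ := ((Nat.prime_iff_prime_int.1 hp).coprime_iff_not_dvd.2 h2)
  have hab' : (a : Od d) * p + b * (2 * r - d) = 1 := by exact_mod_cast hab
  have he : Ideal.span {((p : ℕ) : Od d)} = Ideal.span {((p : ℕ) : Od d), om d - (r : Od d)} *
      Ideal.span {((p : ℕ) : Od d), om d - ((d - r : ℤ) : Od d)} := by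
    obtain ⟨u, hu⟩ := hr
    have h1 := om_quad hg r
    rw [hu] at h1
    push_cast at h1
    rw [span_pair_mul_span_pair]
    apply le_antisymm
    · rw [span_singleton_le_iff_mem]
      have h3 : ((p : ℕ) : Od d) = a * (p * p) + (b * (p * (om d - ((d - r : ℤ) : Od d))) -
          b * ((om d - (r : Od d)) * p)) := by
        push_cast; linear_combination -(p : Od d) * hab'
      have h4 : ∀ I : Ideal (Od d), (p * p : Od d) ∈ I →
          (p * (om d - ((d - r : ℤ) : Od d)) : Od d) ∈ I → (om d - (r : Od d)) * p ∈ I →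
          ((p : ℕ) : Od d) ∈ I := fun I e1 e2 e3 => by
        rw [h3]
        exact I.add_mem (I.mul_mem_left _ e1) (I.sub_mem (I.mul_mem_left _ e2) (I.mul_mem_left _ e3))
      refine h4 _ (subset_span ?_) (subset_span ?_) (subset_span ?_) <;> simp
    · rw [span_le]
      rintro x (rfl | rfl | rfl | rfl) <;>
        rw [SetLike.mem_coe, mem_span_singleton']
      · exact ⟨_, rfl⟩
      · exact ⟨_, mul_comm _ _⟩
      · exact ⟨_, rfl⟩
      · exact ⟨-u, by push_cast; linear_combination -h1⟩
  have hm := congrArg Ideal.absNorm he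
  rw [absNorm_natCast, map_mul] at hm
  obtain ⟨e1, e2⟩ := (Nat.Prime.mul_eq_prime_sq_iff hp
    (fun e => hP (Ideal.absNorm_eq_one_iff.1 e)) (fun e => hQ (Ideal.absNorm_eq_one_iff.1 e))).1 hm.symm
  refine ⟨_, _, fun e => hP ?_, isPrime_of_irreducible_absNorm (by rw [e1]; exact hp),
    isPrime_of_irreducible_absNorm (by rw [e2]; exact hp), he⟩
  rw [eq_top_iff_one]
  have h3 : (1 : Od d) = a * p + b * ((om d - ((d - r : ℤ) : Od d)) - (om d - (r : Od d))) := by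
    push_cast; linear_combination -hab'
  rw [h3]
  refine Ideal.add_mem _ (mul_mem_left _ _ (subset_span (by simp)))
    (mul_mem_left _ _ (Ideal.sub_mem _ ?_ (subset_span (by simp))))
  rw [e]
  exact subset_span (by simp)

lemma splitsIn_iff (hp : p.Prime) (hpS : p ∈ S) :
    SplitsIn p d ↔ LocD S p d := by
  obtain ⟨g, hg⟩ := RealFund.four_dvd d
  have key : ∀ r : ℤ, (2 * r - d) ^ 2 - d = 4 * (r ^ 2 - d * r + g) := fun r => by
    linear_combination hg
  have h4 : p ≠ 2 → ∀ {x : ℤ}, (p : ℤ) ∣ 4 * x → (p : ℤ) ∣ x := fun hp2 x h => by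
    have hc : IsCoprime (p : ℤ) 4 := by
      rw [show (4 : ℤ) = ((2 ^ 2 : ℕ) : ℤ) by norm_num, Nat.isCoprime_iff_coprime]
      exact ((Nat.coprime_primes hp Nat.prime_two).2 hp2).pow_right 2
    exact hc.dvd_of_dvd_mul_left h
  constructor
  · intro h
    obtain ⟨r, h1, h2⟩ := h.exists_simple_root hp hg
    have hk := key r
    unfold LocD
    split_ifs with hp2 _ _
    · subst hp2
      push_cast at h1 h2
      obtain ⟨x, hx⟩ : ∃ x, 2 * r - d = 2 * x + 1 := ⟨(2 * r - d) / 2, by omega⟩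
      obtain ⟨y, hy⟩ := h1
      obtain ⟨z, hz⟩ := Int.even_mul_succ_self x
      rw [hx, hy] at hk
      have : d = 8 * (z - y) + 1 := by linear_combination 4 * hz - hk
      omega
    · exact absurd hpS (by subst hp2; assumption)
    · exact ⟨_, h2, by rw [hk]; exact h1.mul_left 4⟩
  · intro h
    unfold LocD at h
    split_ifs at h with hp2 h3 _
    · subst hp2
      refine splitsIn_of_simple_root (r := 0) hp hg ?_ ?_
      · obtain ⟨j, rfl⟩ : ∃ j, d = 8 * j + 1 := ⟨d / 8, by omega⟩
        exact ⟨8 * j ^ 2 + j, by push_cast; linarith⟩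
      · push_cast; omega
    · exact absurd hpS (by subst hp2; assumption)
    · obtain ⟨t, h1, h2⟩ := h
      obtain ⟨j, hj⟩ := hp.odd_of_ne_two hp2
      have e : 2 * ((t + d) * (j + 1)) - d = t + p * (t + d) := by rw [hj]; push_cast; ring
      refine splitsIn_of_simple_root (r := (t + d) * (j + 1)) hp hg (h4 hp2 ?_) ?_
      · rw [← key, e]
        obtain ⟨u, hu⟩ := h2
        exact ⟨u + (t + d) * (2 * t + p * (t + d)), by linear_combination hu⟩
      · rw [e]
        exact fun h => h1 ((dvd_add_left (dvd_mul_right _ _)).1 h)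

end Quad

lemma squarefree_int_iff (d : ℤ) :
    Squarefree d ↔ ∀ p : ℕ, p.Prime → ¬ (p : ℤ) ^ 2 ∣ d := by
  rw [← Int.squarefree_natAbs, Nat.squarefree_iff_prime_squarefree]
  refine forall_congr' fun p => imp_congr_right fun _ => not_congr ?_
  rw [← Int.natCast_dvd, ← pow_two, Nat.cast_pow]

lemma odd_sq_dvd_four_mul (hp : p.Prime) (hp2 : p ≠ 2) {m : ℤ} (h : (p : ℤ) ^ 2 ∣ 4 * m) :
    (p : ℤ) ^ 2 ∣ m := by
  have hc : IsCoprime ((p : ℤ) ^ 2) 4 := by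
    rw [show (4 : ℤ) = ((2 ^ 2 : ℕ) : ℤ) by norm_num, ← Nat.cast_pow, Nat.isCoprime_iff_coprime]
    exact ((Nat.coprime_primes hp Nat.prime_two).2 hp2).pow 2 2
  exact hc.dvd_of_dvd_mul_left h

lemma fund_iff (d : ℤ) : ((d % 4 = 1 ∧ Squarefree d) ∨
    ∃ m : ℤ, d = 4 * m ∧ (m % 4 = 2 ∨ m % 4 = 3) ∧ Squarefree m) ↔
    ∀ p : ℕ, p.Prime → LocD ∅ p d := by
  constructor
  · rintro (⟨h1, h2⟩ | ⟨m, rfl, h1, h2⟩) p hp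
    · unfold LocD
      split_ifs with hp2 _ _ <;> try simp_all
      exact (squarefree_int_iff _).1 h2 p hp
    · unfold LocD
      split_ifs with hp2 h3 h3
      · simp at h3
      · omega
      · simp at h3
      · exact fun h => (squarefree_int_iff _).1 h2 p hp (odd_sq_dvd_four_mul hp hp2 h)
  · intro h
    have h2 := h 2 Nat.prime_two
    have hodd : ∀ p : ℕ, p.Prime → p ≠ 2 → ¬ (p : ℤ) ^ 2 ∣ d := fun p hp hp2 => by
      have := h p hp
      simpa [LocD, hp2] using this
    simp only [LocD, if_true, Finset.notMem_empty, if_false] at h2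
    have hd : d % 4 = 1 ∨ d % 16 = 8 ∨ d % 16 = 12 := h2
    rcases hd with hd | hd
    · refine Or.inl ⟨hd, (squarefree_int_iff _).2 fun p hp hdv => ?_⟩
      by_cases hp2 : p = 2
      · subst hp2; push_cast at hdv; omega
      · exact hodd p hp hp2 hdv
    · obtain ⟨m, rfl⟩ : ∃ m, d = 4 * m := ⟨d / 4, by omega⟩
      refine Or.inr ⟨m, rfl, by omega, (squarefree_int_iff _).2 fun p hp hdv => ?_⟩
      by_cases hp2 : p = 2
      · subst hp2; push_cast at hdv; omega
      · exact hodd p hp hp2 (hdv.mul_left 4)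

lemma LocD.empty (hp : p.Prime) {d : ℤ} (h : LocD S p d) : LocD ∅ p d := by
  unfold LocD at *
  split_ifs at * <;> try simp_all
  · omega
  · obtain ⟨t, h1, h2⟩ := h
    intro h3
    refine h1 ((Nat.prime_iff_prime_int.1 hp).dvd_of_dvd_pow (n := 2) ?_)
    exact (dvd_sub_left ((dvd_pow_self _ two_ne_zero).trans h3)).1 h2

lemma mem_goodD_iff (hS : ∀ p ∈ S, p.Prime) (d : ℤ) :
    d ∈ goodD S ↔ (∀ p : ℕ, p.Prime → LocD ∅ p d) ∧ ∀ p ∈ S, LocD S p d := by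
  refine ⟨fun h => ⟨fun p hp => (h p hp).empty hp, fun p hp => h p (hS p hp)⟩, fun h p hp => ?_⟩
  by_cases hpS : p ∈ S
  · exact h.2 p hpS
  · have := h.1 p hp
    unfold LocD at *
    split_ifs at * <;> simp_all

lemma family_iff (hS : ∀ p ∈ S, p.Prime) (d : ℤ) :
    (IsFundamentalDiscriminant d ∧ 0 < d ∧ ∀ p ∈ S, SplitsIn p d) ↔
      d ≠ 1 ∧ 0 < d ∧ d ∈ goodD S := by
  rw [mem_goodD_iff hS, ← fund_iff]
  constructor
  · rintro ⟨hf, hd, hs⟩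
    have : RealFund d := ⟨hf, hd⟩
    exact ⟨hf.1, hd, hf.2, fun p hp => (splitsIn_iff (hS p hp) hp).1 (hs p hp)⟩
  · rintro ⟨h1, hd, hf, hs⟩
    have : RealFund d := ⟨⟨h1, hf⟩, hd⟩
    exact ⟨⟨h1, hf⟩, hd, fun p hp => (splitsIn_iff (hS p hp) hp).2 (hs p hp)⟩

lemma one_mem_goodD (hS : ∀ p ∈ S, p.Prime) : (1 : ℤ) ∈ goodD S := by
  rw [mem_goodD_iff hS, ← fund_iff]
  refine ⟨Or.inl ⟨by norm_num, squarefree_one⟩, fun p hp => ?_⟩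
  unfold LocD
  split_ifs with hp2 h
  · norm_num
  · exact absurd hp (by subst hp2; assumption)
  · refine ⟨1, fun h => ?_, by norm_num⟩
    exact (hS p hp).one_lt.ne' (Nat.dvd_one.1 (by exact_mod_cast h))

lemma LocD_sq_mul (hp : p.Prime) {k : ℤ} (hk : ¬ (p : ℤ) ∣ k) (d : ℤ) :
    LocD S p (k ^ 2 * d) ↔ LocD S p d := by
  have hcop := (Nat.prime_iff_prime_int.1 hp).coprime_iff_not_dvd.2 hk
  have hodd : p = 2 → ∃ j, k ^ 2 = 8 * j + 1 := by
    rintro rfl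
    obtain ⟨x, rfl⟩ : ∃ x, k = 2 * x + 1 := ⟨k / 2, by push_cast at hk; omega⟩
    obtain ⟨z, hz⟩ := Int.even_mul_succ_self x
    exact ⟨z, by linear_combination 4 * hz⟩
  unfold LocD
  split_ifs with hp2 h1 h1
  · obtain ⟨j, hj⟩ := hodd hp2
    rw [show k ^ 2 * d = d + 8 * (j * d) by rw [hj]; ring]
    omega
  · obtain ⟨j, hj⟩ := hodd hp2
    rw [show k ^ 2 * d = d + 8 * (j * d) by rw [hj]; ring]
    rcases Int.even_or_odd' d with ⟨e, rfl | rfl⟩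
    · rw [show 8 * (j * (2 * e)) = 16 * (j * e) by ring]
      omega
    · omega
  · obtain ⟨a, b, hab⟩ := hcop
    constructor
    · rintro ⟨t, h2, u, h3⟩
      refine ⟨b * t, fun h4 => ?_, b ^ 2 * u - a * (2 - a * p) * d, ?_⟩
      · rcases (Nat.prime_iff_prime_int.1 hp).dvd_or_dvd h4 with ⟨v, rfl⟩ | h4
        · have : (p : ℤ) ∣ 1 := ⟨a + v * k, by linear_combination -hab⟩
          exact hp.one_lt.ne' (Nat.dvd_one.1 (by exact_mod_cast this))
        · exact h2 h4
      · have h5 : b * k = 1 - a * p := by linear_combination hab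
        linear_combination b ^ 2 * h3 + d * (b * k + 1 - a * p) * h5
    · rintro ⟨t, h2, h3⟩
      refine ⟨k * t, fun h4 => ?_, ?_⟩
      · exact ((Nat.prime_iff_prime_int.1 hp).dvd_or_dvd h4).elim hk h2
      · rw [mul_pow, ← mul_sub]; exact h3.mul_left _
  · exact not_congr ⟨fun h => (IsCoprime.pow hcop).dvd_of_dvd_mul_left h, fun h => h.mul_left _⟩

lemma exists_factor {T : Finset ℕ} (hT : ∀ p ∈ T, p.Prime) (hp : p ∈ T) :
    ∃ k : ℤ, ((∏ q ∈ T, q : ℕ) : ℤ) = p * k ∧ ¬ (p : ℤ) ∣ k := by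
  refine ⟨((∏ q ∈ T.erase p, q : ℕ) : ℤ), ?_, fun h => ?_⟩
  · exact_mod_cast (mul_prod_erase T id hp).symm
  · obtain ⟨q, hq, hpq⟩ := ((hT p hp).prime.dvd_finset_prod_iff _).1 (Int.natCast_dvd_natCast.1 h)
    have := (Nat.prime_dvd_prime_iff_eq (hT p hp) (hT q (mem_of_mem_erase hq))).1 hpq
    exact ne_of_mem_erase hq this.symm

lemma prod_natCast_dvd {T : Finset ℕ} (hT : ∀ p ∈ T, p.Prime) {x : ℤ}
    (h : ∀ p ∈ T, (p : ℤ) ∣ x) : ((∏ q ∈ T, q : ℕ) : ℤ) ∣ x :=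
  Int.natCast_dvd.2 (prod_primes_dvd _ (fun p hp => (hT p hp).prime)
    fun p hp => Int.natCast_dvd.1 (h p hp))

/-- Forms with good local behaviour are the forms with triplicate central coefficients over good
discriminants. -/
lemma mem_locForms_iff (hS : ∀ p ∈ S, p.Prime) (hT : T ⊆ S) (f : ℤ⁴) :
    f ∈ locForms (locS S T) ↔ ∃ d ∈ goodD S, f ∈ hessForms ((∏ p ∈ T, p : ℕ) : ℤ) d := by
  have hTp : ∀ p ∈ T, p.Prime := fun p hp => hS p (hT hp)
  have hloc : f ∈ locForms (locS S T) ↔ ∀ p : ℕ, p.Prime → f ∈ locE S T p :=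
    forall_congr' fun p => forall_congr' fun hp => redMod_mem_locS hT hp
  have hndvd : ∀ p : ℕ, p.Prime → p ∉ T → ¬ (p : ℤ) ∣ ((∏ q ∈ T, q : ℕ) : ℤ) := by
    intro p hp hpT h
    obtain ⟨q, hq, hpq⟩ := (hp.prime.dvd_finset_prod_iff _).1 (Int.natCast_dvd_natCast.1 h)
    rw [(Nat.prime_dvd_prime_iff_eq hp (hTp q hq)).1 hpq] at hpT
    exact hpT hq
  rw [hloc]
  constructor
  · intro h
    have hH : HessDvd ((∏ q ∈ T, q : ℕ) : ℤ) f := by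
      have h1 : ∀ p ∈ T, HessDvd p f := fun p hp => by
        have := h p (hTp p hp)
        rw [locE, mem_setOf_eq, if_pos hp] at this
        exact this.1
      exact ⟨prod_natCast_dvd hTp fun p hp => (h1 p hp).1,
        prod_natCast_dvd hTp fun p hp => (h1 p hp).2.1,
        prod_natCast_dvd hTp fun p hp => (h1 p hp).2.2⟩
    obtain ⟨a, ha⟩ := hH.1
    obtain ⟨b, hb⟩ := hH.2.1
    obtain ⟨c, hc⟩ := hH.2.2
    have hD : cdisc f = ((∏ q ∈ T, q : ℕ) : ℤ) ^ 2 * (b ^ 2 - 4 * a * c) := by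
      rw [cdisc, ha, hb, hc]; ring
    refine ⟨b ^ 2 - 4 * a * c, fun p hp => ?_, hH, hD⟩
    have h1 := h p hp
    rw [locE, mem_setOf_eq] at h1
    split_ifs at h1 with hpT
    · obtain ⟨-, e, he, hl⟩ := h1
      obtain ⟨k, hk, hpk⟩ := exists_factor hTp hpT
      rw [hD, hk, mul_pow, mul_assoc] at he
      rw [← mul_left_cancel₀ (pow_ne_zero 2 (by exact_mod_cast hp.ne_zero)) he] at hl
      exact (LocD_sq_mul hp hpk _).1 hl
    · rw [hD] at h1
      exact (LocD_sq_mul hp (hndvd p hp hpT) _).1 h1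
  · rintro ⟨d, hd, hH, hD⟩ p hp
    rw [locE, mem_setOf_eq]
    split_ifs with hpT
    · obtain ⟨k, hk, hpk⟩ := exists_factor hTp hpT
      have hpn : (p : ℤ) ∣ ((∏ q ∈ T, q : ℕ) : ℤ) := ⟨k, hk⟩
      refine ⟨⟨hpn.trans hH.1, hpn.trans hH.2.1, hpn.trans hH.2.2⟩, k ^ 2 * d, ?_,
        (LocD_sq_mul hp hpk _).2 (hd p hp)⟩
      rw [hD, hk]; ring
    · rw [hD]
      exact (LocD_sq_mul hp (hndvd p hp hpT) _).2 (hd p hp)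

lemma hessForms_inv (n d : ℤ) : SLInv (hessForms n d) :=
  fun _ _ h hf => ⟨hf.1.of_equiv h, h.cdisc_eq.trans hf.2⟩

/-- The irreducible forms in `hessForms`. -/
def irrHess (n d : ℤ) : Set ℤ⁴ := {f | f ∈ hessForms n d ∧ ¬ Reducible f}

lemma irrHess_inv (n d : ℤ) : SLInv (irrHess n d) :=
  fun f g h hf => ⟨hessForms_inv n d f g h hf.1, mt h.reducible_iff.2 hf.2⟩

lemma irrHess_finite {n d : ℤ} (h : 0 < n ^ 2 * d) : (clsSet (irrHess n d)).Finite := by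
  have h1 : (0 : ℝ) < ((n ^ 2 * d : ℤ) : ℝ) := by exact_mod_cast h
  refine (irrCls_bound (E := Set.univ) (fun _ _ _ _ => trivial)
    (X := ((n ^ 2 * d : ℤ) : ℝ) + 1) (by linarith)).1.subset (Set.image_mono ?_)
  rintro f ⟨hf, hr⟩
  refine ⟨trivial, hr, ?_, ?_⟩
  · rw [hf.2]; exact h
  · rw [hf.2]; linarith

/-- The reducible form of discriminant `d`. -/
def redForm (d : ℤ) : ℤ⁴ := ![0, 1, d % 2, (d + 3 * (d % 2) ^ 2) / 4]

lemma redForm_mem {d : ℤ} (hd : d % 4 = 0 ∨ d % 4 = 1) : redForm d ∈ hessForms 1 d := by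
  refine ⟨⟨one_dvd _, one_dvd _, one_dvd _⟩, ?_⟩
  have h4 : 4 * ((d + 3 * (d % 2) ^ 2) / 4) = d + 3 * (d % 2) ^ 2 := by
    rcases hd with h | h
    · rw [show d % 2 = 0 by omega]; omega
    · rw [show d % 2 = 1 by omega]; omega
  simp only [cdisc, hA, hB, hC, redForm, Matrix.cons_val]
  linear_combination h4

lemma hessForms_zero_unit {d : ℤ} (hd : ∀ p : ℕ, p.Prime → LocD ∅ p d) {b c e : ℤ}
    (h : b ^ 2 * (4 * b * e - 3 * c ^ 2) = d) : b = 1 ∨ b = -1 := by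
  rw [← Int.isUnit_iff, Int.isUnit_iff_natAbs_eq, Nat.eq_one_iff_not_exists_prime_dvd]
  intro p hp hpb
  obtain ⟨m, rfl⟩ := Int.natCast_dvd.2 hpb
  have h1 := hd p hp
  simp only [LocD, Finset.notMem_empty, if_false] at h1
  split_ifs at h1 with hp2
  · subst hp2
    have h2 : d = 4 * (m ^ 2 * (8 * m * e - 3 * c ^ 2)) := by rw [← h]; push_cast; ring
    have h3 : (m ^ 2 * (8 * m * e - 3 * c ^ 2)) % 4 = 0 ∨
        (m ^ 2 * (8 * m * e - 3 * c ^ 2)) % 4 = 1 := by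
      rcases Int.even_or_odd' m with ⟨x, rfl | rfl⟩
      · left
        rw [show (2 * x) ^ 2 * (8 * (2 * x) * e - 3 * c ^ 2) =
          4 * (x ^ 2 * (8 * (2 * x) * e - 3 * c ^ 2)) by ring]
        omega
      · rcases Int.even_or_odd' c with ⟨y, rfl | rfl⟩
        · left
          rw [show (2 * x + 1) ^ 2 * (8 * (2 * x + 1) * e - 3 * (2 * y) ^ 2) =
            4 * ((2 * x + 1) ^ 2 * (2 * (2 * x + 1) * e - 3 * y ^ 2)) by ring]
          omega
        · right
          rw [show (2 * x + 1) ^ 2 * (8 * (2 * x + 1) * e - 3 * (2 * y + 1) ^ 2) =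
            4 * ((2 * x + 1) ^ 2 * (2 * (2 * x + 1) * e - 3 * y ^ 2 - 3 * y - 1) + x ^ 2 + x) + 1
            by ring]
          omega
    omega
  · exact h1 ⟨m ^ 2 * (4 * (p * m) * e - 3 * c ^ 2), by rw [← h]; ring⟩

lemma equiv_redForm {d : ℤ} (hd : ∀ p : ℕ, p.Prime → LocD ∅ p d)
    (h0 : f 0 = 0) (h : cdisc f = d) : SLEquiv f (redForm d) := by
  have key : ∀ g : ℤ⁴, g 0 = 0 → g 1 = 1 → cdisc g = d → SLEquiv g (redForm d) := by
    intro g g0 g1 hg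
    simp only [cdisc, hA, hB, hC, g0, g1] at hg
    have h2 : g 2 % 2 = d % 2 := by
      rw [← hg]
      rcases Int.even_or_odd' (g 2) with ⟨x, hx | hx⟩ <;> rw [hx] <;> ring_nf <;> omega
    have h3 : d % 2 = g 2 + 2 * (-(g 2 / 2)) := by omega
    refine ⟨1, -(g 2 / 2), 0, 1, by norm_num, ?_⟩
    apply form_ext <;>
      simp only [cact_zero, cact_one, cact_two, cact_three, redForm, Matrix.cons_val, g0, g1]
    · ring
    · ring
    · rw [h3]; ring
    · rw [h3]
      refine Int.ediv_eq_of_eq_mul_right (by norm_num) ?_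
      rw [← hg]; ring
  rcases hessForms_zero_unit hd (b := f 1) (c := f 2) (e := f 3)
    (by rw [← h, cdisc, hA, hB, hC, h0]; ring) with h1 | h1
  · exact key f h0 h1 h
  · refine (SLEquiv.neg f).trans (key _ ?_ ?_ ?_)
    · simp [h0]
    · simp [h1]
    · rw [cdisc_neg, h]

lemma reducible_hessForms (hS : ∀ p ∈ S, p.Prime) (hT : T ⊆ S) {d : ℤ}
    (hd : d ∈ goodD S) (hf : f ∈ hessForms ((∏ p ∈ T, p : ℕ) : ℤ) d)
    (hr : Reducible f) : T = ∅ ∧ SLEquiv f (redForm d) := by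
  obtain ⟨g, hfg, g0⟩ := hr.exists_zero
  have hg := hessForms_inv _ _ _ _ hfg hf
  have hT0 : T = ∅ := by
    rw [Finset.eq_empty_iff_forall_notMem]
    intro p hpT
    have hp := hS p (hT hpT)
    have hpp := Nat.prime_iff_prime_int.1 hp
    obtain ⟨k, hk, hpk⟩ := exists_factor (fun q hq => hS q (hT hq)) hpT
    have hpn : (p : ℤ) ∣ ((∏ q ∈ T, q : ℕ) : ℤ) := ⟨k, hk⟩
    obtain ⟨⟨h1, h2, h3⟩, h4⟩ := hg
    rw [hk] at h4
    obtain ⟨b, hb⟩ := hpp.dvd_of_dvd_pow (n := 2) (a := g 1) (by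
      have := hpn.trans h1
      rwa [hA, g0, zero_mul, sub_zero] at this)
    obtain ⟨c, hc⟩ := hpp.dvd_of_dvd_pow (n := 2) (a := g 2) (by
      have := hpn.trans h3
      rw [hC, hb, mul_assoc] at this
      exact (dvd_sub_left (dvd_mul_right _ _)).1 this)
    have h5 : k ^ 2 * d = p * (b ^ 2 * (4 * b * g 3 - 3 * p * c ^ 2)) := by
      apply mul_left_cancel₀ (pow_ne_zero 2 hpp.ne_zero)
      rw [← mul_assoc, ← mul_pow, ← h4, cdisc, hA, hB, hC, g0, hb, hc]; ring
    have h6 : (p : ℤ) ∣ d := (hpp.dvd_or_dvd ⟨_, h5⟩).resolve_left fun h =>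
      hpk (hpp.dvd_of_dvd_pow h)
    have h7 := hd p hp
    unfold LocD at h7
    split_ifs at h7 with hp2 hq hq
    · subst hp2; push_cast at h6; omega
    · exact hq (hp2 ▸ hT hpT)
    · obtain ⟨t, ht, h8⟩ := h7
      exact ht (hpp.dvd_of_dvd_pow ((dvd_sub_left h6).1 h8))
    · exact hq (hT hpT)
  subst hT0
  refine ⟨rfl, hfg.trans (equiv_redForm ((mem_goodD_iff hS d).1 hd).1 g0 ?_)⟩
  rw [hg.2]; simp

lemma ncard_hessForms_split (hS : ∀ p ∈ S, p.Prime) (hT : T ⊆ S) {d : ℤ}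
    (hd : d ∈ goodD S) (hd0 : 0 < d) :
    (clsSet (hessForms ((∏ p ∈ T, p : ℕ) : ℤ) d)).ncard =
      (clsSet (irrHess ((∏ p ∈ T, p : ℕ) : ℤ) d)).ncard + if T = ∅ then 1 else 0 := by
  have hnpos : 0 < ((∏ p ∈ T, p : ℕ) : ℤ) := by
    exact_mod_cast prod_pos fun p hp => (hS p (hT hp)).pos
  split_ifs with h
  · subst h
    have hmem : redForm d ∈ hessForms 1 d := by
      apply redForm_mem
      have := ((mem_goodD_iff hS d).1 hd).1 2 Nat.prime_two
      simp only [LocD, if_true, Finset.notMem_empty, if_false] at this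
      omega
    rw [← ncard_insert_of_notMem (a := Quotient.mk formSetoid (redForm d)) ?_
      (irrHess_finite (by positivity))]
    · congr 1
      ext c
      constructor
      · rintro ⟨f, hf, rfl⟩
        by_cases hr : Reducible f
        · exact Or.inl (Quotient.sound (reducible_hessForms hS hT hd hf hr).2)
        · exact Or.inr ⟨f, ⟨hf, hr⟩, rfl⟩
      · rintro (rfl | ⟨f, hf, rfl⟩)
        · exact ⟨_, by simpa using hmem, rfl⟩
        · exact ⟨f, hf.1, rfl⟩
    · rw [mk_mem_clsSet (irrHess_inv _ _)]
      exact fun h => h.2 (reducible_of_zero rfl)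
  · rw [add_zero]
    congr 2
    ext f
    exact ⟨fun hf => ⟨hf, fun hr => h (reducible_hessForms hS hT hd hf hr).1⟩, fun hf => hf.1⟩

lemma ncard_irrCls_eq_sum (hS : ∀ p ∈ S, p.Prime) (hT : T ⊆ S) (X : ℝ) :
    (irrCls (locForms (locS S T)) ((∏ p ∈ T, p : ℕ) ^ 2 * X)).ncard =
      ∑ d ∈ (intsBelow_finite (goodD S) X).toFinset,
        (clsSet (irrHess ((∏ p ∈ T, p : ℕ) : ℤ) d)).ncard := by
  have hn : 0 < ∏ p ∈ T, p := prod_pos fun p hp => (hS p (hT hp)).pos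
  have hn' : (0 : ℝ) < ((∏ p ∈ T, p : ℕ) : ℝ) := by exact_mod_cast hn
  set n : ℕ := ∏ p ∈ T, p with hndef
  have hnz : (0 : ℤ) < (n : ℤ) := by exact_mod_cast hn
  have hU : irrCls (locForms (locS S T)) ((n : ℝ) ^ 2 * X) =
      ⋃ d ∈ (intsBelow_finite (goodD S) X).toFinset, clsSet (irrHess n d) := by
    rw [irrCls]
    simp only [clsSet, ← image_iUnion]
    congr 1
    ext f
    simp only [mem_iUnion, Set.Finite.mem_toFinset, exists_prop, irrForms, irrHess,
      mem_setOf_eq, mem_locForms_iff hS hT, ← hndef]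
    have hiff : ∀ d : ℤ, cdisc f = (n : ℤ) ^ 2 * d →
        ((0 < d ∧ (d : ℝ) < X) ↔ 0 < cdisc f ∧ ((cdisc f : ℤ) : ℝ) < (n : ℝ) ^ 2 * X) := by
      intro d h
      rw [h]
      push_cast
      rw [mul_lt_mul_iff_right₀ (by positivity), mul_pos_iff_of_pos_left (by positivity)]
    constructor
    · rintro ⟨⟨d, hd, hf⟩, hr, h1⟩
      exact ⟨d, ⟨hd, (hiff d hf.2).2 h1⟩, hf, hr⟩
    · rintro ⟨d, ⟨hd, h1⟩, hf, hr⟩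
      exact ⟨⟨d, hd, hf⟩, hr, (hiff d hf.2).1 h1⟩
  have hfin : ∀ d ∈ ((intsBelow_finite (goodD S) X).toFinset : Set ℤ),
      (clsSet (irrHess n d)).Finite := fun d hd => by
    rw [Set.Finite.coe_toFinset] at hd
    exact irrHess_finite (mul_pos (pow_pos hnz 2) hd.2.1)
  have hdisj : ((intsBelow_finite (goodD S) X).toFinset : Set ℤ).PairwiseDisjoint
      fun d => clsSet (irrHess n d) := fun d _ e _ hne => by
    rw [Function.onFun, Set.disjoint_left]
    rintro _ ⟨f, hf, rfl⟩ h
    rw [mk_mem_clsSet (irrHess_inv _ _)] at h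
    exact hne (mul_left_cancel₀ (pow_ne_zero 2 hnz.ne') (hf.1.2.symm.trans h.1.2))
  rw [hU, ← finsum_mem_coe_finset, ← (finite_toSet _).ncard_biUnion hfin hdisj]
  rfl

lemma tendsto_irrCls_scaled (hS : ∀ p ∈ S, p.Prime) (hT : T ⊆ S) :
    Tendsto (fun X : ℝ =>
      ((irrCls (locForms (locS S T)) ((∏ p ∈ T, p : ℕ) ^ 2 * X)).ncard : ℝ) / X) atTop
      (nhds (3 * 2 ^ T.card * phiD S)) := by
  have hp : ∀ p ∈ T, (p : ℝ) ≠ 0 := fun p h => by exact_mod_cast (hS p (hT h)).ne_zero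
  have hn : ((∏ p ∈ T, p : ℕ) : ℝ) ≠ 0 := by
    rw [Nat.cast_prod]; exact Finset.prod_ne_zero_iff.2 hp
  have hn2 : (0 : ℝ) < ((∏ p ∈ T, p : ℕ) : ℝ) ^ 2 := by positivity
  have h := ((tendsto_irrCls_locS hS hT).comp
    (tendsto_id.const_mul_atTop hn2)).const_mul (((∏ p ∈ T, p : ℕ) : ℝ) ^ 2)
  have e : ((∏ p ∈ T, p : ℕ) : ℝ) ^ 2 * (3 * (∏ p ∈ T, 2 / (p : ℝ) ^ 2) * phiD S) =
      3 * 2 ^ T.card * phiD S := by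
    have : ((∏ p ∈ T, p : ℕ) : ℝ) ^ 2 * ∏ p ∈ T, 2 / (p : ℝ) ^ 2 = 2 ^ T.card := by
      rw [Nat.cast_prod, ← Finset.prod_pow, ← prod_mul_distrib, ← prod_const]
      refine prod_congr rfl fun p h => ?_
      field_simp [hp p h]
    rw [← this]; ring
  rw [e] at h
  refine h.congr fun X => ?_
  simp only [Function.comp_apply, id_eq]
  rw [mul_div_assoc', mul_div_mul_left _ _ hn2.ne']

lemma sum_powerset_two_pow (S : Finset ℕ) : ∑ T ∈ S.powerset, (2 : ℝ) ^ T.card = 3 ^ S.card := by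
  have := sum_pow_mul_eq_add_pow (2 : ℝ) 1 S
  norm_num at this
  exact this

lemma card_ClS_eq (hS : ∀ p ∈ S, p.Prime) {d : ℤ}
    (h : d ≠ 1 ∧ 0 < d ∧ d ∈ goodD S) :
    3 ^ (S.card + 1) * Nat.card {x : ClS S d // x ^ 3 = 1} =
      ∑ T ∈ S.powerset, (clsSet (irrHess ((∏ p ∈ T, p : ℕ) : ℤ) d)).ncard + 1 := by
  obtain ⟨hf, hd, hs⟩ := (family_iff hS d).2 h
  have : RealFund d := ⟨hf, hd⟩
  rw [← sum_ncard_hessForms hS hs, sum_congr rfl fun T hT =>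
    ncard_hessForms_split hS (Finset.mem_powerset.1 hT) h.2.2 hd, sum_add_distrib,
    sum_ite_eq', if_pos (empty_mem_powerset S)]

end

/-- When ordered by absolute discriminant, the average size of `Cl(K)_S[3]` over
real quadratic fields in which every prime of `S` splits completely is
`1 + 3^{-|S|-1}`. -/
theorem avg_ClS_three_torsion_real_split (S : Finset ℕ) (hS : ∀ p ∈ S, p.Prime) :
    HasAverage (fun d => IsFundamentalDiscriminant d ∧ 0 < d ∧ ∀ p ∈ S, SplitsIn p d)
      (fun d => (Nat.card {x : ClS S d // x ^ 3 = 1} : ℝ))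
      (1 + (3 : ℝ) ^ (-(S.card : ℤ) - 1)) := by
  have hphi := phiD_pos hS
  set I : Finset ℕ → ℝ → ℝ := fun T X =>
    ((irrCls (locForms (locS S T)) ((∏ p ∈ T, p : ℕ) ^ 2 * X)).ncard : ℝ) with hI
  set N : ℝ → ℝ := fun X => ((intsBelow (goodD S) X).ncard : ℝ) with hN
  set c : ℝ := ∑ T ∈ S.powerset, ((clsSet (irrHess ((∏ p ∈ T, p : ℕ) : ℤ) 1)).ncard : ℝ) with hc
  have hden : Tendsto (fun X => (N X - 1) / X) atTop (nhds (phiD S)) := by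
    have := (tendsto_goodD hS).sub (tendsto_const_nhds (x := (1 : ℝ)).div_atTop tendsto_id)
    rw [sub_zero] at this
    exact this.congr fun X => (sub_div _ _ _).symm
  have hnum : Tendsto (fun X => (∑ T ∈ S.powerset, I T X - c + (N X - 1)) / X) atTop
      (nhds (∑ T ∈ S.powerset, 3 * 2 ^ T.card * phiD S - 0 + phiD S)) := by
    have h1 := tendsto_finsetSum S.powerset fun T hT =>
      tendsto_irrCls_scaled hS (Finset.mem_powerset.1 hT)
    have := (h1.sub (tendsto_const_nhds (x := c).div_atTop tendsto_id)).add hden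
    refine this.congr fun X => ?_
    change ∑ T ∈ S.powerset, I T X / X - c / X + (N X - 1) / X = _
    rw [← Finset.sum_div, ← sub_div, ← add_div]
  have hlim := (hnum.div hden hphi.ne').div_const ((3 : ℝ) ^ (S.card + 1))
  have hval : (∑ T ∈ S.powerset, 3 * 2 ^ T.card * phiD S - 0 + phiD S) / phiD S /
      (3 : ℝ) ^ (S.card + 1) = 1 + (3 : ℝ) ^ (-(S.card : ℤ) - 1) := by
    rw [← Finset.sum_mul, ← Finset.mul_sum, sum_powerset_two_pow, ← neg_add', zpow_neg,
      show (S.card : ℤ) + 1 = ((S.card + 1 : ℕ) : ℤ) by push_cast; rfl, zpow_natCast]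
    field_simp
    ring
  rw [hval] at hlim
  refine hlim.congr' ?_
  filter_upwards [eventually_gt_atTop 1] with X hX
  set D := (intsBelow_finite (goodD S) X).toFinset with hD
  have hmem : ∀ d, d ∈ D ↔ d ∈ goodD S ∧ 0 < d ∧ (d : ℝ) < X := fun d => by
    rw [hD, Set.Finite.mem_toFinset]; rfl
  have h1D : (1 : ℤ) ∈ D := (hmem 1).2 ⟨one_mem_goodD hS, one_pos, by simpa using hX⟩
  have hset : {d : ℤ | (IsFundamentalDiscriminant d ∧ 0 < d ∧ ∀ p ∈ S, SplitsIn p d) ∧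
      |(d : ℝ)| < X} = (D.erase 1 : Finset ℤ) := by
    ext d
    rw [Set.mem_setOf_eq, family_iff hS, Finset.mem_coe, Finset.mem_erase, hmem]
    constructor
    · rintro ⟨⟨h1, h2, h3⟩, h4⟩
      exact ⟨h1, h3, h2, (le_abs_self _).trans_lt h4⟩
    · rintro ⟨h1, h3, h2, h4⟩
      exact ⟨⟨h1, h2, h3⟩, by rwa [abs_of_pos (by exact_mod_cast h2)]⟩
  have hNX : N X = D.card := by
    change ((intsBelow (goodD S) X).ncard : ℝ) = _
    exact_mod_cast Set.ncard_eq_toFinset_card _ (intsBelow_finite (goodD S) X)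
  have hcard : (Nat.card {d : ℤ // (IsFundamentalDiscriminant d ∧ 0 < d ∧ ∀ p ∈ S, SplitsIn p d) ∧
      |(d : ℝ)| < X} : ℝ) = N X - 1 := by
    have h2 : Nat.card {d : ℤ // (IsFundamentalDiscriminant d ∧ 0 < d ∧ ∀ p ∈ S, SplitsIn p d) ∧
      |(d : ℝ)| < X} = (D.erase 1).card := by
      rw [← Set.ncard_coe_finset, ← hset]; rfl
    rw [h2, Finset.card_erase_of_mem h1D, Nat.cast_sub (Finset.card_pos.2 ⟨1, h1D⟩), hNX, Nat.cast_one]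
  have hsum : ∑ d ∈ D.erase 1, (3 : ℝ) ^ (S.card + 1) * (Nat.card {x : ClS S d // x ^ 3 = 1} : ℝ) =
      ∑ T ∈ S.powerset, I T X - c + (N X - 1) := by
    have h3 : ∀ d ∈ D.erase 1, (3 : ℝ) ^ (S.card + 1) * (Nat.card {x : ClS S d // x ^ 3 = 1} : ℝ) =
        ∑ T ∈ S.powerset, ((clsSet (irrHess ((∏ p ∈ T, p : ℕ) : ℤ) d)).ncard : ℝ) + 1 :=
      fun d hd => by
        obtain ⟨h1, h2⟩ := Finset.mem_erase.1 hd
        exact_mod_cast card_ClS_eq hS ⟨h1, ((hmem d).1 h2).2.1, ((hmem d).1 h2).1⟩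
    rw [Finset.sum_congr rfl h3, Finset.sum_add_distrib, Finset.sum_comm, hc,
      ← Finset.sum_sub_distrib]
    congr 1
    · refine Finset.sum_congr rfl fun T hT => ?_
      rw [eq_sub_iff_add_eq, Finset.sum_erase_add _ _ h1D]
      change _ = ((irrCls (locForms (locS S T)) ((∏ p ∈ T, p : ℕ) ^ 2 * X)).ncard : ℝ)
      rw [ncard_irrCls_eq_sum hS (Finset.mem_powerset.1 hT) X, Nat.cast_sum]
    · rw [Finset.sum_const, nsmul_one, Finset.card_erase_of_mem h1D,
        Nat.cast_sub (Finset.card_pos.2 ⟨1, h1D⟩), hNX, Nat.cast_one]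
  have hX0 : X ≠ 0 := by linarith
  have hfs : (∑ᶠ d ∈ {d : ℤ | (IsFundamentalDiscriminant d ∧ 0 < d ∧ ∀ p ∈ S, SplitsIn p d) ∧
      |(d : ℝ)| < X}, (Nat.card {x : ClS S d // x ^ 3 = 1} : ℝ)) =
      ∑ d ∈ D.erase 1, (Nat.card {x : ClS S d // x ^ 3 = 1} : ℝ) := by
    rw [hset, finsum_mem_coe_finset]
  refine Eq.trans ?_ (congrArg₂ (· / ·) hfs hcard).symm
  simp only [Pi.div_apply]
  rw [← hsum, ← Finset.mul_sum, div_div_div_cancel_right₀ hX0, div_right_comm,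
    mul_div_cancel_left₀ _ (by positivity)]
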